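/- Fix an integer d ≥ 3, a finite set M, μ ∈ I_d(M) and an increasing sequence of integers (r_k)_{k≥1}. If every invariant coupling ν ∈ I_d(M×M) of μ with itself satisfies Σ_{r_k}(ν) ≤ 2 Σ_{r_k}(μ) for all k ≥ 1, then μ is strongly typical. -/

import Mathlib

open MeasureTheory Filter Topology
open scoped ENNReal Classical

noncomputable section

namespace TreeEntropy

@[ext]
structure RCG (M : Type*) where
  col : List ℕ → Option M
  adj : List ℕ × List ℕ → Bool

variable {M : Type*}

def resS (r : ℕ) (g : RCG M) : RCG M where
  col l := if l.length ≤ r then g.col l else none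
  adj p := if p.1.length ≤ r ∧ p.2.length ≤ r then g.adj p else false

def rcgDist (g g' : RCG M) : ℝ :=
  ∑' r : ℕ, if resS r g = resS r g' then 0 else (2:ℝ)⁻¹ ^ r

private lemma rcg_summable (a b : RCG M) : Summable
    (fun r : ℕ => if resS r a = resS r b then (0:ℝ) else (2:ℝ)⁻¹ ^ r) := by
  refine Summable.of_nonneg_of_le (fun r => ?_) (fun r => ?_)
    (summable_geometric_of_lt_one (by norm_num) (by norm_num : (2:ℝ)⁻¹ < 1))
  · split
    · exact le_rfl
    · positivity
  · split
    · positivity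
    · exact le_rfl

private lemma rcg_nonneg (a b : RCG M) (r : ℕ) :
    (0:ℝ) ≤ if resS r a = resS r b then (0:ℝ) else (2:ℝ)⁻¹ ^ r := by
  split
  · exact le_rfl
  · positivity

private lemma rcgDist_self (g : RCG M) : rcgDist g g = 0 := by simp [rcgDist]

private lemma rcgDist_comm (g g' : RCG M) : rcgDist g g' = rcgDist g' g :=
  tsum_congr fun r => if_congr eq_comm rfl rfl

private lemma rcgDist_triangle (g₁ g₂ g₃ : RCG M) :
    rcgDist g₁ g₃ ≤ rcgDist g₁ g₂ + rcgDist g₂ g₃ := by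
  unfold rcgDist
  rw [← Summable.tsum_add (rcg_summable _ _) (rcg_summable _ _)]
  refine Summable.tsum_le_tsum (fun r => ?_) (rcg_summable _ _)
    ((rcg_summable _ _).add (rcg_summable _ _))
  have hx : (0:ℝ) ≤ (2:ℝ)⁻¹ ^ r := by positivity
  by_cases h12 : resS r g₁ = resS r g₂
  · by_cases h23 : resS r g₂ = resS r g₃
    · rw [if_pos h12, if_pos h23, if_pos (h12.trans h23)]; linarith
    · rw [if_pos h12, if_neg h23, zero_add]
      split_ifs <;> linarith
  · by_cases h23 : resS r g₂ = resS r g₃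
    · rw [if_neg h12, if_pos h23, add_zero]
      split_ifs <;> linarith
    · rw [if_neg h12, if_neg h23]
      split_ifs <;> linarith

private lemma rcgDist_eq_zero (g g' : RCG M) (h : rcgDist g g' = 0) : g = g' := by
  unfold rcgDist at h
  have hr : ∀ r : ℕ, resS r g = resS r g' := by
    intro r
    by_contra hne
    have hpos : (0:ℝ) <
        ∑' r : ℕ, if resS r g = resS r g' then (0:ℝ) else (2:ℝ)⁻¹ ^ r :=
      Summable.tsum_pos (rcg_summable g g') (rcg_nonneg g g') r
        (by rw [if_neg hne]; positivity)
    exact absurd h hpos.ne'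
  have hc : g.col = g'.col := by
    funext l
    have h1 := congrFun (congrArg RCG.col (hr l.length)) l
    simpa [resS] using h1
  have ha : g.adj = g'.adj := by
    funext p
    have h1 := congrFun (congrArg RCG.adj (hr (max p.1.length p.2.length))) p
    simpa [resS, le_max_left, le_max_right] using h1
  exact RCG.ext hc ha

instance : MetricSpace (RCG M) where
  dist := rcgDist
  dist_self := rcgDist_self
  dist_comm := rcgDist_comm
  dist_triangle := rcgDist_triangle
  eq_of_dist_eq_zero := rcgDist_eq_zero _ _

instance : MeasurableSpace (RCG M) := borel _
instance : BorelSpace (RCG M) := ⟨rfl⟩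


/-! ### The `d`-regular tree `T_d` -/

/-- A list `l = [i_k, …, i_1]` (deepest step first) is the breadth-first-search label of a
vertex of the `d`-regular tree `T_d` iff its first (root-side) step lies in `{1, …, d}` and all
subsequent steps lie in `{1, …, d-1}`. -/
def ValidTd (d : ℕ) (l : List ℕ) : Prop :=
  (∀ i ∈ l.dropLast, 1 ≤ i ∧ i ≤ d - 1) ∧ (∀ i ∈ l.getLast?, 1 ≤ i ∧ i ≤ d)

/-- The vertex set of the `d`-regular tree `T_d`. -/
def TdVertex (d : ℕ) : Type := {l : List ℕ // ValidTd d l}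

/-- The root `o` of `T_d`. -/
def rootTd (d : ℕ) : TdVertex d := ⟨[], by constructor <;> simp [List.getLast?]⟩

/-- The first neighbor `1` of the root of `T_d` (defined as the root for the degenerate case
`d = 0`, which never occurs below). -/
def node1 (d : ℕ) : TdVertex d :=
  if h : 1 ≤ d then ⟨[1], by constructor <;> simp [List.getLast?, h]⟩ else rootTd d

/-- The graph structure of the `d`-regular tree: two vertices are adjacent iff one is obtained
from the other by adding one step. -/
def TdGraph (d : ℕ) : SimpleGraph (TdVertex d) where
  Adj v w := (∃ i, w.1 = i :: v.1) ∨ (∃ i, v.1 = i :: w.1)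
  symm := ⟨by intro v w h; tauto⟩
  loopless := ⟨by
    rintro v (⟨i, h⟩ | ⟨i, h⟩) <;>
      · have := congrArg List.length h
        simp at this⟩

/-- Graph distance between two vertices of a tree encoded by their BFS labels: the nearest
common ancestor corresponds to the longest common suffix. -/
def treeDist (u w : List ℕ) : ℕ :=
  ((u.reverse.zip w.reverse).takeWhile (fun p => p.1 = p.2)).length |> fun c =>
    (u.length - c) + (w.length - c)

/-- The ball `S_r = B_r(o)` of radius `r` around the root of `T_d`. -/
def SrSet (d r : ℕ) : Set (TdVertex d) := {v | v.1.length ≤ r}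

/-- The set `E_r = B_{r-1}({o,1})` of vertices at distance at most `r-1` from the edge `{o,1}`
of `T_d` (for `r ≥ 1`). -/
def ErSet (d r : ℕ) : Set (TdVertex d) :=
  {v | v.1.length + 1 ≤ r ∨ (v.1.getLast? = some 1 ∧ v.1.length ≤ r)}

lemma ErSet_subset_SrSet (d r : ℕ) : ErSet d r ⊆ SrSet d r := by
  rintro v (h | ⟨-, h⟩) <;> simp only [SrSet, Set.mem_setOf_eq] <;> omega

/-! ### Invariant processes on `T_d` and their entropies -/

variable (d : ℕ) (M : Type*)

/-- `I_d(M)`: the set of probability measures on `M^{T_d}` invariant under all automorphisms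
of the tree `T_d`. -/
def InvMeas [MeasurableSpace M] : Set (Measure (TdVertex d → M)) :=
  {μ | IsProbabilityMeasure μ ∧
    ∀ φ : TdGraph d ≃g TdGraph d, μ.map (fun x => fun v => x (φ v)) = μ}

variable {d M}

/-- The Shannon entropy of (the distribution of) a random variable with law `μ`, a measure
with countable support on a discrete space. -/
def shannon {α : Type*} [MeasurableSpace α] (μ : Measure α) : ℝ :=
  ∑' a : α, Real.negMulLog (μ {a}).toReal

/-- The restriction `X_S` of a process `X` on `T_d` to a subset `S` of the vertices:
the pushforward of its law. -/
def restrictTo [MeasurableSpace M] (S : Set (TdVertex d))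
    (μ : Measure (TdVertex d → M)) : Measure (↥S → M) :=
  μ.map (fun x => fun v => x v.1)

/-- The annealed entropy `Σ_r(μ) = H(X_{S_r}) - (d/2) H(X_{E_r})`. -/
def SigmaR [MeasurableSpace M] (d : ℕ) (r : ℕ) (μ : Measure (TdVertex d → M)) : ℝ :=
  shannon (restrictTo (SrSet d r) μ) - (d / 2 : ℝ) * shannon (restrictTo (ErSet d r) μ)

/-- The annealed entropy `Σ(μ) = lim_r Σ_r(μ)`: the limit of the non-increasing sequence
`r ↦ Σ_r(μ)` (`r ≥ 1`), as an extended real (the limit may be `-∞`). -/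
def SigmaInf [MeasurableSpace M] (d : ℕ) (μ : Measure (TdVertex d → M)) : EReal :=
  ⨅ r : ℕ, ((SigmaR d (r + 1) μ : ℝ) : EReal)

/-- `Σ_e(X) = (d/2) H(X_{E_1}) - (d-1) H(X_o)`. -/
def SigmaE [MeasurableSpace M] (d : ℕ) (μ : Measure (TdVertex d → M)) : ℝ :=
  (d / 2 : ℝ) * shannon (restrictTo (ErSet d 1) μ)
    - ((d : ℝ) - 1) * shannon (restrictTo ({rootTd d} : Set (TdVertex d)) μ)

/-! ### Markov processes on `T_d` -/

/-- The elementary cylinder event: the coloring takes the values prescribed by `y` on `S`. -/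
def cylEvent (S : Set (TdVertex d)) (y : TdVertex d → M) : Set (TdVertex d → M) :=
  {x | ∀ v ∈ S, x v = y v}

/-- The side of the edge `{u,w}` containing `u`, in the tree `T_d`. -/
def sideOf (u w : TdVertex d) : Set (TdVertex d) :=
  {v | treeDist v.1 u.1 < treeDist v.1 w.1}

/-- `B_{r-1}({u,w})`: the set of vertices at distance at most `r-1` from the edge `{u,w}`. -/
def edgeBall (r : ℕ) (u w : TdVertex d) : Set (TdVertex d) :=
  {v | treeDist v.1 u.1 + 1 ≤ r ∨ treeDist v.1 w.1 + 1 ≤ r}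

/-- A probability measure on `M^{T_d}` is `r`-Markov on a subset `A` of `T_d` if, for every
edge `{u,w}` of `A`, conditioned on the value on the `(r-1)`-neighborhood of the edge
(within `A`), the processes on the two sides of the edge (within `A`) are independent;
equivalently, the corresponding products of cylinder probabilities agree.  For `A` the whole
tree and `r = 1` this is the edge-Markov property. -/
def rMarkovOn [MeasurableSpace M] (r : ℕ) (A : Set (TdVertex d))
    (μ : Measure (TdVertex d → M)) : Prop :=
  ∀ u w : TdVertex d, u ∈ A → w ∈ A → (TdGraph d).Adj u w →
    ∀ F₁ F₂ : Finset (TdVertex d), ↑F₁ ⊆ sideOf u w ∩ A → ↑F₂ ⊆ sideOf w u ∩ A →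
      ∀ y : TdVertex d → M,
        μ (cylEvent (↑F₁ ∪ ↑F₂ ∪ (edgeBall r u w ∩ A)) y)
            * μ (cylEvent (edgeBall r u w ∩ A) y)
          = μ (cylEvent (↑F₁ ∪ (edgeBall r u w ∩ A)) y)
            * μ (cylEvent (↑F₂ ∪ (edgeBall r u w ∩ A)) y)

/-- A probability measure on `M^{T_d}` is `r`-Markov if, conditioned on the value on the
`(r-1)`-neighborhood of any edge, the processes on the two sides of the edge are
independent. -/
def rMarkov [MeasurableSpace M] (r : ℕ) (μ : Measure (TdVertex d → M)) : Prop :=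
  rMarkovOn r Set.univ μ

/-- A probability measure on `M^{T_d}` is vertex-Markov if, conditioned on the value at a
vertex, the processes on the pending subtrees of that vertex are independent. -/
def vertexMarkov [MeasurableSpace M] (μ : Measure (TdVertex d → M)) : Prop :=
  ∀ v : TdVertex d, ∀ k : ℕ, ∀ u : Fin k → TdVertex d,
    Function.Injective u → (∀ i, (TdGraph d).Adj v (u i)) →
    ∀ F : Fin k → Finset (TdVertex d), (∀ i, ↑(F i) ⊆ sideOf (u i) v) →
      ∀ y : TdVertex d → M,
        μ (cylEvent ((⋃ i, ↑(F i)) ∪ {v}) y) * (μ (cylEvent {v} y)) ^ (k - 1)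
          = ∏ i : Fin k, μ (cylEvent (↑(F i) ∪ {v}) y)

/-- `X_{S_1}` is a vertex-Markov process on `S_1`: the values at the `d` neighbors of the
root are conditionally independent given the value at the root. -/
def vertexMarkovOnS1 [MeasurableSpace M] (d : ℕ) (μ : Measure (TdVertex d → M)) : Prop :=
  ∀ y : TdVertex d → M,
    μ (cylEvent (SrSet d 1) y) * (μ (cylEvent ({rootTd d} : Set (TdVertex d)) y)) ^ (d - 1)
      = ∏ i ∈ Finset.Icc 1 d,
          μ (cylEvent {v : TdVertex d | v = rootTd d ∨ v.1 = [i]} y)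


/-! ### The randomly labeled rooted colored graph associated to a finite colored graph

Given a finite colored graph `(G,f)` and a vertex `v`, the associated randomly labeled rooted
colored graph is obtained by a breadth-first search exploration of the connected component of
`v` started at `v`, ties between vertices being broken uniformly at random.  We implement the
uniformly random tie-breaking by a uniformly random priority permutation `σ`. -/

variable {M : Type*} {n : ℕ}

/-- The `k`-th layer of the breadth-first search of `G` started at `v`, ordered according to
the position of the parents in the previous layer, ties being broken by the priority `σ`. -/
def bfsLayer (G : SimpleGraph (Fin n)) (v : Fin n) (σ : Equiv.Perm (Fin n)) :
    ℕ → List (Fin n)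
  | 0 => [v]
  | (k + 1) =>
    let prev := bfsLayer G v σ k
    let key : Fin n → ℕ := fun w =>
      (prev.idxOf (((prev.find? (fun u => decide (G.Adj u w))).getD v))) * n + (σ w : ℕ)
    ((List.finRange n).filter
        (fun w => decide (G.Reachable v w ∧ G.dist v w = k + 1))).mergeSort
      (fun a b => key a ≤ key b)

/-- The breadth-first-search label of the vertex `w` lying in layer `k` of the exploration of
`G` started at `v` with tie-breaking priority `σ`. -/
def bfsPathAux (G : SimpleGraph (Fin n)) (v : Fin n) (σ : Equiv.Perm (Fin n)) :
    ℕ → Fin n → Option (List ℕ)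
  | 0, w => if w = v then some [] else none
  | (k + 1), w =>
    match (bfsLayer G v σ k).find? (fun u => decide (G.Adj u w)) with
    | none => none
    | some p =>
      let L := bfsLayer G v σ (k + 1)
      let j := 1 + ((L.takeWhile (fun w' => w' ≠ w)).filter
        (fun w' => (bfsLayer G v σ k).find? (fun u => decide (G.Adj u w')) = some p)).length
      (bfsPathAux G v σ k p).map (fun pl => j :: pl)

/-- The breadth-first-search label of the vertex `w` in the exploration of the connected
component of `v` in `G`, with tie-breaking priority `σ` (`none` if `w` is not in the component
of `v`). -/
def bfsPath (G : SimpleGraph (Fin n)) (v : Fin n) (σ : Equiv.Perm (Fin n)) (w : Fin n) :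
    Option (List ℕ) :=
  if G.Reachable v w then bfsPathAux G v σ (G.dist v w) w else none

/-- The rooted colored graph obtained from the colored graph `(G,f)` by the breadth-first
search exploration of the connected component of `v` rooted at `v`, with tie-breaking
priority `σ`. -/
def bfsRCG (G : SimpleGraph (Fin n)) (f : Fin n → M) (v : Fin n) (σ : Equiv.Perm (Fin n)) :
    RCG M where
  col l := if h : ∃ w, bfsPath G v σ w = some l then some (f h.choose) else none
  adj p :=
    if (∃ w₁ w₂, bfsPath G v σ w₁ = some p.1 ∧ bfsPath G v σ w₂ = some p.2 ∧ G.Adj w₁ w₂)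
    then true else false

/-- `distr_{G,v}(f)`: the law of the randomly labeled rooted colored graph obtained from the
connected component of `v` in the colored graph `(G,f)`, rooted at `v`. -/
def distrAt (G : SimpleGraph (Fin n)) (f : Fin n → M) (v : Fin n) : Measure (RCG M) :=
  ((Nat.factorial n : ℝ≥0∞))⁻¹ •
    ∑ σ : Equiv.Perm (Fin n), Measure.dirac (bfsRCG G f v σ)

/-- `distr_G(f) = (1/|V|) ∑_{v ∈ V} distr_{G,v}(f)`. -/
def distrG (G : SimpleGraph (Fin n)) (f : Fin n → M) : Measure (RCG M) :=
  ((n : ℝ≥0∞))⁻¹ • ∑ v : Fin n, distrAt G f v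

/-! ### Random regular graphs -/

/-- The set `𝓖_n(d)` of simple `d`-regular graphs on the vertex set `{1, …, n}`. -/
def regularGraphs (d n : ℕ) : Set (SimpleGraph (Fin n)) :=
  {G | ∀ v, (G.neighborSet v).ncard = d}

/-- The probability that a uniformly distributed random `d`-regular graph `G_n` on `n`
vertices belongs to `A`. -/
def PrG (d n : ℕ) (A : Set (SimpleGraph (Fin n))) : ℝ :=
  ((regularGraphs d n ∩ A).ncard : ℝ) / ((regularGraphs d n).ncard : ℝ)

/-- The expectation of `F(G_n)` for a uniformly distributed random `d`-regular graph `G_n`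
on `n` vertices. -/
def ExG (d n : ℕ) (F : SimpleGraph (Fin n) → ℝ) : ℝ :=
  (∑ᶠ G ∈ regularGraphs d n, F G) / ((regularGraphs d n).ncard : ℝ)

/-- The integers `n` for which the set of simple `d`-regular graphs on `n` vertices is
non-empty: `n ≥ d + 1` and `nd` even.  Limits `n → ∞` are taken along this set. -/
def goodN (d : ℕ) : Set ℕ := {n | d + 1 ≤ n ∧ Even (n * d)}

/-- The filter `n → ∞` along `{n : n ≥ d+1, nd even}`. -/
def goodFilter (d : ℕ) : Filter ℕ := Filter.atTop ⊓ Filter.principal (goodN d)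

/-! ### The embedding of invariant processes into rooted colored graphs -/

/-- The rooted colored graph `(T_d, x, o)` associated to a coloring `x` of `T_d` (the
canonical labeling of `T_d` is a breadth-first-search labeling; for an invariant process the
resulting law is that of the randomly labeled rooted colored graph). -/
def iotaTd (d : ℕ) (x : TdVertex d → M) : RCG M where
  col l := if h : ValidTd d l then some (x ⟨l, h⟩) else none
  adj p :=
    if (ValidTd d p.1 ∧ ValidTd d p.2 ∧ ((∃ i, p.2 = i :: p.1) ∨ (∃ i, p.1 = i :: p.2)))
    then true else false

/-- The law, as a probability measure on rooted colored graphs, of the randomly labeled rooted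
colored tree `(T_d, X, o)` where `X` has law `μ`. -/
def lawTd (d : ℕ) [MeasurableSpace M] (μ : Measure (TdVertex d → M)) : Measure (RCG M) :=
  μ.map (iotaTd d)

/-! ### Micro-state (sofic) entropy -/

/-- `𝓕_G(μ,r,ε)`: the set of colorings `f` of `G` whose radius-`r` local statistics are
`ε`-close (in the Lévy-Prokhorov distance, which generates the weak topology) to the
radius-`r` restriction of `μ`. -/
def FSet (d : ℕ) [MeasurableSpace M] (μ : Measure (TdVertex d → M)) (r : ℕ) (ε : ℝ)
    (G : SimpleGraph (Fin n)) : Set (Fin n → M) :=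
  {f | levyProkhorovDist ((distrG G f).map (resS r)) ((lawTd d μ).map (resS r)) ≤ ε}

/-- `H_{G}(μ,r,ε) = (1/n) log |𝓕_G(μ,r,ε)| ∈ {-∞} ∪ [0,∞)`. -/
def HG (d : ℕ) [MeasurableSpace M] (μ : Measure (TdVertex d → M)) (r : ℕ) (ε : ℝ)
    (G : SimpleGraph (Fin n)) : EReal :=
  if FSet d μ r ε G = ∅ then ⊥
  else ((Real.log ((FSet d μ r ε G).ncard) / n : ℝ) : EReal)

/-- `h_n(μ,r,ε,α)`: the `α`-quantile
`sup { h ∈ {-∞} ∪ [0,∞) : ℙ(H_{G_n}(μ,r,ε) ≥ h) ≥ α }`. -/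
def hquant (d : ℕ) [MeasurableSpace M] (μ : Measure (TdVertex d → M)) (r : ℕ) (ε : ℝ)
    (α : ℝ) (n : ℕ) : EReal :=
  sSup {h : EReal | (h = ⊥ ∨ 0 ≤ h) ∧
    α ≤ PrG d n {G : SimpleGraph (Fin n) | h ≤ HG d μ r ε G}}

/-- The upper entropy `h̄(μ,r,α) = lim_{ε → 0} limsup_n h_n(μ,r,ε,α)` (the limit over `ε`
of a quantity non-decreasing in `ε`, i.e. the infimum over `ε > 0`). -/
def hbarA (d : ℕ) [MeasurableSpace M] (μ : Measure (TdVertex d → M)) (r : ℕ) (α : ℝ) :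
    EReal :=
  ⨅ ε : {e : ℝ // 0 < e}, (goodFilter d).limsup (fun n => hquant d μ r ε.1 α n)

/-- The lower entropy `h̲(μ,r,α) = lim_{ε → 0} liminf_n h_n(μ,r,ε,α)`. -/
def hlowA (d : ℕ) [MeasurableSpace M] (μ : Measure (TdVertex d → M)) (r : ℕ) (α : ℝ) :
    EReal :=
  ⨅ ε : {e : ℝ // 0 < e}, (goodFilter d).liminf (fun n => hquant d μ r ε.1 α n)

/-- `h̄(μ,r)`: the common value of `h̄(μ,r,α)`, `0 < α < 1`. -/
def hbarR (d : ℕ) [MeasurableSpace M] (μ : Measure (TdVertex d → M)) (r : ℕ) : EReal :=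
  hbarA d μ r (1 / 2)

/-- `h̲(μ,r)`: the common value of `h̲(μ,r,α)`, `0 < α < 1`. -/
def hlowR (d : ℕ) [MeasurableSpace M] (μ : Measure (TdVertex d → M)) (r : ℕ) : EReal :=
  hlowA d μ r (1 / 2)

/-- The upper sofic entropy `h̄(μ) = lim_{r → ∞} h̄(μ,r)` (the limit of a non-increasing
sequence, i.e. the infimum over `r`). -/
def hbar (d : ℕ) [MeasurableSpace M] (μ : Measure (TdVertex d → M)) : EReal :=
  ⨅ r : ℕ, hbarR d μ r

/-- The lower sofic entropy `h̲(μ) = lim_{r → ∞} h̲(μ,r)`. -/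
def hlow (d : ℕ) [MeasurableSpace M] (μ : Measure (TdVertex d → M)) : EReal :=
  ⨅ r : ℕ, hlowR d μ r

/-! ### Typical processes -/

/-- The probability that the random `d`-regular graph `G_n` admits a coloring whose local
statistics are `ε`-close to `μ`. -/
def typicalPr (d : ℕ) [MeasurableSpace M] (μ : Measure (TdVertex d → M)) (ε : ℝ) (n : ℕ) :
    ℝ :=
  PrG d n {G : SimpleGraph (Fin n) |
    ∃ f : Fin n → M, levyProkhorovDist (distrG G f) (lawTd d μ) ≤ ε}

/-- `μ ∈ I_d(M)` is weakly typical if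
`lim_{ε → 0} limsup_{n → ∞} ℙ(∃ f : d(distr_{G_n}(f), μ) ≤ ε) = 1`. -/
def WeaklyTypical (d : ℕ) [MeasurableSpace M] (μ : Measure (TdVertex d → M)) : Prop :=
  Tendsto (fun ε => (goodFilter d).limsup (fun n => typicalPr d μ ε n))
    (nhdsWithin 0 (Set.Ioi 0)) (nhds 1)

/-- `μ ∈ I_d(M)` is strongly typical if
`lim_{ε → 0} lim_{n → ∞} ℙ(∃ f : d(distr_{G_n}(f), μ) ≤ ε) = 1` (in particular the inner
limits along `n → ∞` exist). -/
def StronglyTypical (d : ℕ) [MeasurableSpace M] (μ : Measure (TdVertex d → M)) : Prop :=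
  ∃ L : ℝ → ℝ,
    (∀ ε : ℝ, 0 < ε → Tendsto (fun n => typicalPr d μ ε n) (goodFilter d) (nhds (L ε))) ∧
    Tendsto L (nhdsWithin 0 (Set.Ioi 0)) (nhds 1)


/-! ### Processes on balls of `T_d` and the sets `I_{d,r}(M)`, `I_e(M)` -/

/-- The ball `S_r` of `T_d` as an induced subgraph. -/
def SrGraph (d r : ℕ) : SimpleGraph ↥(SrSet d r) := (TdGraph d).induce (SrSet d r)

/-- The set `E_r` of `T_d` as an induced subgraph. -/
def ErGraph (d r : ℕ) : SimpleGraph ↥(ErSet d r) := (TdGraph d).induce (ErSet d r)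

lemma root_mem_Er (d r : ℕ) (hr : 1 ≤ r) : rootTd d ∈ ErSet d r := by
  left; simpa [rootTd] using hr

lemma node1_mem_Er (d r : ℕ) (hr : 1 ≤ r) : node1 d ∈ ErSet d r := by
  by_cases h : 1 ≤ d
  · right
    constructor <;> simp [node1, h, List.getLast?, hr]
  · simpa [node1, h] using root_mem_Er d r hr

variable {M : Type*}

/-- The restriction to `E_r ⊆ S_r` of a probability measure on `M^{S_r}`. -/
def restrictErOfSr [MeasurableSpace M] (d r : ℕ) (p : Measure (↥(SrSet d r) → M)) :
    Measure (↥(ErSet d r) → M) :=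
  p.map (fun x => fun v : ↥(ErSet d r) => x ⟨v.1, ErSet_subset_SrSet d r v.2⟩)

/-- `I_{d,r}(M)`: the set of probability measures on `M^{S_r}` which are invariant under the
automorphisms of `S_r` and whose restriction to `E_r` is invariant under switching the two
sides of the edge `{o,1}`. -/
def IdrMeas (d r : ℕ) (M : Type*) [MeasurableSpace M] :
    Set (Measure (↥(SrSet d r) → M)) :=
  {p | IsProbabilityMeasure p ∧
    (∀ φ : SrGraph d r ≃g SrGraph d r, p.map (fun x => fun v => x (φ v)) = p) ∧
    (∀ ψ : ErGraph d r ≃g ErGraph d r,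
      (∀ hv : rootTd d ∈ ErSet d r, ((ψ ⟨rootTd d, hv⟩ : ↥(ErSet d r)) : TdVertex d) = node1 d) →
      (restrictErOfSr d r p).map (fun x => fun v => x (ψ v)) = restrictErOfSr d r p)}

/-- The annealed entropy `Σ(p) = H(X_{S_r}) - (d/2) H(X_{E_r})` of `p ∈ I_{d,r}(M)`. -/
def SigmaP [MeasurableSpace M] (d r : ℕ) (p : Measure (↥(SrSet d r) → M)) : ℝ :=
  shannon p - (d / 2 : ℝ) * shannon (restrictErOfSr d r p)

/-- The involution of `E_1 = {o, 1}` switching the two sides of the edge `{o,1}`. -/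
def swapE1 (d : ℕ) : ↥(ErSet d 1) → ↥(ErSet d 1) := fun v =>
  if (v : TdVertex d) = rootTd d then ⟨node1 d, node1_mem_Er d 1 le_rfl⟩
  else ⟨rootTd d, root_mem_Er d 1 le_rfl⟩

/-- `I_e(M)`: the set of probability measures on `M^{E_1}` invariant under switching the two
sides of the edge `{o,1}`. -/
def IeMeas (d : ℕ) (M : Type*) [MeasurableSpace M] : Set (Measure (↥(ErSet d 1) → M)) :=
  {p | IsProbabilityMeasure p ∧ p.map (fun x => fun v => x (swapE1 d v)) = p}

/-- The annealed entropy `Σ(p) = (d/2) H(X_{E_1}) - (d-1) H(X_o)` of `p ∈ I_e(M)`. -/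
def SigmaPe [MeasurableSpace M] (d : ℕ) (p : Measure (↥(ErSet d 1) → M)) : ℝ :=
  (d / 2 : ℝ) * shannon p
    - ((d : ℝ) - 1) * shannon (p.map (fun x => x ⟨rootTd d, root_mem_Er d 1 le_rfl⟩))

/-! ### Factor graphs: functions of rooted unlabeled colored graphs of radius `r` -/

/-- The vertex set of a rooted colored graph. -/
def vertsOf (g : RCG M) : Set (List ℕ) := {l | g.col l ≠ none}

/-- An isomorphism of rooted colored graphs (a color- and adjacency-preserving bijection of
the vertex sets mapping root to root). -/
def RCGRootedIso (g g' : RCG M) : Prop :=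
  ∃ e : ↥(vertsOf g) ≃ ↥(vertsOf g'),
    (∀ v, g'.col ((e v) : List ℕ) = g.col (v : List ℕ)) ∧
    (∀ v w, g'.adj (((e v) : List ℕ), ((e w) : List ℕ)) = g.adj ((v : List ℕ), (w : List ℕ))) ∧
    (∀ h : [] ∈ vertsOf g, ∀ _ : [] ∈ vertsOf g', ((e ⟨[], h⟩) : List ℕ) = [])

/-- A function on rooted unlabeled colored graphs of radius `r`: a function of rooted colored
graphs which only depends on the isomorphism class of the ball of radius `r` around the
root. -/
def IsRadiusRFn (r : ℕ) (ψ : RCG M → ℝ) : Prop :=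
  ∀ g g' : RCG M, RCGRootedIso (resS r g) (resS r g') → ψ g = ψ g'

/-- The value `ψ((G,f,v)_r)` of `ψ` at the rooted unlabeled colored graph given by the ball of
radius `r` around `v` in `(G,f)` (computed as the average over the random labelings, which is
the constant value of `ψ` on them when `ψ` is a function of the unlabeled graph). -/
def psiAt {n : ℕ} (G : SimpleGraph (Fin n)) (f : Fin n → M) (v : Fin n) (ψ : RCG M → ℝ) :
    ℝ :=
  ∫ g, ψ g ∂(distrAt G f v)

/-- The partition function `Z_G = ∑_f ∏_v exp(ψ((G,f,v)_r))` of the factor model `ψ`. -/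
def ZG {n : ℕ} [Fintype M] (G : SimpleGraph (Fin n)) (ψ : RCG M → ℝ) : ℝ :=
  ∑ f : Fin n → M, Real.exp (∑ v : Fin n, psiAt G f v ψ)

/-- The ground-state energy `L_G = max_f ∑_v ψ((G,f,v)_r)`. -/
def LG {n : ℕ} (G : SimpleGraph (Fin n)) (ψ : RCG M → ℝ) : ℝ :=
  sSup {x : ℝ | ∃ f : Fin n → M, x = ∑ v : Fin n, psiAt G f v ψ}

/-- The canonical rooted colored graph associated to a coloring of the ball `S_r` of `T_d`. -/
def iotaSr (d r : ℕ) (x : ↥(SrSet d r) → M) : RCG M where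
  col l := if h : ValidTd d l ∧ l.length ≤ r then some (x ⟨⟨l, h.1⟩, h.2⟩) else none
  adj p := if (ValidTd d p.1 ∧ ValidTd d p.2 ∧ p.1.length ≤ r ∧ p.2.length ≤ r ∧
      ((∃ i, p.2 = i :: p.1) ∨ (∃ i, p.1 = i :: p.2))) then true else false

/-- `⟨p, ψ⟩ = E[ψ(X)]` where `X` has law `p ∈ I_{d,r}(M)`. -/
def pairing [MeasurableSpace M] (d r : ℕ) (p : Measure (↥(SrSet d r) → M))
    (ψ : RCG M → ℝ) : ℝ :=
  ∫ x, ψ (iotaSr d r x) ∂p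

/-! ### Annealed quantities for random regular graphs -/

/-- `log` with the convention `log 0 = -∞`, with values in the extended reals. -/
def elog (x : ℝ) : EReal := if x ≤ 0 then ⊥ else ((Real.log x : ℝ) : EReal)

/-- The set `𝓖_n(μ,r,ε)` of pairs `(G,f)` of a `d`-regular graph together with a coloring
whose radius-`r` local statistics are `ε`-close to `μ_r`. -/
def GnPairs (d : ℕ) [MeasurableSpace M] (μ : Measure (TdVertex d → M)) (r : ℕ) (ε : ℝ)
    (n : ℕ) : Set (SimpleGraph (Fin n) × (Fin n → M)) :=
  {Gf | Gf.1 ∈ regularGraphs d n ∧ Gf.2 ∈ FSet d μ r ε Gf.1}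

/-- The annealed entropy
`Σ_n(μ,r,ε) = (1/n) (log |𝓖_n(μ,r,ε)| - log |𝓖_n(d)|) = (1/n) log E |𝓕_{G_n}(μ,r,ε)|`. -/
def SigmaN (d : ℕ) [MeasurableSpace M] (μ : Measure (TdVertex d → M)) (r : ℕ) (ε : ℝ)
    (n : ℕ) : EReal :=
  (((n : ℝ)⁻¹ : ℝ) : EReal) *
    elog (((GnPairs d μ r ε n).ncard : ℝ) / ((regularGraphs d n).ncard : ℝ))

/-- The relaxed partition function `Z_G(β) = ∑_f exp(-nβ d(distr_G(f)_r, μ_r))`. -/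
def ZGbeta (d : ℕ) [MeasurableSpace M] {n : ℕ} [Fintype M] (μ : Measure (TdVertex d → M))
    (r : ℕ) (β : ℝ) (G : SimpleGraph (Fin n)) : ℝ :=
  ∑ f : Fin n → M, Real.exp (-(n : ℝ) * β *
    levyProkhorovDist ((distrG G f).map (resS r)) ((lawTd d μ).map (resS r)))


/-! ### Processes on unimodular Galton-Watson trees

A colored rooted tree `(T, X, o)` with `T` a subtree of the label set, rooted at `[]` and
with the children of a vertex `v` labeled `1 :: v, …, N_v :: v`, is encoded as a rooted
colored graph in `RCG M`. -/

/-- `g` is a canonically labeled colored rooted tree. -/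
def IsCanonTree (g : RCG M) : Prop :=
  g.col [] ≠ none ∧
  (∀ l : List ℕ, g.col l ≠ none → g.col l.tail ≠ none) ∧
  (∀ (v : List ℕ) (i : ℕ), 1 ≤ i → g.col ((i + 1) :: v) ≠ none → g.col (i :: v) ≠ none) ∧
  (∀ v : List ℕ, g.col (0 :: v) = none) ∧
  (∀ p : List ℕ × List ℕ, g.adj p = true ↔
    (g.col p.1 ≠ none ∧ g.col p.2 ≠ none ∧
      ((∃ i, p.2 = i :: p.1) ∨ (∃ i, p.1 = i :: p.2))))

/-- A finite canonically labeled tree. -/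
def IsFinTree (t : Finset (List ℕ)) : Prop :=
  [] ∈ t ∧ (∀ l ∈ t, l.tail ∈ t) ∧
  (∀ (v : List ℕ) (i : ℕ), 1 ≤ i → ((i + 1) :: v) ∈ t → (i :: v) ∈ t) ∧
  (∀ v : List ℕ, (0 :: v) ∉ t)

/-- The number of children of the vertex `v` in the finite tree `t`. -/
def childCountF (t : Finset (List ℕ)) (v : List ℕ) : ℕ :=
  (t.filter (fun w => w ≠ [] ∧ w.tail = v)).card

/-- The size-biased version `π̂(k) = (k+1) π(k+1) / d` of the offspring distribution `π`. -/
def sizeBiased (π : ℕ → ℝ) (dd : ℝ) (k : ℕ) : ℝ := (k + 1 : ℝ) * π (k + 1) / dd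

/-- The probability that the unimodular Galton-Watson tree with degree distribution `π`,
truncated at depth `k`, equals the finite tree `t`. -/
def treeWeight (π : ℕ → ℝ) (dd : ℝ) (k : ℕ) (t : Finset (List ℕ)) : ℝ :=
  π (childCountF t []) *
    ∏ v ∈ t.filter (fun v => v ≠ [] ∧ v.length < k), sizeBiased π dd (childCountF t v)

/-- The law of the underlying tree is the unimodular Galton-Watson law `UGW(π)`:
all finite-depth truncations have the prescribed distribution. -/
def IsUGWTreeLaw (π : ℕ → ℝ) (dd : ℝ) (μ : Measure (RCG M)) : Prop :=
  ∀ (k : ℕ) (t : Finset (List ℕ)), IsFinTree t → (∀ v ∈ t, v.length ≤ k) →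
    (μ {g | ∀ l : List ℕ, l.length ≤ k → (g.col l ≠ none ↔ l ∈ t)}).toReal
      = treeWeight π dd k t

/-- `e` realizes an isomorphism (not necessarily root-preserving) of the colored graphs `g`
and `g'`. -/
def IsIsoVia (g g' : RCG M) (e : List ℕ → List ℕ) : Prop :=
  Set.BijOn e (vertsOf g) (vertsOf g') ∧
  (∀ l ∈ vertsOf g, g'.col (e l) = g.col l) ∧
  (∀ l ∈ vertsOf g, ∀ l' ∈ vertsOf g, g'.adj (e l, e l') = g.adj (l, l'))

/-- A function on doubly rooted colored graphs, invariant under isomorphisms. -/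
def PairInvariant (F : RCG M → List ℕ → List ℕ → ℝ≥0∞) : Prop :=
  ∀ g g' e, IsIsoVia g g' e → ∀ u ∈ vertsOf g, ∀ v ∈ vertsOf g, F g' (e u) (e v) = F g u v

/-- Unimodularity (the mass-transport principle):
`E ∑_v F(G,o,v) = E ∑_v F(G,v,o)` for all isomorphism-invariant `F ≥ 0`. -/
def Unimodular (μ : Measure (RCG M)) : Prop :=
  ∀ F : RCG M → List ℕ → List ℕ → ℝ≥0∞, PairInvariant F →
    ∫⁻ g, (∑' v : ↥(vertsOf g), F g [] (v : List ℕ)) ∂μ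
      = ∫⁻ g, (∑' v : ↥(vertsOf g), F g (v : List ℕ) []) ∂μ

/-- `I_π(M)`: the laws of invariant (unimodular) processes `(T,X)` with colors in `M` over
the unimodular Galton-Watson tree with degree distribution `π` (of mean `dd`). -/
def IPiMeas (π : ℕ → ℝ) (dd : ℝ) (M : Type*) [MeasurableSpace M] :
    Set (Measure (RCG M)) :=
  {μ | IsProbabilityMeasure μ ∧ μ {g | IsCanonTree g} = 1 ∧ Unimodular μ ∧
    IsUGWTreeLaw π dd μ}

/-- The root degree `deg(o)` of a canonically labeled tree (the number of children of the
root). -/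
def rootDeg (g : RCG M) : ℕ := {i : ℕ | g.col [i] ≠ none}.ncard

/-- The edge-biased law `→μ(⬝) = (1/d) E[deg(o) 1{(T,X,(o,1)) ∈ ⬝}]` on colored edge-rooted
trees (the root edge being `([], [1])`). -/
def vecLaw (dd : ℝ) [MeasurableSpace M] (μ : Measure (RCG M)) : Measure (RCG M) :=
  (ENNReal.ofReal dd)⁻¹ • μ.withDensity (fun g => (rootDeg g : ℝ≥0∞))

/-- Membership in `E_r = B_{r-1}({o,1})` for a vertex of a canonically labeled tree. -/
def inErL (r : ℕ) (l : List ℕ) : Prop :=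
  l.length + 1 ≤ r ∨ (l.getLast? = some 1 ∧ l.length ≤ r)

/-- The restriction of a colored edge-rooted tree to `E_r = B_{r-1}({o,1})`. -/
def resE (r : ℕ) (g : RCG M) : RCG M where
  col l := if inErL r l then g.col l else none
  adj p := if inErL r p.1 ∧ inErL r p.2 then g.adj p else false

/-- The Shannon entropy `H(π)` of the probability mass function `π`. -/
def Hpmf (π : ℕ → ℝ) : ℝ := ∑' k : ℕ, Real.negMulLog (π k)

/-- The annealed entropy `Σ_r(μ) = H(X_{S_r}) - (d/2) H(→X_{E_r}) - H(π)` of an invariant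
process over the unimodular Galton-Watson tree. -/
def SigmaUGW (π : ℕ → ℝ) (dd : ℝ) [MeasurableSpace M] (r : ℕ) (μ : Measure (RCG M)) : ℝ :=
  shannon (μ.map (resS r)) - (dd / 2) * shannon ((vecLaw dd μ).map (resE r)) - Hpmf π

/-- `Σ(μ) = lim_{r → ∞} Σ_r(μ)` (the limit of a non-increasing sequence). -/
def SigmaUGWInf (π : ℕ → ℝ) (dd : ℝ) [MeasurableSpace M] (μ : Measure (RCG M)) : EReal :=
  ⨅ r : ℕ, ((SigmaUGW π dd (r + 1) μ : ℝ) : EReal)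

/-- `Σ_e(X) = (d/2) H(→X_{E_1}) - d H(→X_o) + H(X_o) - H(π)`. -/
def SigmaEUGW (π : ℕ → ℝ) (dd : ℝ) [MeasurableSpace M] (μ : Measure (RCG M)) : ℝ :=
  (dd / 2) * shannon ((vecLaw dd μ).map (resE 1))
    - dd * shannon ((vecLaw dd μ).map (resS 0))
    + shannon (μ.map (resS 0)) - Hpmf π

/-! ### Markov processes on random trees -/

/-- The side of the (potential) edge `{u,w}` containing `u`, among the labels. -/
def sideL (u w : List ℕ) : Set (List ℕ) := {v | treeDist v u < treeDist v w}

/-- `B_{r-1}({u,w})` among the labels. -/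
def edgeBallL (r : ℕ) (u w : List ℕ) : Set (List ℕ) :=
  {v | treeDist v u + 1 ≤ r ∨ treeDist v w + 1 ≤ r}

/-- The event that the tree structure agrees with that of `y` on `S` and that the colored
tree agrees with `y` on `B`. -/
def treeCylEvent (S B : Set (List ℕ)) (y : RCG M) : Set (RCG M) :=
  {g | (∀ l ∈ S, (g.col l ≠ none ↔ y.col l ≠ none)) ∧ (∀ l ∈ B, g.col l = y.col l)}

/-- A random colored tree is `r`-Markov on the ambient set `A` if, conditioned on the tree
and on the value on the `(r-1)`-neighborhood of an edge, the processes on the two sides of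
the edge are independent (conditioning on the tree is expressed through arbitrary finite
windows `S`). -/
def rMarkovTreeOn [MeasurableSpace M] (r : ℕ) (A : Set (List ℕ)) (μ : Measure (RCG M)) :
    Prop :=
  ∀ (u : List ℕ) (i : ℕ), 1 ≤ i → u ∈ A → (i :: u) ∈ A →
    ∀ F₁ F₂ : Finset (List ℕ), ↑F₁ ⊆ sideL u (i :: u) ∩ A → ↑F₂ ⊆ sideL (i :: u) u ∩ A →
    ∀ S : Finset (List ℕ), ↑S ⊆ A → ∀ y : RCG M,
      μ (treeCylEvent ↑S (edgeBallL r u (i :: u) ∩ A) y ∩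
          treeCylEvent ∅ ↑F₁ y ∩ treeCylEvent ∅ ↑F₂ y)
        * μ (treeCylEvent ↑S (edgeBallL r u (i :: u) ∩ A) y)
      = μ (treeCylEvent ↑S (edgeBallL r u (i :: u) ∩ A) y ∩ treeCylEvent ∅ ↑F₁ y)
        * μ (treeCylEvent ↑S (edgeBallL r u (i :: u) ∩ A) y ∩ treeCylEvent ∅ ↑F₂ y)

/-- A random colored tree is `r`-Markov if the above holds with ambient set everything. -/
def rMarkovTree [MeasurableSpace M] (r : ℕ) (μ : Measure (RCG M)) : Prop :=
  rMarkovTreeOn r Set.univ μ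

/-- A random colored tree is vertex-Markov on the ambient set `A` if, conditioned on the tree
and on the value at a vertex, the processes on the pending subtrees of that vertex are
independent. -/
def vertexMarkovTreeOn [MeasurableSpace M] (A : Set (List ℕ)) (μ : Measure (RCG M)) :
    Prop :=
  ∀ v ∈ A, ∀ (k : ℕ) (u : Fin k → List ℕ), Function.Injective u →
    (∀ j, u j ∈ A ∧ ((∃ i, 1 ≤ i ∧ u j = i :: v) ∨ (v ≠ [] ∧ u j = v.tail))) →
    ∀ F : Fin k → Finset (List ℕ), (∀ j, ↑(F j) ⊆ sideL (u j) v ∩ A) →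
    ∀ S : Finset (List ℕ), ↑S ⊆ A → ∀ y : RCG M,
      μ (treeCylEvent ↑S {v} y ∩ ⋂ j, treeCylEvent ∅ ↑(F j) y)
          * (μ (treeCylEvent ↑S {v} y)) ^ (k - 1)
        = ∏ j : Fin k, μ (treeCylEvent ↑S {v} y ∩ treeCylEvent ∅ ↑(F j) y)

/-- A random colored tree is vertex-Markov if the above holds with ambient set everything. -/
def vertexMarkovTree [MeasurableSpace M] (μ : Measure (RCG M)) : Prop :=
  vertexMarkovTreeOn Set.univ μ

/-! ### Random graphs with given degree sequences -/

/-- The set of simple graphs on `{1,…,n}` with degree sequence `dn`. -/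
def degSeqGraphs (n : ℕ) (dn : Fin n → ℕ) : Set (SimpleGraph (Fin n)) :=
  {G | ∀ v, (G.neighborSet v).ncard = dn v}

/-- The probability that a uniform random graph with degree sequence `dn` lies in `A`. -/
def PrD (n : ℕ) (dn : Fin n → ℕ) (A : Set (SimpleGraph (Fin n))) : ℝ :=
  ((degSeqGraphs n dn ∩ A).ncard : ℝ) / ((degSeqGraphs n dn).ncard : ℝ)

/-- `𝓕_G(μ,r,ε)` for a process `μ` over a unimodular Galton-Watson tree. -/
def FSetD [MeasurableSpace M] (μ : Measure (RCG M)) (r : ℕ) (ε : ℝ) {n : ℕ}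
    (G : SimpleGraph (Fin n)) : Set (Fin n → M) :=
  {f | levyProkhorovDist ((distrG G f).map (resS r)) (μ.map (resS r)) ≤ ε}

/-- `H_G(μ,r,ε) = (1/n) log |𝓕_G(μ,r,ε)|`. -/
def HGD [MeasurableSpace M] (μ : Measure (RCG M)) (r : ℕ) (ε : ℝ) {n : ℕ}
    (G : SimpleGraph (Fin n)) : EReal :=
  if FSetD μ r ε G = ∅ then ⊥
  else ((Real.log ((FSetD μ r ε G).ncard) / n : ℝ) : EReal)

/-- The `α`-quantile of `H_{G_n}(μ,r,ε)` for the uniform random graph with degree sequence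
`DN n`. -/
def hquantD [MeasurableSpace M] (DN : (n : ℕ) → Fin n → ℕ) (μ : Measure (RCG M)) (r : ℕ)
    (ε : ℝ) (α : ℝ) (n : ℕ) : EReal :=
  sSup {h : EReal | (h = ⊥ ∨ 0 ≤ h) ∧
    α ≤ PrD n (DN n) {G : SimpleGraph (Fin n) | h ≤ HGD μ r ε G}}

/-- `h̄(μ,r,α)` for the degree-sequence ensemble. -/
def hbarAD [MeasurableSpace M] (DN : (n : ℕ) → Fin n → ℕ) (μ : Measure (RCG M)) (r : ℕ)
    (α : ℝ) : EReal :=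
  ⨅ ε : {e : ℝ // 0 < e}, Filter.atTop.limsup (fun n => hquantD DN μ r ε.1 α n)

/-- `h̲(μ,r,α)` for the degree-sequence ensemble. -/
def hlowAD [MeasurableSpace M] (DN : (n : ℕ) → Fin n → ℕ) (μ : Measure (RCG M)) (r : ℕ)
    (α : ℝ) : EReal :=
  ⨅ ε : {e : ℝ // 0 < e}, Filter.atTop.liminf (fun n => hquantD DN μ r ε.1 α n)

/-- `h̄(μ,r)`: the common value of `h̄(μ,r,α)`, `0 < α < 1`. -/
def hbarRD [MeasurableSpace M] (DN : (n : ℕ) → Fin n → ℕ) (μ : Measure (RCG M)) (r : ℕ) :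
    EReal :=
  hbarAD DN μ r (1 / 2)

/-- `h̲(μ,r)`. -/
def hlowRD [MeasurableSpace M] (DN : (n : ℕ) → Fin n → ℕ) (μ : Measure (RCG M)) (r : ℕ) :
    EReal :=
  hlowAD DN μ r (1 / 2)

/-- The upper sofic entropy `h̄(μ) = lim_{r → ∞} h̄(μ,r)`. -/
def hbarD [MeasurableSpace M] (DN : (n : ℕ) → Fin n → ℕ) (μ : Measure (RCG M)) : EReal :=
  ⨅ r : ℕ, hbarRD DN μ r

/-- The lower sofic entropy `h̲(μ) = lim_{r → ∞} h̲(μ,r)`. -/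
def hlowD [MeasurableSpace M] (DN : (n : ℕ) → Fin n → ℕ) (μ : Measure (RCG M)) : EReal :=
  ⨅ r : ℕ, hlowRD DN μ r

/-- The hypotheses on the degree sequences: uniformly bounded by `Δ`, even sums, and
empirical distributions converging (weakly) to `π`. -/
def GoodDegSeq (π : ℕ → ℝ) (Δ : ℝ) (DN : (n : ℕ) → Fin n → ℕ) : Prop :=
  (∀ n v, (DN n v : ℝ) ≤ Δ) ∧ (∀ n, Even (∑ v : Fin n, DN n v)) ∧
  (∀ k : ℕ, Tendsto (fun n => (((Finset.univ.filter (fun v : Fin n => DN n v = k)).card : ℝ) / n))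
    atTop (nhds (π k)))

/-- The hypotheses on the degree distribution `π`: a probability mass function supported in
`{0,…,Δ}` with mean `dd > 0`. -/
def GoodPmf (π : ℕ → ℝ) (Δ : ℝ) (dd : ℝ) : Prop :=
  (∀ k, 0 ≤ π k) ∧ (∑' k : ℕ, π k) = 1 ∧ (∀ k : ℕ, (Δ : ℝ) < k → π k = 0) ∧
  (∑' k : ℕ, (k : ℝ) * π k) = dd ∧ 0 < dd


/-! ### Couplings -/

/-- `ν ∈ I_d(M × M)` is an invariant coupling of `μ` with itself: both coordinate marginal
processes of `ν` have law `μ`. -/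
def IsInvCoupling (d : ℕ) {M : Type*} [MeasurableSpace M] (μ : Measure (TdVertex d → M))
    (ν : Measure (TdVertex d → M × M)) : Prop :=
  ν ∈ InvMeas d (M × M) ∧ ν.map (fun x => fun v => (x v).1) = μ ∧
    ν.map (fun x => fun v => (x v).2) = μ

/-- The first coordinate marginal of a colored graph with colors in a product set. -/
def rcgFst {M₁ M₂ : Type*} (g : RCG (M₁ × M₂)) : RCG M₁ :=
  ⟨fun l => (g.col l).map Prod.fst, g.adj⟩

/-- The second coordinate marginal of a colored graph with colors in a product set. -/
def rcgSnd {M₁ M₂ : Type*} (g : RCG (M₁ × M₂)) : RCG M₂ :=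
  ⟨fun l => (g.col l).map Prod.snd, g.adj⟩

/-- `ν ∈ I_π(M × M)` is an invariant coupling of `μ ∈ I_π(M)` with itself. -/
def IsInvCouplingUGW (π : ℕ → ℝ) (dd : ℝ) {M : Type*} [MeasurableSpace M]
    (μ : Measure (RCG M)) (ν : Measure (RCG (M × M))) : Prop :=
  ν ∈ IPiMeas π dd (M × M) ∧ ν.map rcgFst = μ ∧ ν.map rcgSnd = μ


open Finset in
/-- The number of occurrences of `a` in the family `s`. -/
def cnt {ι α : Type*} [Fintype ι] (s : ι → α) (a : α) : ℕ := #{i | s i = a}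

lemma sum_cnt {ι α : Type*} [Fintype ι] [Fintype α] (s : ι → α) :
    ∑ a, cnt s a = Fintype.card ι := by
  unfold cnt
  rw [← Finset.card_univ]
  exact (Finset.card_eq_sum_card_fiberwise (fun _ _ => Finset.mem_univ _)).symm

lemma cnt_comp_equiv {ι κ α : Type*} [Fintype ι] [Fintype κ] (t : κ → α) (π : ι ≃ κ) :
    cnt (t ∘ π) = cnt t := by
  funext a
  unfold cnt
  refine Finset.card_bij (fun i _ => π i) (by simp) (by simp) ?_
  intro b hb
  exact ⟨π.symm b, by simpa using hb, by simp⟩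

lemma cnt_eq_fintype_card {ι α : Type*} [Fintype ι] (s : ι → α) (a : α) :
    Fintype.card {i // s i = a} = cnt s a := by
  rw [Fintype.card_subtype]; rfl

lemma exists_equiv_of_cnt_eq {ι κ α : Type*} [Fintype ι] [Fintype κ] (s : ι → α) (t : κ → α)
    (h : cnt s = cnt t) : ∃ π : ι ≃ κ, t ∘ π = s := by
  have e : ∀ a, Nonempty ({i // s i = a} ≃ {j // t j = a}) := fun a =>
    ⟨Fintype.equivOfCardEq (by rw [cnt_eq_fintype_card, cnt_eq_fintype_card, h])⟩
  replace e := fun a => Classical.choice (e a)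
  refine ⟨(Equiv.sigmaFiberEquiv s).symm.trans
    ((Equiv.sigmaCongrRight fun a => e a).trans (Equiv.sigmaFiberEquiv t)), ?_⟩
  funext i
  simp only [Function.comp_apply, Equiv.trans_apply]
  exact (e (s i) ⟨i, rfl⟩).2

open Finset in
lemma card_equiv_comp_eq {ι κ α : Type*} [Fintype ι] [Fintype κ] [DecidableEq ι]
    [DecidableEq κ] [Fintype α]
    (s : ι → α) (t : κ → α) (h : cnt s = cnt t) :
    #{π : ι ≃ κ | t ∘ π = s} = ∏ a, (cnt t a).factorial := by
  obtain ⟨π₀, h₀⟩ := exists_equiv_of_cnt_eq s t h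
  have h1 := DomMulAct.stabilizer_card s
  rw [← h]
  simp only [cnt_eq_fintype_card] at h1
  rw [← h1, Fintype.card_subtype]
  symm
  refine Finset.card_bij (fun g _ => g.trans π₀) ?_ ?_ ?_
  · intro g hg
    simp only [mem_filter, mem_univ, true_and] at hg ⊢
    rw [← hg, ← h₀]
    funext i
    simp
  · intro a _ b _ hab
    ext i
    simpa using congrFun (congrArg (fun e : ι ≃ κ => (e : ι → κ)) hab) i
  · intro π hπ
    simp only [mem_filter, mem_univ, true_and] at hπ
    refine ⟨π.trans π₀.symm, ?_, ?_⟩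
    · simp only [mem_filter, mem_univ, true_and]
      funext i
      have h3 := congrFun h₀ (π₀.symm (π i))
      have h4 := congrFun hπ i
      simp only [Function.comp_apply, Equiv.apply_symm_apply, Equiv.trans_apply] at h3 h4 ⊢
      rw [← h3, h4]
    · ext i; simp

open Finset in
lemma card_seq_mul_prod {ι α : Type*} [Fintype ι] [DecidableEq ι] [Fintype α] (t : ι → α) :
    #{s : ι → α | cnt s = cnt t} * ∏ a, (cnt t a).factorial = (Fintype.card ι).factorial := by
  rw [← Fintype.card_perm, ← Finset.card_univ]
  rw [Finset.card_eq_sum_card_fiberwise (f := fun π : Equiv.Perm ι => t ∘ π)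
    (t := {s : ι → α | cnt s = cnt t})]
  · rw [Finset.sum_congr rfl (g := fun _ => ∏ a, (cnt t a).factorial), sum_const, smul_eq_mul]
    intro s hs
    exact card_equiv_comp_eq s t (by simpa using hs)
  · intro π _
    simp [cnt_comp_equiv]

/-- `N` times the entropy of the empirical distribution `m / N`, where `N = ∑ m`. -/
def entN {α : Type*} [Fintype α] (m : α → ℝ) : ℝ :=
  (∑ a, m a) * Real.log (∑ a, m a) - ∑ a, m a * Real.log (m a)

lemma prod_cnt {ι α : Type*} [Fintype ι] [Fintype α] (s : ι → α) (w : α → ℝ) :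
    ∏ i, w (s i) = ∏ a, w a ^ cnt s a := by
  rw [← Finset.prod_fiberwise Finset.univ s]
  refine Finset.prod_congr rfl fun a _ => ?_
  rw [Finset.prod_congr rfl (g := fun _ => w a), Finset.prod_const]; · rfl
  intro i hi
  rw [(Finset.mem_filter.1 hi).2]

lemma sum_prod_weights {ι α : Type*} [Fintype ι] [DecidableEq ι] [Fintype α] (w : α → ℝ) :
    ∑ s : ι → α, ∏ i, w (s i) = (∑ a, w a) ^ Fintype.card ι := by
  rw [← Finset.card_univ, ← Finset.prod_const, Finset.prod_univ_sum, Fintype.piFinset_univ]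

open Finset in
lemma card_seq_le {ι α : Type*} [Fintype ι] [DecidableEq ι] [Fintype α] (t : ι → α) :
    (#{s : ι → α | cnt s = cnt t} : ℝ) ≤ Real.exp (entN (fun a => (cnt t a : ℝ))) := by
  rcases isEmpty_or_nonempty ι with hι | hι
  · have h0 : ∀ a, cnt t a = 0 := by intro a; simp [cnt]
    have : #{s : ι → α | cnt s = cnt t} ≤ 1 := Finset.card_le_one.2 fun a _ b _ =>
      Subsingleton.elim _ _
    simp only [entN, h0]
    simpa using this
  have hN : (0:ℝ) < Fintype.card ι := by exact_mod_cast Fintype.card_pos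
  have hsum : ∑ a, (cnt t a : ℝ) = Fintype.card ι := by exact_mod_cast sum_cnt t
  set N : ℝ := (Fintype.card ι : ℝ)
  have h1 : ∀ s ∈ ({s : ι → α | cnt s = cnt t} : Finset _), ∏ i, (cnt t (s i) / N : ℝ) =
      Real.exp (- entN (fun a => (cnt t a : ℝ))) := by
    intro s hs
    have hs : cnt s = cnt t := by simpa using hs
    rw [prod_cnt s (fun a => (cnt t a / N : ℝ)), hs, entN, hsum, ← hsum, sum_mul,
      ← sum_sub_distrib, ← sum_neg_distrib, Real.exp_sum, hsum]
    refine prod_congr rfl fun a _ => ?_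
    rcases Nat.eq_zero_or_pos (cnt t a) with h | h
    · simp [h]
    · have h' : (0:ℝ) < cnt t a := by exact_mod_cast h
      rw [← Real.exp_log (div_pos h' hN), ← Real.exp_nat_mul, Real.log_div h'.ne' hN.ne']
      congr 1
      ring
  have h2 : ∑ s : ι → α, ∏ i, (cnt t (s i) / N : ℝ) = 1 := by
    rw [sum_prod_weights (fun a => (cnt t a / N : ℝ)), ← sum_div, hsum, div_self hN.ne', one_pow]
  have h3 : ∑ s ∈ ({s : ι → α | cnt s = cnt t} : Finset _), ∏ i, (cnt t (s i) / N : ℝ) ≤ 1 := by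
    rw [← h2]
    refine sum_le_univ_sum_of_nonneg fun s => prod_nonneg fun i _ => by positivity
  rw [sum_congr rfl h1, sum_const, nsmul_eq_mul, Real.exp_neg] at h3
  rwa [← div_eq_mul_inv, div_le_one (Real.exp_pos _)] at h3

lemma le_log_factorial (k : ℕ) : k * Real.log k - k ≤ Real.log (k.factorial) := by
  induction k with
  | zero => simp
  | succ k ih =>
    rw [Nat.factorial_succ, Nat.cast_mul, Real.log_mul (by positivity) (by positivity)]
    rcases Nat.eq_zero_or_pos k with h | h
    · subst h; simp
    have hk : (0:ℝ) < k := by exact_mod_cast h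
    have h1 : Real.log ((k+1 : ℕ) / (k:ℝ)) ≤ ((k+1:ℕ) / (k:ℝ)) - 1 :=
      Real.log_le_sub_one_of_pos (by positivity)
    rw [Real.log_div (by positivity) hk.ne'] at h1
    have h2 : (k:ℝ) * (Real.log (k+1:ℕ) - Real.log k) ≤ 1 := by
      calc _ ≤ (k:ℝ) * (((k+1:ℕ) / (k:ℝ)) - 1) := by gcongr
        _ = 1 := by push_cast; field_simp; ring
    push_cast at *
    nlinarith

lemma log_factorial_le (k : ℕ) :
    Real.log (k.factorial) ≤ k * Real.log k - k + 1 + Real.log (k + 1) := by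
  have key : ∀ k : ℕ, 1 ≤ k → Real.log (k.factorial) ≤ k * Real.log k - k + 1 + Real.log k := by
    intro k hk
    induction k, hk using Nat.le_induction with
    | base => simp
    | succ k hk ih =>
      rw [Nat.factorial_succ, Nat.cast_mul, Real.log_mul (by positivity) (by positivity)]
      have hk : (0:ℝ) < k := by exact_mod_cast hk
      have h1 : Real.log ((k:ℝ) / (k+1 : ℕ)) ≤ ((k:ℝ) / (k+1:ℕ)) - 1 :=
        Real.log_le_sub_one_of_pos (by positivity)
      rw [Real.log_div hk.ne' (by positivity)] at h1
      have h2 : ((k:ℝ)+1) * (Real.log k - Real.log (k+1:ℕ)) ≤ -1 := by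
        calc _ ≤ ((k:ℝ)+1) * (((k:ℝ) / (k+1:ℕ)) - 1) := by gcongr
          _ = -1 := by push_cast; field_simp; ring
      push_cast at *
      nlinarith
  rcases Nat.eq_zero_or_pos k with h | h
  · subst h; simp
  have hk : (0:ℝ) < k := by exact_mod_cast h
  have := key k h
  have : Real.log k ≤ Real.log (k+1) := Real.log_le_log hk (by linarith)
  linarith

/-- Polynomial factor in the comparison of multinomial coefficients with entropies. -/
def polyF (c N : ℕ) : ℝ := (Real.exp 1 * (N + 1)) ^ c

lemma polyF_pos (c N : ℕ) : 0 < polyF c N := by unfold polyF; positivity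

lemma prod_factorial_le {α : Type*} [Fintype α] (m : α → ℕ) :
    (∏ a, ((m a).factorial : ℝ)) ≤ (∑ a, m a).factorial *
      (Real.exp (- entN (fun a => (m a : ℝ))) * polyF (Fintype.card α) (∑ a, m a)) := by
  set N := ∑ a, m a with hN
  have hNr : ∑ a, (m a : ℝ) = N := by rw [hN]; push_cast; rfl
  have hP : polyF (Fintype.card α) N = Real.exp (∑ _a : α, (1 + Real.log (N + 1))) := by
    rw [Finset.sum_const, Finset.card_univ, nsmul_eq_mul, Real.exp_nat_mul, Real.exp_add,
      Real.exp_log (by positivity)]; rfl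
  have h1 : (∏ a, ((m a).factorial : ℝ)) = Real.exp (∑ a, Real.log ((m a).factorial)) := by
    rw [Real.exp_sum]
    exact Finset.prod_congr rfl fun a _ => (Real.exp_log (by positivity)).symm
  rw [h1, hP, ← Real.exp_log (show (0:ℝ) < N.factorial by positivity), ← Real.exp_add,
    ← Real.exp_add, Real.exp_le_exp, entN, hNr]
  have h2 : ∑ a, Real.log ((m a).factorial) ≤
      ∑ a, ((m a : ℝ) * Real.log (m a) - m a + (1 + Real.log (N + 1))) := by
    refine Finset.sum_le_sum fun a _ => ?_
    have h3 := log_factorial_le (m a)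
    have h4 : Real.log ((m a : ℝ) + 1) ≤ Real.log (N + 1) := by
      apply Real.log_le_log (by positivity)
      have : m a ≤ N := Finset.single_le_sum (f := m) (fun _ _ => Nat.zero_le _) (Finset.mem_univ a)
      have : (m a : ℝ) ≤ N := by exact_mod_cast this
      linarith
    linarith
  have h5 := le_log_factorial N
  rw [Finset.sum_add_distrib, Finset.sum_sub_distrib, hNr] at h2
  linarith

open Finset in
lemma le_card_seq {ι α : Type*} [Fintype ι] [DecidableEq ι] [Fintype α] (t : ι → α) :
    Real.exp (entN (fun a => (cnt t a : ℝ))) ≤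
      #{s : ι → α | cnt s = cnt t} * polyF (Fintype.card α) (Fintype.card ι) := by
  have h1 := card_seq_mul_prod t
  have h2 := prod_factorial_le (cnt t)
  rw [sum_cnt] at h2
  have h3 : (#{s : ι → α | cnt s = cnt t} : ℝ) * ∏ a, ((cnt t a).factorial : ℝ) =
    (Fintype.card ι).factorial := by exact_mod_cast h1
  rw [← h3, Real.exp_neg] at h2
  have h4 : (0:ℝ) < ∏ a, ((cnt t a).factorial : ℝ) := Finset.prod_pos fun a _ => by positivity
  set K : ℝ := (#{s : ι → α | cnt s = cnt t} : ℝ)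
  set P : ℝ := ∏ a, ((cnt t a).factorial : ℝ)
  set Q := polyF (Fintype.card α) (Fintype.card ι)
  set E := Real.exp (entN (fun a => (cnt t a : ℝ))) with hE
  have hEp : 0 < E := Real.exp_pos _
  have h5 : P * E ≤ P * (K * Q) := by
    calc P * E ≤ (K * P * (E⁻¹ * Q)) * E := by gcongr
      _ = P * (K * Q) := by field_simp
  exact le_of_mul_le_mul_left h5 h4

lemma factorial_le_prod {ι α : Type*} [Fintype ι] [Fintype α] (t : ι → α) :
    ((Fintype.card ι).factorial : ℝ) * Real.exp (-entN (fun a => (cnt t a : ℝ))) ≤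
      ∏ a, ((cnt t a).factorial : ℝ) := by
  have h1 := card_seq_mul_prod t
  have h2 := card_seq_le t
  have h3 : (Finset.card {s : ι → α | cnt s = cnt t} : ℝ) * ∏ a, ((cnt t a).factorial : ℝ) =
    (Fintype.card ι).factorial := by exact_mod_cast h1
  rw [← h3, Real.exp_neg]
  have h4 : (0:ℝ) < ∏ a, ((cnt t a).factorial : ℝ) := Finset.prod_pos fun a _ => by positivity
  rw [← div_eq_mul_inv, div_le_iff₀ (Real.exp_pos _), mul_comm]
  gcongr

/-- Exchanging the two slots of every edge. -/
def flipB (m : ℕ) : Fin m × Bool ≃ Fin m × Bool := (Equiv.refl _).prodCongr Equiv.boolNot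

@[simp] lemma flipB_apply (m : ℕ) (s : Fin m × Bool) : flipB m s = (s.1, !s.2) := rfl

@[simp] lemma flipB_flipB (m : ℕ) (s : Fin m × Bool) : flipB m (flipB m s) = s := by
  simp

/-- The matching of half-edges defined by a configuration. -/
def inv {m : ℕ} {κ : Type*} (π : Fin m × Bool ≃ κ) (h : κ) : κ := π (flipB m (π.symm h))

@[simp] lemma inv_inv {m : ℕ} {κ : Type*} (π : Fin m × Bool ≃ κ) (h : κ) :
    inv π (inv π h) = h := by
  simp [inv]

lemma inv_ne {m : ℕ} {κ : Type*} (π : Fin m × Bool ≃ κ) (h : κ) : inv π h ≠ h := by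
  intro hh
  have := congrArg π.symm hh
  simp only [inv, Equiv.symm_apply_apply] at this
  have := congrArg Prod.snd this
  simp at this

@[simp] lemma inv_apply {m : ℕ} {κ : Type*} (π : Fin m × Bool ≃ κ) (s : Fin m × Bool) :
    inv π (π s) = π (s.1, !s.2) := by
  simp [inv]

open Finset in
lemma card_compat_le {m : ℕ} {κ β : Type*} [Fintype κ] [DecidableEq κ] [Fintype β] (τ : β → β)
    (hτ : Function.Involutive τ) (t : κ → β) (hm : Fintype.card κ = 2 * m) :
    (#{π : Fin m × Bool ≃ κ | ∀ h, t (inv π h) = τ (t h)} : ℝ) ≤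
      (2 * m).factorial * (Real.exp (- (entN (fun a => (cnt t a : ℝ)) / 2)) *
        polyF (Fintype.card β) (2 * m)) := by
  set ext : (Fin m → β) → (Fin m × Bool → β) := fun s p => bif p.2 then τ (s p.1) else s p.1
  set P : ℝ := ∏ a, ((cnt t a).factorial : ℝ)
  set E : ℝ := entN (fun a => (cnt t a : ℝ)) with hE
  have h1 : (#{π : Fin m × Bool ≃ κ | ∀ h, t (inv π h) = τ (t h)} : ℝ) ≤
      #{s : Fin m → β | cnt (ext s) = cnt t} * P := by
    have : #{π : Fin m × Bool ≃ κ | ∀ h, t (inv π h) = τ (t h)} ≤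
        (∏ a, (cnt t a).factorial) * #{s : Fin m → β | cnt (ext s) = cnt t} := by
      refine card_le_mul_card_image_of_maps_to (f := fun π e => t (π (e, false))) ?_ _ ?_
      · intro π hπ
        simp only [mem_filter, mem_univ, true_and] at hπ ⊢
        rw [← cnt_comp_equiv t π]
        congr 1
        funext ⟨e, b⟩
        cases b
        · rfl
        · simpa [ext] using (hπ (π (e, false))).symm
      · intro s hs
        simp only [mem_filter, mem_univ, true_and] at hs
        rw [← card_equiv_comp_eq (ext s) t hs]
        refine card_le_card ?_
        intro π hπ
        simp only [mem_filter, mem_univ, true_and] at hπ ⊢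
        rw [← hπ.2]
        funext ⟨e, b⟩
        cases b
        · rfl
        · simpa [ext] using (hπ.1 (π (e, false)))
    rw [mul_comm]
    simp only [P]
    exact_mod_cast this
  have h2 : P ≤ (2 * m).factorial * (Real.exp (- E) * polyF (Fintype.card β) (2 * m)) := by
    have := prod_factorial_le (cnt t)
    rwa [sum_cnt, hm] at this
  have h3 : (#{s : Fin m → β | cnt (ext s) = cnt t} : ℝ) ≤ Real.exp (E / 2) := by
    rcases Nat.eq_zero_or_pos m with h0 | h0
    · subst h0
      have h0 : ∀ a, cnt t a = 0 := by
        have : IsEmpty κ := Fintype.card_eq_zero_iff.1 (by simpa using hm)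
        intro a; simp [cnt]
      have : #{s : Fin 0 → β | cnt (ext s) = cnt t} ≤ 1 := Finset.card_le_one.2 fun a _ b _ =>
        Subsingleton.elim _ _
      simp only [entN, h0, hE]
      simpa using this
    set N : ℝ := ((2 * m : ℕ) : ℝ)
    have hN : 0 < N := by positivity
    have hsum : ∑ a, (cnt t a : ℝ) = N := by
      simp only [N]; rw [← hm]; exact_mod_cast sum_cnt t
    set w : β → ℝ := fun y => √((cnt t y / N) * (cnt t (τ y) / N)) with hw
    have hsw : ∑ y, w y ≤ 1 := by
      calc ∑ y, w y ≤ ∑ y, ((cnt t y / N) + (cnt t (τ y) / N)) / 2 := by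
            refine sum_le_sum fun y _ => ?_
            rw [hw, Real.sqrt_le_left (by positivity)]
            nlinarith [sq_nonneg ((cnt t y / N : ℝ) - (cnt t (τ y) / N))]
        _ = 1 := by
            have h4 : ∑ y, (cnt t (τ y) / N : ℝ) = ∑ y, (cnt t y / N : ℝ) :=
              Equiv.sum_comp (Function.Involutive.toPerm τ hτ) (fun y => (cnt t y / N : ℝ))
            rw [← sum_div, sum_add_distrib, h4, ← sum_div, hsum, div_self hN.ne']
            norm_num
    have hterm : ∀ s ∈ ({s : Fin m → β | cnt (ext s) = cnt t} : Finset _),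
        ∏ e, w (s e) = Real.exp (- (E / 2)) := by
      intro s hs
      have hs : cnt (ext s) = cnt t := by simpa using hs
      have ha : (∏ e, w (s e)) ^ 2 = Real.exp (-E) := by
        rw [← prod_pow]
        have hb : ∀ e, w (s e) ^ 2 = ∏ b : Bool, ((cnt t (ext s (e, b)) : ℝ) / N) := by
          intro e
          rw [hw, Real.sq_sqrt (by positivity)]
          simp [ext]; ring
        rw [prod_congr rfl (fun e _ => hb e), ← Fintype.prod_prod_type',
          prod_cnt (ext s) (fun a => (cnt t a / N : ℝ)), hs, hE, entN, hsum, ← hsum, sum_mul,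
          ← sum_sub_distrib, ← sum_neg_distrib, Real.exp_sum, hsum]
        refine prod_congr rfl fun a _ => ?_
        rcases Nat.eq_zero_or_pos (cnt t a) with h | h
        · simp [h]
        · have h' : (0:ℝ) < cnt t a := by exact_mod_cast h
          rw [← Real.exp_log (div_pos h' hN), ← Real.exp_nat_mul, Real.log_div h'.ne' hN.ne']
          congr 1
          ring
      have hpos : 0 ≤ ∏ e, w (s e) := prod_nonneg fun e _ => Real.sqrt_nonneg _
      have hc : Real.exp (- (E/2)) ^ 2 = Real.exp (-E) := by
        rw [← Real.exp_nat_mul]; congr 1; push_cast; ring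
      rw [← hc] at ha
      exact (pow_left_inj₀ hpos (Real.exp_pos _).le two_ne_zero).1 ha
    have htot : ∑ s ∈ ({s : Fin m → β | cnt (ext s) = cnt t} : Finset _), ∏ e, w (s e) ≤ 1 := by
      calc _ ≤ ∑ s : Fin m → β, ∏ e, w (s e) :=
            sum_le_univ_sum_of_nonneg fun s => prod_nonneg fun i _ => Real.sqrt_nonneg _
        _ = (∑ y, w y) ^ m := by rw [sum_prod_weights, Fintype.card_fin]
        _ ≤ 1 := pow_le_one₀ (sum_nonneg fun y _ => Real.sqrt_nonneg _) hsw
    rw [sum_congr rfl hterm, sum_const, nsmul_eq_mul, Real.exp_neg] at htot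
    rwa [← div_eq_mul_inv, div_le_one (Real.exp_pos _)] at htot
  have hP : 0 ≤ P := by positivity
  calc _ ≤ _ := h1
    _ ≤ Real.exp (E/2) * ((2 * m).factorial *
        (Real.exp (- E) * polyF (Fintype.card β) (2 * m))) := by
        gcongr
    _ = (2 * m).factorial *
        ((Real.exp (E/2) * Real.exp (- E)) * polyF (Fintype.card β) (2 * m)) := by
        ring
    _ = _ := by rw [← Real.exp_add]; congr 4; ring

open Finset in
lemma sum_exp_neg_entN_le {ι α : Type*} [Fintype ι] [DecidableEq ι] [Fintype α] :
    ∑ X : ι → α, Real.exp (- entN (fun a => (cnt X a : ℝ))) ≤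
      ((Fintype.card ι : ℝ) + 1) ^ Fintype.card α := by
  set N := Fintype.card ι with hN
  have hmap : ∀ X ∈ (univ : Finset (ι → α)), cnt X ∈
      (Fintype.piFinset fun _ : α => range (N + 1)) := by
    intro X _
    rw [Fintype.mem_piFinset]
    intro a
    rw [mem_range, Nat.lt_succ_iff, hN, ← sum_cnt X]
    exact single_le_sum (f := cnt X) (fun _ _ => Nat.zero_le _) (mem_univ a)
  rw [← sum_fiberwise_of_maps_to hmap]
  have : ∀ c ∈ (Fintype.piFinset fun _ : α => range (N + 1)),
      ∑ X ∈ (univ : Finset (ι → α)) with cnt X = c,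
        Real.exp (- entN (fun a => (cnt X a : ℝ))) ≤ 1 := by
    intro c _
    by_cases hc : ∃ t : ι → α, cnt t = c
    · obtain ⟨t, rfl⟩ := hc
      have h1 := card_seq_le t
      rw [sum_congr rfl (g := fun _ => Real.exp (- entN (fun a => (cnt t a : ℝ))))]
      · rw [sum_const, nsmul_eq_mul, Real.exp_neg, ← div_eq_mul_inv, div_le_one (Real.exp_pos _)]
        exact h1
      · intro X hX
        rw [(mem_filter.1 hX).2]
    · rw [filter_false_of_mem (fun X _ h => hc ⟨X, h⟩)]
      simp
  calc _ ≤ ∑ c ∈ (Fintype.piFinset fun _ : α => range (N + 1)), (1:ℝ) := sum_le_sum this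
    _ = _ := by
      simp [Fintype.card_piFinset]

open Finset in
/-- Exponential upper bound for the number of typed configurations with entropy deficit
bounded by `B`. -/
lemma card_typed_le {ι κ α β : Type*} {m : ℕ} [Fintype ι] [Fintype κ]
    [DecidableEq ι] [DecidableEq κ] [Fintype α] [Fintype β]
    (τ : β → β) (hτ : Function.Involutive τ) (hm : Fintype.card κ = 2 * m)
    (ty : (ι → α) → κ → β) (B : ℝ) :
    (#{p : (Fin m × Bool ≃ κ) × (ι → α) | (∀ h, ty p.2 (inv p.1 h) = τ (ty p.2 h)) ∧
      entN (fun a => (cnt p.2 a : ℝ)) - entN (fun b => (cnt (ty p.2) b : ℝ)) / 2 ≤ B} : ℝ) ≤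
    (2 * m).factorial * Real.exp B * (polyF (Fintype.card β) (2 * m) *
      ((Fintype.card ι : ℝ) + 1) ^ Fintype.card α) := by
  set S := ({p : (Fin m × Bool ≃ κ) × (ι → α) | (∀ h, ty p.2 (inv p.1 h) = τ (ty p.2 h)) ∧
      entN (fun a => (cnt p.2 a : ℝ)) - entN (fun b => (cnt (ty p.2) b : ℝ)) / 2 ≤ B} : Finset _)
  have h1 : (S.card : ℝ) = ∑ X : ι → α, (#{p ∈ S | p.2 = X} : ℝ) := by
    exact_mod_cast card_eq_sum_card_fiberwise (f := Prod.snd) (t := univ) (fun _ _ => mem_univ _)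
  have h2 : ∀ X : ι → α, (#{p ∈ S | p.2 = X} : ℝ) ≤ (2 * m).factorial * Real.exp B *
      polyF (Fintype.card β) (2 * m) * Real.exp (- entN (fun a => (cnt X a : ℝ))) := by
    intro X
    by_cases hX : entN (fun a => (cnt X a : ℝ)) - entN (fun b => (cnt (ty X) b : ℝ)) / 2 ≤ B
    · have h3 := card_compat_le τ hτ (ty X) hm
      have h4 : #{p ∈ S | p.2 = X} ≤
          #{π : Fin m × Bool ≃ κ | ∀ h, ty X (inv π h) = τ (ty X h)} := by
        refine card_le_card_of_injOn Prod.fst ?_ ?_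
        · rintro ⟨π, Y⟩ hp
          simp only [S, coe_filter, mem_filter, mem_univ, true_and, Set.mem_ofPred_eq] at hp ⊢
          obtain ⟨⟨h5, -⟩, rfl⟩ := hp
          exact h5
        · rintro ⟨π, Y⟩ hp ⟨π', Y'⟩ hp' h
          simp only [coe_filter, Set.mem_ofPred_eq] at hp hp' h
          rw [Prod.mk.injEq]
          exact ⟨h, hp.2.trans hp'.2.symm⟩
      have hp := polyF_pos (Fintype.card β) (2 * m)
      calc (#{p ∈ S | p.2 = X} : ℝ) ≤ _ := by exact_mod_cast h4
        _ ≤ _ := h3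
        _ ≤ (2 * m).factorial * (Real.exp (B - entN (fun a => (cnt X a : ℝ))) *
              polyF (Fintype.card β) (2 * m)) := by
            gcongr; linarith
        _ = _ := by rw [sub_eq_add_neg, Real.exp_add]; ring
    · have : #{p ∈ S | p.2 = X} = 0 := by
        rw [card_eq_zero, filter_eq_empty_iff]
        rintro ⟨π, Y⟩ hp rfl
        simp only [S, mem_filter, mem_univ, true_and] at hp
        exact hX hp.2
      rw [this]
      have hp := polyF_pos (Fintype.card β) (2 * m)
      simp only [Nat.cast_zero]
      positivity
  rw [h1]
  have hp := polyF_pos (Fintype.card β) (2 * m)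
  calc _ ≤ _ := sum_le_sum fun X _ => h2 X
    _ ≤ _ := by
      rw [← mul_sum, ← mul_assoc]
      gcongr
      exact sum_exp_neg_entN_le

lemma exists_cnt_eq {ι α : Type*} [Fintype ι] [Fintype α] (c : α → ℕ)
    (h : ∑ a, c a = Fintype.card ι) : ∃ s : ι → α, cnt s = c := by
  have e : Nonempty (ι ≃ Σ a, Fin (c a)) := ⟨Fintype.equivOfCardEq (by simp [h])⟩
  obtain ⟨e⟩ := e
  refine ⟨Sigma.fst ∘ e, ?_⟩
  rw [cnt_comp_equiv]
  funext a
  rw [← cnt_eq_fintype_card]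
  have : {i : Σ a, Fin (c a) // i.1 = a} ≃ Fin (c a) := Equiv.sigmaSubtype a
  simpa using Fintype.card_congr this

lemma cnt_eq_sum {ι α : Type*} [Fintype ι] (s : ι → α) (a : α) :
    cnt s a = ∑ i, if s i = a then 1 else 0 := by
  rw [cnt, Finset.card_filter]

open Finset in
/-- A nearly involution-symmetric family of types can be arranged into slots such that all but
boundedly many edges are compatible. -/
lemma exists_near_compat {m : ℕ} {κ β : Type*} [Fintype κ] [Fintype β] (τ : β → β)
    (hτ : Function.Involutive τ) (t : κ → β) (hm : Fintype.card κ = 2 * m) (c : ℕ)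
    (hc : ∀ y, cnt t y ≤ cnt t (τ y) + c) :
    ∃ s : Fin m × Bool → β, cnt s = cnt t ∧
      #{e | s (e, true) ≠ τ (s (e, false))} ≤ Fintype.card β * (c + 1) ∧
      ∀ y, |(cnt (fun e => s (e, false)) y : ℝ) - cnt t y / 2| ≤
        ((Fintype.card β + 1) * (c + 1) : ℕ) := by
  set a : β → ℕ := fun y => min (cnt t y) (cnt t (τ y)) / 2 with ha
  have hτs : ∑ y, a (τ y) = ∑ y, a y := Equiv.sum_comp (Function.Involutive.toPerm τ hτ) a
  have ha1 : ∀ y, a y + a (τ y) ≤ cnt t y := by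
    intro y; simp only [ha, hτ y]; omega
  have ha2 : ∀ y, cnt t y ≤ 2 * a y + (c + 1) := by
    intro y; have := hc y; simp only [ha]; omega
  have hs1 : ∑ y, a y + ∑ y, a y ≤ 2 * m := by
    nth_rewrite 2 [← hτs]
    rw [← sum_add_distrib, ← hm, ← sum_cnt t]
    exact sum_le_sum fun y _ => ha1 y
  have hs2 : 2 * m ≤ 2 * ∑ y, a y + Fintype.card β * (c + 1) := by
    rw [← hm, ← sum_cnt t, mul_sum, ← smul_eq_mul (Fintype.card β), ← card_univ, ← sum_const,
      ← sum_add_distrib]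
    exact sum_le_sum fun y _ => ha2 y
  set k := m - ∑ y, a y with hk
  obtain ⟨r, hr⟩ := exists_cnt_eq (ι := Fin k × Bool) (fun y => cnt t y - (a y + a (τ y))) (by
    have : ∑ y, (cnt t y - (a y + a (τ y))) + ∑ y, (a y + a (τ y)) = 2 * m := by
      rw [← hm, ← sum_cnt t, ← sum_add_distrib]
      exact sum_congr rfl fun y _ => Nat.sub_add_cancel (ha1 y)
    rw [sum_add_distrib, hτs] at this
    simp
    omega)
  have e : Nonempty (Fin m ≃ (Σ y, Fin (a y)) ⊕ Fin k) := ⟨Fintype.equivOfCardEq (by simp; omega)⟩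
  obtain ⟨e⟩ := e
  set s' : ((Σ y, Fin (a y)) ⊕ Fin k) × Bool → β := fun p =>
    Sum.elim (fun q => bif p.2 then τ q.1 else q.1) (fun i => r (i, p.2)) p.1 with hs'
  have hcnt0 : ∀ y, cnt (fun e => s' (e, false)) y = a y + cnt (fun i => r (i, false)) y := by
    intro y
    rw [cnt_eq_sum, cnt_eq_sum, Fintype.sum_sum_type, Fintype.sum_sigma]
    change (∑ x, ∑ _ : Fin (a x), if x = y then 1 else 0) +
      (∑ i, if r (i, false) = y then 1 else 0) = _
    simp only [sum_const, card_univ, Fintype.card_fin, smul_eq_mul, mul_ite, mul_one, mul_zero,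
      sum_ite_eq', mem_univ, if_true]
  refine ⟨fun p => s' (e p.1, p.2), ?_, ?_, ?_⟩
  · have h1 : (fun p : Fin m × Bool => s' (e p.1, p.2)) = s' ∘ (e.prodCongr (Equiv.refl Bool)) := by
      funext p; rfl
    rw [h1, cnt_comp_equiv]
    funext y
    have hry := congrFun hr y
    rw [cnt_eq_sum, Fintype.sum_prod_type] at hry
    simp only [Fintype.sum_bool] at hry
    rw [cnt_eq_sum, Fintype.sum_prod_type, Fintype.sum_sum_type, Fintype.sum_sigma]
    simp only [Fintype.sum_bool]
    change (∑ x, ∑ _ : Fin (a x), ((if τ x = y then 1 else 0) + if x = y then 1 else 0)) +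
      (∑ i, ((if r (i, true) = y then 1 else 0) + if r (i, false) = y then 1 else 0)) = _
    rw [hry]
    have h2 : ∀ y', (τ y' = y) = (y' = τ y) := fun y' =>
      propext ⟨fun h => by rw [← h, hτ], fun h => by rw [h, hτ]⟩
    simp only [h2, sum_add_distrib, sum_const, card_univ, Fintype.card_fin, smul_eq_mul,
      mul_ite, mul_one, mul_zero, sum_ite_eq', mem_univ, if_true]
    have := ha1 y
    omega
  · have : #{e' | s' (e e', true) ≠ τ (s' (e e', false))} ≤ k := by
      calc _ ≤ #((univ : Finset (Fin k)).image (fun i => e.symm (Sum.inr i))) := by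
            refine card_le_card ?_
            intro e' he'
            simp only [mem_filter, mem_univ, true_and] at he'
            simp only [mem_image, mem_univ, true_and]
            rcases h : e e' with q | i
            · rw [h] at he'; simp [hs'] at he'
            · exact ⟨i, by rw [← h]; simp⟩
        _ ≤ k := card_image_le.trans (by simp)
    refine this.trans ?_
    generalize Fintype.card β * (c + 1) = Q at hs2 ⊢
    omega
  · intro y
    have h1 : cnt (fun e' => s' (e e', false)) y = a y + cnt (fun i => r (i, false)) y := by
      rw [← hcnt0]
      exact congrFun (cnt_comp_equiv (fun e => s' (e, false)) e) y
    have h2 : cnt (fun i => r (i, false)) y ≤ k := by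
      exact (card_filter_le _ _).trans (by simp)
    change |(cnt (fun e' => s' (e e', false)) y : ℝ) - cnt t y / 2| ≤ _
    rw [h1]
    have h3 := ha1 y
    have h4 := ha2 y
    have h5 : 2 * a y ≤ cnt t y := by simp only [ha]; omega
    have h6 : k ≤ Fintype.card β * (c + 1) := by
      generalize Fintype.card β * (c + 1) = Q at hs2 ⊢
      omega
    have h4' : (cnt t y : ℝ) ≤ 2 * a y + (c + 1) := by exact_mod_cast h4
    have h5' : (2:ℝ) * a y ≤ cnt t y := by exact_mod_cast h5
    have h6' : (k:ℝ) ≤ Fintype.card β * (c + 1) := by exact_mod_cast h6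
    have h2' : (cnt (fun i => r (i, false)) y : ℝ) ≤ k := by exact_mod_cast h2
    have h7 : (0:ℝ) ≤ cnt (fun i => r (i, false)) y := by positivity
    have h8 : (0:ℝ) ≤ c := by positivity
    push_cast
    rw [abs_le]
    constructor <;> nlinarith

open Finset in
lemma le_card_near_compat {m : ℕ} {κ β : Type*} [Fintype κ] [DecidableEq κ] [Fintype β]
    (τ : β → β) (t : κ → β) (hm : Fintype.card κ = 2 * m) (C : ℕ) (s : Fin m × Bool → β)
    (hs : cnt s = cnt t) (hC : #{e | s (e, true) ≠ τ (s (e, false))} ≤ C) :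
    (2 * m).factorial * Real.exp (entN (fun a => (cnt (fun e => s (e, false)) a : ℝ)) -
        entN (fun a => (cnt t a : ℝ))) ≤
      (#{π : Fin m × Bool ≃ κ | #{e | t (π (e, true)) ≠ τ (t (π (e, false)))} ≤ C} : ℝ) *
        polyF (Fintype.card β) m := by
  set s0 : Fin m → β := fun e => s (e, false) with hs0
  have h1 := le_card_seq s0
  have h2 := factorial_le_prod t
  rw [hm] at h2
  rw [Fintype.card_fin] at h1
  have h3 : #{s' : Fin m → β | cnt s' = cnt s0} * ∏ a, (cnt t a).factorial ≤
      #{π : Fin m × Bool ≃ κ | #{e | t (π (e, true)) ≠ τ (t (π (e, false)))} ≤ C} := by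
    rw [← smul_eq_mul, ← sum_const]
    have : ∀ s' ∈ ({s' : Fin m → β | cnt s' = cnt s0} : Finset _), ∏ a, (cnt t a).factorial ≤
        #{π ∈ ({π : Fin m × Bool ≃ κ | #{e | t (π (e, true)) ≠ τ (t (π (e, false)))} ≤ C} :
          Finset _) | (fun e => t (π (e, false))) = s'} := by
      intro s' hs'
      obtain ⟨ε, hε⟩ := exists_equiv_of_cnt_eq s' s0 (by simpa using hs')
      have h4 : cnt (s ∘ (ε.prodCongr (Equiv.refl Bool))) = cnt t := by
        rw [cnt_comp_equiv, hs]
      rw [← card_equiv_comp_eq _ t h4]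
      refine card_le_card ?_
      intro π hπ
      simp only [mem_filter, mem_univ, true_and] at hπ ⊢
      have h5 : ∀ e b, t (π (e, b)) = s (ε e, b) := fun e b => congrFun hπ (e, b)
      simp only [h5]
      refine ⟨?_, hε⟩
      refine le_trans (le_of_eq ?_) hC
      refine card_bij (fun e _ => ε e) (by simp) (by simp) ?_
      intro b hb
      exact ⟨ε.symm b, by simpa using hb, by simp⟩
    refine (sum_le_sum this).trans ?_
    rw [← card_biUnion]
    · exact card_le_card (biUnion_subset.2 fun _ _ => filter_subset _ _)
    · intro x _ y _ hxy
      exact disjoint_filter.2 fun π _ h1 h2 => hxy (h1.symm.trans h2)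
  have h3' : (#{s' : Fin m → β | cnt s' = cnt s0} : ℝ) * ∏ a, ((cnt t a).factorial : ℝ) ≤
      #{π : Fin m × Bool ≃ κ | #{e | t (π (e, true)) ≠ τ (t (π (e, false)))} ≤ C} := by
    exact_mod_cast h3
  rw [sub_eq_add_neg, Real.exp_add]
  have hp := polyF_pos (Fintype.card β) m
  calc _ = Real.exp (entN (fun a => (cnt s0 a : ℝ))) *
        ((2 * m).factorial * Real.exp (-entN (fun a => (cnt t a : ℝ)))) := by ring
    _ ≤ (#{s' : Fin m → β | cnt s' = cnt s0} * polyF (Fintype.card β) m) *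
        ∏ a, ((cnt t a).factorial : ℝ) := by
        gcongr
    _ = (#{s' : Fin m → β | cnt s' = cnt s0} * ∏ a, ((cnt t a).factorial : ℝ)) *
        polyF (Fintype.card β) m := by ring
    _ ≤ _ := by gcongr

lemma entN_smul {α : Type*} [Fintype α] (w : α → ℝ) (c : ℝ) :
    entN (fun a => c * w a) = c * entN w := by
  have key : ∀ x : ℝ, (c * x) * Real.log (c * x) = c * (x * Real.log x) + (c * Real.log c) * x := by
    intro x
    rcases eq_or_ne c 0 with h | h
    · simp [h]
    rcases eq_or_ne x 0 with h' | h'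
    · simp [h']
    rw [Real.log_mul h h']; ring
  unfold entN
  rw [← Finset.mul_sum, key, Finset.sum_congr rfl fun a _ => key (w a), Finset.sum_add_distrib,
    ← Finset.mul_sum, ← Finset.mul_sum]
  ring

lemma continuous_entN {α : Type*} [Fintype α] : Continuous (entN (α := α)) := by
  unfold entN
  refine Continuous.sub ?_ ?_
  · exact Real.continuous_mul_log.comp (by fun_prop : Continuous fun m : α → ℝ => ∑ a, m a)
  · exact continuous_finsetSum _ fun a _ => Real.continuous_mul_log.comp (continuous_apply a)

/-- Entropy of a finite probability vector. -/
def Hf {α : Type*} [Fintype α] (p : α → ℝ) : ℝ := ∑ a, Real.negMulLog (p a)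

lemma entN_eq_Hf {α : Type*} [Fintype α] (p : α → ℝ) (h : ∑ a, p a = 1) : entN p = Hf p := by
  simp [entN, Hf, h, Real.negMulLog, Finset.sum_neg_distrib]

/-- Entropies of integer vectors at bounded distance from `n • w`. -/
lemma entN_approx {α : Type*} [Fintype α] (w : α → ℝ) (C : ℝ) {δ : ℝ} (hδ : 0 < δ) :
    ∃ n₀ : ℕ, ∀ n : ℕ, n₀ ≤ n → ∀ m : α → ℝ, (∀ a, |m a - n * w a| ≤ C) →
      |entN m - n * entN w| ≤ δ * n := by
  obtain ⟨ρ, hρ, h⟩ := Metric.continuous_iff.1 (continuous_entN (α := α)) w δ hδ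
  obtain ⟨n₀, hn₀⟩ := exists_nat_gt (C / ρ)
  refine ⟨n₀ + 1, fun n hn m hm => ?_⟩
  have hn' : (0:ℝ) < n := by exact_mod_cast (by omega : 0 < n)
  have hn2 : (n₀ : ℝ) ≤ n := by exact_mod_cast (by omega : n₀ ≤ n)
  have h1 : dist (fun a => m a / n) w < ρ := by
    rw [dist_pi_lt_iff hρ]
    intro a
    rw [Real.dist_eq]
    have h2 : m a / n - w a = (m a - n * w a) / n := by field_simp
    rw [h2, abs_div, abs_of_pos hn', div_lt_iff₀ hn']
    have h3 : C < ρ * n := by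
      rw [div_lt_iff₀ hρ] at hn₀
      nlinarith
    exact (hm a).trans_lt h3
  have h4 := h _ h1
  rw [Real.dist_eq] at h4
  have h5 : m = fun a => n * (m a / n) := by
    funext a; field_simp
  rw [h5, entN_smul, ← mul_sub, abs_mul, abs_of_pos hn', mul_comm]
  gcongr

lemma polyF_le_exp (c : ℕ) (D : ℝ) (hD : 0 < D) {δ : ℝ} (hδ : 0 < δ) :
    ∃ n₀ : ℕ, ∀ n : ℕ, n₀ ≤ n → ∀ m : ℕ, (m : ℝ) ≤ D * n → polyF c m ≤ Real.exp (δ * n) := by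
  have h1 : Tendsto (fun n : ℕ => (Real.exp 1 * (D * n + 1)) ^ c / Real.exp (δ * n)) atTop
      (𝓝 0) := by
    have h := Real.tendsto_pow_mul_exp_neg_atTop_nhds_zero c
    have h2 : Tendsto (fun n : ℕ => δ * (n : ℝ) + 1) atTop atTop :=
      tendsto_atTop_add_const_right _ _ (tendsto_natCast_atTop_atTop.const_mul_atTop hδ)
    have h3 := (h.comp h2).const_mul ((Real.exp 1 * (D / δ + 1)) ^ c * Real.exp 1)
    rw [mul_zero] at h3
    refine squeeze_zero (fun n => by positivity) (fun n => ?_) h3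
    simp only [Function.comp]
    have h4 : Real.exp 1 * (D * n + 1) ≤ Real.exp 1 * (D / δ + 1) * (δ * n + 1) := by
      rw [mul_assoc]
      gcongr
      have : (D / δ + 1) * (δ * n + 1) = D * n + 1 + (D / δ + δ * n) := by field_simp; ring
      rw [this]
      have : 0 ≤ D / δ + δ * n := by positivity
      linarith
    calc (Real.exp 1 * (D * n + 1)) ^ c / Real.exp (δ * n)
        ≤ (Real.exp 1 * (D / δ + 1) * (δ * n + 1)) ^ c / Real.exp (δ * n) := by gcongr
      _ = _ := by
        rw [mul_pow, div_eq_mul_inv, ← Real.exp_neg, neg_add, Real.exp_add, Real.exp_neg 1]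
        field_simp
  obtain ⟨n₀, h⟩ := eventually_atTop.1 (h1.eventually (gt_mem_nhds one_pos))
  refine ⟨n₀, fun n hn m hm => ?_⟩
  have h2 := h n hn
  rw [div_lt_one (Real.exp_pos _)] at h2
  refine le_trans ?_ h2.le
  unfold polyF
  gcongr

open Finset in
lemma exists_rounding {α : Type*} [Fintype α] (p : α → ℝ) (hp0 : ∀ a, 0 ≤ p a)
    (hp1 : ∑ a, p a = 1) (n : ℕ) :
    ∃ c : α → ℕ, ∑ a, c a = n ∧ ∀ a, |(c a : ℝ) - n * p a| ≤ Fintype.card α := by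
  have hne : Nonempty α := by
    by_contra h
    rw [not_nonempty_iff] at h
    simp at hp1
  obtain ⟨a₀⟩ := hne
  set g : α → ℕ := fun a => ⌊n * p a⌋₊ with hg
  have hg1 : ∀ a, (g a : ℝ) ≤ n * p a := fun a => Nat.floor_le (by have := hp0 a; positivity)
  have hg2 : ∀ a, n * p a < g a + 1 := fun a => Nat.lt_floor_add_one _
  have hn : ∑ a, n * p a = n := by rw [← mul_sum, hp1, mul_one]
  have h1 : (∑ a, g a : ℝ) ≤ n := by
    rw [← hn]; exact sum_le_sum fun a _ => hg1 a
  have h2 : (n : ℝ) ≤ (∑ a, g a : ℝ) + Fintype.card α := by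
    rw [← hn]
    refine (sum_le_sum fun a _ => (hg2 a).le).trans ?_
    rw [sum_add_distrib]; simp
  have h1' : ∑ a, g a ≤ n := by exact_mod_cast h1
  have hc1 : (1 : ℝ) ≤ Fintype.card α := by
    exact_mod_cast Fintype.card_pos_iff.2 ⟨a₀⟩
  refine ⟨fun a => g a + if a = a₀ then n - ∑ a, g a else 0, ?_, fun a => ?_⟩
  · rw [sum_add_distrib, sum_ite_eq']; simp; omega
  · have := hg1 a
    have := hg2 a
    dsimp only
    split_ifs
    · rw [Nat.cast_add, Nat.cast_sub h1']
      push_cast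
      rw [abs_le]; constructor <;> linarith
    · simp only [add_zero]
      rw [abs_le]; constructor <;> linarith

open Finset in
/-- Lower bound for the number of pairs of a configuration and a vertex typing which is
compatible up to boundedly many edges. -/
theorem le_card_typed {d : ℕ} [NeZero d] {α β : Type*} [Fintype α] [Fintype β] (p : α → ℝ)
    (hp0 : ∀ a, 0 ≤ p a) (hp1 : ∑ a, p a = 1) (y : α → ZMod d → β) (τ : β → β)
    (hτ : Function.Involutive τ) (q : β → ℝ)
    (hq : ∀ b, d * q b = ∑ a, (p a * #{i | y a i = b} : ℝ)) (hqτ : ∀ b, q (τ b) = q b) :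
    ∃ C : ℕ, ∀ δ : ℝ, 0 < δ → ∃ n₀ : ℕ, ∀ n : ℕ, n₀ ≤ n → ∀ m : ℕ, n * d = 2 * m →
      Real.exp (n * (Hf p - d / 2 * Hf q - δ)) * (2 * m).factorial ≤
        (#{z : (Fin m × Bool ≃ Fin n × ZMod d) × (Fin n → α) |
          (∀ a, |(cnt z.2 a : ℝ) - n * p a| ≤ C) ∧
          #{e | y (z.2 (z.1 (e, true)).1) (z.1 (e, true)).2 ≠
            τ (y (z.2 (z.1 (e, false)).1) (z.1 (e, false)).2)} ≤ C} : ℝ) := by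
  set A := Fintype.card α with hA
  set K := A * d * A with hK
  set B := Fintype.card β with hB
  set C₂ := (B + 1) * (2 * K + 1) with hC₂
  have hd : 0 < d := Nat.pos_of_ne_zero (NeZero.ne d)
  have hqs : ∑ b, q b = 1 := by
    have h1 : ∑ b, (d : ℝ) * q b = d := by
      simp only [hq]
      rw [sum_comm]
      simp only [← mul_sum]
      have : ∀ a, ∑ b, (#{i | y a i = b} : ℝ) = d := by
        intro a
        have := sum_cnt (y a)
        rw [ZMod.card] at this
        exact_mod_cast this
      simp only [this, ← sum_mul, hp1, one_mul]
    rw [← mul_sum] at h1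
    have : (d : ℝ) ≠ 0 := by positivity
    field_simp at h1
    exact h1
  refine ⟨A + C₂, fun δ hδ => ?_⟩
  have hδ' : 0 < δ / 5 := by positivity
  obtain ⟨n₁, hn₁⟩ := entN_approx p A hδ'
  obtain ⟨n₂, hn₂⟩ := entN_approx (fun b => d * q b) K hδ'
  obtain ⟨n₃, hn₃⟩ := entN_approx (fun b => d / 2 * q b) (C₂ + K) hδ'
  obtain ⟨n₄, hn₄⟩ := polyF_le_exp A 1 one_pos hδ'
  obtain ⟨n₅, hn₅⟩ := polyF_le_exp B d (by positivity) hδ'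
  refine ⟨n₁ + n₂ + n₃ + n₄ + n₅, fun n hn m hm => ?_⟩
  obtain ⟨c, hc, hcp⟩ := exists_rounding p hp0 hp1 n
  obtain ⟨X₀, hX₀⟩ := exists_cnt_eq (ι := Fin n) c (by simpa using hc)
  have e1 := hn₁ n (by omega) (fun a => c a) hcp
  rw [entN_eq_Hf p hp1, abs_le] at e1
  have e4 := hn₄ n (by omega) n (by simp)
  have e5 := hn₅ n (by omega) m (by
    have : (n : ℝ) * d = 2 * m := by exact_mod_cast hm
    have : (0 : ℝ) ≤ m := by positivity
    nlinarith)
  have main : ∀ X : Fin n → α, cnt X = c →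
      (2 * m).factorial * Real.exp (n * (-(d / 2 * Hf q) - 3 * (δ / 5))) ≤
      (#{π : Fin m × Bool ≃ Fin n × ZMod d | #{e | y (X (π (e, true)).1) (π (e, true)).2 ≠
            τ (y (X (π (e, false)).1) (π (e, false)).2)} ≤ A + C₂} : ℝ) := by
    intro X hX
    set t : Fin n × ZMod d → β := fun k => y (X k.1) k.2 with ht
    have hκ : Fintype.card (Fin n × ZMod d) = 2 * m := by simp [hm]
    have hcnt : ∀ b, (cnt t b : ℝ) = ∑ a, (c a * #{i | y a i = b} : ℝ) := by
      intro b
      have : cnt t b = ∑ a, c a * #{i | y a i = b} := by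
        rw [cnt_eq_sum, Fintype.sum_prod_type, ← sum_fiberwise univ X]
        refine sum_congr rfl fun a _ => ?_
        rw [← hX, cnt, ← smul_eq_mul, ← sum_const]
        refine sum_congr rfl fun v hv => ?_
        rw [card_filter]
        simp only [ht]
        rw [(mem_filter.1 hv).2]
      rw [this]; push_cast; rfl
    have hcq : ∀ b, |(cnt t b : ℝ) - n * (d * q b)| ≤ K := by
      intro b
      rw [hcnt, hq, mul_sum, ← sum_sub_distrib]
      refine (abs_sum_le_sum_abs _ _).trans ?_
      have : ∀ a ∈ (univ : Finset α),
          |(c a * #{i | y a i = b} : ℝ) - n * (p a * #{i | y a i = b})| ≤ A * d := by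
        intro a _
        rw [← mul_assoc, ← sub_mul, abs_mul]
        have h1 := hcp a
        have h2 : |(#{i | y a i = b} : ℝ)| ≤ d := by
          rw [abs_of_nonneg (by positivity)]
          have : #{i | y a i = b} ≤ d := (card_filter_le _ _).trans (by simp [ZMod.card])
          exact_mod_cast this
        gcongr
      refine (sum_le_sum this).trans ?_
      rw [sum_const, card_univ, nsmul_eq_mul, hK]
      push_cast
      linarith
    have hcc : ∀ b, cnt t b ≤ cnt t (τ b) + 2 * K := by
      intro b
      have h1 := (abs_le.1 (hcq b)).2
      have h2 := (abs_le.1 (hcq (τ b))).1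
      rw [hqτ] at h2
      have : (cnt t b : ℝ) ≤ cnt t (τ b) + 2 * K := by linarith
      exact_mod_cast this
    obtain ⟨s, hs1, hs2, hs3⟩ := exists_near_compat τ hτ t hκ (2 * K) hcc
    have hs2' : #{e | s (e, true) ≠ τ (s (e, false))} ≤ A + C₂ := by
      refine hs2.trans ?_
      rw [hC₂, add_mul, hB]; omega
    have h3 := le_card_near_compat τ t hκ (A + C₂) s hs1 hs2'
    have e2 := hn₂ n (by omega) (fun a => cnt t a) hcq
    have e3 := hn₃ n (by omega) (fun b => cnt (fun e => s (e, false)) b) (by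
      intro b
      have h1 := abs_le.1 (hcq b)
      have h2 := abs_le.1 (hs3 b)
      have hKp : (0:ℝ) ≤ K := by positivity
      rw [hC₂, abs_le]
      constructor <;> linarith [h1.1, h1.2, h2.1, h2.2])
    rw [entN_smul, entN_eq_Hf q hqs, abs_le] at e2 e3
    have h4 : Real.exp (n * (-(d / 2 * Hf q) - 3 * (δ / 5))) * polyF B m ≤
        Real.exp (entN (fun a => (cnt (fun e => s (e, false)) a : ℝ)) -
          entN (fun a => (cnt t a : ℝ))) := by
      refine (mul_le_mul_of_nonneg_left e5 (Real.exp_pos _).le).trans ?_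
      rw [← Real.exp_add]
      refine Real.exp_le_exp.2 ?_
      linarith [e2.2, e3.1]
    have h5 := (mul_le_mul_of_nonneg_left h4 (Nat.cast_nonneg (2 * m).factorial)).trans h3
    rw [← mul_assoc] at h5
    exact le_of_mul_le_mul_right h5 (polyF_pos _ _)
  have hX := le_card_seq X₀
  rw [hX₀, Fintype.card_fin] at hX
  have hX2 : Real.exp (n * (Hf p - 2 * (δ / 5))) ≤ #{s : Fin n → α | cnt s = c} := by
    have h4 : Real.exp (n * (Hf p - 2 * (δ / 5))) * polyF A n ≤
        Real.exp (entN (fun a => (c a : ℝ))) := by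
      refine (mul_le_mul_of_nonneg_left e4 (Real.exp_pos _).le).trans ?_
      rw [← Real.exp_add]
      refine Real.exp_le_exp.2 ?_
      linarith [e1.1]
    exact le_of_mul_le_mul_right (h4.trans hX) (polyF_pos _ _)
  calc Real.exp (n * (Hf p - d / 2 * Hf q - δ)) * (2 * m).factorial
      = Real.exp (n * (Hf p - 2 * (δ / 5))) *
        ((2 * m).factorial * Real.exp (n * (-(d / 2 * Hf q) - 3 * (δ / 5)))) := by
        rw [mul_left_comm, ← Real.exp_add, mul_comm]
        congr 2
        ring
    _ ≤ #{s : Fin n → α | cnt s = c} *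
        ((2 * m).factorial * Real.exp (n * (-(d / 2 * Hf q) - 3 * (δ / 5)))) := by gcongr
    _ = ∑ X ∈ ({s : Fin n → α | cnt s = c} : Finset _),
        ((2 * m).factorial * Real.exp (n * (-(d / 2 * Hf q) - 3 * (δ / 5)))) := by
        rw [sum_const, nsmul_eq_mul]
    _ ≤ ∑ X ∈ ({s : Fin n → α | cnt s = c} : Finset _),
        (#{π : Fin m × Bool ≃ Fin n × ZMod d | #{e | y (X (π (e, true)).1) (π (e, true)).2 ≠
            τ (y (X (π (e, false)).1) (π (e, false)).2)} ≤ A + C₂} : ℝ) :=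
        sum_le_sum fun X hX => main X (by simpa using hX)
    _ ≤ _ := by
        rw [← Nat.cast_sum]
        refine Nat.cast_le.2 ?_
        rw [← card_sigma]
        refine card_le_card_of_injOn (fun z => (z.2, z.1)) ?_ ?_
        · rintro ⟨X, π⟩ hz
          simp only [coe_sigma, Set.mem_sigma_iff, coe_filter, mem_univ, true_and,
            Set.mem_ofPred_eq] at hz
          simp only [coe_filter, mem_univ, true_and, Set.mem_ofPred_eq]
          refine ⟨fun a => ?_, hz.2⟩
          rw [hz.1]
          refine (hcp a).trans ?_
          push_cast
          have : (0:ℝ) ≤ C₂ := by positivity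
          linarith
        · rintro ⟨X, π⟩ _ ⟨X', π'⟩ _ h
          simp only [Prod.mk.injEq] at h
          obtain ⟨rfl, rfl⟩ := h
          rfl

open Finset in
lemma sum_exp_le_of_bounded {ι : Type*} [Fintype ι] [Nonempty ι] (Y : ι → ℝ) (c : ℝ)
    (h0 : ∑ i, Y i = 0) (hc : ∀ i, |Y i| ≤ c) :
    ∑ i, Real.exp (Y i) ≤ Fintype.card ι * Real.exp (c ^ 2 / 2) := by
  have hc0 : 0 ≤ c := (abs_nonneg _).trans (hc (Classical.arbitrary ι))
  rcases hc0.eq_or_lt with rfl | hcp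
  · have : ∀ i, Y i = 0 := fun i => abs_nonpos_iff.1 (hc i)
    simp [this]
  have key : ∀ i, Real.exp (Y i) ≤ Real.cosh c + Y i * (Real.sinh c / c) := by
    intro i
    have h := abs_le.1 (hc i)
    have h1 := convexOn_exp.2 (Set.mem_univ c) (Set.mem_univ (-c))
      (show 0 ≤ (1 + Y i / c) / 2 by
        have : -1 ≤ Y i / c := by rw [le_div_iff₀ hcp]; linarith
        linarith)
      (show 0 ≤ (1 - Y i / c) / 2 by
        have : Y i / c ≤ 1 := by rw [div_le_iff₀ hcp]; linarith
        linarith) (by ring)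
    simp only [smul_eq_mul] at h1
    have h2 : (1 + Y i / c) / 2 * c + (1 - Y i / c) / 2 * -c = Y i := by field_simp; ring
    rw [h2] at h1
    refine h1.trans (le_of_eq ?_)
    rw [Real.cosh_eq, Real.sinh_eq]
    field_simp
    ring
  calc ∑ i, Real.exp (Y i) ≤ ∑ i, (Real.cosh c + Y i * (Real.sinh c / c)) :=
        sum_le_sum fun i _ => key i
    _ = Fintype.card ι * Real.cosh c := by
        rw [sum_add_distrib, ← sum_mul, h0]; simp
    _ ≤ _ := by gcongr; exact Real.cosh_le_exp_half_sq c

open Finset in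
lemma sum_exp_perm_le (L : ℝ) (n : ℕ) (F : Equiv.Perm (Fin n) → ℝ)
    (hF : ∀ π i j, |F (π * Equiv.swap i j) - F π| ≤ L) (E : ℝ)
    (hE : ∑ π, F π = n.factorial * E) :
    ∑ π, Real.exp (F π - E) ≤ n.factorial * Real.exp (2 * L ^ 2 * n) := by
  induction n generalizing E with
  | zero =>
    have h1 : ∀ π, F π = E := fun π => by
      rw [Subsingleton.elim π default]
      simpa using hE
    simp [h1]
  | succ n ih =>
    have hleft : ∀ (π : Equiv.Perm (Fin (n + 1))) i j, |F (Equiv.swap i j * π) - F π| ≤ L := by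
      intro π i j
      have h := hF π (π.symm i) (π.symm j)
      rwa [Equiv.mul_swap_eq_swap_mul, Equiv.apply_symm_apply, Equiv.apply_symm_apply] at h
    set G : Fin (n + 1) → Equiv.Perm (Fin n) → ℝ := fun p e =>
      F (Equiv.Perm.decomposeFin.symm (p, e)) with hG
    have hn : (0 : ℝ) < n.factorial := by positivity
    set e : Fin (n + 1) → ℝ := fun p => (∑ σ, G p σ) / n.factorial with he
    have he' : ∀ p, ∑ σ, G p σ = n.factorial * e p := fun p => by
      simp only [he]; field_simp
    have hsum : ∀ f : Equiv.Perm (Fin (n + 1)) → ℝ, ∑ π, f π =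
        ∑ p, ∑ σ, f (Equiv.Perm.decomposeFin.symm (p, σ)) := by
      intro f
      rw [← Equiv.sum_comp Equiv.Perm.decomposeFin.symm, Fintype.sum_prod_type]
    have hdec : ∀ (p : Fin (n + 1)) (σ : Equiv.Perm (Fin n)),
        Equiv.Perm.decomposeFin.symm (p, σ) =
          Equiv.swap 0 p * Equiv.Perm.decomposeFin.symm (0, σ) := by
      intro p σ
      ext x
      refine Fin.cases ?_ (fun x => ?_) x <;> simp
    have hdec2 : ∀ (σ : Equiv.Perm (Fin n)) i j,
        Equiv.Perm.decomposeFin.symm ((0 : Fin (n + 1)), σ * Equiv.swap i j) =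
        Equiv.Perm.decomposeFin.symm (0, σ) * Equiv.swap i.succ j.succ := by
      intro σ i j
      ext x
      refine Fin.cases ?_ (fun x => ?_) x
      · rw [Equiv.Perm.mul_apply, Equiv.swap_apply_of_ne_of_ne (Fin.succ_ne_zero i).symm
          (Fin.succ_ne_zero j).symm]
        simp
      · rw [Equiv.Perm.mul_apply]
        have h1 : Equiv.swap i.succ j.succ x.succ = (Equiv.swap i j x).succ := by
          rw [Equiv.swap_apply_def, Equiv.swap_apply_def]
          simp only [Fin.succ_inj]
          split_ifs <;> rfl
        rw [h1]
        simp
    have hGL : ∀ p σ i j, |G p (σ * Equiv.swap i j) - G p σ| ≤ L := by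
      intro p σ i j
      simp only [hG]
      rw [hdec, hdec p σ, hdec2, ← mul_assoc]
      exact hF _ _ _
    have hdiff : ∀ p p', |e p - e p'| ≤ 2 * L := by
      intro p p'
      simp only [he]
      rw [← sub_div, ← sum_sub_distrib, abs_div, abs_of_pos hn, div_le_iff₀ hn]
      refine (abs_sum_le_sum_abs _ _).trans ?_
      have : ∀ σ ∈ (univ : Finset (Equiv.Perm (Fin n))), |G p σ - G p' σ| ≤ 2 * L := by
        intro σ _
        simp only [hG]
        rw [hdec, hdec p' σ]
        have h1 := abs_le.1 (hleft (Equiv.Perm.decomposeFin.symm (0, σ)) 0 p)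
        have h2 := abs_le.1 (hleft (Equiv.Perm.decomposeFin.symm (0, σ)) 0 p')
        rw [abs_le]
        constructor <;> linarith [h1.1, h1.2, h2.1, h2.2]
      refine (sum_le_sum this).trans ?_
      rw [sum_const, card_univ, Fintype.card_perm, Fintype.card_fin, nsmul_eq_mul, mul_comm]
    have hEe : ∑ p, e p = (n + 1) * E := by
      rw [hsum] at hE
      change ∑ p, ∑ σ, G p σ = _ at hE
      simp only [he'] at hE
      rw [← mul_sum, Nat.factorial_succ] at hE
      push_cast at hE
      refine mul_left_cancel₀ hn.ne' ?_
      linarith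
    have hY := sum_exp_le_of_bounded (fun p => e p - E) (2 * L)
      (by rw [sum_sub_distrib, hEe]; simp) (by
        intro p
        have h1 : (n + 1 : ℝ) * (e p - E) = ∑ p', (e p - e p') := by
          rw [sum_sub_distrib, hEe]; simp; ring
        have h2 : |(n + 1 : ℝ) * (e p - E)| ≤ (n + 1) * (2 * L) := by
          rw [h1]
          refine (abs_sum_le_sum_abs _ _).trans ((sum_le_sum fun p' _ => hdiff p p').trans ?_)
          simp
        rw [abs_mul, abs_of_pos (by positivity)] at h2
        exact le_of_mul_le_mul_left h2 (by positivity))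
    rw [hsum]
    calc ∑ p, ∑ σ, Real.exp (G p σ - E)
        = ∑ p, Real.exp (e p - E) * ∑ σ, Real.exp (G p σ - e p) := by
          refine sum_congr rfl fun p _ => ?_
          rw [mul_sum]
          refine sum_congr rfl fun σ _ => ?_
          rw [← Real.exp_add]; congr 1; ring
      _ ≤ ∑ p, Real.exp (e p - E) * (n.factorial * Real.exp (2 * L ^ 2 * n)) := by
          refine sum_le_sum fun p _ => ?_
          gcongr
          exact ih (G p) (hGL p) (e p) (he' p)
      _ ≤ ((Fintype.card (Fin (n + 1)) : ℝ) * Real.exp ((2 * L) ^ 2 / 2)) *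
            (n.factorial * Real.exp (2 * L ^ 2 * n)) := by
          rw [← sum_mul]
          gcongr
      _ = _ := by
          rw [Fintype.card_fin, Nat.factorial_succ, mul_mul_mul_comm, ← Real.exp_add]
          push_cast
          congr 2
          ring

open Finset in
/-- Laplace transform of a Lipschitz function of a uniformly random bijection. -/
lemma sum_exp_equiv_le {ι κ : Type*} [Fintype ι] [Fintype κ] [DecidableEq ι] [DecidableEq κ]
    (L : ℝ) (N : ℕ) (hι : Fintype.card ι = N) (hκ : Fintype.card κ = N) (F : (ι ≃ κ) → ℝ)
    (hF : ∀ (π : ι ≃ κ) i j, |F ((Equiv.swap i j).trans π) - F π| ≤ L) (E : ℝ)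
    (hE : ∑ π, F π = N.factorial * E) (l : ℝ) :
    ∑ π, Real.exp (l * (F π - E)) ≤ N.factorial * Real.exp (2 * (l * L) ^ 2 * N) := by
  have a := Fintype.equivFinOfCardEq hι
  have b := Fintype.equivFinOfCardEq hκ
  set T : Equiv.Perm (Fin N) ≃ (ι ≃ κ) := Equiv.equivCongr a.symm b.symm with hT
  have hsum : ∀ f : (ι ≃ κ) → ℝ, ∑ π, f π = ∑ σ, f (T σ) := fun f => (Equiv.sum_comp T f).symm
  rw [hsum]
  have h := sum_exp_perm_le (|l| * L) N (fun σ => l * F (T σ)) (by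
    intro π i j
    rw [← mul_sub, abs_mul]
    gcongr
    have h1 : T (π * Equiv.swap i j) = (Equiv.swap (a.symm i) (a.symm j)).trans (T π) := by
      ext x
      simp only [hT, Equiv.equivCongr_apply_apply, Equiv.Perm.mul_apply, Equiv.trans_apply,
        Equiv.symm_symm]
      congr 2
      rw [Equiv.swap_apply_def, Equiv.swap_apply_def]
      simp only [Equiv.eq_symm_apply]
      split_ifs <;> simp
    rw [h1]
    exact hF _ _ _) (l * E) (by
    rw [← mul_sum, ← hsum, hE]; ring)
  simp only [← mul_sub] at h
  rw [mul_pow, sq_abs, ← mul_pow] at h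
  exact h

open Finset in
/-- Concentration for Lipschitz functions of a uniformly random bijection: if a lower tail event
is not too unlikely, then the corresponding upper tail event is unlikely. -/
theorem card_upper_tail_le {ι κ : Type*} [Fintype ι] [Fintype κ] [DecidableEq ι] [DecidableEq κ]
    {L : ℝ} (hL : 0 < L) {N : ℕ} (hN : 0 < N) (hι : Fintype.card ι = N)
    (hκ : Fintype.card κ = N) (F : (ι ≃ κ) → ℝ)
    (hF : ∀ (π : ι ≃ κ) i j, |F ((Equiv.swap i j).trans π) - F π| ≤ L) {s : ℝ} (hs : 0 ≤ s)
    (a : ℝ) (ha : N.factorial * Real.exp (-(s ^ 2 / (8 * L ^ 2 * N))) < #{π | F π ≤ a}) :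
    #{π | a + 2 * s ≤ F π} ≤ N.factorial * Real.exp (-(s ^ 2 / (8 * L ^ 2 * N))) := by
  have hN' : (0:ℝ) < N := by exact_mod_cast hN
  have hf : (0 : ℝ) < N.factorial := by positivity
  set E := (∑ π, F π) / N.factorial with hE
  have hE' : ∑ π, F π = N.factorial * E := by rw [hE]; field_simp
  set l := s / (4 * L ^ 2 * N) with hl
  have hl0 : 0 ≤ l := by positivity
  have hexp : 2 * (l * L) ^ 2 * N - l * s = -(s ^ 2 / (8 * L ^ 2 * N)) := by
    rw [hl]; field_simp; ring
  have tail : ∀ (l' : ℝ) (A : Finset (ι ≃ κ)), l' ^ 2 = l ^ 2 →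
      (∀ π ∈ A, l * s ≤ l' * (F π - E)) →
      (#A : ℝ) ≤ N.factorial * Real.exp (-(s ^ 2 / (8 * L ^ 2 * N))) := by
    intro l' A hl' hA
    have h1 := sum_exp_equiv_le L N hι hκ F hF E hE' l'
    rw [mul_pow, hl', ← mul_pow] at h1
    have h2 : (#A : ℝ) * Real.exp (l * s) ≤ ∑ π, Real.exp (l' * (F π - E)) := by
      rw [← nsmul_eq_mul, ← sum_const]
      refine (sum_le_sum fun π hπ => Real.exp_le_exp.2 (hA π hπ)).trans ?_
      exact sum_le_sum_of_subset_of_nonneg (subset_univ _) fun _ _ _ => (Real.exp_pos _).le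
    rw [← hexp, sub_eq_add_neg, Real.exp_add, Real.exp_neg, ← mul_assoc, ← div_eq_mul_inv,
      le_div_iff₀ (Real.exp_pos _)]
    exact h2.trans h1
  have hEa : E - s < a := by
    by_contra h
    push Not at h
    refine absurd (tail (-l) {π | F π ≤ a} (by ring) fun π hπ => ?_) (not_le.2 ha)
    have := (mem_filter.1 hπ).2
    nlinarith
  refine tail l _ rfl fun π hπ => ?_
  have := (mem_filter.1 hπ).2
  gcongr
  linarith

/-! ### Automorphisms of the tree -/

/-- The largest letter allowed after the word `u`. -/
def maxLetter (d : ℕ) (u : List ℕ) : ℕ := if u = [] then d else d - 1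

lemma validTd_nil (d : ℕ) : ValidTd d [] := by constructor <;> simp [List.getLast?]

lemma validTd_cons {d : ℕ} {a : ℕ} {u : List ℕ} :
    ValidTd d (a :: u) ↔ ValidTd d u ∧ 1 ≤ a ∧ a ≤ maxLetter d u := by
  unfold ValidTd maxLetter
  cases u with
  | nil => simp
  | cons b u =>
    simp only [List.dropLast_cons_cons, List.mem_cons, forall_eq_or_imp, List.getLast?_cons_cons,
      if_neg (List.cons_ne_nil b u)]
    tauto

/-- The automorphism group of the tree. -/
abbrev TdAut (d : ℕ) : Type := TdGraph d ≃g TdGraph d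

lemma TdVertex.ext {d : ℕ} {v w : TdVertex d} (h : v.1 = w.1) : v = w := Subtype.ext h

/-- Adjacency of words. -/
def WAdj (u w : List ℕ) : Prop := (∃ i, w = i :: u) ∨ (∃ i, u = i :: w)

lemma WAdj.symm {u w : List ℕ} (h : WAdj u w) : WAdj w u := Or.symm h

/-- Automorphisms from maps of words. -/
def mkAut {d : ℕ} (f g : List ℕ → List ℕ) (hf : ∀ u, ValidTd d u → ValidTd d (f u))
    (hg : ∀ u, ValidTd d u → ValidTd d (g u)) (hgf : ∀ u, ValidTd d u → g (f u) = u)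
    (hfg : ∀ u, ValidTd d u → f (g u) = u)
    (hfa : ∀ a u, ValidTd d (a :: u) → WAdj (f u) (f (a :: u)))
    (hga : ∀ a u, ValidTd d (a :: u) → WAdj (g u) (g (a :: u))) : TdAut d where
  toFun v := ⟨f v.1, hf _ v.2⟩
  invFun v := ⟨g v.1, hg _ v.2⟩
  left_inv v := TdVertex.ext (hgf _ v.2)
  right_inv v := TdVertex.ext (hfg _ v.2)
  map_rel_iff' := by
    have key : ∀ (h : List ℕ → List ℕ), (∀ a u, ValidTd d (a :: u) → WAdj (h u) (h (a :: u))) →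
        ∀ v w : TdVertex d, WAdj v.1 w.1 → WAdj (h v.1) (h w.1) := by
      rintro h hh v w (⟨i, hi⟩ | ⟨i, hi⟩)
      · have := hh i v.1 (hi ▸ w.2)
        rwa [← hi] at this
      · have := hh i w.1 (hi ▸ v.2)
        rw [← hi] at this
        exact this.symm
    intro v w
    constructor
    · intro h
      have h1 := key g hga ⟨f v.1, hf _ v.2⟩ ⟨f w.1, hf _ w.2⟩ h
      simp only [hgf _ v.2, hgf _ w.2] at h1
      exact h1
    · exact key f hfa v w

/-- Map of words acting letter by letter. -/
def locW (α : List ℕ → ℕ → ℕ) : List ℕ → List ℕ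
  | [] => []
  | a :: u => α u a :: locW α u

/-- Inverse of `locW`. -/
def locInvW (β : List ℕ → ℕ → ℕ) : List ℕ → List ℕ
  | [] => []
  | a :: u => β (locInvW β u) a :: locInvW β u

lemma locW_length (α : List ℕ → ℕ → ℕ) (u : List ℕ) : (locW α u).length = u.length := by
  induction u with
  | nil => rfl
  | cons a u ih => simp [locW, ih]

lemma locInvW_length (α : List ℕ → ℕ → ℕ) (u : List ℕ) : (locInvW α u).length = u.length := by
  induction u with
  | nil => rfl
  | cons a u ih => simp [locInvW, ih]

lemma maxLetter_congr {d : ℕ} {u w : List ℕ} (h : u.length = w.length) :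
    maxLetter d u = maxLetter d w := by
  have : u = [] ↔ w = [] := by
    rw [← List.length_eq_zero_iff, ← List.length_eq_zero_iff, h]
  simp only [maxLetter, this]

/-- The root-fixing automorphism given by permutations of the letters at each vertex. -/
def locAut {d : ℕ} (α β : List ℕ → ℕ → ℕ)
    (hα : ∀ u a, ValidTd d (a :: u) → ValidTd d (α u a :: u) ∧ β u (α u a) = a)
    (hβ : ∀ u a, ValidTd d (a :: u) → ValidTd d (β u a :: u) ∧ α u (β u a) = a) : TdAut d :=
  have v1 : ∀ u, ValidTd d u → ValidTd d (locW α u) := by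
    intro u hu
    induction u with
    | nil => exact hu
    | cons a u ih =>
      have h1 := (hα u a hu).1
      rw [validTd_cons] at h1 hu
      rw [locW, validTd_cons, maxLetter_congr (locW_length α u)]
      exact ⟨ih hu.1, h1.2⟩
  have v2 : ∀ u, ValidTd d u → ValidTd d (locInvW β u) := by
    intro u hu
    induction u with
    | nil => exact hu
    | cons a u ih =>
      rw [validTd_cons] at hu
      have h0 : ValidTd d (a :: locInvW β u) := by
        rw [validTd_cons, maxLetter_congr (locInvW_length β u)]
        exact ⟨ih hu.1, hu.2⟩
      exact (hβ _ a h0).1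
  mkAut (locW α) (locInvW β) v1 v2
    (by
      intro u hu
      induction u with
      | nil => rfl
      | cons a u ih =>
        have h1 := (hα u a hu).2
        rw [validTd_cons] at hu
        rw [locW, locInvW, ih hu.1, h1])
    (by
      intro u hu
      induction u with
      | nil => rfl
      | cons a u ih =>
        rw [validTd_cons] at hu
        have h0 : ValidTd d (a :: locInvW β u) := by
          rw [validTd_cons, maxLetter_congr (locInvW_length β u)]
          exact ⟨v2 _ hu.1, hu.2⟩
        rw [locInvW, locW, (hβ _ _ h0).2, ih hu.1])
    (fun a u _ => Or.inl ⟨_, rfl⟩) (fun a u _ => Or.inl ⟨_, rfl⟩)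

/-- The letter in `{1, …, d}` representing a residue. -/
def lt {d : ℕ} (z : ZMod d) : ℕ := (z - 1).val + 1

lemma cast_lt {d : ℕ} [NeZero d] (z : ZMod d) : ((lt z : ℕ) : ZMod d) = z := by
  simp [lt]

lemma lt_cast {d : ℕ} [NeZero d] {a : ℕ} (h1 : 1 ≤ a) (h2 : a ≤ d) : lt (a : ZMod d) = a := by
  obtain ⟨b, rfl⟩ := Nat.exists_eq_add_of_le' h1
  unfold lt
  push_cast
  rw [add_sub_cancel_right, ZMod.val_natCast, Nat.mod_eq_of_lt (by omega)]

lemma one_le_lt {d : ℕ} (z : ZMod d) : 1 ≤ lt z := by simp [lt]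

lemma lt_le {d : ℕ} [NeZero d] (z : ZMod d) : lt z ≤ d := ZMod.val_lt (z - 1)

/-- The action on letters of the rotation around the root. -/
def rotLetter {d : ℕ} (i : ZMod d) (u : List ℕ) (a : ℕ) : ℕ :=
  if u = [] then lt ((a : ZMod d) + i) else a

lemma rotLetter_spec {d : ℕ} [NeZero d] (i j : ZMod d) (hij : i + j = 0) (u : List ℕ) (a : ℕ)
    (h : ValidTd d (a :: u)) :
    ValidTd d (rotLetter i u a :: u) ∧ rotLetter j u (rotLetter i u a) = a := by
  unfold rotLetter
  split_ifs with hu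
  · subst hu
    rw [validTd_cons] at h ⊢
    refine ⟨⟨h.1, one_le_lt _, by simpa [maxLetter] using lt_le _⟩, ?_⟩
    rw [cast_lt, add_assoc, hij, add_zero, lt_cast h.2.1 (by simpa [maxLetter] using h.2.2)]
  · exact ⟨h, rfl⟩

/-- The rotation around the root by `i`. -/
def rot {d : ℕ} [NeZero d] (i : ZMod d) : TdAut d :=
  locAut (rotLetter i) (rotLetter (-i)) (rotLetter_spec i (-i) (by ring))
    (rotLetter_spec (-i) i (by ring))

lemma rot_val {d : ℕ} [NeZero d] (i : ZMod d) (v : TdVertex d) :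
    (rot i v).1 = locW (rotLetter i) v.1 := rfl

lemma rot_add {d : ℕ} [NeZero d] (i j : ZMod d) : rot (i + j) = rot i * rot j := by
  refine RelIso.ext fun v => TdVertex.ext ?_
  change locW _ v.1 = locW _ (locW _ v.1)
  obtain ⟨u, hu⟩ := v
  simp only
  induction u with
  | nil => rfl
  | cons a u ih =>
    rw [validTd_cons] at hu
    simp only [locW, ih hu.1, List.cons.injEq, and_true]
    cases u with
    | nil => simp [rotLetter, locW, cast_lt, add_assoc, add_comm i j]
    | cons b u => simp [rotLetter, locW]

lemma rot_zero {d : ℕ} [NeZero d] : rot (0 : ZMod d) = 1 := by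
  have h := rot_add (0 : ZMod d) 0
  rw [add_zero] at h
  exact (mul_eq_left.1 h.symm)

/-- The action on words of the inversion of the edge between the root and its first
neighbor. -/
def flipW : List ℕ → List ℕ
  | [] => [1]
  | [a] => if a = 1 then [] else [a - 1, 1]
  | a :: b :: u => if u = [] ∧ b = 1 then [a + 1] else a :: flipW (b :: u)

lemma flipW_ne_nil {u : List ℕ} (h : u ≠ [1]) : flipW u ≠ [] := by
  match u with
  | [] => simp [flipW]
  | [a] => simp only [flipW]; split_ifs <;> simp_all
  | a :: b :: u => simp only [flipW]; split_ifs <;> simp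

lemma flipW_cons_wAdj (a : ℕ) (u : List ℕ) : WAdj (flipW u) (flipW (a :: u)) := by
  match u with
  | [] =>
    simp only [flipW]
    split_ifs
    · exact Or.inr ⟨_, rfl⟩
    · exact Or.inl ⟨_, rfl⟩
  | b :: u =>
    rw [flipW]
    split_ifs with h
    · obtain ⟨rfl, rfl⟩ := h
      simp [flipW, WAdj]
    · exact Or.inl ⟨_, rfl⟩

lemma flipW_valid {d : ℕ} [NeZero d] (u : List ℕ) (h : ValidTd d u) :
    ValidTd d (flipW u) := by
  have hd : 1 ≤ d := Nat.one_le_iff_ne_zero.2 (NeZero.ne d)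
  induction u with
  | nil => simp [flipW, validTd_cons, validTd_nil, maxLetter]; exact hd
  | cons a u ih =>
    match u with
    | [] =>
      simp only [flipW]
      simp only [validTd_cons, maxLetter, if_true] at h
      split_ifs
      · exact validTd_nil d
      · simp [validTd_cons, validTd_nil, maxLetter]; omega
    | b :: u =>
      rw [validTd_cons] at h
      have ih' := ih h.1
      rw [flipW]
      simp only [maxLetter, if_neg (List.cons_ne_nil b u)] at h
      split_ifs with h'
      · obtain ⟨rfl, rfl⟩ := h'
        simp [validTd_cons, validTd_nil, maxLetter]; omega
      · rw [validTd_cons]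
        refine ⟨ih', ?_⟩
        rw [maxLetter, if_neg (flipW_ne_nil (by simpa [and_comm] using h'))]
        exact h.2

lemma flipW_flipW (u : List ℕ) (h : ∀ a ∈ u, 1 ≤ a) : flipW (flipW u) = u := by
  induction u with
  | nil => simp [flipW]
  | cons a u ih =>
    have ha : 1 ≤ a := h a (by simp)
    match u with
    | [] =>
      simp only [flipW]
      split_ifs with h1
      · simp [flipW, h1]
      · simp [flipW]; omega
    | b :: u =>
      have ih' := ih (fun a ha => h a (by simp [ha]))
      rw [flipW]
      split_ifs with h'
      · obtain ⟨rfl, rfl⟩ := h'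
        simp [flipW]; omega
      · obtain ⟨c, w, hc⟩ := List.exists_cons_of_ne_nil
          (flipW_ne_nil (u := b :: u) (by simpa [and_comm] using h'))
        rw [hc] at ih' ⊢
        have : ¬ (w = [] ∧ c = 1) := by
          rintro ⟨rfl, rfl⟩
          simp [flipW] at ih'
        rw [flipW, if_neg this, ih']

lemma one_le_of_mem {d : ℕ} {u : List ℕ} (h : ValidTd d u) : ∀ a ∈ u, 1 ≤ a := by
  induction u with
  | nil => simp
  | cons b u ih =>
    rw [validTd_cons] at h
    intro a ha
    rcases List.mem_cons.1 ha with rfl | ha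
    · exact h.2.1
    · exact ih h.1 a ha

/-- The inversion of the edge between the root and its first neighbor. -/
def flip {d : ℕ} [NeZero d] : TdAut d :=
  mkAut flipW flipW flipW_valid flipW_valid (fun u h => flipW_flipW u (one_le_of_mem h))
    (fun u h => flipW_flipW u (one_le_of_mem h)) (fun a u _ => flipW_cons_wAdj a u)
    (fun a u _ => flipW_cons_wAdj a u)

lemma flip_val {d : ℕ} [NeZero d] (v : TdVertex d) : (flip v).1 = flipW v.1 := rfl

lemma flip_flip {d : ℕ} [NeZero d] (v : TdVertex d) : flip (flip v) = v :=
  TdVertex.ext (flipW_flipW _ (one_le_of_mem v.2))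

lemma flipW_append_one (w : List ℕ) : (flipW (w ++ [1])).length = w.length := by
  induction w with
  | nil => simp [flipW]
  | cons a w ih =>
    match w with
    | [] => simp [flipW]
    | b :: w =>
      rw [List.cons_append, List.cons_append, flipW, if_neg (by simp), ← List.cons_append,
        List.length_cons, ih]
      rfl

lemma flipW_length_le (w : List ℕ) : (flipW w).length ≤ w.length + 1 := by
  induction w with
  | nil => simp [flipW]
  | cons a w ih =>
    match w with
    | [] => simp only [flipW]; split_ifs <;> simp
    | b :: w =>
      rw [flipW]
      split_ifs
      · simp
      · simpa using ih

lemma flipW_getLast {u : List ℕ} (h : u.getLast? ≠ some 1) : (flipW u).getLast? = some 1 := by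
  induction u with
  | nil => simp [flipW]
  | cons a w ih =>
    match w with
    | [] => simp only [flipW]; split_ifs <;> simp_all
    | b :: w =>
      rw [List.getLast?_cons_cons] at h
      rw [flipW, if_neg (by rintro ⟨rfl, rfl⟩; simp at h), List.getLast?_cons, ih h]
      simp

lemma length_rot {d : ℕ} [NeZero d] (i : ZMod d) (v : TdVertex d) :
    (rot i v).1.length = v.1.length := locW_length _ _

lemma rot_append {d : ℕ} [NeZero d] (i : ZMod d) (w : List ℕ) (a : ℕ) :
    locW (rotLetter i) (w ++ [a]) = w ++ [lt ((a : ZMod d) + i)] := by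
  induction w with
  | nil => simp [locW, rotLetter]
  | cons b w ih => simp [locW, rotLetter, ih]

lemma flip_mem_ErSet {d r : ℕ} [NeZero d] {v : TdVertex d} (h : v ∈ ErSet d r) :
    flip v ∈ ErSet d r := by
  by_cases h1 : v.1.getLast? = some 1
  · left
    have : v.1.length ≤ r := ErSet_subset_SrSet d r h
    obtain ⟨w, hw⟩ := List.getLast?_eq_some_iff.1 h1
    rw [flip_val, hw, flipW_append_one]
    rw [hw] at this
    simpa using this
  · right
    rcases h with h | h
    · exact ⟨flipW_getLast h1, (flipW_length_le _).trans h⟩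
    · exact absurd h.1 h1

lemma flip_mem_of_SrSet {d r : ℕ} [NeZero d] {v : TdVertex d} (h : v ∈ SrSet d r) :
    flip v ∈ SrSet d (r + 1) :=
  (flipW_length_le _).trans (Nat.succ_le_succ h)

lemma rot_mem_SrSet {d r : ℕ} [NeZero d] (i : ZMod d) {v : TdVertex d} :
    rot i v ∈ SrSet d r ↔ v ∈ SrSet d r := by
  simp only [SrSet, Set.mem_ofPred_eq, length_rot]

/-- Every vertex other than the root is rotated to a vertex below the first neighbor of the
root, which is brought closer to the root by the flip. -/
lemma exists_rot_flip {d : ℕ} [NeZero d] (v : TdVertex d) (hv : v ≠ rootTd d) :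
    ∃ i : ZMod d, (flip (rot i v)).1.length + 1 = v.1.length := by
  have hne : v.1 ≠ [] := fun h => hv (TdVertex.ext h)
  obtain ⟨w, a, hw⟩ := (List.eq_nil_or_concat v.1).resolve_left hne
  rw [List.concat_eq_append] at hw
  refine ⟨1 - a, ?_⟩
  rw [flip_val, rot_val, hw, rot_append, add_sub_cancel]
  have : lt (1 : ZMod d) = 1 := by simp [lt]
  rw [this, flipW_append_one]
  simp

lemma finite_validTd (d r : ℕ) : {l : List ℕ | ValidTd d l ∧ l.length ≤ r}.Finite := by
  induction r with
  | zero =>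
    refine (Set.finite_singleton ([] : List ℕ)).subset ?_
    rintro l ⟨-, h⟩
    exact List.length_eq_zero_iff.1 (Nat.le_zero.1 h)
  | succ r ih =>
    refine (((Set.finite_Iic d).image2 List.cons ih).insert []).subset ?_
    rintro l ⟨h1, h2⟩
    match l with
    | [] => exact Set.mem_insert _ _
    | a :: u =>
      rw [validTd_cons] at h1
      refine Set.mem_insert_of_mem _ ⟨a, ?_, u, ⟨h1.1, by simpa using h2⟩, rfl⟩
      have := h1.2.2
      unfold maxLetter at this
      rw [Set.mem_Iic]
      split_ifs at this <;> omega

lemma finite_SrSet (d r : ℕ) : (SrSet d r).Finite :=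
  Set.Finite.of_finite_image (f := Subtype.val) ((finite_validTd d r).subset (by
    rintro _ ⟨v, hv, rfl⟩
    exact ⟨v.2, hv⟩)) Subtype.val_injective.injOn

instance (d r : ℕ) : Finite ↥(SrSet d r) := (finite_SrSet d r).to_subtype

instance (d r : ℕ) : Fintype ↥(SrSet d r) := Fintype.ofFinite _

lemma finite_ErSet (d r : ℕ) : (ErSet d r).Finite :=
  (finite_SrSet d r).subset (ErSet_subset_SrSet d r)

instance (d r : ℕ) : Finite ↥(ErSet d r) := (finite_ErSet d r).to_subtype

instance (d r : ℕ) : Fintype ↥(ErSet d r) := Fintype.ofFinite _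

instance (d : ℕ) : Countable (TdVertex d) := Subtype.countable

lemma aut_fix_cons {d : ℕ} (φ : TdAut d) (h0 : φ (rootTd d) = rootTd d) (a : ℕ) (u : List ℕ)
    (h : ValidTd d (a :: u)) :
    ∃ b, (φ ⟨a :: u, h⟩).1 = b :: (φ ⟨u, (validTd_cons.1 h).1⟩).1 := by
  induction u generalizing a with
  | nil =>
    have h1 : (TdGraph d).Adj ⟨[], (validTd_cons.1 h).1⟩ ⟨[a], h⟩ := Or.inl ⟨a, rfl⟩
    have h2 := φ.map_rel_iff.2 h1
    rcases h2 with h1 | ⟨i, hi⟩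
    · exact h1
    · have : φ ⟨[], (validTd_cons.1 h).1⟩ = rootTd d := h0
      rw [this] at hi
      simp [rootTd] at hi
  | cons c w ih =>
    have hu := (validTd_cons.1 h).1
    obtain ⟨e, he⟩ := ih c hu
    have h1 : (TdGraph d).Adj ⟨c :: w, hu⟩ ⟨a :: c :: w, h⟩ := Or.inl ⟨a, rfl⟩
    have h2 := φ.map_rel_iff.2 h1
    rcases h2 with h1 | ⟨i, hi⟩
    · exact h1
    · rw [he, List.cons.injEq] at hi
      have h4 := φ.injective (TdVertex.ext hi.2)
      have h3 := congrArg (fun v : TdVertex d => v.1.length) h4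
      simp at h3
      omega

lemma aut_fix_length {d : ℕ} (φ : TdAut d) (h0 : φ (rootTd d) = rootTd d) (v : TdVertex d) :
    (φ v).1.length = v.1.length := by
  obtain ⟨u, hu⟩ := v
  induction u with
  | nil =>
    have : φ ⟨[], hu⟩ = rootTd d := h0
    rw [this]; rfl
  | cons a u ih =>
    obtain ⟨b, hb⟩ := aut_fix_cons φ h0 a u hu
    rw [hb, List.length_cons, ih, List.length_cons]

/-- The automorphism group is generated by the stabilizer of the root, the rotations and the
flip. -/
lemma aut_induction {d : ℕ} [NeZero d] {P : TdAut d → Prop}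
    (hfix : ∀ φ : TdAut d, φ (rootTd d) = rootTd d → P φ)
    (hflip : P flip) (hmul : ∀ φ ψ : TdAut d, P φ → P ψ → P (φ * ψ)) (φ : TdAut d) : P φ := by
  have key : ∀ (k : ℕ) (φ : TdAut d), (φ (rootTd d)).1.length = k → P φ := by
    intro k
    induction k with
    | zero =>
      intro φ h
      exact hfix φ (TdVertex.ext (List.length_eq_zero_iff.1 h))
    | succ k ih =>
      intro φ h
      obtain ⟨i, hi⟩ := exists_rot_flip (φ (rootTd d)) (by
        intro h1; rw [h1] at h; simp [rootTd] at h)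
      have h1 := ih (flip * (rot i * φ)) (by
        change (flip (rot i (φ (rootTd d)))).1.length = k
        omega)
      have h2 : φ = rot (-i) * (flip * (flip * (rot i * φ))) := by
        have h3 : (flip : TdAut d) * flip = 1 := RelIso.ext fun v => flip_flip v
        rw [← mul_assoc flip flip, h3, one_mul, ← mul_assoc, ← rot_add, neg_add_cancel, rot_zero,
          one_mul]
      rw [h2]
      exact hmul _ _ (hfix _ rfl) (hmul _ _ hflip h1)
  exact key _ φ rfl

/-! ### Walks along matchings of half-edges -/

/-- Shift of half-edges at a vertex. -/
def sh {V : Type*} {d : ℕ} (a : ZMod d) (k : V × ZMod d) : V × ZMod d := (k.1, k.2 + a)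

lemma sh_sh {V : Type*} {d : ℕ} (a b : ZMod d) (k : V × ZMod d) :
    sh a (sh b k) = sh (b + a) k := by simp [sh, add_assoc]

lemma sh_zero {V : Type*} {d : ℕ} (k : V × ZMod d) : sh 0 k = k := by simp [sh]

lemma sh_neg_sh {V : Type*} {d : ℕ} (a : ZMod d) (k : V × ZMod d) : sh (-a) (sh a k) = k := by
  rw [sh_sh, add_neg_cancel, sh_zero]

lemma sh_sh_neg {V : Type*} {d : ℕ} (a : ZMod d) (k : V × ZMod d) : sh a (sh (-a) k) = k := by
  rw [sh_sh, neg_add_cancel, sh_zero]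

/-- The shift as a permutation. -/
def shE {V : Type*} {d : ℕ} (a : ZMod d) : Equiv.Perm (V × ZMod d) where
  toFun := sh a
  invFun := sh (-a)
  left_inv := sh_neg_sh a
  right_inv := sh_sh_neg a

/-- The walk along the word `u` started at `k`. -/
def wk {V : Type*} {d : ℕ} (ι : V × ZMod d → V × ZMod d) (k : V × ZMod d) :
    List ℕ → V × ZMod d
  | [] => k
  | a :: u => ι (sh (a : ZMod d) (wk ι k u))

lemma wk_rot {V : Type*} {d : ℕ} [NeZero d] (ι : V × ZMod d → V × ZMod d) (i : ZMod d)
    (k : V × ZMod d) (u : List ℕ) (hu : u ≠ []) :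
    wk ι (sh i k) u = wk ι k (locW (rotLetter i) u) := by
  induction u with
  | nil => exact absurd rfl hu
  | cons a u ih =>
    match u with
    | [] => simp [wk, locW, rotLetter, sh_sh, cast_lt, add_comm]
    | b :: u =>
      rw [wk, ih (by simp)]
      simp [locW, rotLetter, wk]

/-- The neighbor of a half-edge through the matching, seen from the reference half-edges. -/
def cross {V : Type*} {d : ℕ} (ι : V × ZMod d → V × ZMod d) (k : V × ZMod d) : V × ZMod d :=
  sh (-1) (ι (sh 1 k))

lemma wk_flip {V : Type*} {d : ℕ} (ι : V × ZMod d → V × ZMod d)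
    (hι : Function.Involutive ι) (k : V × ZMod d) (u : List ℕ) (hu : u ≠ []) (hu1 : u ≠ [1])
    (hu2 : ∀ a ∈ u, 1 ≤ a) :
    wk ι (cross ι k) u = wk ι k (flipW u) := by
  induction u with
  | nil => exact absurd rfl hu
  | cons a u ih =>
    match u with
    | [] =>
      have h1 : a ≠ 1 := by simpa using hu1
      obtain ⟨b, rfl⟩ := Nat.exists_eq_add_of_le' (hu2 a (by simp))
      simp only [flipW, if_neg h1, wk, cross, sh_sh]
      simp
    | b :: u =>
      rw [flipW]
      split_ifs with h
      · obtain ⟨rfl, rfl⟩ := h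
        simp only [wk, cross, sh_sh]
        simp [hι (sh 1 k), sh_zero, sh_sh, add_comm]
      · rw [wk, ih (by simp) (by simpa [and_comm] using h) (fun a ha => hu2 a (by simp [ha]))]
        rfl

lemma wk_flip_fst {V : Type*} {d : ℕ} (ι : V × ZMod d → V × ZMod d)
    (hι : Function.Involutive ι) (k : V × ZMod d) (u : List ℕ) (hu2 : ∀ a ∈ u, 1 ≤ a) :
    (wk ι (cross ι k) u).1 = (wk ι k (flipW u)).1 := by
  by_cases h0 : u = []
  · subst h0; simp [wk, flipW, cross, sh]
  by_cases h1 : u = [1]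
  · subst h1
    simp only [wk, flipW, if_true, cross, sh_sh]
    simp [sh_zero, hι (sh 1 k)]
    rfl
  rw [wk_flip ι hι k u h0 h1 hu2]

/-- The coloring of the tree seen from a half-edge. -/
def vw {V N : Type*} {d : ℕ} (ι : V × ZMod d → V × ZMod d) (f : V → N) (k : V × ZMod d)
    (v : TdVertex d) : N := f (wk ι k v.1).1

lemma vw_rot {V N : Type*} {d : ℕ} [NeZero d] (ι : V × ZMod d → V × ZMod d) (f : V → N)
    (i : ZMod d) (k : V × ZMod d) (v : TdVertex d) :
    vw ι f (sh i k) v = vw ι f k (rot i v) := by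
  unfold vw
  by_cases h : v.1 = []
  · simp [rot_val, h, wk, locW, sh]
  · rw [wk_rot ι i k _ h]; rfl

lemma vw_flip {V N : Type*} {d : ℕ} [NeZero d] (ι : V × ZMod d → V × ZMod d)
    (hι : Function.Involutive ι) (f : V → N) (k : V × ZMod d) (v : TdVertex d) :
    vw ι f (cross ι k) v = vw ι f k (flip v) := by
  unfold vw
  rw [wk_flip_fst ι hι k v.1 (one_le_of_mem v.2), flip_val]

lemma vw_root {V N : Type*} {d : ℕ} (ι : V × ZMod d → V × ZMod d) (f : V → N)
    (k : V × ZMod d) : vw ι f k (rootTd d) = f k.1 := rfl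

/-- The half-edges whose ball of radius `l` meets a bad half-edge. -/
def badL {V : Type*} [Fintype V] {d : ℕ} [NeZero d] (ι : V × ZMod d → V × ZMod d)
    (Bad : Finset (V × ZMod d)) : ℕ → Finset (V × ZMod d)
  | 0 => ∅
  | l + 1 => Finset.univ.filter fun k => ∃ a : ZMod d, sh a k ∈ Bad ∨
      sh (-1) (ι (sh a k)) ∈ badL ι Bad l

/-- The constant in the bound for the number of bad half-edges. -/
def badC (d : ℕ) : ℕ → ℕ
  | 0 => 0
  | l + 1 => d * (1 + badC d l)

open Finset in
lemma card_badL_le {V : Type*} [Fintype V] {d : ℕ} [NeZero d] (ι : V × ZMod d → V × ZMod d)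
    (hι : Function.Injective ι) (Bad : Finset (V × ZMod d)) (l : ℕ) :
    #(badL ι Bad l) ≤ badC d l * #Bad := by
  induction l with
  | zero => simp [badL]
  | succ l ih =>
    have h1 : badL ι Bad (l + 1) ⊆ univ.biUnion fun a : ZMod d =>
        (univ.filter fun k => sh a k ∈ Bad) ∪
          univ.filter fun k => sh (-1) (ι (sh a k)) ∈ badL ι Bad l := by
      intro k hk
      rw [badL, mem_filter] at hk
      obtain ⟨a, ha⟩ := hk.2
      simp only [mem_biUnion, mem_union, mem_filter, mem_univ, true_and]
      exact ⟨a, ha⟩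
    refine (card_le_card h1).trans (card_biUnion_le.trans ?_)
    have h2 : ∀ a ∈ (univ : Finset (ZMod d)), #((univ.filter fun k => sh a k ∈ Bad) ∪
          univ.filter fun k => sh (-1) (ι (sh a k)) ∈ badL ι Bad l) ≤ (1 + badC d l) * #Bad := by
      intro a _
      refine (card_union_le _ _).trans ?_
      rw [add_mul, one_mul]
      refine add_le_add ?_ (le_trans ?_ ih)
      · exact card_le_card_of_injOn (sh a) (fun k hk => by simpa using hk)
          (shE a).injective.injOn
      · exact card_le_card_of_injOn (fun k => sh (-1) (ι (sh a k))) (fun k hk => by simpa using hk)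
          ((shE (-1)).injective.comp (hι.comp (shE a).injective)).injOn
    refine (sum_le_sum h2).trans ?_
    rw [sum_const, card_univ, ZMod.card, smul_eq_mul, badC, mul_assoc]

/-- Two families of colorings which satisfy the rotation and flip relations and agree at the
root agree on balls. -/
lemma agree_of_relations {V N : Type*} [Fintype V] {d : ℕ} [NeZero d]
    (ι : V × ZMod d → V × ZMod d) (Bad : Finset (V × ZMod d)) (R : ℕ)
    (X X' : V × ZMod d → TdVertex d → N)
    (hr : ∀ i k v, X (sh i k) v = X k (rot i v)) (hr' : ∀ i k v, X' (sh i k) v = X' k (rot i v))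
    (hf : ∀ k, sh 1 k ∉ Bad → ∀ v : TdVertex d, v.1.length + 1 ≤ R →
      X (cross ι k) v = X k (flip v))
    (hf' : ∀ k, sh 1 k ∉ Bad → ∀ v : TdVertex d, v.1.length + 1 ≤ R →
      X' (cross ι k) v = X' k (flip v))
    (h0 : ∀ k, X k (rootTd d) = X' k (rootTd d)) (l : ℕ) (hl : l ≤ R) (k : V × ZMod d)
    (hk : k ∉ badL ι Bad l) (v : TdVertex d) (hv : v.1.length ≤ l) : X k v = X' k v := by
  induction l generalizing k v with
  | zero =>
    have : v = rootTd d := TdVertex.ext (List.length_eq_zero_iff.1 (Nat.le_zero.1 hv))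
    rw [this, h0]
  | succ l ih =>
    by_cases hroot : v = rootTd d
    · rw [hroot, h0]
    obtain ⟨i, hi⟩ := exists_rot_flip v hroot
    have hk' : ∀ a : ZMod d, sh a k ∉ Bad ∧ sh (-1) (ι (sh a k)) ∉ badL ι Bad l := by
      intro a
      by_contra hcon
      refine hk ?_
      rw [badL, Finset.mem_filter]
      exact ⟨Finset.mem_univ _, a, by tauto⟩
    have hvw : v = rot (-i) (flip (flip (rot i v))) := by
      rw [flip_flip]
      have h1 : (rot (-i) * rot i : TdAut d) v = v := by
        rw [← rot_add, neg_add_cancel, rot_zero]; rfl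
      exact h1.symm
    have hb : sh 1 (sh (-i) k) = sh (-i + 1) k := sh_sh _ _ _
    obtain ⟨hk1, hk2⟩ := hk' (-i + 1)
    rw [← hb] at hk1 hk2
    have hlen : (flip (rot i v)).1.length + 1 ≤ R := by omega
    rw [hvw, ← hr, ← hr', ← hf _ hk1 _ hlen, ← hf' _ hk1 _ hlen]
    exact ih (by omega) _ hk2 _ (by omega)

/-! ### Means of functions on groups invariant under a subgroup of finite index -/

/-- Right invariance under a subgroup. -/
def RInv {G : Type*} [Group G] (N : Subgroup G) (F : G → ℝ) : Prop :=
  ∀ g, ∀ n ∈ N, F (g * n) = F g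

lemma RInv.mono {G : Type*} [Group G] {N N' : Subgroup G} {F : G → ℝ} (h : RInv N F)
    (hN : N' ≤ N) : RInv N' F := fun g n hn => h g n (hN hn)

lemma RInv.eq_of_mk_eq {G : Type*} [Group G] {N : Subgroup G} {F : G → ℝ} (h : RInv N F)
    {a b : G} (hab : (a : G ⧸ N) = b) : F a = F b := by
  have h1 := h a (a⁻¹ * b) (QuotientGroup.eq.1 hab)
  rw [← h1, mul_inv_cancel_left]

/-- The average of a function over the cosets of a subgroup. -/
def gavg {G : Type*} [Group G] (N : Subgroup G) (F : G → ℝ) : ℝ :=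
  (∑ᶠ q : G ⧸ N, F q.out) / N.index

lemma gavg_eq {G : Type*} [Group G] (N : Subgroup G) [Fintype (G ⧸ N)] (F : G → ℝ) :
    gavg N F = (∑ q : G ⧸ N, F q.out) / Fintype.card (G ⧸ N) := by
  rw [gavg, finsum_eq_sum_of_fintype, Subgroup.index, Nat.card_eq_fintype_card]

lemma gavg_of_le {G : Type*} [Group G] {N N' : Subgroup G} [N'.FiniteIndex]
    (hle : N' ≤ N) {F : G → ℝ} (hF : RInv N F) : gavg N' F = gavg N F := by
  have : N.FiniteIndex := Subgroup.finiteIndex_of_le hle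
  let : Fintype (G ⧸ N) := Fintype.ofFinite _
  let : Fintype (G ⧸ N') := Fintype.ofFinite _
  let e := Subgroup.quotientEquivProdOfLE hle
  have : Finite (N ⧸ N'.subgroupOf N) :=
    Finite.of_injective (fun b => e.symm (((1 : G) : G ⧸ N), b)) fun b c h => by
      simpa using e.symm.injective h
  let : Fintype (N ⧸ N'.subgroupOf N) := Fintype.ofFinite _
  have h1 : ∀ q : G ⧸ N', F q.out = F (e q).1.out := by
    intro q
    refine hF.eq_of_mk_eq ?_
    rw [QuotientGroup.out_eq']
    conv_rhs => rw [← q.out_eq]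
    rfl
  have hne : (Fintype.card (N ⧸ N'.subgroupOf N) : ℝ) ≠ 0 := by
    have : Nonempty (N ⧸ N'.subgroupOf N) := ⟨((1 : N) : N ⧸ N'.subgroupOf N)⟩
    exact_mod_cast Fintype.card_ne_zero
  rw [gavg_eq, gavg_eq, Finset.sum_congr rfl fun q _ => h1 q,
    e.sum_comp (fun p => F p.1.out), Fintype.sum_prod_type, Fintype.card_congr e,
    Fintype.card_prod]
  simp only [Finset.sum_const, Finset.card_univ, nsmul_eq_mul]
  rw [← Finset.mul_sum]
  push_cast
  rw [mul_comm (Fintype.card (G ⧸ N) : ℝ), mul_div_mul_left _ _ hne]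

lemma gavg_congr {G : Type*} [Group G] {N N' : Subgroup G} [N'.FiniteIndex] [N.FiniteIndex]
    {F : G → ℝ} (hF : RInv N F) (hF' : RInv N' F) : gavg N F = gavg N' F := by
  rw [← gavg_of_le (inf_le_left : N ⊓ N' ≤ N) hF, ← gavg_of_le (inf_le_right : N ⊓ N' ≤ N') hF']

/-- The mean of a function invariant under a subgroup of finite index. -/
def gmean {G : Type*} [Group G] (F : G → ℝ) : ℝ :=
  if h : ∃ N : Subgroup G, N.FiniteIndex ∧ RInv N F then gavg h.choose F else 0

lemma gmean_eq {G : Type*} [Group G] (N : Subgroup G) [N.FiniteIndex] {F : G → ℝ}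
    (hF : RInv N F) : gmean F = gavg N F := by
  have h : ∃ N : Subgroup G, N.FiniteIndex ∧ RInv N F := ⟨N, inferInstance, hF⟩
  have := h.choose_spec.1
  rw [gmean, dif_pos h]
  exact gavg_congr h.choose_spec.2 hF

lemma gavg_equiv {G H : Type*} [Group G] [Group H] (e : G ≃* H) (N : Subgroup H)
    [N.FiniteIndex] {F : H → ℝ} (hF : RInv N F) :
    gavg (N.comap e.toMonoidHom) (fun g => F (e g)) = gavg N F := by
  have hfi : (N.comap e.toMonoidHom).FiniteIndex := by
    constructor
    rw [Subgroup.index_comap_of_surjective _ e.surjective]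
    exact Subgroup.FiniteIndex.index_ne_zero
  let : Fintype (H ⧸ N) := Fintype.ofFinite _
  let : Fintype (G ⧸ N.comap e.toMonoidHom) := Fintype.ofFinite _
  let e' : G ⧸ N.comap e.toMonoidHom ≃ H ⧸ N := Quotient.congr e.toEquiv (by
    intro a b
    rw [QuotientGroup.leftRel_apply, QuotientGroup.leftRel_apply, Subgroup.mem_comap]
    simp)
  rw [gavg_eq, gavg_eq, Fintype.card_congr e', ← e'.sum_comp (fun q => F q.out)]
  congr 1
  refine Finset.sum_congr rfl fun q _ => hF.eq_of_mk_eq ?_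
  rw [QuotientGroup.out_eq']
  conv_rhs => rw [← q.out_eq]
  rfl

lemma gmean_equiv {G H : Type*} [Group G] [Group H] (e : G ≃* H) (N : Subgroup H)
    [N.FiniteIndex] {F : H → ℝ} (hF : RInv N F) : gmean (fun g => F (e g)) = gmean F := by
  have hfi : (N.comap e.toMonoidHom).FiniteIndex := by
    constructor
    rw [Subgroup.index_comap_of_surjective _ e.surjective]
    exact Subgroup.FiniteIndex.index_ne_zero
  rw [gmean_eq N hF, gmean_eq (N.comap e.toMonoidHom) (fun g n hn => by
    rw [map_mul]; exact hF _ _ hn), gavg_equiv e N hF]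

lemma gmean_left {G : Type*} [Group G] (N : Subgroup G) [N.FiniteIndex] {F : G → ℝ}
    (hF : RInv N F) (a : G) : gmean (fun g => F (a * g)) = gmean F := by
  let : Fintype (G ⧸ N) := Fintype.ofFinite _
  rw [gmean_eq N hF, gmean_eq N (fun g n hn => by rw [← mul_assoc]; exact hF _ _ hn), gavg_eq,
    gavg_eq, ← Equiv.sum_comp (MulAction.toPerm a : Equiv.Perm (G ⧸ N)) (fun q => F q.out)]
  congr 1
  refine Finset.sum_congr rfl fun q _ => hF.eq_of_mk_eq ?_
  rw [QuotientGroup.out_eq']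
  conv_rhs => rw [← q.out_eq]
  rfl

lemma gmean_right {G : Type*} [Group G] (N : Subgroup G) [N.FiniteIndex] {F : G → ℝ}
    (hF : RInv N F) (a : G) : gmean (fun g => F (g * a)) = gmean F := by
  rw [← gmean_left N hF a, ← gmean_equiv (MulAut.conj a⁻¹) N (F := fun g => F (a * g))
    (fun g n hn => by change F (a * (g * n)) = _; rw [← mul_assoc]; exact hF _ _ hn)]
  congr 1
  funext g
  simp [mul_assoc]

lemma gmean_const {G : Type*} [Group G] (c : ℝ) : gmean (fun _ : G => c) = c := by
  rw [gmean_eq (⊤ : Subgroup G) (fun _ _ _ => rfl)]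
  let : Fintype (G ⧸ (⊤ : Subgroup G)) := Fintype.ofFinite _
  rw [gavg_eq]
  have : Nonempty (G ⧸ (⊤ : Subgroup G)) := ⟨((1 : G) : G ⧸ (⊤ : Subgroup G))⟩
  simp

lemma gmean_sum {G ι : Type*} [Group G] (N : Subgroup G) [N.FiniteIndex] (s : Finset ι)
    {F : ι → G → ℝ} (hF : ∀ i ∈ s, RInv N (F i)) :
    gmean (fun g => ∑ i ∈ s, F i g) = ∑ i ∈ s, gmean (F i) := by
  let : Fintype (G ⧸ N) := Fintype.ofFinite _
  rw [gmean_eq N (fun g n hn => Finset.sum_congr rfl fun i hi => hF i hi g n hn), gavg_eq,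
    Finset.sum_comm, Finset.sum_div]
  refine Finset.sum_congr rfl fun i hi => ?_
  rw [gmean_eq N (hF i hi), gavg_eq]

lemma gmean_nonneg {G : Type*} [Group G] (N : Subgroup G) [N.FiniteIndex]
    {F : G → ℝ} (hF : RInv N F) (h0 : ∀ g, 0 ≤ F g) : 0 ≤ gmean F := by
  let : Fintype (G ⧸ N) := Fintype.ofFinite _
  rw [gmean_eq N hF, gavg_eq]
  exact div_nonneg (Finset.sum_nonneg fun q _ => h0 _) (by positivity)

/-- The mean over a group as an average of means over a subgroup of finite index, for a
function invariant under a subgroup `N` of that subgroup. -/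
lemma gmean_subgroup {G ι : Type*} [Group G] [Fintype ι] [Nonempty ι] (H : Subgroup G)
    (t : ι → G) (ht : Function.Bijective fun i => ((t i : G) : G ⧸ H)) (N : Subgroup G)
    [N.FiniteIndex] {F : G → ℝ} (hF : RInv N F) :
    gmean F = (∑ i, gmean (fun h : H => F (t i * h))) / Fintype.card ι := by
  let e : ι ≃ G ⧸ H := Equiv.ofBijective _ ht
  have : Finite (G ⧸ H) := Finite.of_equiv _ e
  have : H.FiniteIndex := Subgroup.finiteIndex_of_finite_quotient
  let N' := N ⊓ H
  have hle : N' ≤ H := inf_le_right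
  have hfi : (N'.subgroupOf H).FiniteIndex := inferInstance
  let : Fintype (G ⧸ N') := Fintype.ofFinite _
  let : Fintype (H ⧸ N'.subgroupOf H) := Fintype.ofFinite _
  have hF' : RInv N' F := hF.mono inf_le_left
  have hR : ∀ i, RInv (N'.subgroupOf H) (fun h : H => F (t i * h)) := by
    intro i g n hn
    have := hF' (t i * g) n (Subgroup.mem_subgroupOf.1 hn)
    simpa [mul_assoc] using this
  let f : G ⧸ H → G := fun q => t (e.symm q)
  have hf : Function.RightInverse f QuotientGroup.mk := fun q => e.apply_symm_apply q
  let E : (G ⧸ N') ≃ (G ⧸ H) × (H ⧸ N'.subgroupOf H) :=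
    Subgroup.quotientEquivProdOfLE' hle f hf
  let : Fintype (G ⧸ H) := Fintype.ofFinite _
  rw [gmean_eq N' hF', gavg_eq, ← E.symm.sum_comp, Fintype.sum_prod_type_right]
  have hcard : (Fintype.card (G ⧸ N') : ℝ) =
      Fintype.card ι * Fintype.card (H ⧸ N'.subgroupOf H) := by
    rw [Fintype.card_congr E, Fintype.card_prod, Fintype.card_congr e]; push_cast; rfl
  have h2 : ∀ b : H ⧸ N'.subgroupOf H, ∀ q : G ⧸ H,
      F (E.symm (q, b)).out = F (f q * (b.out : H)) := by
    intro b q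
    refine hF'.eq_of_mk_eq ?_
    rw [QuotientGroup.out_eq']
    conv_lhs => rw [← b.out_eq]
    rfl
  rw [hcard]
  simp_rw [h2]
  rw [Finset.sum_comm, ← e.sum_comp, mul_comm, ← div_div]
  congr 1
  rw [Finset.sum_div]
  refine Finset.sum_congr rfl fun i _ => ?_
  rw [gmean_eq _ (hR i), gavg_eq]
  simp [f]

/-! ### Symmetrization over the stabilizer of the root -/

/-- The automorphisms fixing the ball of radius `r` pointwise. -/
def fixS (d r : ℕ) : Subgroup (TdAut d) where
  carrier := {φ | ∀ v ∈ SrSet d r, φ v = v}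
  mul_mem' := by
    intro φ ψ hφ hψ v hv
    change φ (ψ v) = v
    rw [hψ v hv, hφ v hv]
  one_mem' := fun v _ => rfl
  inv_mem' := by
    intro φ hφ v hv
    change φ.symm v = v
    rw [RelIso.symm_apply_eq, hφ v hv]

lemma root_mem_SrSet (d r : ℕ) : rootTd d ∈ SrSet d r := Nat.zero_le _

lemma mem_fixS_zero {d : ℕ} {φ : TdAut d} : φ ∈ fixS d 0 ↔ φ (rootTd d) = rootTd d := by
  refine ⟨fun h => h _ (root_mem_SrSet d 0), fun h v hv => ?_⟩
  have : v = rootTd d := TdVertex.ext (List.length_eq_zero_iff.1 (Nat.le_zero.1 hv))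
  rw [this, h]

lemma fixS_le {d r : ℕ} : fixS d r ≤ fixS d 0 :=
  fun _ h => mem_fixS_zero.2 (h _ (root_mem_SrSet d r))

lemma map_mem_SrSet {d r : ℕ} {φ : TdAut d} (hφ : φ ∈ fixS d 0) {v : TdVertex d} :
    φ v ∈ SrSet d r ↔ v ∈ SrSet d r := by
  have := aut_fix_length φ (mem_fixS_zero.1 hφ) v
  simp only [SrSet, Set.mem_ofPred_eq, this]

lemma node1_val {d : ℕ} [NeZero d] : (node1 d).1 = [1] := by
  have h : 1 ≤ d := NeZero.one_le
  have h1 : node1 d = ⟨[1], by constructor <;> simp [List.getLast?, h]⟩ := dif_pos h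
  rw [h1]

lemma flip_root {d : ℕ} [NeZero d] : flip (rootTd d) = node1 d :=
  TdVertex.ext (by rw [node1_val]; rfl)

lemma flip_node1 {d : ℕ} [NeZero d] : flip (node1 d) = rootTd d := by
  rw [← flip_root, flip_flip]

lemma rot_mem {d : ℕ} [NeZero d] (i : ZMod d) : rot i ∈ fixS d 0 := mem_fixS_zero.2 rfl

lemma rot_node1_val {d : ℕ} [NeZero d] (i : ZMod d) : (rot i (node1 d)).1 = [lt (1 + i)] := by
  rw [rot_val, node1_val]
  simp [locW, rotLetter]

/-- The stabilizer of the root. -/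
abbrev RootStab (d : ℕ) : Type := ↥(fixS d 0)

/-- The subgroup of the stabilizer of the root which fixes the first neighbor. -/
def edgeStab (d : ℕ) : Subgroup (RootStab d) where
  carrier := {q | q.1 (node1 d) = node1 d}
  mul_mem' := by
    intro φ ψ hφ hψ
    change φ.1 (ψ.1 _) = _
    rw [hψ, hφ]
  one_mem' := rfl
  inv_mem' := by
    intro φ hφ
    change φ.1.symm _ = _
    rw [RelIso.symm_apply_eq, hφ]

lemma mem_edgeStab {d : ℕ} {q : RootStab d} : q ∈ edgeStab d ↔ q.1 (node1 d) = node1 d := Iff.rfl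

instance (d r : ℕ) : ((fixS d r).subgroupOf (fixS d 0)).FiniteIndex := by
  have : Finite (RootStab d ⧸ (fixS d r).subgroupOf (fixS d 0)) := by
    refine Finite.of_injective (fun q => fun v : ↥(SrSet d r) =>
      (⟨q.out.1 v.1, (map_mem_SrSet q.out.2).2 v.2⟩ : ↥(SrSet d r))) fun q q' h => ?_
    rw [← q.out_eq, ← q'.out_eq]
    refine QuotientGroup.eq.2 ?_
    rw [Subgroup.mem_subgroupOf]
    intro v hv
    have h1 := congrArg Subtype.val (congrFun h ⟨v, hv⟩)
    change q.out.1.symm (q'.out.1 v) = v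
    rw [RelIso.symm_apply_eq]
    exact h1.symm
  exact Subgroup.finiteIndex_of_finite_quotient

/-- The coset representatives of `edgeStab` given by the rotations. -/
def rotK (d : ℕ) [NeZero d] (i : ZMod d) : RootStab d := ⟨rot i, rot_mem i⟩

lemma rotK_bijective (d : ℕ) [NeZero d] :
    Function.Bijective fun i => ((rotK d i : RootStab d) : RootStab d ⧸ edgeStab d) := by
  constructor
  · intro i j h
    have h1 := QuotientGroup.eq.1 h
    rw [mem_edgeStab] at h1
    change (rot i).symm (rot j (node1 d)) = node1 d at h1
    rw [RelIso.symm_apply_eq] at h1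
    have h2 := congrArg Subtype.val h1
    rw [rot_node1_val, rot_node1_val] at h2
    have h3 : lt (1 + j) = lt (1 + i) := by simpa using h2
    have h4 := congrArg (fun a : ℕ => (a : ZMod d)) h3
    simp only [cast_lt] at h4
    exact (add_left_cancel h4).symm
  · intro q
    induction q using QuotientGroup.induction_on with
    | H φ =>
      have h1 := aut_fix_cons φ.1 (mem_fixS_zero.1 φ.2) 1 [] (by
        rw [← node1_val (d := d)]; exact (node1 d).2)
      obtain ⟨b, hb⟩ := h1
      have h2 : (φ.1 (node1 d)).1 = [b] := by
        have e1 : (⟨[1], by rw [← node1_val (d := d)]; exact (node1 d).2⟩ : TdVertex d) = node1 d :=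
          TdVertex.ext node1_val.symm
        rw [e1] at hb
        rw [hb]
        congr 1
        exact congrArg Subtype.val (mem_fixS_zero.1 φ.2)
      have h3 := (φ.1 (node1 d)).2
      rw [h2, validTd_cons] at h3
      refine ⟨(b : ZMod d) - 1, QuotientGroup.eq.2 ?_⟩
      rw [mem_edgeStab]
      change (rot ((b : ZMod d) - 1)).symm (φ.1 (node1 d)) = node1 d
      rw [RelIso.symm_apply_eq]
      refine TdVertex.ext ?_
      rw [h2, rot_node1_val, add_sub_cancel, lt_cast h3.2.1 (by simpa [maxLetter] using h3.2.2)]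

/-- Conjugation by the flip. -/
def flipConj (d : ℕ) [NeZero d] : ↥(edgeStab d) ≃* ↥(edgeStab d) where
  toFun q := ⟨⟨flip * q.1.1 * flip, mem_fixS_zero.2 (by
      change flip (q.1.1 (flip (rootTd d))) = _
      rw [flip_root, mem_edgeStab.1 q.2, flip_node1])⟩, by
    change flip (q.1.1 (flip (node1 d))) = _
    rw [flip_node1, mem_fixS_zero.1 q.1.2, flip_root]⟩
  invFun q := ⟨⟨flip * q.1.1 * flip, mem_fixS_zero.2 (by
      change flip (q.1.1 (flip (rootTd d))) = _
      rw [flip_root, mem_edgeStab.1 q.2, flip_node1])⟩, by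
    change flip (q.1.1 (flip (node1 d))) = _
    rw [flip_node1, mem_fixS_zero.1 q.1.2, flip_root]⟩
  left_inv q := Subtype.ext (Subtype.ext (RelIso.ext fun v => by
    change flip (flip (q.1.1 (flip (flip v)))) = _
    rw [flip_flip, flip_flip]))
  right_inv q := Subtype.ext (Subtype.ext (RelIso.ext fun v => by
    change flip (flip (q.1.1 (flip (flip v)))) = _
    rw [flip_flip, flip_flip]))
  map_mul' q q' := Subtype.ext (Subtype.ext (RelIso.ext fun v => by
    change flip (q.1.1 (q'.1.1 (flip v))) = flip (q.1.1 (flip (flip (q'.1.1 (flip v)))))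
    rw [flip_flip]))

/-- Dependence on the restriction to a ball. -/
def CylS {N β : Type*} {d : ℕ} (r : ℕ) (h : (TdVertex d → N) → β) : Prop :=
  ∀ x x' : TdVertex d → N, (∀ v ∈ SrSet d r, x v = x' v) → h x = h x'

lemma CylS.comp_fix {N β : Type*} {d r : ℕ} {h : (TdVertex d → N) → β} (hh : CylS r h)
    {φ : TdAut d} (hφ : φ ∈ fixS d 0) : CylS r fun x => h fun v => x (φ v) :=
  fun _ _ hx => hh _ _ fun _ hv => hx _ ((map_mem_SrSet hφ).2 hv)

lemma CylS.comp_flip {N β : Type*} {d r : ℕ} [NeZero d] {h : (TdVertex d → N) → β}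
    (hh : CylS r h) : CylS (r + 1) fun x => h fun v => x (flip v) :=
  fun _ _ hx => hh _ _ fun _ hv => hx _ (flip_mem_of_SrSet hv)

lemma CylS.mono {N β : Type*} {d r s : ℕ} {h : (TdVertex d → N) → β} (hh : CylS r h)
    (hrs : r ≤ s) : CylS s h :=
  fun _ _ hx => hh _ _ fun v hv => hx v (le_trans (show v.1.length ≤ r from hv) hrs)

lemma CylS.rInv {N : Type*} {d r : ℕ} {h : (TdVertex d → N) → ℝ} (hh : CylS r h)
    (x : TdVertex d → N) :
    RInv ((fixS d r).subgroupOf (fixS d 0)) fun q : RootStab d => h fun v => x (q.1 v) := by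
  intro g n hn
  refine hh _ _ fun v hv => ?_
  change x (g.1 (n.1 v)) = _
  rw [Subgroup.mem_subgroupOf.1 hn v hv]

lemma CylS.rInv_edge {N : Type*} {d r : ℕ} {h : (TdVertex d → N) → ℝ} (hh : CylS r h)
    (x : TdVertex d → N) :
    RInv (((fixS d r).subgroupOf (fixS d 0)).subgroupOf (edgeStab d))
      fun q : ↥(edgeStab d) => h fun v => x (q.1.1 v) := by
  intro g n hn
  exact hh.rInv x g.1 n.1 (Subgroup.mem_subgroupOf.1 hn)

/-- The symmetrized empirical expectation. -/
def symE {V N : Type*} [Fintype V] {d : ℕ} [NeZero d] (x : V × ZMod d → TdVertex d → N)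
    (h : (TdVertex d → N) → ℝ) : ℝ :=
  (∑ k, gmean fun q : RootStab d => h fun v => x k (q.1 v)) / Fintype.card (V × ZMod d)

lemma symE_eq_edge {V N : Type*} [Fintype V] {d : ℕ} [NeZero d]
    (x : V × ZMod d → TdVertex d → N) (hx : ∀ i k v, x (sh i k) v = x k (rot i v)) {r : ℕ}
    {h : (TdVertex d → N) → ℝ} (hh : CylS r h) :
    symE x h = (∑ k, gmean fun q : ↥(edgeStab d) => h fun v => x k (q.1.1 v)) /
      Fintype.card (V × ZMod d) := by
  rw [symE]
  congr 1
  have h1 : ∀ k, (gmean fun q : RootStab d => h fun v => x k (q.1 v)) =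
      (∑ i : ZMod d, gmean fun q : ↥(edgeStab d) => h fun v => x (sh i k) (q.1.1 v)) /
        Fintype.card (ZMod d) := by
    intro k
    rw [gmean_subgroup (edgeStab d) (rotK d) (rotK_bijective d) _ (hh.rInv (x k))]
    congr 1
    refine Finset.sum_congr rfl fun i _ => ?_
    congr 1
    funext q
    congr 1
    funext v
    rw [hx]
    rfl
  rw [Finset.sum_congr rfl fun k _ => h1 k, ← Finset.sum_div, Finset.sum_comm]
  have h2 : ∀ i : ZMod d,
      (∑ k, gmean fun q : ↥(edgeStab d) => h fun v => x (sh i k) (q.1.1 v)) =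
      ∑ k, gmean fun q : ↥(edgeStab d) => h fun v => x k (q.1.1 v) := fun i =>
    Equiv.sum_comp (shE i : Equiv.Perm (V × ZMod d))
      fun k => gmean fun q : ↥(edgeStab d) => h fun v => x k (q.1.1 v)
  rw [Finset.sum_congr rfl fun i _ => h2 i, Finset.sum_const, Finset.card_univ, nsmul_eq_mul,
    mul_div_cancel_left₀]
  exact_mod_cast Fintype.card_ne_zero

lemma symE_comp_fix {V N : Type*} [Fintype V] {d : ℕ} [NeZero d]
    (x : V × ZMod d → TdVertex d → N) {r : ℕ} {h : (TdVertex d → N) → ℝ} (hh : CylS r h)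
    {φ : TdAut d} (hφ : φ ∈ fixS d 0) :
    symE x (fun y => h fun v => y (φ v)) = symE x h := by
  rw [symE, symE]
  congr 1
  refine Finset.sum_congr rfl fun k _ => ?_
  exact gmean_right _ (hh.rInv (x k)) (⟨φ, hφ⟩ : RootStab d)

lemma symE_comp_flip {V N : Type*} [Fintype V] {d : ℕ} [NeZero d]
    (ι : V × ZMod d → V × ZMod d) (hι : Function.Involutive ι)
    (x : V × ZMod d → TdVertex d → N) (hx : ∀ i k v, x (sh i k) v = x k (rot i v))
    (hf : ∀ k v, x (cross ι k) v = x k (flip v)) {r : ℕ}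
    {h : (TdVertex d → N) → ℝ} (hh : CylS r h) :
    symE x (fun y => h fun v => y (flip v)) = symE x h := by
  rw [symE_eq_edge x hx hh.comp_flip, symE_eq_edge x hx hh]
  congr 1
  let e : Equiv.Perm (V × ZMod d) := (shE 1).trans ((hι.toPerm ι).trans (shE (-1)))
  rw [← Equiv.sum_comp e fun k => gmean fun q : ↥(edgeStab d) => h fun v => x k (q.1.1 v)]
  refine Finset.sum_congr rfl fun k _ => ?_
  rw [← gmean_equiv (flipConj d) _ (hh.rInv_edge (x (e k)))]
  congr 1
  funext q
  congr 1
  funext v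
  change x k (q.1.1 (flip v)) = x (cross ι k) (flip (q.1.1 (flip v)))
  rw [hf, flip_flip]

/-! ### Limits of symmetrized empirical measures -/

/-- Extension of a coloring of a set of vertices by an arbitrary color. -/
def extC {N : Type*} [Nonempty N] {d : ℕ} {S : Set (TdVertex d)} (a : ↥S → N) (v : TdVertex d) :
    N := if h : v ∈ S then a ⟨v, h⟩ else Classical.arbitrary N

lemma extC_apply {N : Type*} [Nonempty N] {d : ℕ} {S : Set (TdVertex d)} (a : ↥S → N)
    (v : ↥S) : extC a v.1 = a v := by simp [extC]

lemma CylS.eq_extC {N β : Type*} [Nonempty N] {d r : ℕ} {h : (TdVertex d → N) → β}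
    (hh : CylS r h) :
    h = (fun a : ↥(SrSet d r) → N => h (extC a)) ∘ fun x v => x v.1 := by
  funext x
  exact hh _ _ fun v hv => (extC_apply (fun v : ↥(SrSet d r) => x v.1) ⟨v, hv⟩).symm

lemma CylS.measurable {N β : Type*} [Nonempty N] [Finite N] [MeasurableSpace N]
    [DiscreteMeasurableSpace N] [MeasurableSpace β] {d r : ℕ} {h : (TdVertex d → N) → β}
    (hh : CylS r h) : Measurable h := by
  rw [hh.eq_extC]
  exact Measurable.of_discrete.comp (measurable_pi_lambda _ fun v => measurable_pi_apply _)

lemma CylS.bounded {N : Type*} [Nonempty N] [Finite N] {d r : ℕ} {h : (TdVertex d → N) → ℝ}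
    (hh : CylS r h) : ∃ C, ∀ x, |h x| ≤ C := by
  obtain ⟨C, hC⟩ := (Set.finite_range fun a : ↥(SrSet d r) → N => |h (extC a)|).bddAbove
  refine ⟨C, fun x => ?_⟩
  rw [hh.eq_extC]
  exact hC ⟨_, rfl⟩

lemma CylS.integrable {N : Type*} [Nonempty N] [Finite N] [MeasurableSpace N]
    [DiscreteMeasurableSpace N] {d r : ℕ} {h : (TdVertex d → N) → ℝ}
    (hh : CylS r h) (ν : Measure (TdVertex d → N)) [IsFiniteMeasure ν] : Integrable h ν := by
  obtain ⟨C, hC⟩ := hh.bounded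
  exact Integrable.of_bound hh.measurable.aestronglyMeasurable C (ae_of_all _ hC)

lemma exists_subset_SrSet {d : ℕ} (I : Finset (TdVertex d)) : ∃ r, ↑I ⊆ SrSet d r :=
  ⟨I.sup fun v => v.1.length, fun _ hv => Finset.le_sup (f := fun v : TdVertex d => v.1.length) hv⟩

lemma measure_ext_cyl {N : Type*} [Nonempty N] [Finite N] [MeasurableSpace N]
    [DiscreteMeasurableSpace N] {d : ℕ} (μ ν : Measure (TdVertex d → N)) [IsProbabilityMeasure μ]
    [IsProbabilityMeasure ν]
    (h : ∀ r, ∀ f : (TdVertex d → N) → ℝ, CylS r f → ∫ x, f x ∂μ = ∫ x, f x ∂ν) : μ = ν := by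
  refine IsProjectiveLimit.unique (P := fun I : Finset (TdVertex d) => ν.map I.restrict)
    (fun I => ?_) fun I => rfl
  refine Measure.ext fun B hB => ?_
  have hm : Measurable (I.restrict : (TdVertex d → N) → _) := Finset.measurable_restrict I
  rw [Measure.map_apply hm hB, Measure.map_apply hm hB]
  obtain ⟨r, hr⟩ := exists_subset_SrSet I
  have h1 := h r ((I.restrict ⁻¹' B).indicator fun _ => 1) (by
    intro x x' hx
    have : I.restrict x = I.restrict x' := funext fun v => hx v.1 (hr v.2)
    simp only [Set.indicator, Set.mem_preimage, this])
  rw [integral_indicator (hm hB), integral_indicator (hm hB)] at h1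
  simp only [integral_const, smul_eq_mul, mul_one, MeasurableSet.univ, measureReal_restrict_apply,
    Set.univ_inter] at h1
  exact (measureReal_eq_measureReal_iff).1 h1

/-- Uniform averages of point masses. -/
lemma integral_uniform_dirac {Ω P : Type*} [MeasurableSpace Ω] [Fintype P] [Nonempty P]
    (F : P → Ω) : ∃ ν : Measure Ω, IsProbabilityMeasure ν ∧ ∀ h : Ω → ℝ, Measurable h →
      ∫ x, h x ∂ν = (∑ p, h (F p)) / Fintype.card P := by
  have hc : (Fintype.card P : ℝ≥0∞) ≠ 0 := by exact_mod_cast Fintype.card_ne_zero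
  refine ⟨(Fintype.card P : ℝ≥0∞)⁻¹ • ∑ p, Measure.dirac (F p), ⟨?_⟩, fun h hm => ?_⟩
  · simp [ENNReal.inv_mul_cancel hc (ENNReal.natCast_ne_top _)]
  · rw [integral_smul_measure, integral_finsetSum_measure]
    · simp only [ENNReal.toReal_inv, ENNReal.toReal_natCast, smul_eq_mul]
      rw [Finset.sum_congr rfl fun p _ => integral_dirac' h (F p) hm.stronglyMeasurable]
      rw [div_eq_inv_mul]
    · intro p _
      refine Integrable.of_bound hm.aestronglyMeasurable (|h (F p)|) ?_
      rw [ae_dirac_iff]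
      · rfl
      · exact measurableSet_le hm.norm measurable_const

lemma exists_symE_measure {V N : Type*} [Fintype V] [Nonempty V] [Nonempty N] [Finite N]
    [MeasurableSpace N] [DiscreteMeasurableSpace N] {d : ℕ} [NeZero d]
    (x : V × ZMod d → TdVertex d → N) (j : ℕ) : ∃ ν : Measure (TdVertex d → N),
      IsProbabilityMeasure ν ∧ ∀ h : (TdVertex d → N) → ℝ, CylS j h → ∫ y, h y ∂ν = symE x h := by
  let K := (fixS d j).subgroupOf (fixS d 0)
  let : Fintype (RootStab d ⧸ K) := Fintype.ofFinite _
  have : Nonempty (RootStab d ⧸ K) := ⟨((1 : RootStab d) : RootStab d ⧸ K)⟩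
  obtain ⟨ν, hν, h1⟩ := integral_uniform_dirac
    (fun (p : (V × ZMod d) × (RootStab d ⧸ K)) v => x p.1 (p.2.out.1 v))
  refine ⟨ν, hν, fun h hh => ?_⟩
  rw [h1 h hh.measurable, symE, Fintype.sum_prod_type, Fintype.card_prod]
  have h2 : ∀ k, (gmean fun q : RootStab d => h fun v => x k (q.1 v)) =
      (∑ q : RootStab d ⧸ K, h fun v => x k (q.out.1 v)) / Fintype.card (RootStab d ⧸ K) :=
    fun k => by rw [gmean_eq K (hh.rInv (x k)), gavg_eq]
  rw [Finset.sum_congr rfl fun k _ => h2 k, ← Finset.sum_div, div_div]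
  push_cast
  rw [mul_comm (Fintype.card (RootStab d ⧸ K) : ℝ)]

/-- A sequence of systems of rooted views has a limiting invariant process. -/
lemma exists_limit_measure {N : Type*} [Nonempty N] [Finite N]
    [MeasurableSpace N] [DiscreteMeasurableSpace N] {d : ℕ} [NeZero d]
    (V : ℕ → Type) [∀ j, Fintype (V j)] [∀ j, Nonempty (V j)]
    (ι : ∀ j, V j × ZMod d → V j × ZMod d) (hι : ∀ j, Function.Involutive (ι j))
    (x : ∀ j, V j × ZMod d → TdVertex d → N)
    (hx : ∀ j i k v, x j (sh i k) v = x j k (rot i v))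
    (hf : ∀ j k v, x j (cross (ι j) k) v = x j k (flip v)) :
    ∃ ν : Measure (TdVertex d → N), ν ∈ InvMeas d N ∧ ∀ r, ∀ h : (TdVertex d → N) → ℝ, CylS r h →
      Tendsto (fun j => symE (x j) h) (hyperfilter ℕ) (𝓝 (∫ y, h y ∂ν)) := by
  let : TopologicalSpace N := ⊥
  have : DiscreteTopology N := ⟨rfl⟩
  choose P hP hPint using fun j => exists_symE_measure (x j) j
  let Q : ℕ → ProbabilityMeasure (TdVertex d → N) := fun j => ⟨P j, hP j⟩
  obtain ⟨ν, hν⟩ : ∃ ν, Tendsto Q (hyperfilter ℕ) (𝓝 ν) :=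
    ⟨_, ((hyperfilter ℕ).map Q).le_nhds_lim⟩
  have hlim : ∀ r, ∀ h : (TdVertex d → N) → ℝ, CylS r h →
      Tendsto (fun j => symE (x j) h) (hyperfilter ℕ) (𝓝 (∫ y, h y ∂(ν : Measure _))) := by
    intro r h hh
    have hcont : Continuous h := by
      rw [hh.eq_extC]
      exact continuous_of_discreteTopology.comp
        (continuous_pi fun v => continuous_apply _)
    obtain ⟨C, hC⟩ := hh.bounded
    have h1 := (ProbabilityMeasure.tendsto_iff_forall_integral_tendsto.1 hν)
      (BoundedContinuousFunction.ofNormedAddCommGroup h hcont C hC)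
    refine h1.congr' ?_
    have : ∀ᶠ j in (hyperfilter ℕ : Filter ℕ), r ≤ j := by
      have h2 : (hyperfilter ℕ : Filter ℕ) ≤ atTop := by
        rw [← Nat.cofinite_eq_atTop]; exact hyperfilter_le_cofinite
      exact h2 (eventually_ge_atTop r)
    filter_upwards [this] with j hj
    exact hPint j h (hh.mono hj)
  refine ⟨ν, ⟨inferInstance, fun φ => ?_⟩, hlim⟩
  have hmeas : ∀ φ : TdAut d, Measurable fun (y : TdVertex d → N) v => y (φ v) := fun φ =>
    measurable_pi_lambda _ fun v => measurable_pi_apply _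
  have key : ∀ φ : TdAut d, (∀ r, ∀ h : (TdVertex d → N) → ℝ, CylS r h →
      ∃ s, CylS s (fun y => h fun v => y (φ v)) ∧
        ∀ j, symE (x j) (fun y => h fun v => y (φ v)) = symE (x j) h) →
      (ν : Measure (TdVertex d → N)).map (fun y v => y (φ v)) = ν := by
    intro φ hφ
    have : IsProbabilityMeasure ((ν : Measure (TdVertex d → N)).map (fun y v => y (φ v))) :=
      Measure.isProbabilityMeasure_map (hmeas φ).aemeasurable
    refine measure_ext_cyl _ _ fun r h hh => ?_
    rw [integral_map (hmeas φ).aemeasurable hh.measurable.aestronglyMeasurable]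
    obtain ⟨s, hs, h1⟩ := hφ r h hh
    refine tendsto_nhds_unique (hlim s _ hs) ((hlim r h hh).congr fun j => (h1 j).symm)
  induction φ using aut_induction with
  | hfix φ h0 =>
    refine key φ fun r h hh => ⟨r, hh.comp_fix (mem_fixS_zero.2 h0), fun j => ?_⟩
    exact symE_comp_fix (x j) hh (mem_fixS_zero.2 h0)
  | hflip =>
    exact key flip fun r h hh => ⟨r + 1, hh.comp_flip, fun j =>
      symE_comp_flip (ι j) (hι j) (x j) (hx j) (hf j) hh⟩
  | hmul φ ψ h1 h2 =>
    have h3 : (fun (y : TdVertex d → N) v => y ((φ * ψ) v)) =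
      (fun (y : TdVertex d → N) v => y (ψ v)) ∘ fun y v => y (φ v) := rfl
    rw [h3, ← Measure.map_map (hmeas ψ) (hmeas φ), h1, h2]

/-! ### Orbits of colorings and conditional entropies -/

/-- Stability of a set of vertices under a group of automorphisms. -/
def StableSet {d : ℕ} (L : Subgroup (TdAut d)) (S : Set (TdVertex d)) : Prop :=
  ∀ φ ∈ L, ∀ v ∈ S, φ v ∈ S

lemma StableSet.mem_iff {d : ℕ} {L : Subgroup (TdAut d)} {S : Set (TdVertex d)}
    (h : StableSet L S) {φ : TdAut d} (hφ : φ ∈ L) {v : TdVertex d} : φ v ∈ S ↔ v ∈ S := by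
  refine ⟨fun hv => ?_, h φ hφ v⟩
  have h1 := h φ⁻¹ (L.inv_mem hφ) _ hv
  have h2 : (φ⁻¹ : TdAut d) (φ v) = v := φ.symm_apply_apply v
  rwa [h2] at h1

/-- Equality of restrictions to `S` up to the action of `L`. -/
def orbS {d : ℕ} (N : Type*) (L : Subgroup (TdAut d)) (S : Set (TdVertex d))
    (h : StableSet L S) : Setoid (TdVertex d → N) where
  r x x' := ∃ φ ∈ L, ∀ v ∈ S, x' v = x (φ v)
  iseqv := ⟨fun x => ⟨1, L.one_mem, fun v _ => rfl⟩, by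
    rintro x x' ⟨φ, hφ, hx⟩
    refine ⟨φ⁻¹, L.inv_mem hφ, fun v hv => ?_⟩
    rw [hx _ (h _ (L.inv_mem hφ) v hv)]
    exact congrArg x (φ.apply_symm_apply v).symm, by
    rintro x x' x'' ⟨φ, hφ, hx⟩ ⟨ψ, hψ, hx'⟩
    refine ⟨φ * ψ, L.mul_mem hφ hψ, fun v hv => ?_⟩
    rw [hx' v hv, hx _ (h ψ hψ v hv)]
    rfl⟩

/-- The type of orbits of restrictions. -/
abbrev Cls {d : ℕ} (N : Type*) (L : Subgroup (TdAut d)) (S : Set (TdVertex d))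
    (h : StableSet L S) : Type _ := Quotient (orbS N L S h)

/-- The orbit of a coloring. -/
def cls {d : ℕ} {N : Type*} {L : Subgroup (TdAut d)} {S : Set (TdVertex d)}
    (h : StableSet L S) (x : TdVertex d → N) : Cls N L S h := Quotient.mk _ x

lemma cls_eq_iff {d : ℕ} {N : Type*} {L : Subgroup (TdAut d)} {S : Set (TdVertex d)}
    (h : StableSet L S) {x x' : TdVertex d → N} :
    cls h x = cls h x' ↔ ∃ φ ∈ L, ∀ v ∈ S, x' v = x (φ v) := Quotient.eq

lemma cls_congr {d : ℕ} {N : Type*} {L : Subgroup (TdAut d)} {S : Set (TdVertex d)}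
    (h : StableSet L S) {x x' : TdVertex d → N} (hx : ∀ v ∈ S, x v = x' v) :
    cls h x = cls h x' := (cls_eq_iff h).2 ⟨1, L.one_mem, fun v hv => (hx v hv).symm⟩

lemma cls_extC {d : ℕ} {N : Type*} [Nonempty N] {L : Subgroup (TdAut d)} {S : Set (TdVertex d)}
    (h : StableSet L S) (x : TdVertex d → N) :
    cls h (extC fun v : ↥S => x v.1) = cls h x :=
  cls_congr h fun v hv => extC_apply (fun v : ↥S => x v.1) ⟨v, hv⟩

lemma finite_cls {d : ℕ} {N : Type*} [Nonempty N] [Finite N] {L : Subgroup (TdAut d)}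
    {S : Set (TdVertex d)} [Finite ↥S] (h : StableSet L S) : Finite (Cls N L S h) :=
  Finite.of_surjective (fun a : ↥S → N => cls h (extC a)) fun c => by
    obtain ⟨x, rfl⟩ := Quotient.exists_rep c
    exact ⟨_, cls_extC h x⟩

/-- The size of an orbit. -/
def osz {d : ℕ} {N : Type*} (L : Subgroup (TdAut d)) (S : Set (TdVertex d))
    (x : TdVertex d → N) : ℕ := Set.ncard {a : ↥S → N | ∃ φ ∈ L, a = fun v => x (φ v.1)}

lemma one_le_osz {d : ℕ} {N : Type*} [Finite N] (L : Subgroup (TdAut d)) (S : Set (TdVertex d))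
    [Finite ↥S] (x : TdVertex d → N) : 1 ≤ osz L S x :=
  (Set.ncard_pos (Set.toFinite _)).2 ⟨_, 1, L.one_mem, rfl⟩

lemma cylS_osz {d : ℕ} (N : Type*) {L : Subgroup (TdAut d)} {S : Set (TdVertex d)} {r : ℕ}
    (h : StableSet L S) (hS : S ⊆ SrSet d r) : CylS r (fun x : TdVertex d → N => osz L S x) := by
  intro x x' hx
  have h1 : {a : ↥S → N | ∃ φ ∈ L, a = fun v => x (φ v.1)} =
      {a : ↥S → N | ∃ φ ∈ L, a = fun v => x' (φ v.1)} := by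
    ext a
    refine exists_congr fun φ => and_congr_right fun hφ => ?_
    have : (fun v : ↥S => x (φ v.1)) = fun v => x' (φ v.1) :=
      funext fun v => hx _ (hS (h φ hφ _ v.2))
    rw [this]
  exact congrArg (fun s => ((Set.ncard s : ℕ) : _)) h1

open Finset in
lemma sum_negMulLog_orbits {A C : Type*} [Fintype A] [Fintype C] (cl : A → C) (P : A → ℝ)
    (hP : ∀ a a', cl a = cl a' → P a = P a') :
    ∑ a, Real.negMulLog (P a) = ∑ c, Real.negMulLog (∑ a with cl a = c, P a) +
      ∑ a, P a * Real.log #{a' | cl a' = cl a} := by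
  have h1 : ∀ a, Real.negMulLog (P a) = -(P a * Real.log (∑ a' with cl a' = cl a, P a')) +
      P a * Real.log #{a' | cl a' = cl a} := by
    intro a
    have h2 : ∑ a' with cl a' = cl a, P a' = #{a' | cl a' = cl a} * P a := by
      rw [sum_congr rfl fun a' ha' => hP a' a (mem_filter.1 ha').2, sum_const, nsmul_eq_mul]
    have h3 : (#{a' | cl a' = cl a} : ℝ) ≠ 0 := by
      have : a ∈ univ.filter fun a' => cl a' = cl a := by simp
      exact_mod_cast (card_pos.2 ⟨a, this⟩).ne'
    by_cases h0 : P a = 0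
    · simp [h0]
    · rw [h2, Real.log_mul h3 h0, Real.negMulLog]
      ring
  rw [sum_congr rfl fun a _ => h1 a, sum_add_distrib, add_left_inj,
    ← sum_fiberwise univ cl]
  refine sum_congr rfl fun c _ => ?_
  rw [Real.negMulLog, neg_mul, sum_mul, ← sum_neg_distrib]
  refine sum_congr rfl fun a ha => ?_
  rw [(mem_filter.1 ha).2]

lemma measurable_restr {d : ℕ} {N : Type*} [MeasurableSpace N] (S : Set (TdVertex d)) :
    Measurable fun (x : TdVertex d → N) (v : ↥S) => x v.1 :=
  measurable_pi_lambda _ fun _ => measurable_pi_apply _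

lemma shannon_restrictTo {d : ℕ} {N : Type*} [Nonempty N] [Finite N] [MeasurableSpace N]
    [DiscreteMeasurableSpace N] {L : Subgroup (TdAut d)} {S : Set (TdVertex d)} [Finite ↥S]
    (h : StableSet L S) [Fintype (Cls N L S h)] (ν : Measure (TdVertex d → N))
    [IsProbabilityMeasure ν]
    (hν : ∀ φ ∈ L, ν.map (fun x v => x (φ v)) = ν) :
    shannon (restrictTo S ν) = ∑ c, Real.negMulLog (ν.real {x | cls h x = c}) +
      ∫ x, Real.log (osz L S x) ∂ν := by
  have : Fintype (↥S → N) := Fintype.ofFinite _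
  let P : (↥S → N) → ℝ := fun a => (restrictTo S ν).real {a}
  let cl : (↥S → N) → Cls N L S h := fun a => cls h (extC a)
  have hcl : ∀ x : TdVertex d → N, cl (fun v => x v.1) = cls h x := fun x => cls_extC h x
  have hm := measurable_restr (N := N) S
  have hPr : IsProbabilityMeasure (restrictTo S ν) :=
    Measure.isProbabilityMeasure_map hm.aemeasurable
  have hPa : ∀ a, P a = ν.real {x | (fun v : ↥S => x v.1) = a} := by
    intro a
    change (ν.map _).real {a} = _
    rw [map_measureReal_apply hm (MeasurableSet.singleton a)]
    rfl
  have hP : ∀ a a', cl a = cl a' → P a = P a' := by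
    intro a a' haa
    obtain ⟨φ, hφ, h1⟩ := (cls_eq_iff h).1 haa
    have hmφ : Measurable fun (y : TdVertex d → N) v => y (φ v) :=
      measurable_pi_lambda _ fun v => measurable_pi_apply _
    rw [hPa a', ← hν φ hφ, map_measureReal_apply hmφ (measurableSet_eq_fun hm measurable_const),
      hPa]
    congr 1
    ext x
    simp only [Set.mem_ofPred_eq, Set.mem_preimage]
    constructor
    · rintro rfl
      funext v
      rw [← extC_apply a' v, h1 v.1 v.2]
      exact (extC_apply (fun v : ↥S => x v.1) ⟨φ v.1, h φ hφ _ v.2⟩).symm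
    · intro h2
      funext v
      have hv : (φ⁻¹ : TdAut d) v.1 ∈ S := h _ (L.inv_mem hφ) _ v.2
      have h3 := congrFun h2 ⟨_, hv⟩
      have h4 := h1 _ hv
      have h5 : φ ((φ⁻¹ : TdAut d) v.1) = v.1 := φ.apply_symm_apply v.1
      rw [h5, extC_apply a v] at h4
      simp only [h5] at h3
      rw [h3, ← h4, extC_apply a' ⟨_, hv⟩]
  have hsum : ∀ (p : (↥S → N) → Prop), ∑ a with p a, P a = ν.real {x | p fun v => x v.1} := by
    intro p
    change ∑ a with p a, (restrictTo S ν).real {a} = _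
    rw [sum_measureReal_singleton]
    change (ν.map _).real _ = _
    rw [map_measureReal_apply hm (Set.toFinite _).measurableSet]
    congr 1
    ext x
    simp
  have h1 := sum_negMulLog_orbits cl P hP
  rw [shannon, tsum_fintype]
  refine h1.trans ?_
  congr 1
  · refine Finset.sum_congr rfl fun c _ => ?_
    rw [hsum]
    simp only [hcl]
  · have h2 : ∀ x : TdVertex d → N, Real.log (osz L S x) =
        (fun a => Real.log (Finset.card {a' | cl a' = cl a} : ℝ)) fun v : ↥S => x v.1 := by
      intro x
      simp only [hcl]
      rw [osz, ← Set.ncard_coe_finset]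
      congr 3
      ext a
      simp only [Set.mem_ofPred_eq, Finset.coe_filter, Finset.mem_univ, true_and]
      rw [eq_comm (a := cl a), cls_eq_iff]
      refine exists_congr fun φ => and_congr_right fun hφ => ?_
      rw [funext_iff]
      refine ⟨fun h3 v hv => ?_, fun h3 v => ?_⟩
      · rw [← h3 ⟨v, hv⟩, ← extC_apply a ⟨v, hv⟩]
      · rw [← h3 v.1 v.2, extC_apply]
    simp_rw [h2]
    rw [← integral_map (f := fun a => Real.log (Finset.card {a' | cl a' = cl a} : ℝ))
      hm.aemeasurable Measurable.of_discrete.aestronglyMeasurable]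
    change _ = ∫ a, _ ∂(restrictTo S ν)
    rw [integral_fintype (Integrable.of_finite)]
    refine Finset.sum_congr rfl fun a _ => ?_
    rw [smul_eq_mul]
    congr!

/-! ### Arms of the tree -/

/-- The automorphisms fixing both ends of the edge `{o, 1}`. -/
def edgeFix (d : ℕ) : Subgroup (TdAut d) where
  carrier := {φ | φ (rootTd d) = rootTd d ∧ φ (node1 d) = node1 d}
  mul_mem' := by
    rintro φ ψ ⟨h1, h2⟩ ⟨h3, h4⟩
    change φ (ψ _) = _ ∧ φ (ψ _) = _
    rw [h3, h4]
    exact ⟨h1, h2⟩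
  one_mem' := ⟨rfl, rfl⟩
  inv_mem' := by
    rintro φ ⟨h1, h2⟩
    change φ.symm _ = _ ∧ φ.symm _ = _
    exact ⟨φ.symm_apply_eq.2 h1.symm, φ.symm_apply_eq.2 h2.symm⟩

lemma mem_edgeFix {d : ℕ} {φ : TdAut d} :
    φ ∈ edgeFix d ↔ φ (rootTd d) = rootTd d ∧ φ (node1 d) = node1 d := Iff.rfl

lemma edgeFix_le (d : ℕ) : edgeFix d ≤ fixS d 0 := fun _ h => mem_fixS_zero.2 h.1

/-- The part of the ball behind the first neighbor of the root. -/
def Arm (d r : ℕ) : Set (TdVertex d) := {v | v.1.getLast? = some 1 ∧ v.1.length ≤ r}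

lemma arm_subset_ErSet (d r : ℕ) : Arm d r ⊆ ErSet d r := fun _ h => Or.inr h

instance (d r : ℕ) : Finite ↥(Arm d r) :=
  ((finite_ErSet d r).subset (arm_subset_ErSet d r)).to_subtype

lemma edgeFix_getLast {d : ℕ} [NeZero d] {φ : TdAut d} (hφ : φ ∈ edgeFix d) {v : TdVertex d}
    (hv : v.1.getLast? = some 1) : (φ v).1.getLast? = some 1 := by
  obtain ⟨u, hu⟩ := v
  induction u with
  | nil => simp at hv
  | cons a u ih =>
    by_cases h : u = []
    · subst h
      simp only [List.getLast?_singleton, Option.some.injEq] at hv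
      subst hv
      have : (⟨[1], hu⟩ : TdVertex d) = node1 d := TdVertex.ext node1_val.symm
      rw [this, hφ.2, node1_val]
      rfl
    · obtain ⟨b, hb⟩ := aut_fix_cons φ hφ.1 a u hu
      rw [hb]
      obtain ⟨c, w, rfl⟩ := List.exists_cons_of_ne_nil h
      have h1 := ih (validTd_cons.1 hu).1 (by simpa [List.getLast?_cons_cons] using hv)
      have hne : (φ ⟨c :: w, (validTd_cons.1 hu).1⟩).1 ≠ [] := by
        rintro h2
        rw [h2] at h1
        simp at h1
      obtain ⟨e, z, hz⟩ := List.exists_cons_of_ne_nil hne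
      rw [hz] at h1 ⊢
      rw [List.getLast?_cons_cons, h1]

lemma stable_arm (d r : ℕ) [NeZero d] : StableSet (edgeFix d) (Arm d r) := fun φ hφ v hv =>
  ⟨edgeFix_getLast hφ hv.1, (aut_fix_length φ hφ.1 v).trans_le hv.2⟩

lemma stable_ErSet (d r : ℕ) [NeZero d] : StableSet (edgeFix d) (ErSet d r) := by
  rintro φ hφ v (h | h)
  · exact Or.inl (by rw [aut_fix_length φ hφ.1]; exact h)
  · exact Or.inr (stable_arm d r φ hφ v h)

lemma stable_SrSet (d r s : ℕ) : StableSet (fixS d s) (SrSet d r) :=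
  fun _ hφ _ hv => (map_mem_SrSet (fixS_le hφ)).2 hv

lemma flip_conj_mem {d : ℕ} [NeZero d] {φ : TdAut d} (hφ : φ ∈ edgeFix d) :
    flip * φ * flip ∈ edgeFix d := by
  change flip (φ (flip (rootTd d))) = _ ∧ flip (φ (flip (node1 d))) = _
  rw [flip_root, flip_node1, hφ.1, hφ.2, flip_root, flip_node1]
  exact ⟨rfl, rfl⟩

lemma flip_mem_arm {d r : ℕ} [NeZero d] {v : TdVertex d} (hv : v ∈ ErSet d r) (h : v ∉ Arm d r) :
    flip v ∈ Arm d r := by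
  have h1 : v.1.getLast? ≠ some 1 := fun h1 => h ⟨h1, ErSet_subset_SrSet d r hv⟩
  exact ⟨flipW_getLast h1, ErSet_subset_SrSet d r (flip_mem_ErSet hv)⟩

lemma osz_ErSet_le {d : ℕ} [NeZero d] {N : Type*} [Finite N] (r : ℕ) (x : TdVertex d → N) :
    osz (edgeFix d) (ErSet d r) x ≤ osz (edgeFix d) (Arm d r) x *
      osz (edgeFix d) (Arm d r) (fun v => x (flip v)) := by
  unfold osz
  rw [← Set.ncard_prod]
  have hA : ∀ v : ↥(Arm d r), v.1 ∈ ErSet d r := fun v => arm_subset_ErSet d r v.2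
  refine Set.ncard_le_ncard_of_injOn (fun a => (fun v => a ⟨v.1, hA v⟩,
    fun v => a ⟨flip v.1, flip_mem_ErSet (hA v)⟩)) ?_ ?_ (Set.toFinite _)
  · rintro _ ⟨φ, hφ, rfl⟩
    refine ⟨⟨φ, hφ, rfl⟩, ⟨flip * φ * flip, flip_conj_mem hφ, ?_⟩⟩
    funext v
    change _ = x (flip (flip (φ (flip v.1))))
    rw [flip_flip]
  · intro a _ b _ hab
    funext v
    rw [Prod.mk.injEq] at hab
    by_cases hv : v.1 ∈ Arm d r
    · exact congrFun hab.1 ⟨v.1, hv⟩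
    · have h1 := congrFun hab.2 ⟨flip v.1, flip_mem_arm v.2 hv⟩
      simpa only [flip_flip] using h1

/-- The index of the arm containing a vertex. -/
def armIdx {d : ℕ} (v : TdVertex d) : ZMod d := ((v.1.getLast?.getD 1 : ℕ) : ZMod d) - 1

lemma armIdx_eq_of_adj {d : ℕ} {v w : TdVertex d} (h : (TdGraph d).Adj v w)
    (hv : v ≠ rootTd d) (hw : w ≠ rootTd d) : armIdx v = armIdx w := by
  have hv' : v.1 ≠ [] := fun h => hv (TdVertex.ext h)
  have hw' : w.1 ≠ [] := fun h => hw (TdVertex.ext h)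
  unfold armIdx
  rcases h with ⟨i, h⟩ | ⟨i, h⟩
  · obtain ⟨a, u, hu⟩ := List.exists_cons_of_ne_nil hv'
    rw [h, hu, List.getLast?_cons_cons]
  · obtain ⟨a, u, hu⟩ := List.exists_cons_of_ne_nil hw'
    rw [h, hu, List.getLast?_cons_cons]

lemma armIdx_rot {d : ℕ} [NeZero d] (i : ZMod d) {v : TdVertex d} (hv : v ≠ rootTd d) :
    armIdx (rot i v) = armIdx v + i := by
  have hv' : v.1 ≠ [] := fun h => hv (TdVertex.ext h)
  obtain ⟨w, a, hw⟩ : ∃ w a, v.1 = w ++ [a] :=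
    ⟨_, _, (List.dropLast_append_getLast hv').symm⟩
  unfold armIdx
  rw [rot_val, hw, rot_append]
  simp only [List.getLast?_append, List.getLast?_singleton, Option.some_or, Option.getD_some,
    cast_lt]
  ring

lemma armIdx_eq_zero_iff {d : ℕ} [NeZero d] {v : TdVertex d} (hv : v ≠ rootTd d) :
    armIdx v = 0 ↔ v.1.getLast? = some 1 := by
  have hv' : v.1 ≠ [] := fun h => hv (TdVertex.ext h)
  obtain ⟨w, a, hw⟩ : ∃ w a, v.1 = w ++ [a] :=
    ⟨_, _, (List.dropLast_append_getLast hv').symm⟩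
  have ha : a ∈ v.1.getLast? := by rw [hw]; simp
  have h2 := v.2.2 a ha
  unfold armIdx
  rw [hw]
  simp only [List.getLast?_append, List.getLast?_singleton, Option.some_or, Option.getD_some,
    Option.some.injEq, sub_eq_zero]
  refine ⟨fun h => ?_, fun h => by rw [h]; simp⟩
  have h3 := congrArg lt h
  rw [lt_cast h2.1 h2.2, ← Nat.cast_one, lt_cast le_rfl NeZero.one_le] at h3
  exact h3

lemma aut_ne_root {d : ℕ} {φ : TdAut d} (hφ : φ (rootTd d) = rootTd d) {v : TdVertex d}
    (hv : v ≠ rootTd d) : φ v ≠ rootTd d := fun h =>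
  hv (φ.injective (h.trans hφ.symm))

/-- The conjugate by a rotation. -/
def rotConj {d : ℕ} [NeZero d] (φ : ZMod d → TdAut d) (i : ZMod d) : TdAut d :=
  rot i * φ i * rot (-i)

lemma rotConj_inv {d : ℕ} [NeZero d] (φ : ZMod d → TdAut d) (i : ZMod d) :
    rotConj (fun i => (φ i)⁻¹) i * rotConj φ i = 1 := by
  have h : rot (-i) * rot i = (1 : TdAut d) := by rw [← rot_add, neg_add_cancel, rot_zero]
  have h' : rot i * rot (-i) = (1 : TdAut d) := by rw [← rot_add, add_neg_cancel, rot_zero]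
  calc rotConj (fun i => (φ i)⁻¹) i * rotConj φ i
      = rot i * ((φ i)⁻¹ * (rot (-i) * rot i) * φ i) * rot (-i) := by
        simp only [rotConj, mul_assoc]
    _ = 1 := by rw [h, mul_one, inv_mul_cancel, mul_one, h']

lemma rotConj_root {d : ℕ} [NeZero d] {φ : ZMod d → TdAut d} (hφ : ∀ i, φ i ∈ edgeFix d)
    (i : ZMod d) : rotConj φ i (rootTd d) = rootTd d :=
  mem_fixS_zero.1 ((fixS d 0).mul_mem ((fixS d 0).mul_mem (rot_mem i) (edgeFix_le d (hφ i)))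
    (rot_mem (-i)))

lemma rotConj_armIdx {d : ℕ} [NeZero d] {φ : ZMod d → TdAut d} (hφ : ∀ i, φ i ∈ edgeFix d)
    {v : TdVertex d} (hv : v ≠ rootTd d) : armIdx (rotConj φ (armIdx v) v) = armIdx v := by
  have h1 := aut_ne_root (mem_fixS_zero.1 (rot_mem (-(armIdx v)))) hv
  have h2 := aut_ne_root (hφ (armIdx v)).1 h1
  change armIdx (rot _ (φ _ (rot _ v))) = _
  rw [armIdx_rot _ h2]
  have h3 : armIdx (rot (-(armIdx v)) v) = 0 := by rw [armIdx_rot _ hv, add_neg_cancel]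
  rw [(armIdx_eq_zero_iff h2).2 (edgeFix_getLast (hφ _) ((armIdx_eq_zero_iff h1).1 h3)), zero_add]

/-- Independent automorphisms acting on the arms. -/
def armMap {d : ℕ} [NeZero d] (φ : ZMod d → TdAut d) (v : TdVertex d) : TdVertex d :=
  rotConj φ (armIdx v) v

lemma armMap_root {d : ℕ} [NeZero d] {φ : ZMod d → TdAut d} (hφ : ∀ i, φ i ∈ edgeFix d) :
    armMap φ (rootTd d) = rootTd d := rotConj_root hφ _

lemma armMap_inv {d : ℕ} [NeZero d] {φ : ZMod d → TdAut d} (hφ : ∀ i, φ i ∈ edgeFix d)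
    (v : TdVertex d) : armMap (fun i => (φ i)⁻¹) (armMap φ v) = v := by
  by_cases hv : v = rootTd d
  · rw [hv, armMap_root hφ, armMap_root fun i => (edgeFix d).inv_mem (hφ i)]
  · unfold armMap
    rw [rotConj_armIdx hφ hv]
    exact DFunLike.congr_fun (rotConj_inv φ _) v

lemma armMap_adj {d : ℕ} [NeZero d] {φ : ZMod d → TdAut d} (hφ : ∀ i, φ i ∈ edgeFix d)
    {v w : TdVertex d} (h : (TdGraph d).Adj v w) : (TdGraph d).Adj (armMap φ v) (armMap φ w) := by
  by_cases hv : v = rootTd d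
  · have : armMap φ v = rotConj φ (armIdx w) v := by rw [hv, armMap_root hφ, rotConj_root hφ]
    rw [this]
    exact (rotConj φ (armIdx w)).map_rel_iff.2 h
  · by_cases hw : w = rootTd d
    · have : armMap φ w = rotConj φ (armIdx v) w := by rw [hw, armMap_root hφ, rotConj_root hφ]
      rw [this]
      exact (rotConj φ (armIdx v)).map_rel_iff.2 h
    · unfold armMap
      rw [armIdx_eq_of_adj h hv hw]
      exact (rotConj φ (armIdx w)).map_rel_iff.2 h

/-- Independent automorphisms acting on the arms, as an automorphism. -/
def armAut {d : ℕ} [NeZero d] (φ : ZMod d → TdAut d) (hφ : ∀ i, φ i ∈ edgeFix d) : TdAut d where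
  toFun := armMap φ
  invFun := armMap fun i => (φ i)⁻¹
  left_inv := armMap_inv hφ
  right_inv v := by
    have := armMap_inv (fun i => (edgeFix d).inv_mem (hφ i)) v
    simpa only [_root_.inv_inv] using this
  map_rel_iff' {v w} := by
    refine ⟨fun h => ?_, armMap_adj hφ⟩
    have := armMap_adj (fun i => (edgeFix d).inv_mem (hφ i)) h
    simp only [Equiv.coe_fn_mk] at this
    rwa [armMap_inv hφ, armMap_inv hφ] at this

lemma armAut_mem {d : ℕ} [NeZero d] (φ : ZMod d → TdAut d) (hφ : ∀ i, φ i ∈ edgeFix d) :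
    armAut φ hφ ∈ fixS d 1 := by
  intro v hv
  change armMap φ v = v
  by_cases h : v = rootTd d
  · rw [h, armMap_root hφ]
  have h' : v.1 ≠ [] := fun h1 => h (TdVertex.ext h1)
  have hn : rot (-(armIdx v)) v = node1 d := by
    have h1 := aut_ne_root (mem_fixS_zero.1 (rot_mem (-(armIdx v)))) h
    have h3 : armIdx (rot (-(armIdx v)) v) = 0 := by rw [armIdx_rot _ h, add_neg_cancel]
    have h4 := (armIdx_eq_zero_iff h1).1 h3
    have h5 : (rot (-(armIdx v)) v).1.length ≤ 1 := by rw [length_rot]; exact hv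
    apply TdVertex.ext
    rw [node1_val]
    match hw : (rot (-(armIdx v)) v).1 with
    | [] => rw [hw] at h4; simp at h4
    | [a] => rw [hw] at h4; simpa using h4
    | a :: b :: u => rw [hw] at h5; simp at h5
  change rot _ (φ _ (rot _ v)) = v
  rw [hn, (hφ _).2, ← hn]
  change (rot (armIdx v) * rot (-(armIdx v))) v = v
  rw [← rot_add, add_neg_cancel, rot_zero]
  rfl

lemma prod_osz_arm_le {d : ℕ} [NeZero d] {N : Type*} [Finite N] (r : ℕ) (x : TdVertex d → N) :
    ∏ i : ZMod d, osz (edgeFix d) (Arm d r) (fun v => x (rot i v)) ≤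
      osz (fixS d 1) (SrSet d r) x := by
  have hA : ∀ v : ↥(Arm d r), v.1 ∈ SrSet d r := fun v =>
    ErSet_subset_SrSet d r (arm_subset_ErSet d r v.2)
  have hidx : ∀ v : ↥(Arm d r), v.1 ≠ rootTd d ∧ armIdx v.1 = 0 := fun v => by
    have h1 : v.1 ≠ rootTd d := fun h => by
      have := v.2.1
      rw [h] at this
      simp [rootTd] at this
    exact ⟨h1, (armIdx_eq_zero_iff h1).2 v.2.1⟩
  choose g hg using fun (i : ZMod d) (a : ↥{a : ↥(Arm d r) → N | ∃ φ ∈ edgeFix d,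
    a = fun v : ↥(Arm d r) => x (rot i (φ v.1))}) => a.2
  let T : ZMod d → Type _ := fun i => ↥{a : ↥(Arm d r) → N | ∃ φ ∈ edgeFix d,
    a = fun v : ↥(Arm d r) => x (rot i (φ v.1))}
  have hcard : ∏ i : ZMod d, osz (edgeFix d) (Arm d r) (fun v => x (rot i v)) =
      Nat.card (∀ i, T i) := by
    rw [Nat.card_pi]
    exact Finset.prod_congr rfl fun i _ => (Nat.card_coe_set_eq _).symm
  rw [hcard, osz, ← Nat.card_coe_set_eq]
  let Φ : (∀ i, T i) → TdAut d := fun a =>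
    armAut (fun i => g i (a i)) fun i => (hg i (a i)).1
  refine Nat.card_le_card_of_injective (fun a => ⟨fun v => x (Φ a v.1), Φ a, armAut_mem _ _, rfl⟩)
    fun a b hab => ?_
  have key : ∀ (a : ∀ i, T i) (i : ZMod d) (v : ↥(Arm d r)),
      x (Φ a (rot i v.1)) = (a i).1 v := by
    intro a i v
    rw [(hg i (a i)).2]
    change x (rotConj (fun i => g i (a i)) (armIdx (rot i v.1)) (rot i v.1)) =
      x (rot i (g i (a i) v.1))
    rw [armIdx_rot i (hidx v).1, (hidx v).2, zero_add]
    have h2 : rot (-i) (rot i v.1) = v.1 := by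
      change (rot (-i) * rot i) v.1 = _
      rw [← rot_add, neg_add_cancel, rot_zero]
      rfl
    change x (rot i (g i (a i) (rot (-i) (rot i v.1)))) = x (rot i (g i (a i) v.1))
    rw [h2]
  funext i
  refine Subtype.ext (funext fun v => ?_)
  rw [← key a i v, ← key b i v]
  exact congrFun (congrArg Subtype.val hab) ⟨rot i v.1, (rot_mem_SrSet i).2 (hA v)⟩

/-- Replacing colorings of balls and edge neighborhoods by their orbits does not increase the
annealed entropy. -/
lemma sigma_orbits_le {d : ℕ} [NeZero d] {N : Type*} [Nonempty N] [Finite N] [MeasurableSpace N]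
    [DiscreteMeasurableSpace N] (r : ℕ)
    [Fintype (Cls N (fixS d 1) (SrSet d r) (stable_SrSet d r 1))]
    [Fintype (Cls N (edgeFix d) (ErSet d r) (stable_ErSet d r))]
    (ν : Measure (TdVertex d → N)) (hν : ν ∈ InvMeas d N) :
    ∑ c, Real.negMulLog (ν.real {x | cls (stable_SrSet d r 1) x = c}) -
      d / 2 * ∑ c, Real.negMulLog (ν.real {x | cls (stable_ErSet d r) x = c}) ≤ SigmaR d r ν := by
  have hP : IsProbabilityMeasure ν := hν.1
  have hmap : ∀ (φ : TdAut d) (h : (TdVertex d → N) → ℝ) (s : ℕ), CylS s h →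
      ∫ x, h (fun v => x (φ v)) ∂ν = ∫ x, h x ∂ν := by
    intro φ h s hs
    have hm : Measurable fun (x : TdVertex d → N) v => x (φ v) :=
      measurable_pi_lambda _ fun v => measurable_pi_apply _
    conv_rhs => rw [← hν.2 φ]
    rw [integral_map hm.aemeasurable hs.measurable.aestronglyMeasurable]
  have hAS : Arm d r ⊆ SrSet d r := (arm_subset_ErSet d r).trans (ErSet_subset_SrSet d r)
  let lA : (TdVertex d → N) → ℝ := fun x => Real.log (osz (edgeFix d) (Arm d r) x)
  let lE : (TdVertex d → N) → ℝ := fun x => Real.log (osz (edgeFix d) (ErSet d r) x)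
  let lS : (TdVertex d → N) → ℝ := fun x => Real.log (osz (fixS d 1) (SrSet d r) x)
  have cA : CylS r lA := fun x x' h => by
    simp only [lA, cylS_osz N (stable_arm d r) hAS x x' h]
  have cE : CylS r lE := fun x x' h => by
    simp only [lE, cylS_osz N (stable_ErSet d r) (ErSet_subset_SrSet d r) x x' h]
  have cS : CylS r lS := fun x x' h => by
    simp only [lS, cylS_osz N (stable_SrSet d r 1) subset_rfl x x' h]
  have pos : ∀ (L : Subgroup (TdAut d)) (S : Set (TdVertex d)) [Finite ↥S] (x : TdVertex d → N),
      (0 : ℝ) < osz L S x := fun L S _ x => by exact_mod_cast one_le_osz L S x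
  have h1 : ∫ x, lE x ∂ν ≤ 2 * ∫ x, lA x ∂ν := by
    have h2 : ∫ x, lE x ∂ν ≤ ∫ x, lA x + lA (fun v => x (flip v)) ∂ν := by
      refine integral_mono (cE.integrable ν)
        ((cA.integrable ν).add (cA.comp_flip.integrable ν)) fun x => ?_
      change Real.log _ ≤ Real.log _ + Real.log _
      rw [← Real.log_mul (pos _ _ _).ne' (pos _ _ _).ne']
      exact Real.log_le_log (pos _ _ _) (by exact_mod_cast osz_ErSet_le r x)
    rw [integral_add (cA.integrable ν) (cA.comp_flip.integrable ν), hmap flip lA r cA] at h2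
    linarith
  have h2 : d * ∫ x, lA x ∂ν ≤ ∫ x, lS x ∂ν := by
    have h3 : ∫ x, ∑ i : ZMod d, lA (fun v => x (rot i v)) ∂ν ≤ ∫ x, lS x ∂ν := by
      refine integral_mono (integrable_finsetSum _ fun i _ =>
        (cA.comp_fix (rot_mem i)).integrable ν) (cS.integrable ν) fun x => ?_
      change ∑ i : ZMod d, Real.log _ ≤ Real.log _
      rw [← Real.log_prod fun i _ => (pos _ _ _).ne']
      refine Real.log_le_log (Finset.prod_pos fun i _ => pos _ _ _) ?_
      exact_mod_cast prod_osz_arm_le r x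
    rw [integral_finsetSum _ fun i _ => (cA.comp_fix (rot_mem i)).integrable ν] at h3
    simpa [hmap _ lA r cA, Finset.sum_const, ZMod.card] using h3
  rw [SigmaR, shannon_restrictTo (stable_SrSet d r 1) ν fun φ _ => hν.2 φ,
    shannon_restrictTo (stable_ErSet d r) ν fun φ _ => hν.2 φ]
  change _ ≤ _ + ∫ x, lS x ∂ν - d / 2 * (_ + ∫ x, lE x ∂ν)
  have hd : (0 : ℝ) ≤ d / 2 := by positivity
  have := mul_le_mul_of_nonneg_left h1 hd
  linarith

/-! ### Types of vertices and half-edges -/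

/-- The orbits of colored balls. -/
def ClsS (N : Type*) (d r : ℕ) : Type _ := Cls N (fixS d 1) (SrSet d r) (stable_SrSet d r 1)

/-- The orbits of colored edge neighborhoods. -/
def ClsE (N : Type*) (d r : ℕ) [NeZero d] : Type _ :=
  Cls N (edgeFix d) (ErSet d r) (stable_ErSet d r)

instance (N : Type*) (d r : ℕ) [Nonempty N] [Finite N] : Finite (ClsS N d r) :=
  finite_cls _

instance (N : Type*) (d r : ℕ) [NeZero d] [Nonempty N] [Finite N] : Finite (ClsE N d r) :=
  finite_cls _

instance (N : Type*) (d r : ℕ) [Nonempty N] [Finite N] : Fintype (ClsS N d r) :=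
  Fintype.ofFinite _

instance (N : Type*) (d r : ℕ) [NeZero d] [Nonempty N] [Finite N] : Fintype (ClsE N d r) :=
  Fintype.ofFinite _

/-- The orbit of a colored ball. -/
def cS {N : Type*} {d : ℕ} (r : ℕ) (x : TdVertex d → N) : ClsS N d r := cls _ x

/-- The orbit of a colored edge neighborhood. -/
def cE {N : Type*} {d : ℕ} [NeZero d] (r : ℕ) (x : TdVertex d → N) : ClsE N d r := cls _ x

lemma cylS_cS {N : Type*} {d : ℕ} (r : ℕ) : CylS r (cS (N := N) (d := d) r) :=
  fun _ _ hx => cls_congr _ hx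

lemma cylS_cE {N : Type*} {d : ℕ} [NeZero d] (r : ℕ) : CylS r (cE (N := N) (d := d) r) :=
  fun _ _ hx => cls_congr _ fun v hv => hx v (ErSet_subset_SrSet d r hv)

lemma conj_mem_fixS {d s : ℕ} {φ q : TdAut d} (hφ : φ ∈ fixS d s) (hq : q ∈ fixS d 0) :
    q⁻¹ * φ * q ∈ fixS d s := by
  intro v hv
  change q⁻¹ (φ (q v)) = v
  rw [hφ _ ((map_mem_SrSet hq).2 hv)]
  exact q.symm_apply_apply v

/-- The action of the stabilizer of the root on orbits of colored balls. -/
def actS {N : Type*} {d : ℕ} (r : ℕ) (q : RootStab d) (c : ClsS N d r) : ClsS N d r :=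
  Quotient.map (fun (x : TdVertex d → N) v => x (q.1 v)) (by
    rintro x x' ⟨φ, hφ, hx⟩
    refine ⟨q.1⁻¹ * φ * q.1, conj_mem_fixS hφ q.2, fun v hv => ?_⟩
    refine (hx _ ((map_mem_SrSet q.2).2 hv)).trans ?_
    exact congrArg x (q.1.apply_symm_apply _).symm) c

lemma actS_cS {N : Type*} {d : ℕ} (r : ℕ) (q : RootStab d) (x : TdVertex d → N) :
    actS r q (cS r x) = cS r fun v => x (q.1 v) := rfl

lemma actS_inv {N : Type*} {d : ℕ} (r : ℕ) (q : RootStab d) (c : ClsS N d r) :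
    actS r q⁻¹ (actS r q c) = c := by
  obtain ⟨x, rfl⟩ := Quotient.exists_rep c
  change actS r q⁻¹ (actS r q (cS r x)) = cS r x
  rw [actS_cS, actS_cS]
  congr 1
  funext v
  exact congrArg x (q.1.apply_symm_apply v)

lemma actS_bijective {N : Type*} {d : ℕ} (r : ℕ) (q : RootStab d) :
    Function.Bijective (actS (N := N) r q) :=
  Function.bijective_iff_has_inverse.2 ⟨actS r q⁻¹, actS_inv r q, fun c => by
    have := actS_inv r q⁻¹ c
    rwa [_root_.inv_inv] at this⟩

/-- The edge type seen from a vertex type along a half-edge. -/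
def yS {N : Type*} {d : ℕ} [NeZero d] (r : ℕ) (c : ClsS N d r) (i : ZMod d) : ClsE N d r :=
  Quotient.map (fun (x : TdVertex d → N) v => x (rot (i - 1) v)) (by
    rintro x x' ⟨φ, hφ, hx⟩
    have h0 := conj_mem_fixS (q := rot (i - 1)) hφ (rot_mem _)
    refine ⟨(rot (i - 1))⁻¹ * φ * rot (i - 1), ⟨mem_fixS_zero.1 (fixS_le h0), h0 _ ?_⟩,
      fun v hv => ?_⟩
    · change (node1 d).1.length ≤ 1
      rw [node1_val]
      rfl
    · refine (hx _ ((rot_mem_SrSet _).2 (ErSet_subset_SrSet d r hv))).trans ?_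
      exact congrArg x ((rot (i - 1)).apply_symm_apply _).symm) c

lemma yS_cS {N : Type*} {d : ℕ} [NeZero d] (r : ℕ) (x : TdVertex d → N) (i : ZMod d) :
    yS r (cS r x) i = cE r fun v => x (rot (i - 1) v) := rfl

/-- Reversal of edge types. -/
def tauE {N : Type*} {d : ℕ} [NeZero d] (r : ℕ) (c : ClsE N d r) : ClsE N d r :=
  Quotient.map (fun (x : TdVertex d → N) v => x (flip v)) (by
    rintro x x' ⟨φ, hφ, hx⟩
    refine ⟨flip * φ * flip, flip_conj_mem hφ, fun v hv => ?_⟩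
    refine (hx _ (flip_mem_ErSet hv)).trans ?_
    exact congrArg x (flip_flip _).symm) c

lemma tauE_cE {N : Type*} {d : ℕ} [NeZero d] (r : ℕ) (x : TdVertex d → N) :
    tauE r (cE r x) = cE r fun v => x (flip v) := rfl

lemma tauE_involutive {N : Type*} {d : ℕ} [NeZero d] (r : ℕ) :
    Function.Involutive (tauE (N := N) (d := d) r) := by
  intro c
  obtain ⟨x, rfl⟩ := Quotient.exists_rep c
  change tauE r (tauE r (cE r x)) = cE r x
  rw [tauE_cE, tauE_cE]
  simp only [flip_flip]

lemma cS_root {N : Type*} {d r : ℕ} {x x' : TdVertex d → N} (h : cS r x = cS r x') :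
    x (rootTd d) = x' (rootTd d) := by
  obtain ⟨φ, hφ, hx⟩ := (cls_eq_iff _).1 h
  rw [hx _ (root_mem_SrSet d r), hφ _ (root_mem_SrSet d 1)]

/-! ### Entropies of types -/

lemma CylS.indicator {N β : Type*} {d r : ℕ} {h : (TdVertex d → N) → β} (hh : CylS r h) (c : β) :
    CylS r fun x => if h x = c then (1 : ℝ) else 0 :=
  fun x x' hx => by simp only [hh x x' hx]

open Finset in
/-- Averaging over the stabilizer of the root does not decrease the entropy of types. -/
lemma Hf_le_symE {V N : Type*} [Fintype V] [Nonempty V] [Nonempty N] [Finite N] {d : ℕ} [NeZero d]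
    (x : V × ZMod d → TdVertex d → N) (hx : ∀ i k v, x (sh i k) v = x k (rot i v)) (r : ℕ) :
    Hf (fun c : ClsS N d r => (cnt (fun v => cS r (x (v, 0))) c : ℝ) / Fintype.card V) ≤
      Hf (fun c : ClsS N d r => symE x fun y => if cS r y = c then 1 else 0) := by
  let p : ClsS N d r → ℝ := fun c => (cnt (fun v => cS r (x (v, 0))) c : ℝ) / Fintype.card V
  let W : ClsS N d r → ClsS N d r → ℝ := fun c' c =>
    gmean fun q : RootStab d => if actS r q c' = c then (1 : ℝ) else 0
  let K := (fixS d r).subgroupOf (fixS d 0)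
  have hV : (Fintype.card V : ℝ) ≠ 0 := by exact_mod_cast Fintype.card_ne_zero
  have hdr : (d : ℝ) ≠ 0 := by exact_mod_cast NeZero.ne d
  have hR : ∀ c' c : ClsS N d r, RInv K fun q : RootStab d =>
      if actS r q c' = c then (1 : ℝ) else 0 := by
    intro c' c
    obtain ⟨z, rfl⟩ := Quotient.exists_rep c'
    exact ((cylS_cS r).indicator c).rInv z
  have hW0 : ∀ c' c, 0 ≤ W c' c := fun c' c => gmean_nonneg K (hR c' c) fun q => by
    split_ifs <;> norm_num
  have hW1 : ∀ c', ∑ c, W c' c = 1 := by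
    intro c'
    rw [← gmean_sum K univ fun c _ => hR c' c]
    simp only [sum_ite_eq, mem_univ, if_true]
    exact gmean_const 1
  have hW2 : ∀ c, ∑ c', W c' c = 1 := by
    intro c
    rw [← gmean_sum K univ fun c' _ => hR c' c]
    have : (fun q : RootStab d => ∑ c', if actS r q c' = c then (1 : ℝ) else 0) = fun _ => 1 := by
      funext q
      rw [sum_boole, Nat.cast_eq_one, card_eq_one]
      obtain ⟨c0, hc0⟩ := (actS_bijective r q).2 c
      refine ⟨c0, ?_⟩
      ext c'
      simp only [mem_filter, mem_univ, true_and, mem_singleton]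
      exact ⟨fun h => (actS_bijective r q).1 (h.trans hc0.symm), fun h => by rw [h, hc0]⟩
    rw [this]
    exact gmean_const 1
  have hP : ∀ c, symE x (fun y => if cS r y = c then 1 else 0) = ∑ c', W c' c * p c' := by
    intro c
    have h1 : ∀ k : V × ZMod d, gmean (fun q : RootStab d =>
        if cS r (fun v => x k (q.1 v)) = c then (1 : ℝ) else 0) = W (cS r (x (k.1, 0))) c := by
      intro k
      have h2 : x k = fun v => x (k.1, 0) (rot k.2 v) := by
        funext v
        rw [← hx]
        congr 1
        simp [sh]
      rw [h2]
      exact gmean_left K (hR (cS r (x (k.1, 0))) c) (rotK d k.2)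
    rw [symE]
    simp only [h1]
    rw [Fintype.sum_prod_type]
    simp only [sum_const, card_univ, ZMod.card, nsmul_eq_mul, Fintype.card_prod, Nat.cast_mul]
    rw [← mul_sum, mul_comm (Fintype.card V : ℝ), mul_div_mul_left _ _ hdr,
      ← sum_fiberwise univ (fun v => cS r (x (v, 0))), sum_div]
    refine sum_congr rfl fun c' _ => ?_
    rw [sum_congr rfl fun v hv => by rw [(mem_filter.1 hv).2], sum_const, nsmul_eq_mul]
    change (cnt (fun v => cS r (x (v, 0))) c' : ℝ) * W c' c / _ = W c' c * (_ / _)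
    rw [mul_div_assoc', mul_comm]
  have hp0 : ∀ c, 0 ≤ p c := fun c => by positivity
  unfold Hf
  simp only [hP]
  calc ∑ c, Real.negMulLog (p c) = ∑ c', ∑ c, W c' c * Real.negMulLog (p c') := by
        refine sum_congr rfl fun c' _ => ?_
        rw [← sum_mul, hW1, one_mul]
    _ = ∑ c, ∑ c', W c' c * Real.negMulLog (p c') := sum_comm
    _ ≤ _ := by
        refine sum_le_sum fun c _ => ?_
        have := Real.concaveOn_negMulLog.le_map_sum (t := univ) (w := fun c' => W c' c) (p := p)
          (fun c' _ => hW0 c' c) (hW2 c) fun c' _ => hp0 c'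
        simpa only [smul_eq_mul] using this

open Finset in
lemma symE_cE {V N : Type*} [Fintype V] [Nonempty V] [Nonempty N] [Finite N] {d : ℕ} [NeZero d]
    (x : V × ZMod d → TdVertex d → N) (hx : ∀ i k v, x (sh i k) v = x k (rot i v)) (r : ℕ)
    (b : ClsE N d r) : symE x (fun y => if cE r y = b then 1 else 0) =
      (cnt (fun h : V × ZMod d => yS r (cS r (x (h.1, 0))) h.2) b : ℝ) /
        (Fintype.card V * d) := by
  have h1 : ∀ k : V × ZMod d, gmean (fun q : ↥(edgeStab d) =>
      if cE r (fun v => x k (q.1.1 v)) = b then (1 : ℝ) else 0) =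
        if cE r (x k) = b then 1 else 0 := by
    intro k
    have h2 : ∀ q : ↥(edgeStab d), cE r (fun v => x k (q.1.1 v)) = cE r (x k) := fun q =>
      ((cls_eq_iff _).2 ⟨q.1.1, mem_edgeFix.2 ⟨mem_fixS_zero.1 q.1.2, mem_edgeStab.1 q.2⟩,
          fun v _ => rfl⟩).symm
    simp only [h2]
    exact gmean_const _
  rw [symE_eq_edge x hx ((cylS_cE r).indicator b)]
  simp only [h1]
  rw [sum_boole, Fintype.card_prod, ZMod.card, Nat.cast_mul]
  congr 2
  rw [← cnt, ← cnt_comp_equiv _ (shE (-1) : Equiv.Perm (V × ZMod d))]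
  congr 1
  funext h
  rw [yS_cS]
  change cE r (x (sh (-1) h)) = _
  congr 1
  funext v
  rw [← hx]
  congr 1
  ext <;> simp [sh, sub_eq_add_neg]

/-! ### Deviation of empirical measures -/

/-- The total deviation of the empirical distribution of a family of colorings on the ball of
radius `R` from a measure. -/
def devF {κ M : Type*} [Fintype κ] [Fintype M] [MeasurableSpace M] {d : ℕ}
    (μ : Measure (TdVertex d → M)) (R : ℕ) (x : κ → TdVertex d → M) : ℝ :=
  ∑ y : ↥(SrSet d R) → M, |(cnt (fun k (v : ↥(SrSet d R)) => x k v.1) y : ℝ) -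
    Fintype.card κ * (restrictTo (SrSet d R) μ).real {y}|

lemma nonempty_of_prob {M : Type*} [MeasurableSpace M] {d : ℕ} (μ : Measure (TdVertex d → M))
    [IsProbabilityMeasure μ] : Nonempty M :=
  (Measure.nonempty_of_neZero μ).map fun x => x (rootTd d)

open Finset in
lemma sum_comp_sub_eq {κ M : Type*} [Fintype κ] [Fintype M] [MeasurableSpace M]
    [DiscreteMeasurableSpace M] {d : ℕ}
    (μ : Measure (TdVertex d → M)) [IsProbabilityMeasure μ] (R : ℕ) (x : κ → TdVertex d → M)
    (g : (↥(SrSet d R) → M) → ℝ) :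
    ∑ k, g (fun v => x k v.1) - Fintype.card κ * ∫ y, g (fun v => y v.1) ∂μ =
      ∑ y : ↥(SrSet d R) → M, g y * ((cnt (fun k (v : ↥(SrSet d R)) => x k v.1) y : ℝ) -
        Fintype.card κ * (restrictTo (SrSet d R) μ).real {y}) := by
  have hPr : IsProbabilityMeasure (restrictTo (SrSet d R) μ) :=
    Measure.isProbabilityMeasure_map (measurable_restr _).aemeasurable
  have h1 : ∫ y, g (fun v => y v.1) ∂μ =
      ∑ y, (restrictTo (SrSet d R) μ).real {y} * g y := by
    rw [← integral_map (f := g) (measurable_restr _).aemeasurable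
      Measurable.of_discrete.aestronglyMeasurable]
    change ∫ a, _ ∂(restrictTo (SrSet d R) μ) = _
    rw [integral_fintype (Integrable.of_finite)]
    simp only [smul_eq_mul]
  have h2 : ∑ k, g (fun v => x k v.1) =
      ∑ y, (cnt (fun k (v : ↥(SrSet d R)) => x k v.1) y : ℝ) * g y := by
    rw [← sum_fiberwise univ (fun k (v : ↥(SrSet d R)) => x k v.1)]
    refine sum_congr rfl fun y _ => ?_
    rw [sum_congr rfl fun k hk => by rw [(mem_filter.1 hk).2], sum_const, nsmul_eq_mul]
    unfold cnt; congr!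
  rw [h1, h2, mul_sum, ← sum_sub_distrib]
  refine sum_congr rfl fun y _ => ?_
  ring

lemma abs_sum_sub_le_devF {κ M : Type*} [Fintype κ] [Fintype M] [MeasurableSpace M]
    [DiscreteMeasurableSpace M] {d : ℕ}
    (μ : Measure (TdVertex d → M)) [IsProbabilityMeasure μ] {R : ℕ} (x : κ → TdVertex d → M)
    {h : (TdVertex d → M) → ℝ} (hh : CylS R h) {C : ℝ} (hC : ∀ y, |h y| ≤ C) :
    |∑ k, h (x k) - Fintype.card κ * ∫ y, h y ∂μ| ≤ C * devF μ R x := by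
  have : Nonempty M := nonempty_of_prob μ
  have h1 := sum_comp_sub_eq μ R x fun a => h (extC a)
  have h2 : ∀ y : TdVertex d → M, h (extC fun v : ↥(SrSet d R) => y v.1) = h y := fun y =>
    (congrFun hh.eq_extC y).symm
  simp only [h2] at h1
  rw [h1, devF, Finset.mul_sum]
  refine (Finset.abs_sum_le_sum_abs _ _).trans (Finset.sum_le_sum fun y _ => ?_)
  rw [abs_mul]
  exact mul_le_mul_of_nonneg_right (hC _) (abs_nonneg _)

lemma devF_mono {κ M : Type*} [Fintype κ] [Fintype M] [MeasurableSpace M]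
    [DiscreteMeasurableSpace M] {d : ℕ}
    (μ : Measure (TdVertex d → M)) [IsProbabilityMeasure μ] {s R : ℕ} (hsR : s ≤ R)
    (x : κ → TdVertex d → M) : devF μ s x ≤ devF μ R x := by
  let D : (↥(SrSet d s) → M) → ℝ := fun y =>
    (cnt (fun k (v : ↥(SrSet d s)) => x k v.1) y : ℝ) -
        Fintype.card κ * (restrictTo (SrSet d s) μ).real {y}
  have h1 := sum_comp_sub_eq μ s x fun y => SignType.sign (D y)
  have h2 : devF μ s x = ∑ y, (SignType.sign (D y) : ℝ) * D y :=
    Finset.sum_congr rfl fun y _ => (sign_mul_self (D y)).symm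
  have hc : CylS s fun x : TdVertex d → M =>
      ((SignType.sign (D fun v => x v.1) : SignType) : ℝ) := by
    intro x x' hx
    have : (fun v : ↥(SrSet d s) => x v.1) = fun v => x' v.1 := funext fun v => hx v.1 v.2
    simp only [this]
  have h3 := abs_sum_sub_le_devF μ x (hc.mono hsR) (C := 1) fun y => by
    rcases SignType.sign (D fun v => y v.1) <;> simp
  rw [h1, one_mul] at h3
  rw [h2]
  exact (le_abs_self _).trans h3

lemma abs_gmean_sub_le {G : Type*} [Group G] (N : Subgroup G) [N.FiniteIndex] {F : G → ℝ}
    (hF : RInv N F) {c C : ℝ} (h : ∀ g, |F g - c| ≤ C) : |gmean F - c| ≤ C := by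
  let : Fintype (G ⧸ N) := Fintype.ofFinite _
  have : Nonempty (G ⧸ N) := ⟨((1 : G) : G ⧸ N)⟩
  have h0 : (0 : ℝ) < Fintype.card (G ⧸ N) := by exact_mod_cast Fintype.card_pos
  rw [gmean_eq N hF, gavg_eq]
  have : (∑ q : G ⧸ N, F q.out) / Fintype.card (G ⧸ N) - c =
      (∑ q : G ⧸ N, (F q.out - c)) / Fintype.card (G ⧸ N) := by
    rw [Finset.sum_sub_distrib, Finset.sum_const, Finset.card_univ, nsmul_eq_mul]
    field_simp
  rw [this, abs_div, abs_of_pos h0, div_le_iff₀ h0]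
  refine (Finset.abs_sum_le_sum_abs _ _).trans ((Finset.sum_le_sum fun q _ => h _).trans ?_)
  rw [Finset.sum_const, Finset.card_univ, nsmul_eq_mul, mul_comm]

lemma InvMeas.integral_comp {N : Type*} [Nonempty N] [Finite N] [MeasurableSpace N]
    [DiscreteMeasurableSpace N] {d : ℕ} {ν : Measure (TdVertex d → N)} (hν : ν ∈ InvMeas d N)
    (φ : TdAut d) {h : (TdVertex d → N) → ℝ} {s : ℕ} (hs : CylS s h) :
    ∫ x, h (fun v => x (φ v)) ∂ν = ∫ x, h x ∂ν := by
  have hm : Measurable fun (x : TdVertex d → N) v => x (φ v) :=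
    measurable_pi_lambda _ fun v => measurable_pi_apply _
  conv_rhs => rw [← hν.2 φ]
  rw [integral_map hm.aemeasurable hs.measurable.aestronglyMeasurable]

lemma abs_symE_sub_le {V M : Type*} [Fintype V] [Nonempty V] [Fintype M] [MeasurableSpace M]
    [DiscreteMeasurableSpace M] {d : ℕ} [NeZero d] {μ : Measure (TdVertex d → M)}
    (hμ : μ ∈ InvMeas d M) {R : ℕ} (x : V × ZMod d → TdVertex d → M)
    {h : (TdVertex d → M) → ℝ} (hh : CylS R h) {C : ℝ} (hC : ∀ y, |h y| ≤ C) :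
    |symE x h - ∫ y, h y ∂μ| ≤ C * devF μ R x / Fintype.card (V × ZMod d) := by
  have hP : IsProbabilityMeasure μ := hμ.1
  have : Nonempty M := nonempty_of_prob μ
  let K := (fixS d R).subgroupOf (fixS d 0)
  have h0 : (0 : ℝ) < Fintype.card (V × ZMod d) := by exact_mod_cast Fintype.card_pos
  have h1 : symE x h = (gmean fun q : RootStab d => ∑ k, h fun v => x k (q.1 v)) /
      Fintype.card (V × ZMod d) := by
    rw [symE, gmean_sum K Finset.univ fun k _ => hh.rInv (x k)]
  have h2 := abs_gmean_sub_le K (F := fun q : RootStab d => ∑ k, h fun v => x k (q.1 v))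
    (fun g n hn => Finset.sum_congr rfl fun k _ => hh.rInv (x k) g n hn)
    (c := Fintype.card (V × ZMod d) * ∫ y, h y ∂μ) (C := C * devF μ R x) (fun q => by
      have := abs_sum_sub_le_devF μ x (hh.comp_fix q.2) (C := C) fun y => hC _
      rwa [InvMeas.integral_comp hμ q.1 hh] at this)
  rw [h1, le_div_iff₀ h0, ← abs_of_pos h0, ← abs_mul, abs_of_pos h0, sub_mul,
    div_mul_cancel₀ _ h0.ne', mul_comm (∫ y, h y ∂μ)]
  exact h2

/-- The entropy functional of the types of a pair of colorings, both with empirical distribution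
close to `μ`, is asymptotically bounded by the annealed entropies of the couplings. -/
lemma types_entropy_le {M : Type} [Fintype M] [Nonempty M] [MeasurableSpace M]
    [DiscreteMeasurableSpace M] {d : ℕ} [NeZero d] {μ : Measure (TdVertex d → M)}
    (hμ : μ ∈ InvMeas d M) (r : ℕ) (B : ℝ)
    (hB : ∀ ν, IsInvCoupling d μ ν → SigmaR d r ν ≤ B) {δ : ℝ} (hδ : 0 < δ) :
    ∃ R : ℕ, ∃ ε > 0, ∀ (V : Type) [Fintype V] [Nonempty V] (ι : V × ZMod d → V × ZMod d)
      (_ : Function.Involutive ι) (f₁ f₂ : V → M),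
      devF μ R (vw ι f₁) ≤ ε * Fintype.card (V × ZMod d) →
      devF μ R (vw ι f₂) ≤ ε * Fintype.card (V × ZMod d) →
      Hf (fun c : ClsS (M × M) d r =>
        (cnt (fun v => cS r (vw ι (fun v => (f₁ v, f₂ v)) (v, 0))) c : ℝ) / Fintype.card V) -
      d / 2 * Hf (fun b : ClsE (M × M) d r => (cnt (fun h : V × ZMod d =>
        yS r (cS r (vw ι (fun v => (f₁ v, f₂ v)) (h.1, 0))) h.2) b : ℝ) /
          (Fintype.card V * d)) ≤ B + δ := by
  have hP : IsProbabilityMeasure μ := hμ.1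
  by_contra! hcon
  choose V hF hN ι hι f₁ f₂ h1 h2 h3 using fun j : ℕ => hcon j (1 / (j + 1 : ℝ)) (by positivity)
  let x : ∀ j, V j × ZMod d → TdVertex d → M × M := fun j =>
    vw (ι j) fun v => (f₁ j v, f₂ j v)
  have hx : ∀ j i k v, x j (sh i k) v = x j k (rot i v) := fun j i k v => vw_rot _ _ i k v
  obtain ⟨ν, hν, hlim⟩ := exists_limit_measure V ι hι x hx fun j k v => vw_flip _ (hι j) _ k v
  have hPν : IsProbabilityMeasure ν := hν.1
  have marg : ∀ (g : M × M → M) (f : ∀ j, V j → M), (∀ j v, g (f₁ j v, f₂ j v) = f j v) →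
      (∀ j : ℕ, devF μ j (vw (ι j) (f j)) ≤ 1 / (j + 1 : ℝ) * Fintype.card (V j × ZMod d)) →
      ν.map (fun x v => g (x v)) = μ := by
    intro g f hg hf
    have hm : Measurable fun (x : TdVertex d → M × M) v => g (x v) :=
      measurable_pi_lambda _ fun v => Measurable.of_discrete.comp (measurable_pi_apply v)
    have hPm : IsProbabilityMeasure (ν.map fun (x : TdVertex d → M × M) v => g (x v)) :=
      Measure.isProbabilityMeasure_map hm.aemeasurable
    refine measure_ext_cyl _ _ fun s h hs => ?_
    rw [integral_map hm.aemeasurable hs.measurable.aestronglyMeasurable]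
    have hs' : CylS s fun x : TdVertex d → M × M => h fun v => g (x v) :=
      fun x x' hx => hs _ _ fun v hv => by rw [hx v hv]
    refine tendsto_nhds_unique (hlim s _ hs') ?_
    obtain ⟨C, hC⟩ := hs.bounded
    have hC0 : 0 ≤ C := (abs_nonneg _).trans (hC fun _ => Classical.arbitrary M)
    have hsy : ∀ j, symE (x j) (fun x => h fun v => g (x v)) = symE (vw (ι j) (f j)) h := by
      intro j
      simp only [symE, x, vw, hg]
    rw [tendsto_iff_norm_sub_tendsto_zero]
    have hz : Tendsto (fun j : ℕ => C * (1 / (j + 1 : ℝ))) (hyperfilter ℕ) (𝓝 0) := by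
      have := (tendsto_one_div_add_atTop_nhds_zero_nat (𝕜 := ℝ)).const_mul C
      rw [mul_zero] at this
      exact this.mono_left Nat.hyperfilter_le_atTop
    refine squeeze_zero' (Eventually.of_forall fun _ => norm_nonneg _) ?_ hz
    have hev : ∀ᶠ j in (hyperfilter ℕ : Filter ℕ), s ≤ j :=
      (eventually_ge_atTop s).filter_mono Nat.hyperfilter_le_atTop
    filter_upwards [hev] with j hj
    have h0 : (0 : ℝ) < Fintype.card (V j × ZMod d) := by exact_mod_cast Fintype.card_pos
    rw [hsy, Real.norm_eq_abs]
    refine (abs_symE_sub_le hμ (vw (ι j) (f j)) (hs.mono hj) hC).trans ?_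
    rw [div_le_iff₀ h0, mul_assoc]
    exact mul_le_mul_of_nonneg_left (hf j) hC0
  have hcoup : IsInvCoupling d μ ν :=
    ⟨hν, marg Prod.fst f₁ (fun _ _ => rfl) h1, marg Prod.snd f₂ (fun _ _ => rfl) h2⟩
  have hcyl : ∀ {β : Type} (c : (TdVertex d → M × M) → β) (b : β), CylS r c →
      ∫ y, (if c y = b then (1 : ℝ) else 0) ∂ν = ν.real {y | c y = b} := by
    intro β c b hc
    have hms : MeasurableSet {y | c y = b} := by
      let : MeasurableSpace β := ⊤
      exact hc.measurable (MeasurableSpace.measurableSet_top (s := {b}))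
    rw [← integral_indicator_one hms]
    refine integral_congr_ae (ae_of_all _ fun y => ?_)
    simp [Set.indicator_apply]
  have hHf : ∀ {β : Type} [Fintype β] (c : (TdVertex d → M × M) → β), CylS r c →
      Tendsto (fun j => Hf fun b => symE (x j) fun y => if c y = b then 1 else 0)
        (hyperfilter ℕ) (𝓝 (∑ b, Real.negMulLog (ν.real {y | c y = b}))) := by
    intro β _ c hc
    refine tendsto_finsetSum _ fun b _ => ?_
    have := hlim r _ (hc.indicator b)
    rw [hcyl c b hc] at this
    exact (Real.continuous_negMulLog.tendsto _).comp this
  have hfin := (hHf (cS r) (cylS_cS r)).sub ((hHf (cE r) (cylS_cE r)).const_mul (d / 2 : ℝ))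
  let _ : Fintype (Cls (M × M) (fixS d 1) (SrSet d r) (stable_SrSet d r 1)) :=
    inferInstanceAs (Fintype (ClsS (M × M) d r))
  let _ : Fintype (Cls (M × M) (edgeFix d) (ErSet d r) (stable_ErSet d r)) :=
    inferInstanceAs (Fintype (ClsE (M × M) d r))
  have h4 := (sigma_orbits_le r ν hν).trans (hB ν hcoup)
  have h5 := ge_of_tendsto' hfin fun j => by
    have h6 := Hf_le_symE (x j) (hx j) r
    have h7 := symE_cE (x j) (hx j) r
    simp only [h7]
    exact (h3 j).le.trans (sub_le_sub_right h6 _)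
  have h8 := h5.trans h4
  linarith

/-! ### The second moment -/

lemma entN_cnt_eq {ι α : Type*} [Fintype ι] [Nonempty ι] [Fintype α] (s : ι → α) :
    entN (fun a => (cnt s a : ℝ)) =
      Fintype.card ι * Hf fun a => (cnt s a : ℝ) / Fintype.card ι := by
  have h0 : (Fintype.card ι : ℝ) ≠ 0 := by exact_mod_cast Fintype.card_ne_zero
  rw [← entN_eq_Hf, ← entN_smul]
  · congr 1
    funext a
    field_simp
  · rw [← Finset.sum_div, div_eq_one_iff_eq h0]
    exact_mod_cast sum_cnt s

lemma yS_vw_inv {V N : Type*} {d : ℕ} [NeZero d] {m : ℕ} (π : Fin m × Bool ≃ V × ZMod d)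
    (f : V → N) (r : ℕ) (h : V × ZMod d) :
    yS r (cS r (vw (inv π) f ((inv π h).1, 0))) (inv π h).2 =
      tauE r (yS r (cS r (vw (inv π) f (h.1, 0))) h.2) := by
  have key : ∀ h : V × ZMod d, yS r (cS r (vw (inv π) f (h.1, 0))) h.2 =
      cE r (vw (inv π) f (sh (-1) h)) := by
    intro h
    rw [yS_cS]
    congr 1
    funext v
    rw [← vw_rot]
    congr 1
    simp [sh, sub_eq_add_neg]
  rw [key, key, tauE_cE]
  congr 1
  funext v
  rw [← vw_flip _ (inv_inv π)]
  congr 1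
  rw [cross, sh_sh_neg]

open Finset in
/-- The second moment of the number of colorings whose empirical distribution is close to `μ`. -/
lemma card_pairs_le {M : Type} [Fintype M] [Nonempty M] [MeasurableSpace M]
    [DiscreteMeasurableSpace M] {d : ℕ} [NeZero d] {μ : Measure (TdVertex d → M)}
    (hμ : μ ∈ InvMeas d M) (r : ℕ) (B : ℝ)
    (hB : ∀ ν, IsInvCoupling d μ ν → SigmaR d r ν ≤ B) {δ : ℝ} (hδ : 0 < δ) :
    ∃ R : ℕ, ∃ ε > 0, ∃ c₁ c₂ : ℕ, ∀ (V : Type) [Fintype V] [DecidableEq V] [Nonempty V] (m : ℕ)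
      (_ : Fintype.card V * d = 2 * m),
      (#{p : (Fin m × Bool ≃ V × ZMod d) × ((V → M) × (V → M)) |
        devF μ R (vw (inv p.1) p.2.1) ≤ ε * Fintype.card (V × ZMod d) ∧
        devF μ R (vw (inv p.1) p.2.2) ≤ ε * Fintype.card (V × ZMod d)} : ℝ) ≤
      (2 * m).factorial * Real.exp (Fintype.card V * (B + δ)) *
        (polyF c₁ (2 * m) * ((Fintype.card V : ℝ) + 1) ^ c₂) := by
  obtain ⟨R, ε, hε, h⟩ := types_entropy_le hμ r B hB hδ
  refine ⟨R, ε, hε, Fintype.card (ClsE (M × M) d r), Fintype.card (ClsS (M × M) d r), ?_⟩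
  intro V _ _ _ m hm
  have hcard : Fintype.card (V × ZMod d) = 2 * m := by rw [Fintype.card_prod, ZMod.card, hm]
  refine le_trans ?_ (card_typed_le (ι := V) (κ := V × ZMod d) (α := ClsS (M × M) d r)
    (tauE r) (tauE_involutive r) hcard (fun X h => yS r (X h.1) h.2)
    (Fintype.card V * (B + δ)))
  norm_cast
  refine card_le_card_of_injOn (fun p => (p.1, fun v =>
    cS r (vw (inv p.1) (fun v => (p.2.1 v, p.2.2 v)) (v, 0)))) ?_ ?_
  · rintro ⟨π, f₁, f₂⟩ hp
    simp only [coe_filter, mem_univ, true_and, Set.mem_ofPred_eq] at hp ⊢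
    refine ⟨fun h => yS_vw_inv π _ r h, ?_⟩
    have h1 := h V (inv π) (inv_inv π) f₁ f₂ hp.1 hp.2
    have h0 : (0 : ℝ) < Fintype.card V := by exact_mod_cast Fintype.card_pos
    rw [entN_cnt_eq, entN_cnt_eq]
    have h2 : (Fintype.card (V × ZMod d) : ℝ) = Fintype.card V * d := by
      rw [Fintype.card_prod, ZMod.card, Nat.cast_mul]
    rw [h2]
    refine le_trans (le_of_eq ?_) (mul_le_mul_of_nonneg_left h1 h0.le)
    ring
  · rintro ⟨π, f₁, f₂⟩ - ⟨π', g₁, g₂⟩ - heq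
    simp only [Prod.mk.injEq] at heq
    obtain ⟨rfl, h1⟩ := heq
    have h2 : ∀ v, (f₁ v, f₂ v) = (g₁ v, g₂ v) := fun v => cS_root (congrFun h1 v)
    simp only [Prod.mk.injEq] at h2
    rw [funext fun v => (h2 v).1, funext fun v => (h2 v).2]

/-! ### Stability of empirical distributions -/

open Finset in
lemma sum_abs_cnt_sub_le {ι α : Type*} [Fintype ι] [Fintype α] (s t : ι → α) :
    ∑ a, |(cnt s a : ℝ) - cnt t a| ≤ 2 * #{i | s i ≠ t i} := by
  have h1 : ∀ (s : ι → α) a, (cnt s a : ℝ) = ∑ i, if s i = a then 1 else 0 := by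
    intro s a
    rw [Finset.sum_boole]
    rfl
  have h2 : ∀ a, |(cnt s a : ℝ) - cnt t a| ≤
      ∑ i, |(if s i = a then (1 : ℝ) else 0) - if t i = a then 1 else 0| := by
    intro a
    rw [h1, h1, ← sum_sub_distrib]
    exact abs_sum_le_sum_abs _ _
  refine (sum_le_sum fun a _ => h2 a).trans ?_
  rw [sum_comm, card_filter, Nat.cast_sum, mul_sum]
  refine sum_le_sum fun i _ => ?_
  by_cases h : s i = t i
  · simp [h]
  · simp only [ne_eq, h, not_false_eq_true, if_true, Nat.cast_one, mul_one]
    calc _ ≤ ∑ a, ((if s i = a then (1 : ℝ) else 0) + if t i = a then 1 else 0) := by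
          refine sum_le_sum fun a _ => ?_
          split_ifs <;> norm_num
      _ = 2 := by
          rw [sum_add_distrib]
          simp only [sum_ite_eq, mem_univ, if_true]
          norm_num

open Finset in
lemma card_differ_le {ι α : Type*} [Fintype ι] [DecidableEq ι] [Fintype α] (X₀ : ι → α) (c : ℕ) :
    #{X : ι → α | #{i | X i ≠ X₀ i} ≤ c} ≤ (Fintype.card ι * Fintype.card α + 1) ^ c := by
  let Φ : (Fin c → Option (ι × α)) → ι → α := fun u i =>
    if h : ∃ a, ∃ j, u j = some (i, a) then h.choose else X₀ i
  have h1 : ({X : ι → α | #{i | X i ≠ X₀ i} ≤ c} : Finset (ι → α)) ⊆ univ.image Φ := by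
    intro X hX
    rw [mem_filter] at hX
    set D : Finset ι := {i | X i ≠ X₀ i} with hD
    let e := D.equivFin
    rw [mem_image]
    refine ⟨fun j => if h : j.1 < #D then
      some ((e.symm ⟨j.1, h⟩).1, X (e.symm ⟨j.1, h⟩).1) else none, mem_univ _, ?_⟩
    funext i
    simp only [Φ]
    split_ifs with h
    · obtain ⟨j, hj⟩ := h.choose_spec
      split_ifs at hj with h2
      simp only [Option.some.injEq, Prod.mk.injEq] at hj
      rw [← hj.2, hj.1]
    · by_contra hne
      have hi : i ∈ D := by simpa [hD] using fun h => hne h.symm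
      refine h ⟨X i, ⟨(e ⟨i, hi⟩).1, (e ⟨i, hi⟩).2.trans_le hX.2⟩, ?_⟩
      simp
  refine (card_le_card h1).trans (card_image_le.trans ?_)
  rw [card_univ, Fintype.card_fun, Fintype.card_option, Fintype.card_prod, Fintype.card_fin]

lemma abs_devF_sub_le {κ M : Type*} [Fintype κ] [Fintype M] [MeasurableSpace M] {d : ℕ}
    (μ : Measure (TdVertex d → M)) (R : ℕ) (x x' : κ → TdVertex d → M) (A : Finset κ)
    (hA : ∀ k ∉ A, ∀ v ∈ SrSet d R, x k v = x' k v) :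
    |devF μ R x - devF μ R x'| ≤ 2 * A.card := by
  rw [devF, devF, ← Finset.sum_sub_distrib]
  refine (Finset.abs_sum_le_sum_abs _ _).trans ?_
  refine (Finset.sum_le_sum fun y _ => abs_abs_sub_abs_le _ _).trans ?_
  simp only [sub_sub_sub_cancel_right]
  refine (sum_abs_cnt_sub_le _ _).trans ?_
  refine mul_le_mul_of_nonneg_left ?_ zero_le_two
  norm_cast
  refine Finset.card_le_card fun k hk => ?_
  by_contra hkA
  exact (Finset.mem_filter.1 hk).2 (funext fun v => hA k hkA v.1 v.2)

open Finset in
lemma card_inv_swap_le {m : ℕ} {κ : Type*} [Fintype κ] (π : Fin m × Bool ≃ κ)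
    (i j : Fin m × Bool) :
    #{h | inv π h ≠ inv ((Equiv.swap i j).trans π) h} ≤ 4 := by
  have h1 : ({h | inv π h ≠ inv ((Equiv.swap i j).trans π) h} : Finset κ) ⊆
      {π i, π j, π (flipB m i), π (flipB m j)} := by
    intro h hh
    by_contra hcon
    simp only [mem_insert, mem_singleton, not_or] at hcon
    obtain ⟨h1, h2, h3, h4⟩ := hcon
    refine (mem_filter.1 hh).2 ?_
    have h5 : ((Equiv.swap i j).trans π).symm h = π.symm h := by
      change (Equiv.swap i j).symm (π.symm h) = _
      rw [Equiv.symm_swap]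
      exact Equiv.swap_apply_of_ne_of_ne (fun h => h1 (by rw [← h]; simp))
        fun h => h2 (by rw [← h]; simp)
    rw [inv, inv, h5, Equiv.trans_apply, Equiv.swap_apply_of_ne_of_ne]
    · intro h6
      refine h3 ?_
      rw [← h6, flipB_flipB, Equiv.apply_symm_apply]
    · intro h6
      refine h4 ?_
      rw [← h6, flipB_flipB, Equiv.apply_symm_apply]
  exact (card_le_card h1).trans card_le_four

lemma vw_agree {V N : Type*} [Fintype V] {d : ℕ} [NeZero d]
    (ι ι' : V × ZMod d → V × ZMod d) (hι : Function.Involutive ι) (hι' : Function.Involutive ι')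
    (Bad : Finset (V × ZMod d)) (hB : ∀ h ∉ Bad, ι h = ι' h) (f : V → N) (R : ℕ)
    (k : V × ZMod d) (hk : k ∉ badL ι Bad R) (v : TdVertex d) (hv : v ∈ SrSet d R) :
    vw ι f k v = vw ι' f k v := by
  refine agree_of_relations ι Bad R (vw ι f) (vw ι' f) (vw_rot ι f) (vw_rot ι' f)
    (fun k _ v _ => vw_flip ι hι f k v) (fun k hk v _ => ?_) (fun _ => rfl) R le_rfl k hk v hv
  rw [← vw_flip ι' hι', cross, cross, hB _ hk]

open Finset in
lemma devF_swap_le {V M : Type*} [Fintype V] [Fintype M] [MeasurableSpace M] {d : ℕ} [NeZero d]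
    (μ : Measure (TdVertex d → M)) (R : ℕ) (f : V → M) {m : ℕ}
    (π : Fin m × Bool ≃ V × ZMod d) (i j : Fin m × Bool) :
    |devF μ R (vw (inv ((Equiv.swap i j).trans π)) f) - devF μ R (vw (inv π) f)| ≤
      8 * badC d R := by
  set Bad : Finset (V × ZMod d) := {h | inv π h ≠ inv ((Equiv.swap i j).trans π) h} with hBad
  rw [abs_sub_comm]
  refine (abs_devF_sub_le μ R _ _ (badL (inv π) Bad R) fun k hk v hv =>
    vw_agree _ _ (inv_inv π) (inv_inv _) Bad (fun h hh => ?_) f R k hk v hv).trans ?_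
  · by_contra hne
    exact hh (by simp [hBad, hne])
  · have h1 := card_badL_le (inv π) (Function.Involutive.injective (inv_inv π)) Bad R
    have h2 : #Bad ≤ 4 := by rw [hBad]; convert card_inv_swap_le π i j
    have h3 : #(badL (inv π) Bad R) ≤ badC d R * 4 := h1.trans (Nat.mul_le_mul_left _ h2)
    have h4 : (#(badL (inv π) Bad R) : ℝ) ≤ badC d R * 4 := by exact_mod_cast h3
    linarith

/-! ### The first moment -/

/-- The family of colorings of the tree generated by local colorings at the vertices. -/
def locX {V N : Type*} [Nonempty N] {d R : ℕ} [NeZero d] (X : V → ↥(SrSet d R) → N)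
    (k : V × ZMod d) (v : TdVertex d) : N := extC (X k.1) (rot k.2 v)

lemma rot_rot {d : ℕ} [NeZero d] (i j : ZMod d) (v : TdVertex d) :
    rot i (rot j v) = rot (i + j) v := by rw [rot_add]; rfl

lemma rot_zero_apply {d : ℕ} [NeZero d] (v : TdVertex d) : rot (0 : ZMod d) v = v := by
  rw [rot_zero]; rfl

lemma locX_sh {V N : Type*} [Nonempty N] {d R : ℕ} [NeZero d] (X : V → ↥(SrSet d R) → N)
    (i : ZMod d) (k : V × ZMod d) (v : TdVertex d) : locX X (sh i k) v = locX X k (rot i v) := by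
  rw [locX, locX, rot_rot]
  rfl

/-- The edge pattern of a local coloring along a half-edge. -/
def yE {N : Type*} [Nonempty N] {d R : ℕ} [NeZero d] (a : ↥(SrSet d R) → N) (i : ZMod d)
    (v : ↥(ErSet d R)) : N := extC a (rot (i - 1) v.1)

/-- Reversal of edge patterns. -/
def tE {N : Type*} {d R : ℕ} [NeZero d] (b : ↥(ErSet d R) → N) (v : ↥(ErSet d R)) : N :=
  b ⟨flip v.1, flip_mem_ErSet v.2⟩

lemma tE_involutive {N : Type*} {d R : ℕ} [NeZero d] :
    Function.Involutive (tE (N := N) (d := d) (R := R)) := by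
  intro b
  funext v
  simp only [tE, flip_flip]

open Finset in
lemma locX_agree {V N : Type*} [Fintype V] [Nonempty N] {d R : ℕ} [NeZero d]
    (ι : V × ZMod d → V × ZMod d) (hι : Function.Involutive ι) (X : V → ↥(SrSet d R) → N)
    (Bad : Finset (V × ZMod d))
    (hB : ∀ h ∉ Bad, yE (X h.1) h.2 = tE (yE (X (ι h).1) (ι h).2))
    (k : V × ZMod d) (hk : k ∉ badL ι Bad R) (v : TdVertex d) (hv : v ∈ SrSet d R) :
    vw ι (fun v => X v ⟨rootTd d, root_mem_SrSet d R⟩) k v = locX X k v := by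
  refine agree_of_relations ι Bad R _ (locX X) (vw_rot ι _) (locX_sh X)
    (fun k _ v _ => vw_flip ι hι _ k v) (fun k hk v hv => ?_) (fun k => ?_) R le_rfl k hk v hv
  · have h1 := congrFun (hB _ hk) ⟨flip v, flip_mem_ErSet (Or.inl hv)⟩
    simp only [yE, tE, flip_flip] at h1
    rw [locX, locX, cross]
    change extC _ (rot ((ι (sh 1 k)).2 + -1) v) = _
    rw [← sub_eq_add_neg]
    refine h1.symm.trans ?_
    simp [sh]
  · rw [vw_root, locX]
    have : rot k.2 (rootTd d) = rootTd d := TdVertex.ext (by rw [rot_val]; rfl)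
    rw [this]
    exact (extC_apply (X k.1) ⟨rootTd d, root_mem_SrSet d R⟩).symm

open Finset in
lemma devF_locX_le {V M : Type*} [Fintype V] [Fintype M] [Nonempty M] [MeasurableSpace M]
    [DiscreteMeasurableSpace M] {d : ℕ} [NeZero d] {μ : Measure (TdVertex d → M)}
    (hμ : μ ∈ InvMeas d M) (R : ℕ) (X : V → ↥(SrSet d R) → M) (C : ℝ)
    (hX : ∀ a, |(cnt X a : ℝ) - Fintype.card V * (restrictTo (SrSet d R) μ).real {a}| ≤ C) :
    devF μ R (locX X) ≤ Fintype.card (↥(SrSet d R) → M) * (d * C) := by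
  let ρ : ZMod d → (↥(SrSet d R) → M) → ↥(SrSet d R) → M := fun i y v =>
    extC y (rot (-i) v.1)
  have hρ : ∀ i a y, (fun v : ↥(SrSet d R) => extC a (rot i v.1)) = y ↔ a = ρ i y := by
    intro i a y
    constructor
    · rintro rfl
      funext v
      have := extC_apply (fun v : ↥(SrSet d R) => extC a (rot i v.1))
        ⟨rot (-i) v.1, rot_mem_SrSet _ |>.2 v.2⟩
      simp only [ρ]
      rw [this]
      simp only
      rw [rot_rot, add_neg_cancel, rot_zero_apply, extC_apply]
    · rintro rfl
      funext v
      have := extC_apply (ρ i y) ⟨rot i v.1, rot_mem_SrSet _ |>.2 v.2⟩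
      rw [this]
      simp only [ρ]
      rw [rot_rot, neg_add_cancel, rot_zero_apply, extC_apply]
  have hcnt : ∀ y, (cnt (fun k (v : ↥(SrSet d R)) => locX X k v.1) y : ℝ) =
      ∑ i, (cnt X (ρ i y) : ℝ) := by
    intro y
    have h1 : ∀ k : V × ZMod d, (fun v : ↥(SrSet d R) => locX X k v.1) = y ↔
        X k.1 = ρ k.2 y := fun k => hρ k.2 (X k.1) y
    simp only [cnt, h1, card_filter, Nat.cast_sum]
    rw [Fintype.sum_prod_type, sum_comm]
    congr!
  have hmass : ∀ i y, (restrictTo (SrSet d R) μ).real {ρ i y} =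
      (restrictTo (SrSet d R) μ).real {y} := by
    intro i y
    have hm : Measurable fun (x : TdVertex d → M) v => x (rot i v) :=
      measurable_pi_lambda _ fun v => measurable_pi_apply _
    rw [measureReal_def, measureReal_def, restrictTo,
      Measure.map_apply (measurable_restr _) (MeasurableSet.singleton _),
      Measure.map_apply (measurable_restr _) (MeasurableSet.singleton _)]
    conv_rhs => rw [← hμ.2 (rot i)]
    rw [Measure.map_apply hm ((measurable_restr _) (MeasurableSet.singleton _))]
    congr 2
    ext x
    simp only [Set.mem_preimage, Set.mem_singleton_iff]
    rw [← hρ]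
    refine Eq.congr_left ?_
    funext v
    exact extC_apply (fun v : ↥(SrSet d R) => x v.1) ⟨rot i v.1, rot_mem_SrSet _ |>.2 v.2⟩
  rw [devF]
  refine (sum_le_card_nsmul _ _ (d * C) fun y _ => ?_).trans ?_
  · rw [hcnt, Fintype.card_prod, ZMod.card]
    have h2 : ((Fintype.card V * d : ℕ) : ℝ) * (restrictTo (SrSet d R) μ).real {y} =
        ∑ i : ZMod d, Fintype.card V * (restrictTo (SrSet d R) μ).real {ρ i y} := by
      simp only [hmass, sum_const, card_univ, ZMod.card, nsmul_eq_mul, Nat.cast_mul]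
      ring
    rw [h2, ← sum_sub_distrib]
    refine (abs_sum_le_sum_abs _ _).trans ((sum_le_card_nsmul _ _ C fun i _ => hX _).trans ?_)
    rw [card_univ, ZMod.card, nsmul_eq_mul]
  · rw [card_univ, nsmul_eq_mul]

lemma real_restrictTo {M : Type*} [MeasurableSpace M] [DiscreteMeasurableSpace M] [Finite M] {d : ℕ}
    (μ : Measure (TdVertex d → M)) (S : Set (TdVertex d)) [Finite ↥S] (b : ↥S → M) :
    (restrictTo S μ).real {b} = μ.real {x | (fun v : ↥S => x v.1) = b} := by
  rw [measureReal_def, restrictTo, Measure.map_apply (measurable_restr _)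
    (MeasurableSet.singleton _)]
  rfl

lemma real_comp_aut {M : Type*} [MeasurableSpace M] [DiscreteMeasurableSpace M] [Finite M]
    {d : ℕ} {μ : Measure (TdVertex d → M)} (hμ : μ ∈ InvMeas d M) (φ : TdAut d)
    (S : Set (TdVertex d)) [Finite ↥S] (b : ↥S → M) :
    μ.real {x | (fun v : ↥S => x (φ v.1)) = b} = (restrictTo S μ).real {b} := by
  have hm : Measurable fun (x : TdVertex d → M) v => x (φ v) :=
    measurable_pi_lambda _ fun v => measurable_pi_apply _
  have hS : MeasurableSet {x : TdVertex d → M | (fun v : ↥S => x v.1) = b} :=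
    (measurable_restr S) (MeasurableSet.singleton b)
  rw [real_restrictTo, measureReal_def, measureReal_def]
  conv_rhs => rw [← hμ.2 φ]
  rw [Measure.map_apply hm hS]
  rfl

lemma shannon_eq_Hf {M : Type*} [MeasurableSpace M] {d : ℕ} (μ : Measure (TdVertex d → M))
    (S : Set (TdVertex d)) [Fintype (↥S → M)] :
    shannon (restrictTo S μ) = Hf fun a => (restrictTo S μ).real {a} := by
  rw [shannon, tsum_fintype]
  rfl

open Finset in
lemma sum_mul_card_yE {M : Type*} [Fintype M] [Nonempty M] [MeasurableSpace M]
    [DiscreteMeasurableSpace M] {d : ℕ} [NeZero d] {μ : Measure (TdVertex d → M)}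
    (hμ : μ ∈ InvMeas d M) (R : ℕ) (b : ↥(ErSet d R) → M) :
    d * (restrictTo (ErSet d R) μ).real {b} = ∑ a : ↥(SrSet d R) → M,
      ((restrictTo (SrSet d R) μ).real {a} * #{i | yE a i = b} : ℝ) := by
  have hP : IsProbabilityMeasure μ := hμ.1
  have h1 : ∀ i : ZMod d, (restrictTo (ErSet d R) μ).real {b} =
      ∑ a : ↥(SrSet d R) → M, (restrictTo (SrSet d R) μ).real {a} *
        if yE a i = b then 1 else 0 := by
    intro i
    rw [← real_comp_aut hμ (rot (i - 1))]
    have h2 : {x : TdVertex d → M | (fun v : ↥(ErSet d R) => x (rot (i - 1) v.1)) = b} =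
        ⋃ a ∈ (univ.filter fun a : ↥(SrSet d R) → M => yE a i = b),
          {x | (fun v : ↥(SrSet d R) => x v.1) = a} := by
      ext x
      simp only [Set.mem_ofPred_eq, mem_filter, mem_univ, true_and, Set.mem_iUnion, exists_prop,
        exists_eq_right']
      refine Eq.congr_left ?_
      funext v
      exact (extC_apply (fun v : ↥(SrSet d R) => x v.1)
        ⟨rot (i - 1) v.1, (rot_mem_SrSet _).2 (ErSet_subset_SrSet d R v.2)⟩).symm
    rw [h2, measureReal_biUnion_finset, sum_filter]
    · refine sum_congr rfl fun a _ => ?_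
      rw [real_restrictTo]
      split_ifs <;> simp
    · intro a _ a' _ haa
      rw [Function.onFun, Set.disjoint_left]
      rintro x rfl h
      exact haa h
    · intro a _
      exact (measurable_restr _) (MeasurableSet.singleton a)
  have h3 : (d : ℝ) * (restrictTo (ErSet d R) μ).real {b} =
      ∑ i : ZMod d, (restrictTo (ErSet d R) μ).real {b} := by
    rw [sum_const, card_univ, ZMod.card, nsmul_eq_mul]
  rw [h3, sum_congr rfl fun i _ => h1 i, sum_comm]
  refine sum_congr rfl fun a _ => ?_
  rw [← mul_sum, sum_boole]

open Finset in
set_option maxHeartbeats 400000 in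
/-- The first moment of the number of colorings whose empirical distribution is close to `μ`. -/
lemma le_card_close {M : Type} [Fintype M] [Nonempty M] [MeasurableSpace M]
    [DiscreteMeasurableSpace M] {d : ℕ} [NeZero d] {μ : Measure (TdVertex d → M)}
    (hμ : μ ∈ InvMeas d M) (R : ℕ) {ε δ : ℝ} (hε : 0 < ε) (hδ : 0 < δ) :
    ∃ n₀ : ℕ, ∀ n : ℕ, n₀ ≤ n → ∀ m : ℕ, n * d = 2 * m →
      Real.exp (n * (SigmaR d R μ - δ)) * (2 * m).factorial ≤
      (#{p : (Fin m × Bool ≃ Fin n × ZMod d) × (Fin n → M) |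
        devF μ R (vw (inv p.1) p.2) ≤ ε * Fintype.card (Fin n × ZMod d)} : ℝ) := by
  have hP : IsProbabilityMeasure μ := hμ.1
  have hPr : IsProbabilityMeasure (restrictTo (SrSet d R) μ) :=
    Measure.isProbabilityMeasure_map (measurable_restr _).aemeasurable
  let p : (↥(SrSet d R) → M) → ℝ := fun a => (restrictTo (SrSet d R) μ).real {a}
  let q : (↥(ErSet d R) → M) → ℝ := fun b => (restrictTo (ErSet d R) μ).real {b}
  have hp1 : ∑ a, p a = 1 := by
    simp only [p]
    rw [sum_measureReal_singleton, coe_univ, probReal_univ]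
  have hqτ : ∀ b, q (tE b) = q b := by
    intro b
    simp only [q]
    rw [← real_comp_aut hμ flip (ErSet d R) b, real_restrictTo]
    congr 1
    ext x
    simp only [Set.mem_ofPred_eq]
    constructor
    · intro h
      funext v
      have := congrFun h ⟨flip v.1, flip_mem_ErSet v.2⟩
      simp only [tE, flip_flip] at this
      exact this
    · rintro rfl
      funext v
      simp only [tE, flip_flip]
  obtain ⟨C, hC⟩ := le_card_typed p (fun a => measureReal_nonneg) hp1 yE tE tE_involutive q
    (fun b => by convert sum_mul_card_yE hμ R b) hqτ
  set c := badC d R * (2 * C) with hc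
  set A := Fintype.card (↥(SrSet d R) → M) with hA
  obtain ⟨n₁, hn₁⟩ := hC (δ / 2) (by positivity)
  obtain ⟨n₂, hn₂⟩ := polyF_le_exp c A (by exact_mod_cast Fintype.card_pos)
    (δ := δ / 2) (by positivity)
  obtain ⟨n₃, hn₃⟩ := exists_nat_gt ((A * (d * C) + 2 * c) / (ε * d))
  have hd : 0 < d := Nat.pos_of_ne_zero (NeZero.ne d)
  refine ⟨max n₁ (max n₂ n₃), fun n hn m hm => ?_⟩
  have hn1 := (le_max_left _ _).trans hn
  have hn2 := ((le_max_left _ _).trans (le_max_right _ _)).trans hn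
  have hn3 := ((le_max_right _ _).trans (le_max_right _ _)).trans hn
  set Z := ({z : (Fin m × Bool ≃ Fin n × ZMod d) × (Fin n → ↥(SrSet d R) → M) |
          (∀ a, |(cnt z.2 a : ℝ) - n * p a| ≤ C) ∧
          #{e | yE (z.2 (z.1 (e, true)).1) (z.1 (e, true)).2 ≠
            tE (yE (z.2 (z.1 (e, false)).1) (z.1 (e, false)).2)} ≤ C} : Finset _) with hZ
  have h1 : Real.exp (n * (Hf p - d / 2 * Hf q - δ / 2)) * (2 * m).factorial ≤ (#Z : ℝ) := by
    convert hn₁ n hn1 m hm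
  set T := ({p : (Fin m × Bool ≃ Fin n × ZMod d) × (Fin n → M) |
        devF μ R (vw (inv p.1) p.2) ≤ ε * Fintype.card (Fin n × ZMod d)} : Finset _) with hT
  let Ψ : (Fin m × Bool ≃ Fin n × ZMod d) × (Fin n → ↥(SrSet d R) → M) →
      (Fin m × Bool ≃ Fin n × ZMod d) × (Fin n → M) := fun z =>
    (z.1, fun v => z.2 v ⟨rootTd d, root_mem_SrSet d R⟩)
  have key : ∀ z ∈ Z, ∃ D : Finset (Fin n × ZMod d), #D ≤ c ∧ ∀ k ∉ D, ∀ v ∈ SrSet d R,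
      vw (inv z.1) (Ψ z).2 k v = locX z.2 k v := by
    rintro ⟨π, X⟩ hz
    rw [hZ, mem_filter] at hz
    obtain ⟨-, -, hz⟩ := hz
    set E : Finset (Fin m) := {e | yE (X (π (e, true)).1) (π (e, true)).2 ≠
            tE (yE (X (π (e, false)).1) (π (e, false)).2)} with hE
    let Bad : Finset (Fin n × ZMod d) := (E ×ˢ univ).map π.toEmbedding
    refine ⟨badL (inv π) Bad R, ?_, locX_agree _ (inv_inv π) X Bad fun h hh => ?_⟩
    · refine (card_badL_le _ (Function.Involutive.injective (inv_inv π)) _ _).trans ?_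
      rw [card_map, card_product, card_univ, Fintype.card_bool, hc, mul_comm 2 C]
      exact Nat.mul_le_mul_left _ (Nat.mul_le_mul_right _ hz)
    · obtain ⟨⟨e, s⟩, rfl⟩ := π.surjective h
      have he : e ∉ E := fun he => hh (mem_map.2 ⟨(e, s), by simp [he], rfl⟩)
      rw [hE, mem_filter] at he
      have he' : yE (X (π (e, true)).1) (π (e, true)).2 =
            tE (yE (X (π (e, false)).1) (π (e, false)).2) := by
        by_contra hne
        exact he ⟨mem_univ _, hne⟩
      cases s
      · simp [inv, he', tE_involutive _]
      · simpa [inv] using he'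
  have hmaps : ∀ z ∈ Z, Ψ z ∈ T := by
    intro z hz
    obtain ⟨D, hD, hD2⟩ := key z hz
    rw [hT, mem_filter]
    refine ⟨mem_univ _, ?_⟩
    rw [hZ, mem_filter] at hz
    have h2 := devF_locX_le hμ R z.2 C (by simpa using hz.2.1)
    have h3 := (abs_le.1 (abs_devF_sub_le μ R _ _ D hD2)).2
    have h4 : (#D : ℝ) ≤ c := by exact_mod_cast hD
    have h5 : (n₃ : ℝ) ≤ n := by exact_mod_cast hn3
    have h6 := hn₃.le.trans h5
    rw [div_le_iff₀ (by positivity)] at h6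
    rw [Fintype.card_prod, ZMod.card, Fintype.card_fin, Nat.cast_mul]
    simp only [Ψ] at h3 ⊢
    linarith
  have hfib : ∀ t ∈ T, #{z ∈ Z | Ψ z = t} ≤ (n * A + 1) ^ c := by
    rintro ⟨π, f⟩ -
    let X₀ : Fin n → ↥(SrSet d R) → M := fun v w => vw (inv π) f (v, 0) w.1
    have h2 : #{X : Fin n → ↥(SrSet d R) → M | #{i | X i ≠ X₀ i} ≤ c} ≤ (n * A + 1) ^ c := by
      have := card_differ_le X₀ c
      rw [Fintype.card_fin] at this
      convert this
    refine le_trans (card_le_card_of_injOn Prod.snd ?_ ?_) h2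
    · rintro ⟨π', X⟩ hz
      simp only [coe_filter, Set.mem_ofPred_eq, mem_univ, true_and] at hz ⊢
      obtain ⟨hz, hΨ⟩ := hz
      obtain ⟨D, hD, hD2⟩ := key _ hz
      rw [hΨ] at hD2
      obtain rfl : π' = π := congrArg Prod.fst hΨ
      refine le_trans (card_le_card_of_injOn (fun v => (v, (0 : ZMod d))) ?_ ?_) hD
      · intro v hv
        by_contra hvD
        refine (mem_filter.1 hv).2 ?_
        funext w
        simp only [X₀]
        rw [hD2 _ hvD _ w.2, locX]
        simp only
        rw [rot_zero_apply, extC_apply]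
      · intro v _ v' _ h
        exact congrArg Prod.fst h
    · rintro ⟨π₁, X₁⟩ hz₁ ⟨π₂, X₂⟩ hz₂ h
      simp only [coe_filter, Set.mem_ofPred_eq] at hz₁ hz₂ h
      have h3 : π₁ = π := congrArg Prod.fst hz₁.2
      have h4 : π₂ = π := congrArg Prod.fst hz₂.2
      rw [h3, h4, h]
  have h2 : #Z ≤ (n * A + 1) ^ c * #T := card_le_mul_card_image_of_maps_to hmaps _ hfib
  have h3 : (((n * A + 1) ^ c : ℕ) : ℝ) ≤ Real.exp (n * (δ / 2)) := by
    have h4 := hn₂ n hn2 (n * A) (by push_cast; linarith)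
    rw [mul_comm (δ / 2)] at h4
    refine le_trans ?_ h4
    rw [polyF]
    push_cast
    refine pow_le_pow_left₀ (by positivity) ?_ c
    have := Real.add_one_le_exp (1 : ℝ)
    nlinarith [show (0 : ℝ) ≤ n * A by positivity]
  have h4 : (#Z : ℝ) ≤ Real.exp (n * (δ / 2)) * #T := by
    refine le_trans (by exact_mod_cast h2) (mul_le_mul_of_nonneg_right h3 (Nat.cast_nonneg _))
  have h5 : SigmaR d R μ = Hf p - d / 2 * Hf q := by
    rw [SigmaR, shannon_eq_Hf, shannon_eq_Hf]
  rw [h5]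
  have h6 : Real.exp (n * (Hf p - d / 2 * Hf q - δ)) =
      Real.exp (n * (Hf p - d / 2 * Hf q - δ / 2)) / Real.exp (n * (δ / 2)) := by
    rw [← Real.exp_sub]
    congr 1
    ring
  rw [h6, div_mul_eq_mul_div, div_le_iff₀ (Real.exp_pos _)]
  linarith [h1.trans h4]

/-! ### Injectivity of the exploration of a random matching -/

/-- The vertex reached by the walk along `u`. -/
def lw {V : Type*} {d : ℕ} (ι : V × ZMod d → V × ZMod d) (k : V × ZMod d) (u : List ℕ) : V :=
  (wk ι k u).1

/-- A finite set of vertices of the tree that is closed under taking parents. -/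
structure IsSubtree (d : ℕ) (P : Finset (List ℕ)) : Prop where
  valid : ∀ u ∈ P, ValidTd d u
  nil_mem : [] ∈ P
  parent_mem : ∀ a u, a :: u ∈ P → u ∈ P

lemma letter_le {d : ℕ} {a : ℕ} {u : List ℕ} (h : ValidTd d (a :: u)) : 1 ≤ a ∧ a ≤ d := by
  have h1 := (validTd_cons.1 h).2
  unfold maxLetter at h1
  split_ifs at h1 <;> omega

lemma letter_cast_inj {d : ℕ} [NeZero d] {a b : ℕ} (ha : 1 ≤ a ∧ a ≤ d) (hb : 1 ≤ b ∧ b ≤ d)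
    (h : (a : ZMod d) = b) : a = b := by
  rw [← lt_cast ha.1 ha.2, ← lt_cast hb.1 hb.2, h]

lemma letter_cast_ne_zero {d : ℕ} [NeZero d] {a : ℕ} {u : List ℕ} (h : ValidTd d (a :: u))
    (hu : u ≠ []) : (a : ZMod d) ≠ 0 := by
  have h1 := (validTd_cons.1 h).2
  rw [maxLetter, if_neg hu] at h1
  have h2 := letter_le h
  intro h0
  have h3 := letter_cast_inj (d := d) (a := a) (b := d) h2 (by omega) (by simp [h0])
  omega

lemma inv_swap {m : ℕ} {κ : Type*} [DecidableEq κ] (π : Fin m × Bool ≃ κ) (b g h : κ) :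
    inv (π.trans (Equiv.swap b g)) h = Equiv.swap b g (inv π (Equiv.swap b g h)) := by
  simp [inv]

open Finset in
/-- The half-edges used by the exploration of `P`. -/
def seen {V : Type*} {d : ℕ} [DecidableEq V] (ι : V × ZMod d → V × ZMod d) (k : V × ZMod d)
    (P : Finset (List ℕ)) : Finset (V × ZMod d) :=
  (P.erase []).image (wk ι k) ∪ (P.erase []).image (fun u => ι (wk ι k u))

open Finset in
lemma seen_closed {V : Type*} {d : ℕ} [DecidableEq V] {ι : V × ZMod d → V × ZMod d}
    (hι : Function.Involutive ι) {k : V × ZMod d} {P : Finset (List ℕ)} {x : V × ZMod d}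
    (hx : x ∈ seen ι k P) : ι x ∈ seen ι k P := by
  simp only [seen, mem_union, mem_image] at hx ⊢
  rcases hx with ⟨u, hu, rfl⟩ | ⟨u, hu, rfl⟩
  · exact Or.inr ⟨u, hu, rfl⟩
  · exact Or.inl ⟨u, hu, (hι _).symm⟩

open Finset in
lemma card_seen_lt {V : Type*} {d : ℕ} [DecidableEq V] (ι : V × ZMod d → V × ZMod d)
    (k : V × ZMod d) (P : Finset (List ℕ)) (h0 : [] ∈ P) : #(seen ι k P) + 1 ≤ 2 * #P := by
  have h1 := card_union_le ((P.erase []).image (wk ι k))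
    ((P.erase []).image (fun u => ι (wk ι k u)))
  have h2 := card_image_le (s := P.erase []) (f := wk ι k)
  have h3 := card_image_le (s := P.erase []) (f := fun u => ι (wk ι k u))
  have h4 := card_erase_add_one h0
  unfold seen
  omega

lemma wk_swap {V : Type*} {d m : ℕ} [DecidableEq V] (π : Fin m × Bool ≃ V × ZMod d)
    (k b g : V × ZMod d) {P : Finset (List ℕ)} (hP : IsSubtree d P)
    (hb : b ∉ seen (inv π) k P) (hg : g ∉ seen (inv π) k P) (u : List ℕ) (hu : u ∈ P) :
    wk (inv (π.trans (Equiv.swap b g))) k u = wk (inv π) k u := by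
  induction u with
  | nil => rfl
  | cons a u ih =>
    rw [wk, ih (hP.parent_mem a u hu), inv_swap]
    have h1 : wk (inv π) k (a :: u) ∈ seen (inv π) k P :=
      Finset.mem_union_left _ (Finset.mem_image_of_mem _ (by simp [hu]))
    have h2 := seen_closed (inv_inv π) h1
    have h3 : inv π (wk (inv π) k (a :: u)) = sh (a : ZMod d) (wk (inv π) k u) := by
      rw [wk, inv_inv]
    rw [h3] at h2
    rw [Equiv.swap_apply_of_ne_of_ne (a := b) (b := g) (x := sh (a : ZMod d) (wk (inv π) k u))
      (fun h => hb (h ▸ h2)) (fun h => hg (h ▸ h2))]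
    change Equiv.swap b g (wk (inv π) k (a :: u)) = _
    exact Equiv.swap_apply_of_ne_of_ne (fun h => hb (h ▸ h1)) (fun h => hg (h ▸ h1))

lemma step_notMem_seen {V : Type*} {d m : ℕ} [NeZero d] [DecidableEq V]
    (π : Fin m × Bool ≃ V × ZMod d)
    (k : V × ZMod d) {P : Finset (List ℕ)} (hP : IsSubtree d P)
    (hinj : Set.InjOn (lw (inv π) k) P) {a : ℕ} {u : List ℕ} (hu : u ∈ P)
    (hv : ValidTd d (a :: u)) (hau : a :: u ∉ P) :
    sh (a : ZMod d) (wk (inv π) k u) ∉ seen (inv π) k P := by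
  intro hmem
  simp only [seen, Finset.mem_union, Finset.mem_image, Finset.mem_erase] at hmem
  rcases hmem with ⟨v, ⟨hv0, hvP⟩, h⟩ | ⟨v, ⟨hv0, hvP⟩, h⟩
  · have h0 : lw (inv π) k v = lw (inv π) k u := congrArg (fun x => x.1) h
    have h1 : v = u := hinj hvP hu h0
    subst h1
    have h2 := congrArg Prod.snd h
    simp only [sh] at h2
    exact letter_cast_ne_zero hv hv0 (by simpa using h2.symm)
  · match v, hv0 with
    | c :: v, _ =>
      rw [wk, inv_inv] at h
      have h0 : lw (inv π) k v = lw (inv π) k u := congrArg (fun x => x.1) h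
      have h1 : v = u := hinj (hP.parent_mem c v hvP) hu h0
      subst h1
      have h2 := congrArg Prod.snd h
      simp only [sh] at h2
      have h3 := letter_cast_inj (letter_le (hP.valid _ hvP)) (letter_le hv)
        (by simpa using h2)
      exact hau (h3 ▸ hvP)

open Finset in
/-- A single step of the exploration closes a cycle with small probability. -/
lemma card_collision_le {V : Type*} {d m : ℕ} [NeZero d] [Fintype V] [DecidableEq V]
    (hm : Fintype.card (V × ZMod d) = 2 * m) (k : V × ZMod d)
    {P : Finset (List ℕ)} (hP : IsSubtree d P) {a : ℕ} {u : List ℕ} (hu : u ∈ P)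
    (hv : ValidTd d (a :: u)) (hau : a :: u ∉ P) :
    (#{π : Fin m × Bool ≃ V × ZMod d | Set.InjOn (lw (inv π) k) P ∧
      ∃ w ∈ P, lw (inv π) k (a :: u) = lw (inv π) k w} : ℝ) * (2 * m - 2 * #P) ≤
      (2 * m).factorial * (#P * d) := by
  set B := ({π : Fin m × Bool ≃ V × ZMod d | Set.InjOn (lw (inv π) k) P ∧
      ∃ w ∈ P, lw (inv π) k (a :: u) = lw (inv π) k w} : Finset _) with hB
  let hh : (Fin m × Bool ≃ V × ZMod d) → V × ZMod d := fun π => sh (a : ZMod d) (wk (inv π) k u)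
  let T : Finset ((_ : Fin m × Bool ≃ V × ZMod d) × (V × ZMod d)) :=
    B.sigma fun π => (insert (hh π) (seen (inv π) k P))ᶜ
  have hT : (#B : ℝ) * (2 * m - 2 * #P) ≤ #T := by
    rw [card_sigma, Nat.cast_sum, ← nsmul_eq_mul]
    refine card_nsmul_le_sum _ _ _ fun π hπ => ?_
    rw [card_compl, hm, Nat.cast_sub (by
      rw [← hm]; exact card_le_univ _)]
    have h1 := card_insert_le (hh π) (seen (inv π) k P)
    have h2 := card_seen_lt (inv π) k P hP.nil_mem
    have h3 : (#(insert (hh π) (seen (inv π) k P)) : ℝ) ≤ 2 * #P := by exact_mod_cast h1.trans h2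
    push_cast
    linarith
  have hw : ∀ π ∈ B, ∃ w ∈ P, lw (inv π) k (a :: u) = lw (inv π) k w := fun π hπ =>
    (mem_filter.1 hπ).2.2
  let wf : (Fin m × Bool ≃ V × ZMod d) → List ℕ := fun π =>
    if h : ∃ w ∈ P, lw (inv π) k (a :: u) = lw (inv π) k w then h.choose else []
  have hwf : ∀ π ∈ B, wf π ∈ P ∧ lw (inv π) k (a :: u) = lw (inv π) k (wf π) := fun π hπ => by
    simp only [wf, dif_pos (hw π hπ)]
    exact (hw π hπ).choose_spec
  let F : ((_ : Fin m × Bool ≃ V × ZMod d) × (V × ZMod d)) →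
      ((Fin m × Bool ≃ V × ZMod d) × (List ℕ × ZMod d)) := fun p =>
    (p.1.trans (Equiv.swap (inv p.1 (hh p.1)) p.2), (wf p.1, (inv p.1 (hh p.1)).2))
  have hcard : #T ≤ #((univ : Finset (Fin m × Bool ≃ V × ZMod d)) ×ˢ
      (P ×ˢ (univ : Finset (ZMod d)))) := by
    refine card_le_card_of_injOn F ?_ ?_
    · intro p hp
      have hp := mem_sigma.1 (mem_coe.1 hp)
      simp only [F, coe_product, Set.mem_prod, coe_univ, Set.mem_univ, true_and, and_true, mem_coe]
      exact (hwf _ hp.1).1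
    · have key : ∀ p ∈ T, wk (inv (F p).1) k u = wk (inv p.1) k u ∧
          inv p.1 (hh p.1) = (lw (inv (F p).1) k (F p).2.1, (F p).2.2) ∧
          p.2 = inv (F p).1 (sh (a : ZMod d) (wk (inv (F p).1) k u)) := by
        rintro ⟨π, g⟩ hp
        obtain ⟨hπ, hg⟩ := mem_sigma.1 hp
        simp only [mem_compl, mem_insert, not_or] at hg hπ
        have hinj := (mem_filter.1 hπ).2.1
        have hhn := step_notMem_seen π k hP hinj hu hv hau
        have hbn : inv π (hh π) ∉ seen (inv π) k P := fun hmem => hhn (by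
          have := seen_closed (inv_inv π) hmem
          rwa [inv_inv] at this)
        have hwk := wk_swap π k (inv π (hh π)) g hP hbn hg.2
        refine ⟨hwk u hu, ?_, ?_⟩
        · simp only [F]
          refine Prod.ext ?_ rfl
          simp only [lw, hwk _ (hwf π hπ).1]
          exact (hwf π hπ).2
        · simp only [F]
          rw [hwk u hu, inv_swap]
          change g = Equiv.swap _ _ (inv π (Equiv.swap _ _ (hh π)))
          rw [Equiv.swap_apply_of_ne_of_ne (inv_ne π (hh π)).symm (Ne.symm hg.1),
            Equiv.swap_apply_left]
      intro p hp q hq hpq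
      obtain ⟨h1, h2, h3⟩ := key p hp
      obtain ⟨h1', h2', h3'⟩ := key q hq
      rw [← hpq] at h2' h3'
      have hg : p.2 = q.2 := h3.trans h3'.symm
      have hb : inv p.1 (hh p.1) = inv q.1 (hh q.1) := h2.trans h2'.symm
      have h4 : (F p).1 = (F q).1 := congrArg Prod.fst hpq
      simp only [F, hb, hg] at h4
      have h5 : p.1 = q.1 := by
        ext1 x
        have := congrArg (fun e : Fin m × Bool ≃ V × ZMod d => e x) h4
        simpa using this
      exact Sigma.ext h5 (heq_of_eq hg)
  have h6 : #((univ : Finset (Fin m × Bool ≃ V × ZMod d)) ×ˢ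
      (P ×ˢ (univ : Finset (ZMod d)))) = (2 * m).factorial * (#P * d) := by
    rw [card_product, card_product, card_univ, card_univ, ZMod.card]
    congr 1
    have h7 : Fintype.card (Fin m × Bool) = 2 * m := by simp [mul_comm]
    rw [← h7]
    convert Fintype.card_equiv (Fintype.equivOfCardEq (h7.trans hm.symm))
  refine hT.trans ?_
  exact_mod_cast hcard.trans h6.le

lemma card_config {κ : Type*} [Fintype κ] [DecidableEq κ] {m : ℕ} (hm : Fintype.card κ = 2 * m) :
    Fintype.card (Fin m × Bool ≃ κ) = (2 * m).factorial := by
  have h7 : Fintype.card (Fin m × Bool) = 2 * m := by simp [mul_comm]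
  rw [← h7]
  convert Fintype.card_equiv (Fintype.equivOfCardEq (h7.trans hm.symm))

open Finset in
lemma exists_parent_erase {d : ℕ} {P : Finset (List ℕ)} (hP : IsSubtree d P)
    (h1 : 1 < #P) : ∃ a u, a :: u ∈ P ∧ IsSubtree d (P.erase (a :: u)) ∧ u ∈ P.erase (a :: u) := by
  obtain ⟨x, hx, hmax⟩ := exists_max_image P List.length ⟨_, hP.nil_mem⟩
  match x with
  | [] =>
    exfalso
    have h2 : P ⊆ {[]} := fun y hy => by
      have := hmax y hy
      simpa using this
    have := card_le_card h2
    simp at this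
    omega
  | a :: u =>
    refine ⟨a, u, hx, ⟨fun v hv => hP.valid v (mem_of_mem_erase hv), ?_, ?_⟩, ?_⟩
    · simp [hP.nil_mem]
    · intro b v hv
      have h3 := hP.parent_mem b v (mem_of_mem_erase hv)
      refine mem_erase.2 ⟨?_, h3⟩
      rintro rfl
      have := hmax _ (mem_of_mem_erase hv)
      simp at this
    · refine mem_erase.2 ⟨?_, hP.parent_mem a u hx⟩
      intro h
      have := congrArg List.length h
      simp at this

open Finset in
lemma card_not_injOn_le {V : Type*} {d m : ℕ} [NeZero d] [Fintype V] [DecidableEq V]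
    (hm : Fintype.card (V × ZMod d) = 2 * m) (k : V × ZMod d) {C : ℕ} (hC : 2 * C ≤ 2 * m) (c : ℕ) :
    ∀ {P : Finset (List ℕ)} (_ : IsSubtree d P) (_ : #P = c) (_ : c ≤ C),
    (#{π : Fin m × Bool ≃ V × ZMod d | ¬ Set.InjOn (lw (inv π) k) P} : ℝ) * (2 * m - 2 * C) ≤
      (2 * m).factorial * (c * (C * d)) := by
  have hpos : (0 : ℝ) ≤ 2 * m - 2 * C := by
    have : (2 * C : ℝ) ≤ 2 * m := by exact_mod_cast hC
    linarith
  induction c with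
  | zero =>
    intro P hP h0 _
    have := card_pos.2 ⟨_, hP.nil_mem⟩
    omega
  | succ c ih =>
    intro P hP hc hcC
    by_cases h1 : 1 < #P
    · obtain ⟨a, u, hau, hP', hu⟩ := exists_parent_erase hP h1
      have hc' : #(P.erase (a :: u)) = c := by rw [card_erase_of_mem hau]; omega
      have h2 := ih hP' hc' (by omega)
      have h3 := card_collision_le hm k hP' hu (hP.valid _ hau) (by simp)
      rw [hc'] at h3
      set P' := P.erase (a :: u) with hP'd
      have hsub : ({π : Fin m × Bool ≃ V × ZMod d | ¬ Set.InjOn (lw (inv π) k) P} : Finset _) ⊆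
          ({π : Fin m × Bool ≃ V × ZMod d | ¬ Set.InjOn (lw (inv π) k) P'} : Finset _) ∪
          ({π : Fin m × Bool ≃ V × ZMod d | Set.InjOn (lw (inv π) k) P' ∧
            ∃ w ∈ P', lw (inv π) k (a :: u) = lw (inv π) k w} : Finset _) := by
        intro π hπ
        simp only [mem_union, mem_filter, mem_univ, true_and] at hπ ⊢
        by_cases h4 : Set.InjOn (lw (inv π) k) P'
        · refine Or.inr ⟨h4, ?_⟩
          by_contra hcon
          push Not at hcon
          refine hπ ?_
          have h5 : (P : Set (List ℕ)) = insert (a :: u) (P' : Set (List ℕ)) := by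
            rw [← coe_insert, hP'd, insert_erase hau]
          rw [h5]
          refine (Set.injOn_insert (by simp [hP'd])).2 ⟨h4, ?_⟩
          rintro ⟨w, hw, hw'⟩
          exact hcon w hw hw'.symm
        · exact Or.inl h4
      have h6 := (card_le_card hsub).trans (card_union_le _ _)
      have h6' : (#{π : Fin m × Bool ≃ V × ZMod d | ¬ Set.InjOn (lw (inv π) k) P} : ℝ) ≤ _ :=
        (Nat.cast_le (α := ℝ)).2 h6
      rw [Nat.cast_add] at h6'
      refine (mul_le_mul_of_nonneg_right h6' hpos).trans ?_
      rw [add_mul]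
      have hcC' : (c : ℝ) ≤ C := by exact_mod_cast (by omega : c ≤ C)
      have h8 : (#{π : Fin m × Bool ≃ V × ZMod d | Set.InjOn (lw (inv π) k) P' ∧
            ∃ w ∈ P', lw (inv π) k (a :: u) = lw (inv π) k w} : ℝ) * (2 * m - 2 * C) ≤
          (2 * m).factorial * (C * d) := by
        refine le_trans ?_ (h3.trans ?_)
        · gcongr
        · gcongr
      push_cast
      calc _ ≤ _ := add_le_add h2 h8
        _ = _ := by ring
    · have h2 : P = {[]} := by
        refine (eq_of_subset_of_card_le (singleton_subset_iff.2 hP.nil_mem) ?_).symm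
        simpa using h1
      subst h2
      simp
      positivity

/-- The words of the ball of radius `s`. -/
def ballW (d s : ℕ) : Finset (List ℕ) := (finite_validTd d s).toFinset

lemma mem_ballW {d s : ℕ} {u : List ℕ} : u ∈ ballW d s ↔ ValidTd d u ∧ u.length ≤ s := by
  simp [ballW]

lemma ballW_isSubtree (d s : ℕ) : IsSubtree d (ballW d s) where
  valid u hu := (mem_ballW.1 hu).1
  nil_mem := mem_ballW.2 ⟨validTd_nil d, by simp⟩
  parent_mem a u h := by
    rw [mem_ballW, validTd_cons] at h
    rw [mem_ballW]
    exact ⟨h.1.1, by have := h.2; simp at this; omega⟩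

/-- The half-edges from which the ball of radius `s` is not a tree. -/
def nonTree {V : Type*} {d : ℕ} [NeZero d] [Fintype V] (s : ℕ) (ι : V × ZMod d → V × ZMod d) :
    Finset (V × ZMod d) := {k | ¬ Set.InjOn (lw ι k) (ballW d s)}

open Finset in
/-- On average, only boundedly many half-edges see a cycle. -/
lemma exists_sum_nonTree_le (d s : ℕ) [NeZero d] : ∃ C : ℕ, ∀ (V : Type) [Fintype V]
    [DecidableEq V] (m : ℕ), Fintype.card (V × ZMod d) = 2 * m →
    (∑ π : Fin m × Bool ≃ V × ZMod d, (#(nonTree s (inv π)) : ℝ)) ≤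
      C * (2 * m).factorial := by
  set c := #(ballW d s) with hc
  refine ⟨4 * c + 2 * (c * (c * d)), fun V _ _ m hm => ?_⟩
  have htriv : ∀ k : V × ZMod d, (#{π : Fin m × Bool ≃ V × ZMod d |
      ¬ Set.InjOn (lw (inv π) k) (ballW d s)} : ℝ) ≤ (2 * m).factorial := fun k => by
    rw [← card_config hm, ← card_univ]
    exact_mod_cast card_le_card (filter_subset _ _)
  have hswap : (∑ π : Fin m × Bool ≃ V × ZMod d, (#(nonTree s (inv π)) : ℝ)) =
      ∑ k : V × ZMod d, (#{π : Fin m × Bool ≃ V × ZMod d |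
        ¬ Set.InjOn (lw (inv π) k) (ballW d s)} : ℝ) := by
    simp only [nonTree, card_filter, Nat.cast_sum]
    rw [Finset.sum_comm]
    congr!
  rw [hswap]
  have hk : (#(univ : Finset (V × ZMod d)) : ℝ) = 2 * m := by rw [card_univ, hm]; push_cast; rfl
  by_cases hsmall : m < 2 * c
  · refine (sum_le_card_nsmul _ _ _ fun k _ => htriv k).trans ?_
    rw [nsmul_eq_mul, hk]
    have h1 : (m : ℝ) ≤ 2 * c := by exact_mod_cast hsmall.le
    push_cast
    gcongr
    nlinarith [show (0 : ℝ) ≤ c * (c * d) by positivity]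
  · push Not at hsmall
    have h2 : (2 * c : ℝ) ≤ m := by exact_mod_cast hsmall
    have hc0 : (1 : ℝ) ≤ c := by
      exact_mod_cast card_pos.2 ⟨_, (ballW_isSubtree d s).nil_mem⟩
    have hm0 : (0 : ℝ) < m := by linarith
    have h3 : ∀ k : V × ZMod d, (#{π : Fin m × Bool ≃ V × ZMod d |
      ¬ Set.InjOn (lw (inv π) k) (ballW d s)} : ℝ) ≤ (2 * m).factorial * (c * (c * d)) / m := by
      intro k
      rw [le_div_iff₀ hm0]
      refine le_trans ?_ (card_not_injOn_le hm k (C := c) (by omega) c (ballW_isSubtree d s)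
        rfl le_rfl)
      gcongr
      linarith
    refine (sum_le_card_nsmul _ _ _ fun k _ => h3 k).trans ?_
    rw [nsmul_eq_mul, hk]
    have h4 : 2 * (m : ℝ) * ((2 * m).factorial * (c * (c * d)) / m) =
        2 * (c * (c * d)) * (2 * m).factorial := by field_simp
    rw [h4]
    push_cast
    gcongr
    linarith

/-! ### The probability that a random matching gives a simple graph -/

/-- The half-edges lying on loops or multiple edges. -/
def badH {κ V : Type*} (p : κ → V) (ι : κ → κ) (h : κ) : Prop :=
  p (ι h) = p h ∨ ∃ h', h' ≠ h ∧ p h' = p h ∧ p (ι h') = p (ι h)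

/-- A matching without loops and multiple edges. -/
def simpleH {κ V : Type*} (p : κ → V) (ι : κ → κ) : Prop := ∀ h, ¬ badH p ι h

lemma badH_switch {κ V : Type*} (p : κ → V) (ι ι' : κ → κ) (hι : Function.Involutive ι)
    {h b g c : κ} (hbg : ι h = b) (hc : ι g = c)
    (h1 : ι' h = g) (h2 : ι' g = h) (h3 : ι' b = c) (h4 : ι' c = b)
    (h5 : ∀ e, e ≠ h → e ≠ b → e ≠ g → e ≠ c → ι' e = ι e)
    (hxy : p g ≠ p c) (d1 : p g ≠ p h) (d2 : p g ≠ p b) (d3 : p c ≠ p h) (d4 : p c ≠ p b)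
    (n1 : ∀ e, p e = p h → p (ι e) ≠ p g ∧ p (ι e) ≠ p c)
    (n2 : ∀ e, p e = p b → p (ι e) ≠ p g ∧ p (ι e) ≠ p c) (e : κ) (he : badH p ι' e) :
    badH p ι e ∧ e ≠ h := by
  have n3 : ∀ e, p e = p g → p (ι e) ≠ p h ∧ p (ι e) ≠ p b := fun e he =>
    ⟨fun h => (n1 (ι e) h).1 (by rw [hι]; exact he), fun h => (n2 (ι e) h).1 (by rw [hι]; exact he)⟩
  have n4 : ∀ e, p e = p c → p (ι e) ≠ p h ∧ p (ι e) ≠ p b := fun e he =>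
    ⟨fun h => (n1 (ι e) h).2 (by rw [hι]; exact he), fun h => (n2 (ι e) h).2 (by rw [hι]; exact he)⟩
  have key : ∀ e, e = h ∨ e = b ∨ e = g ∨ e = c ∨
      (e ≠ h ∧ e ≠ b ∧ e ≠ g ∧ e ≠ c ∧ ι' e = ι e) := fun e => by
    by_cases q1 : e = h
    · exact Or.inl q1
    by_cases q2 : e = b
    · exact Or.inr (Or.inl q2)
    by_cases q3 : e = g
    · exact Or.inr (Or.inr (Or.inl q3))
    by_cases q4 : e = c
    · exact Or.inr (Or.inr (Or.inr (Or.inl q4)))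
    exact Or.inr (Or.inr (Or.inr (Or.inr ⟨q1, q2, q3, q4, h5 e q1 q2 q3 q4⟩)))
  have hnb : ∀ e, (e = h ∨ e = b ∨ e = g ∨ e = c) → ¬ badH p ι' e := by
    rintro e he (hb | ⟨e', hne, hb1, hb2⟩)
    · grind
    · have k1 := n1 e'
      have k2 := n2 e'
      have k3 := n3 e'
      have k4 := n4 e'
      rcases he with rfl | rfl | rfl | rfl <;> rcases key e' with rfl | rfl | rfl | rfl | hk <;>
        grind
  have hn : ¬ (e = h ∨ e = b ∨ e = g ∨ e = c) := fun hh => hnb e hh he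
  push Not at hn
  refine ⟨?_, hn.1⟩
  have hee := h5 e hn.1 hn.2.1 hn.2.2.1 hn.2.2.2
  rcases he with hb | ⟨e', hne, hb1, hb2⟩
  · exact Or.inl (by rw [← hee]; exact hb)
  · right
    have k1 := n1 e
    have k2 := n2 e
    have k3 := n3 e
    have k4 := n4 e
    refine ⟨e', hne, hb1, ?_⟩
    rcases key e' with rfl | rfl | rfl | rfl | hk
    · grind
    · grind
    · grind
    · grind
    · rw [← hee, ← hb2, hk.2.2.2.2]

/-- The number of half-edges on loops or multiple edges. -/
def numBad {V : Type*} {d : ℕ} [NeZero d] [Fintype V] (ι : V × ZMod d → V × ZMod d) : ℕ :=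
  (Finset.univ.filter fun h => badH Prod.fst ι h).card

open Finset in
lemma numBad_le_nonTree {V : Type*} {d : ℕ} [NeZero d] [Fintype V] (hd : 2 ≤ d)
    (ι : V × ZMod d → V × ZMod d) : numBad ι ≤ #(nonTree 1 ι) := by
  refine card_le_card fun h hh => ?_
  simp only [nonTree, mem_filter, mem_univ, true_and] at hh ⊢
  have hw : ∀ a, 1 ≤ a → a ≤ d → [a] ∈ (ballW d 1 : Set (List ℕ)) := fun a h1 h2 => by
    rw [mem_coe, mem_ballW, validTd_cons]
    exact ⟨⟨validTd_nil d, h1, by simpa [maxLetter] using h2⟩, by simp⟩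
  have hdd : sh ((d : ℕ) : ZMod d) h = h := by rw [ZMod.natCast_self, sh_zero]
  intro hinj
  rcases hh with hb | ⟨h', hne, hb1, hb2⟩
  · have h1 : lw ι h [d] = lw ι h [] := by simpa [lw, wk, sh_zero] using hb
    have := hinj (hw d (by omega) le_rfl) (mem_coe.2 (ballW_isSubtree d 1).nil_mem) h1
    simp at this
  · have h2 : sh ((lt (h'.2 - h.2) : ℕ) : ZMod d) h = h' := by
      rw [cast_lt]
      exact Prod.ext hb1.symm (by simp [sh])
    have h1 : lw ι h [lt (h'.2 - h.2)] = lw ι h [d] := by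
      simp only [lw, wk, h2, hdd, hb2]
    have h3 := hinj (hw _ (one_le_lt _) (lt_le _)) (hw d (by omega) le_rfl) h1
    rw [List.cons.injEq] at h3
    rw [h3.1, hdd] at h2
    exact hne h2.symm

open Finset in
lemma exists_switch {V : Type*} {d m : ℕ} [NeZero d] [Fintype V] [DecidableEq V]
    (π : Fin m × Bool ≃ V × ZMod d) (hm : Fintype.card (V × ZMod d) = 2 * m)
    (hbig : numBad (inv π) + 4 * (d * (d + 1)) < 2 * m) (h0 : 0 < numBad (inv π)) :
    ∃ b g, numBad (inv (π.trans (Equiv.swap b g))) < numBad (inv π) := by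
  obtain ⟨h, hh⟩ := card_pos.1 h0
  set b := inv π h with hb
  let nb : V → Finset V := fun v =>
    insert v ((univ : Finset (ZMod d)).image fun i => (inv π (v, i)).1)
  have hnb : ∀ v, #(nb v) ≤ d + 1 := fun v =>
    (card_insert_le _ _).trans (Nat.add_le_add_right (card_image_le.trans_eq (by simp)) 1)
  have hnbm : ∀ e : V × ZMod d, (inv π e).1 ∈ nb e.1 := fun e =>
    mem_insert_of_mem (mem_image.2 ⟨e.2, mem_univ _, rfl⟩)
  let X : Finset (V × ZMod d) := (nb h.1 ∪ nb b.1) ×ˢ univ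
  have hX : #X ≤ 2 * (d * (d + 1)) := by
    rw [card_product, card_univ, ZMod.card]
    have := (card_union_le (nb h.1) (nb b.1)).trans (Nat.add_le_add (hnb _) (hnb _))
    calc _ ≤ _ := Nat.mul_le_mul_right d this
      _ = _ := by ring
  have hex : ∃ g, g ∉ (univ.filter fun h => badH Prod.fst (inv π) h) ∪ (X ∪ X.image (inv π)) := by
    by_contra hcon
    push Not at hcon
    have h1 := card_le_card (fun x _ => hcon x : (univ : Finset (V × ZMod d)) ⊆ _)
    have h2 := card_union_le (univ.filter fun h => badH Prod.fst (inv π) h) (X ∪ X.image (inv π))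
    have h3 := card_union_le X (X.image (inv π))
    have h4 := card_image_le (s := X) (f := inv π)
    rw [card_univ, hm] at h1
    unfold numBad at hbig
    omega
  obtain ⟨g, hg⟩ := hex
  simp only [mem_union, not_or, mem_filter, mem_univ, true_and] at hg
  obtain ⟨hg1, hg2, hg3⟩ := hg
  have hg2' : g.1 ∉ nb h.1 ∪ nb b.1 := fun hmem => hg2 (mem_product.2 ⟨hmem, mem_univ _⟩)
  have hg3' : (inv π g).1 ∉ nb h.1 ∪ nb b.1 := fun hmem =>
    hg3 (mem_image.2 ⟨inv π g, mem_product.2 ⟨hmem, mem_univ _⟩, inv_inv π g⟩)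
  simp only [mem_union, not_or] at hg2' hg3'
  have self : ∀ v, v ∈ nb v := fun v => mem_insert_self _ _
  have d1 : g.1 ≠ h.1 := fun h => hg2'.1 (h ▸ self _)
  have d2 : g.1 ≠ b.1 := fun h => hg2'.2 (h ▸ self _)
  have d3 : (inv π g).1 ≠ h.1 := fun h => hg3'.1 (h ▸ self _)
  have d4 : (inv π g).1 ≠ b.1 := fun h => hg3'.2 (h ▸ self _)
  have hbh : inv π b = h := inv_inv π h
  have ne1 : h ≠ b := (inv_ne π h).symm
  have ne2 : h ≠ g := fun h => d1 (congrArg Prod.fst h.symm)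
  have ne3 : b ≠ g := fun h => d2 (congrArg Prod.fst h.symm)
  have ne4 : inv π g ≠ b := fun h => d4 (congrArg Prod.fst h)
  have ne5 : inv π g ≠ g := inv_ne π g
  have n1 : ∀ e : V × ZMod d, e.1 = h.1 → (inv π e).1 ≠ g.1 ∧ (inv π e).1 ≠ (inv π g).1 :=
    fun e he => ⟨fun h' => hg2'.1 (h' ▸ he ▸ hnbm e), fun h' => hg3'.1 (h' ▸ he ▸ hnbm e)⟩
  have n2 : ∀ e : V × ZMod d, e.1 = b.1 → (inv π e).1 ≠ g.1 ∧ (inv π e).1 ≠ (inv π g).1 :=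
    fun e he => ⟨fun h' => hg2'.2 (h' ▸ he ▸ hnbm e), fun h' => hg3'.2 (h' ▸ he ▸ hnbm e)⟩
  have key : ∀ e, badH Prod.fst (inv (π.trans (Equiv.swap b g))) e →
      badH Prod.fst (inv π) e ∧ e ≠ h := fun e he => by
    refine badH_switch Prod.fst (inv π) _ (inv_inv π) (h := h) (b := b) (g := g) rfl rfl
      ?_ ?_ ?_ ?_ ?_ ?_ d1 d2 d3 d4 n1 n2 e he
    · rw [inv_swap, Equiv.swap_apply_of_ne_of_ne ne1 ne2, ← hb, Equiv.swap_apply_left]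
    · rw [inv_swap, Equiv.swap_apply_right, hbh, Equiv.swap_apply_of_ne_of_ne ne1 ne2]
    · rw [inv_swap, Equiv.swap_apply_left, Equiv.swap_apply_of_ne_of_ne ne4 ne5]
    · rw [inv_swap, Equiv.swap_apply_of_ne_of_ne ne4 ne5, inv_inv, Equiv.swap_apply_right]
    · intro e e1 e2 e3 e4
      rw [inv_swap, Equiv.swap_apply_of_ne_of_ne e2 e3, Equiv.swap_apply_of_ne_of_ne]
      · intro h'; exact e1 (by rw [← hbh, ← h', inv_inv])
      · intro h'; exact e4 (by rw [← h', inv_inv])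
    · intro h'; exact hg1 (Or.inl h'.symm)
  refine ⟨b, g, card_lt_card (ssubset_iff_of_subset (fun e he => ?_) |>.2 ⟨h, hh, fun he => ?_⟩)⟩
  · simp only [mem_filter, mem_univ, true_and] at he ⊢
    exact (key e he).1
  · exact (key h (by simpa using he)).2 rfl

open Finset in
lemma card_numBad_le_succ {V : Type*} {d m : ℕ} [NeZero d] [Fintype V] [DecidableEq V]
    (hm : Fintype.card (V × ZMod d) = 2 * m) (j : ℕ) (hbig : j + 1 + 4 * (d * (d + 1)) < 2 * m) :
    #{π : Fin m × Bool ≃ V × ZMod d | numBad (inv π) ≤ j + 1} ≤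
      #{π : Fin m × Bool ≃ V × ZMod d | numBad (inv π) ≤ j} * (1 + (2 * m) ^ 2) := by
  let F : ((Fin m × Bool ≃ V × ZMod d) × ((V × ZMod d) × (V × ZMod d))) →
    (Fin m × Bool ≃ V × ZMod d) := fun p => p.1.trans (Equiv.swap p.2.1 p.2.2)
  set S := ({π : Fin m × Bool ≃ V × ZMod d | numBad (inv π) ≤ j} : Finset _) with hS
  have hsub : ({π : Fin m × Bool ≃ V × ZMod d | numBad (inv π) ≤ j + 1} : Finset _) ⊆
      S ∪ (S ×ˢ univ).image F := by
    intro π hπ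
    simp only [mem_filter, mem_univ, true_and] at hπ
    by_cases h : numBad (inv π) ≤ j
    · exact mem_union_left _ (by simpa [hS] using h)
    · obtain ⟨b, g, hbg⟩ := exists_switch π hm (by omega) (by omega)
      refine mem_union_right _ (mem_image.2 ⟨(π.trans (Equiv.swap b g), (b, g)), ?_, ?_⟩)
      · refine mem_product.2 ⟨?_, mem_univ _⟩
        simp only [hS, mem_filter, mem_univ, true_and]
        omega
      · ext1 x
        simp [F]
  refine (card_le_card hsub).trans ((card_union_le _ _).trans ?_)
  have h1 : #((S ×ˢ (univ : Finset ((V × ZMod d) × (V × ZMod d)))).image F) ≤ #S * (2 * m) ^ 2 := by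
    refine card_image_le.trans_eq ?_
    rw [card_product, card_univ, Fintype.card_prod, hm, sq]
  calc _ ≤ #S + #S * (2 * m) ^ 2 := Nat.add_le_add_left h1 _
    _ = _ := by ring

open Finset in
/-- A random matching of half-edges gives a simple graph with at least polynomial probability. -/
lemma exists_card_simple_ge (d : ℕ) [NeZero d] (hd : 2 ≤ d) : ∃ C m₀ : ℕ, ∀ (V : Type) [Fintype V]
    [DecidableEq V] (m : ℕ), m₀ ≤ m → Fintype.card (V × ZMod d) = 2 * m →
    (2 * m).factorial ≤ 2 * (1 + (2 * m) ^ 2) ^ C *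
      #{π : Fin m × Bool ≃ V × ZMod d | simpleH Prod.fst (inv π)} := by
  obtain ⟨C, hC⟩ := exists_sum_nonTree_le d 1
  refine ⟨2 * C, 2 * C + 4 * (d * (d + 1)) + 1, fun V _ _ m hm0 hm => ?_⟩
  have h1 : ∀ j ≤ 2 * C, #{π : Fin m × Bool ≃ V × ZMod d | numBad (inv π) ≤ j} ≤
      #{π : Fin m × Bool ≃ V × ZMod d | numBad (inv π) ≤ 0} * (1 + (2 * m) ^ 2) ^ j := by
    intro j
    induction j with
    | zero => intro _; simp
    | succ j ih =>
      intro hj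
      refine (card_numBad_le_succ hm j (by omega)).trans ?_
      rw [pow_succ _ j, ← mul_assoc]
      exact Nat.mul_le_mul_right _ (ih (by omega))
  have h2 : #{π : Fin m × Bool ≃ V × ZMod d | numBad (inv π) ≤ 0} =
      #{π : Fin m × Bool ≃ V × ZMod d | simpleH Prod.fst (inv π)} := by
    congr 1
    ext π
    simp [numBad, simpleH, filter_eq_empty_iff]
  have h3 : #{π : Fin m × Bool ≃ V × ZMod d | ¬ numBad (inv π) ≤ 2 * C} * (2 * C + 1) ≤
      C * (2 * m).factorial := by
    have h4 : (#{π : Fin m × Bool ≃ V × ZMod d | ¬ numBad (inv π) ≤ 2 * C} : ℝ) * (2 * C + 1) ≤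
        C * (2 * m).factorial := by
      refine le_trans ?_ (hC V m hm)
      refine le_trans ?_ (sum_le_sum_of_subset_of_nonneg (filter_subset
        (fun π : Fin m × Bool ≃ V × ZMod d => ¬ numBad (inv π) ≤ 2 * C) univ)
        fun _ _ _ => Nat.cast_nonneg _)
      rw [← nsmul_eq_mul]
      refine card_nsmul_le_sum _ _ _ fun π hπ => ?_
      have h5 := (mem_filter.1 hπ).2
      have h6 := numBad_le_nonTree hd (inv π)
      exact_mod_cast (by omega : 2 * C + 1 ≤ #(nonTree 1 (inv π)))
    exact_mod_cast h4
  have h5 : #{π : Fin m × Bool ≃ V × ZMod d | numBad (inv π) ≤ 2 * C} +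
      #{π : Fin m × Bool ≃ V × ZMod d | ¬ numBad (inv π) ≤ 2 * C} = (2 * m).factorial := by
    rw [card_filter_add_card_filter_not, card_univ, card_config hm]
  have h6 := h1 _ le_rfl
  rw [h2] at h6
  have h7 : (2 * m).factorial ≤ 2 * #{π : Fin m × Bool ≃ V × ZMod d | numBad (inv π) ≤ 2 * C} := by
    nlinarith [Nat.zero_le C]
  calc _ ≤ _ := h7
    _ ≤ 2 * _ := Nat.mul_le_mul_left 2 h6
    _ = _ := by ring

/-! ### Uniform matchings and uniform regular graphs -/

/-- The graph obtained from a matching of half-edges. -/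
def hGraph {κ V : Type*} (p : κ → V) (ι : κ → κ) : SimpleGraph V :=
  SimpleGraph.fromRel fun v w => ∃ h, p h = v ∧ p (ι h) = w

lemma hGraph_adj {κ V : Type*} {p : κ → V} {ι : κ → κ} (hι : Function.Involutive ι)
    (hs : simpleH p ι) {v w : V} : (hGraph p ι).Adj v w ↔ ∃ h, p h = v ∧ p (ι h) = w := by
  rw [hGraph, SimpleGraph.fromRel_adj]
  constructor
  · rintro ⟨-, h | ⟨h, h1, h2⟩⟩
    · exact h
    · exact ⟨ι h, h2, by rw [hι, h1]⟩
  · rintro ⟨h, h1, h2⟩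
    refine ⟨fun hvw => hs h (Or.inl ?_), Or.inl ⟨h, h1, h2⟩⟩
    rw [h1, h2, hvw]

lemma simpleH.eq {κ V : Type*} {p : κ → V} {ι : κ → κ} (hs : simpleH p ι) {h h' : κ}
    (h1 : p h = p h') (h2 : p (ι h) = p (ι h')) : h = h' := by
  by_contra hne
  exact hs h' (Or.inr ⟨h, hne, h1, h2⟩)

lemma exists_conj_of_hGraph_eq {κ V : Type*} [Finite κ] {p : κ → V} {ι₁ ι₂ : κ → κ}
    (hι₁ : Function.Involutive ι₁) (hι₂ : Function.Involutive ι₂) (hs₁ : simpleH p ι₁)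
    (hs₂ : simpleH p ι₂) (hG : hGraph p ι₁ = hGraph p ι₂) :
    ∃ σ : Equiv.Perm κ, (∀ h, p (σ h) = p h) ∧ ∀ h, ι₂ (σ h) = σ (ι₁ h) := by
  have hex : ∀ h, ∃ h', p h' = p h ∧ p (ι₂ h') = p (ι₁ h) := fun h => by
    rw [← hGraph_adj hι₂ hs₂, ← hG, hGraph_adj hι₁ hs₁]
    exact ⟨h, rfl, rfl⟩
  choose f hf1 hf2 using hex
  have hinj : Function.Injective f := fun h h' hh => by
    refine hs₁.eq ?_ ?_
    · rw [← hf1 h, hh, hf1]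
    · rw [← hf2 h, hh, hf2]
  refine ⟨Equiv.ofBijective f (Finite.injective_iff_bijective.1 hinj), hf1, fun h => ?_⟩
  change ι₂ (f h) = f (ι₁ h)
  refine hs₂.eq ?_ ?_
  · rw [hf1, hf2]
  · rw [hι₂, hf1, hf2, hι₁]

lemma simpleH_conj {κ V : Type*} {p : κ → V} {ι₁ ι₂ : κ → κ} {σ : Equiv.Perm κ}
    (h1 : ∀ h, p (σ h) = p h) (h2 : ∀ h, ι₂ (σ h) = σ (ι₁ h)) (hs : simpleH p ι₁) :
    simpleH p ι₂ := by
  intro h hb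
  obtain ⟨k, rfl⟩ := σ.surjective h
  refine hs k ?_
  rcases hb with hb | ⟨h', hne, hb1, hb2⟩
  · rw [h2, h1, h1] at hb
    exact Or.inl hb
  · obtain ⟨k', rfl⟩ := σ.surjective h'
    rw [h2, h2, h1, h1] at hb2
    rw [h1, h1] at hb1
    exact Or.inr ⟨k', fun h => hne (by rw [h]), hb1, hb2⟩

lemma hGraph_conj {κ V : Type*} {p : κ → V} {ι₁ ι₂ : κ → κ} {σ : Equiv.Perm κ}
    (h1 : ∀ h, p (σ h) = p h) (h2 : ∀ h, ι₂ (σ h) = σ (ι₁ h)) : hGraph p ι₁ = hGraph p ι₂ := by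
  unfold hGraph
  congr 1
  ext v w
  rw [← σ.exists_congr_right (q := fun h => p h = v ∧ p (ι₂ h) = w)]
  refine exists_congr fun h => ?_
  rw [h2, h1, h1]

lemma inv_conj {κ : Type*} {m : ℕ} (π : Fin m × Bool ≃ κ) (σ : Equiv.Perm κ)
    (c : Equiv.Perm (Fin m × Bool)) (hc : ∀ s, c (flipB m s) = flipB m (c s)) (h : κ) :
    inv ((c.trans π).trans σ) (σ h) = σ (inv π h) := by
  simp only [inv, Equiv.trans_apply, Equiv.symm_trans_apply, Equiv.symm_apply_apply, hc,
    Equiv.apply_symm_apply]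

open Finset in
/-- All graphs arise from the same number of matchings. -/
lemma card_hGraph_eq {κ V : Type*} [Fintype κ] [DecidableEq κ] {m : ℕ} (p : κ → V)
    (π₁ : Fin m × Bool ≃ κ) (hs : simpleH p (inv π₁)) :
    #{π : Fin m × Bool ≃ κ | simpleH p (inv π) ∧ hGraph p (inv π) = hGraph p (inv π₁)} =
      #{x : Equiv.Perm κ × Equiv.Perm (Fin m × Bool) | (∀ h, p (x.1 h) = p h) ∧
        ∀ s, x.2 (flipB m s) = flipB m (x.2 s)} := by
  symm
  refine card_bij (fun x _ => (x.2.trans π₁).trans x.1) ?_ ?_ ?_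
  · rintro ⟨σ, c⟩ hx
    simp only [mem_filter, mem_univ, true_and] at hx ⊢
    exact ⟨simpleH_conj hx.1 (inv_conj π₁ σ c hx.2) hs, (hGraph_conj hx.1
      (inv_conj π₁ σ c hx.2)).symm⟩
  · rintro ⟨σ, c⟩ hx ⟨σ', c'⟩ hx' heq
    simp only [mem_filter, mem_univ, true_and] at hx hx'
    have h1 := inv_conj π₁ σ c hx.2
    have h2 := inv_conj π₁ σ' c' hx'.2
    simp only at heq
    rw [heq] at h1
    have hσ : σ = σ' := by
      ext1 h
      have hs' := simpleH_conj hx'.1 h2 hs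
      refine hs'.eq (by rw [hx.1, hx'.1]) ?_
      rw [h1, h2, hx.1, hx'.1]
    subst hσ
    refine Prod.ext rfl ?_
    ext1 s
    have := congrArg (fun e : Fin m × Bool ≃ κ => e s) heq
    simpa using this
  · intro π hπ
    simp only [mem_filter, mem_univ, true_and] at hπ
    obtain ⟨σ, h1, h2⟩ := exists_conj_of_hGraph_eq (inv_inv π₁) (inv_inv π) hs hπ.1 hπ.2.symm
    refine ⟨(σ, (π.trans σ.symm).trans π₁.symm), ?_, ?_⟩
    · simp only [mem_filter, mem_univ, true_and]
      refine ⟨h1, fun s => ?_⟩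
      have h3 := h2 (σ.symm (π s))
      simp only [Equiv.apply_symm_apply, inv_apply] at h3
      simp only [Equiv.trans_apply, flipB_apply]
      rw [Equiv.symm_apply_eq, Equiv.symm_apply_eq, h3, inv]
      simp
    · ext1 s
      simp

/-- Every matching arises from a configuration. -/
lemma exists_inv_eq {κ : Type*} [Fintype κ] [DecidableEq κ] {m : ℕ}
    (hm : Fintype.card κ = 2 * m) (τ : κ → κ) (hτ : Function.Involutive τ) (hfp : ∀ h, τ h ≠ h) :
    ∃ π : Fin m × Bool ≃ κ, inv π = τ := by
  have h7 : Fintype.card (Fin m × Bool) = 2 * m := by simp [mul_comm]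
  let e : Fin m × Bool ≃ κ := Fintype.equivOfCardEq (h7.trans hm.symm)
  have key : ∀ t : Equiv.Perm κ, (∀ h, t (t h) = h) → (∀ h, t h ≠ h) →
      t.cycleType = Multiset.replicate m 2 := fun t h1 h2 => by
    have h3 : ∀ c ∈ t.cycleType, c = 2 := by
      rw [← Equiv.Perm.pow_prime_eq_one_iff]
      ext h
      rw [sq, Equiv.Perm.mul_apply, h1]; rfl
    have h4 := Multiset.eq_replicate_card.2 h3
    have h5 := Equiv.Perm.sum_cycleType t
    have h6 : t.support = Finset.univ := by
      ext h; simp [h2]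
    rw [h4, Multiset.sum_replicate, h6, Finset.card_univ, hm, smul_eq_mul] at h5
    rw [h4]
    congr 1
    omega
  have hc : IsConj ((e.symm.trans (flipB m)).trans e : Equiv.Perm κ) (hτ.toPerm τ) := by
    rw [Equiv.Perm.isConj_iff_cycleType_eq, key, key]
    · exact hτ
    · exact hfp
    · intro h
      simp
    · exact inv_ne e
  obtain ⟨c, hc⟩ := isConj_iff.1 hc
  refine ⟨e.trans c, ?_⟩
  ext1 h
  have h1 := congrArg (fun t : Equiv.Perm κ => t h) hc
  simp only [Equiv.Perm.mul_apply, Equiv.trans_apply] at h1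
  change c (e (flipB m (e.symm (c.symm h)))) = τ h
  exact h1

lemma exists_config_of_regular {V : Type*} [Fintype V] [DecidableEq V] {d m : ℕ} [NeZero d]
    (hm : Fintype.card (V × ZMod d) = 2 * m) (G : SimpleGraph V)
    (hG : ∀ v, (G.neighborSet v).ncard = d) :
    ∃ π : Fin m × Bool ≃ V × ZMod d, simpleH Prod.fst (inv π) ∧ hGraph Prod.fst (inv π) = G := by
  have he : ∀ v, Nonempty (ZMod d ≃ G.neighborSet v) := fun v => by
    rw [← Fintype.card_eq, ZMod.card, ← Nat.card_eq_fintype_card]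
    exact (hG v).symm
  let e : ∀ v, ZMod d ≃ G.neighborSet v := fun v => (he v).some
  let τ : V × ZMod d → V × ZMod d := fun h =>
    ((e h.1 h.2 : V), (e (e h.1 h.2 : V)).symm ⟨h.1, (e h.1 h.2).2.symm⟩)
  have hadj : ∀ h, G.Adj h.1 (τ h).1 := fun h => (e h.1 h.2).2
  have huniq : ∀ h h' : V × ZMod d, h.1 = h'.1 → (τ h).1 = (τ h').1 → h = h' := by
    rintro ⟨v, i⟩ ⟨v', i'⟩ h1 h2
    obtain rfl : v = v' := h1
    exact Prod.ext rfl ((e v).injective (Subtype.ext h2))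
  have hτ1 : ∀ h, (τ (τ h)).1 = h.1 := fun h => by simp [τ]
  have hτ : Function.Involutive τ := fun h => by
    refine huniq _ _ (hτ1 h) ?_
    rw [hτ1]
  obtain ⟨π, hπ⟩ := exists_inv_eq hm τ hτ fun h hh => (hadj h).ne (congrArg Prod.fst hh).symm
  rw [← hπ] at hadj huniq
  have hs : simpleH Prod.fst (inv π) := by
    rintro h (hb | ⟨h', hne, hb1, hb2⟩)
    · exact (hadj h).ne hb.symm
    · exact hne (huniq _ _ hb1 hb2)
  refine ⟨π, hs, ?_⟩
  ext v w
  rw [hGraph_adj (inv_inv π) hs]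
  constructor
  · rintro ⟨h, rfl, rfl⟩
    exact hadj h
  · intro h
    refine ⟨(v, (e v).symm ⟨w, h⟩), rfl, ?_⟩
    rw [hπ]
    simp [τ]

lemma hGraph_regular {n d : ℕ} [NeZero d] {ι : Fin n × ZMod d → Fin n × ZMod d}
    (hι : Function.Involutive ι) (hs : simpleH Prod.fst ι) :
    hGraph Prod.fst ι ∈ regularGraphs d n := by
  intro v
  have h1 : (hGraph Prod.fst ι).neighborSet v = Set.range fun i : ZMod d => (ι (v, i)).1 := by
    ext w
    rw [SimpleGraph.mem_neighborSet, hGraph_adj hι hs]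
    constructor
    · rintro ⟨⟨v', i⟩, h1, h2⟩
      obtain rfl : v' = v := h1
      exact ⟨i, h2⟩
    · rintro ⟨i, hi⟩
      exact ⟨_, rfl, hi⟩
  rw [h1, ← Nat.card_coe_set_eq, Nat.card_range_of_injective, Nat.card_zmod]
  intro i j hij
  exact congrArg Prod.snd (hs.eq (h := (v, i)) (h' := (v, j)) rfl hij)

open Finset in
/-- Transfer from matchings to random regular graphs. -/
lemma PrG_mul_eq {n d m : ℕ} [NeZero d] (hm : n * d = 2 * m) (A : Set (SimpleGraph (Fin n))) :
    PrG d n A * #{π : Fin m × Bool ≃ Fin n × ZMod d | simpleH Prod.fst (inv π)} =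
      #{π : Fin m × Bool ≃ Fin n × ZMod d | simpleH Prod.fst (inv π) ∧
        hGraph Prod.fst (inv π) ∈ A} := by
  have hcard : Fintype.card (Fin n × ZMod d) = 2 * m := by simpa [ZMod.card] using hm
  set N := #{x : Equiv.Perm (Fin n × ZMod d) × Equiv.Perm (Fin m × Bool) |
    (∀ h, (x.1 h).1 = h.1) ∧ ∀ s, x.2 (flipB m s) = flipB m (x.2 s)} with hN
  have key : ∀ B : Set (SimpleGraph (Fin n)),
      #{π : Fin m × Bool ≃ Fin n × ZMod d | simpleH Prod.fst (inv π) ∧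
        hGraph Prod.fst (inv π) ∈ B} = (regularGraphs d n ∩ B).ncard * N := by
    intro B
    rw [Set.ncard_eq_toFinset_card', ← smul_eq_mul, ← sum_const]
    rw [card_eq_sum_card_fiberwise (f := fun π => hGraph Prod.fst (inv π))
      (t := (regularGraphs d n ∩ B).toFinset)]
    · refine sum_congr rfl fun G hG => ?_
      rw [Set.mem_toFinset] at hG
      obtain ⟨π₁, hs, rfl⟩ := exists_config_of_regular hcard G hG.1
      have hN' : N = _ := (by rw [hN]; congr! : N = _).trans (card_hGraph_eq Prod.fst π₁ hs).symm
      rw [hN', filter_filter]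
      congr 1
      ext π
      simp only [mem_filter, mem_univ, true_and]
      constructor
      · rintro ⟨⟨h1, -⟩, h2⟩; exact ⟨h1, h2⟩
      · rintro ⟨h1, h2⟩; exact ⟨⟨h1, by rw [h2]; exact hG.2⟩, h2⟩
    · intro π hπ
      simp only [coe_filter, mem_univ, true_and, Set.mem_ofPred_eq] at hπ
      rw [mem_coe, Set.mem_toFinset]
      exact ⟨hGraph_regular (inv_inv π) hπ.1, hπ.2⟩
  have h1 := key A
  have h2 := key Set.univ
  simp only [Set.mem_univ, and_true, Set.inter_univ] at h2
  rw [h1, h2, PrG]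
  by_cases h0 : ((regularGraphs d n).ncard : ℝ) = 0
  · have h3 : (regularGraphs d n).ncard = 0 := by exact_mod_cast h0
    have h4 : (regularGraphs d n ∩ A).ncard = 0 :=
      Nat.le_zero.1 ((Set.ncard_le_ncard Set.inter_subset_left).trans h3.le)
    simp [h3, h4]
  · push_cast
    field_simp

/-! ### Breadth-first search on tree-like balls -/

/-- The ball of radius `s` around `L []` is a tree parametrized by `L`. -/
structure TreeBall {V : Type*} (G : SimpleGraph V) (d s : ℕ) (L : List ℕ → V) : Prop where
  inj : Set.InjOn L (ballW d s)
  adj : ∀ u, ValidTd d u → u.length < s → ∀ w, G.Adj (L u) w ↔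
    ∃ u', ValidTd d u' ∧ WAdj u u' ∧ w = L u'

lemma WAdj.length_le {u w : List ℕ} (h : WAdj u w) : w.length ≤ u.length + 1 := by
  rcases h with ⟨i, rfl⟩ | ⟨i, rfl⟩ <;> simp
  omega

lemma treeBall_of_injOn {V : Type*} [Fintype V] [DecidableEq V] {d s : ℕ} [NeZero d]
    {ι : V × ZMod d → V × ZMod d} (hι : Function.Involutive ι) (hs : simpleH Prod.fst ι)
    {k : V × ZMod d} (hk : Set.InjOn (lw ι k) (ballW d s)) :
    TreeBall (hGraph Prod.fst ι) d s (lw ι k) := by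
  refine ⟨hk, fun u hu hus w => ?_⟩
  rw [hGraph_adj hι hs]
  have hfst : ∀ (a : ℕ) u, (sh (a : ZMod d) (wk ι k u)).1 = lw ι k u := fun _ _ => rfl
  constructor
  · rintro ⟨h, h1, rfl⟩
    set z := h.2 - (wk ι k u).2 with hz
    have hh : sh z (wk ι k u) = h := Prod.ext h1.symm (by simp [sh, hz])
    have hchild : ValidTd d (lt z :: u) → ∃ u', ValidTd d u' ∧ WAdj u u' ∧ (ι h).1 = lw ι k u' :=
      fun hv => ⟨_, hv, Or.inl ⟨_, rfl⟩, by rw [lw, wk, cast_lt, hh]⟩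
    match u, hu with
    | [], hu =>
      exact hchild (validTd_cons.2 ⟨hu, one_le_lt _, by simpa [maxLetter] using lt_le _⟩)
    | c :: u0, hu =>
      by_cases hz0 : z = 0
      · refine ⟨u0, (validTd_cons.1 hu).1, Or.inr ⟨c, rfl⟩, ?_⟩
        rw [hz0, sh_zero, wk] at hh
        rw [← hh, hι, hfst]
      · refine hchild (validTd_cons.2 ⟨hu, one_le_lt _, ?_⟩)
        have h2 := lt_le z
        have h3 : lt z ≠ d := fun h4 => hz0 (by rw [← cast_lt z, h4, ZMod.natCast_self])
        rw [maxLetter, if_neg (by simp)]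
        omega
  · rintro ⟨u', hu', ⟨i, rfl⟩ | ⟨i, rfl⟩, rfl⟩
    · exact ⟨sh (i : ZMod d) (wk ι k u), rfl, rfl⟩
    · exact ⟨wk ι k (i :: u'), rfl, by rw [wk, hι, hfst]⟩

lemma TreeBall.adj_iff {V : Type*} {G : SimpleGraph V} {d s : ℕ} {L : List ℕ → V}
    (h : TreeBall G d s L) {u w : List ℕ} (hu : u ∈ ballW d s) (hus : u.length < s)
    (hw : w ∈ ballW d s) : G.Adj (L u) (L w) ↔ WAdj u w := by
  rw [h.adj u (mem_ballW.1 hu).1 hus]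
  constructor
  · rintro ⟨u', h1, h2, h3⟩
    have h4 : w = u' := h.inj hw (mem_ballW.2 ⟨h1, h2.length_le.trans hus⟩) h3
    exact h4 ▸ h2
  · exact fun h1 => ⟨w, (mem_ballW.1 hw).1, h1, rfl⟩

lemma TreeBall.exists_of_walk {V : Type*} {G : SimpleGraph V} {d s : ℕ} {L : List ℕ → V}
    (h : TreeBall G d s L) {v w : V} (p : G.Walk w v) (hv : v = L []) (hp : p.length ≤ s) :
    ∃ u ∈ ballW d s, u.length ≤ p.length ∧ L u = w := by
  induction p with
  | nil => exact ⟨[], (ballW_isSubtree d s).nil_mem, by simp, hv.symm⟩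
  | cons hadj p ih =>
    rw [SimpleGraph.Walk.length_cons] at hp
    obtain ⟨u, hu, hul, hLu⟩ := ih hv (by omega)
    have h1 := hadj.symm
    rw [← hLu, h.adj u (mem_ballW.1 hu).1 (by omega)] at h1
    obtain ⟨u', h2, h3, h4⟩ := h1
    have h5 := h3.length_le
    refine ⟨u', mem_ballW.2 ⟨h2, by omega⟩, ?_, h4.symm⟩
    rw [SimpleGraph.Walk.length_cons]
    omega

lemma TreeBall.exists_walk {V : Type*} {G : SimpleGraph V} {d s : ℕ} {L : List ℕ → V}
    (h : TreeBall G d s L) (u : List ℕ) (hu : u ∈ ballW d s) :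
    ∃ p : G.Walk (L u) (L []), p.length = u.length := by
  induction u with
  | nil => exact ⟨.nil, rfl⟩
  | cons a u ih =>
    have h1 := (ballW_isSubtree d s).parent_mem a u hu
    obtain ⟨p, hp⟩ := ih h1
    have h2 := (mem_ballW.1 hu).2
    rw [List.length_cons] at h2
    exact ⟨.cons ((h.adj_iff h1 (by omega) hu).2 (Or.inl ⟨a, rfl⟩)).symm p, by simp [hp]⟩

lemma TreeBall.reachable {V : Type*} {G : SimpleGraph V} {d s : ℕ} {L : List ℕ → V}
    (h : TreeBall G d s L) {u : List ℕ} (hu : u ∈ ballW d s) : G.Reachable (L []) (L u) := by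
  obtain ⟨p, -⟩ := h.exists_walk u hu
  exact ⟨p.reverse⟩

lemma TreeBall.dist_eq {V : Type*} {G : SimpleGraph V} {d s : ℕ} {L : List ℕ → V}
    (h : TreeBall G d s L) {u : List ℕ} (hu : u ∈ ballW d s) : G.dist (L []) (L u) = u.length := by
  obtain ⟨p, hp⟩ := h.exists_walk u hu
  rw [SimpleGraph.dist_comm]
  refine _root_.le_antisymm (hp ▸ SimpleGraph.dist_le p) ?_
  obtain ⟨q, hq⟩ := (h.reachable hu).symm.exists_walk_length_eq_dist
  have h1 := SimpleGraph.dist_le p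
  have h2 := (mem_ballW.1 hu).2
  obtain ⟨u', hu', h3, h4⟩ := h.exists_of_walk q rfl (by omega)
  rw [h.inj hu' hu h4] at h3
  omega

lemma TreeBall.exists_of_dist_le {V : Type*} {G : SimpleGraph V} {d s : ℕ} {L : List ℕ → V}
    (h : TreeBall G d s L) {w : V} (hr : G.Reachable (L []) w) (hs : G.dist (L []) w ≤ s) :
    ∃ u ∈ ballW d s, u.length = G.dist (L []) w ∧ L u = w := by
  rw [SimpleGraph.dist_comm] at hs
  obtain ⟨q, hq⟩ := hr.symm.exists_walk_length_eq_dist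
  obtain ⟨u, hu, -, h4⟩ := h.exists_of_walk q rfl (by omega)
  exact ⟨u, hu, by rw [← h4, h.dist_eq hu], h4⟩

lemma bfsLayer_zero {n : ℕ} (G : SimpleGraph (Fin n)) (v : Fin n) (σ : Equiv.Perm (Fin n)) :
    bfsLayer G v σ 0 = [v] := rfl

lemma mem_bfsLayer_succ {n : ℕ} (G : SimpleGraph (Fin n)) (v : Fin n) (σ : Equiv.Perm (Fin n))
    (j : ℕ) (w : Fin n) :
    w ∈ bfsLayer G v σ (j + 1) ↔ G.Reachable v w ∧ G.dist v w = j + 1 := by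
  simp [bfsLayer]

lemma nodup_bfsLayer {n : ℕ} (G : SimpleGraph (Fin n)) (v : Fin n) (σ : Equiv.Perm (Fin n))
    (j : ℕ) : (bfsLayer G v σ j).Nodup := by
  cases j with
  | zero => simp [bfsLayer_zero]
  | succ j =>
    rw [bfsLayer]
    exact (List.mergeSort_perm _ _).nodup_iff.2 ((List.nodup_finRange n).filter _)

lemma pairwise_bfsLayer_succ {n : ℕ} (G : SimpleGraph (Fin n)) (v : Fin n)
    (σ : Equiv.Perm (Fin n)) (j : ℕ) :
    (bfsLayer G v σ (j + 1)).Pairwise fun a b =>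
      ((bfsLayer G v σ j).idxOf ((((bfsLayer G v σ j).find?
        (fun u => decide (G.Adj u a))).getD v))) * n + (σ a : ℕ) ≤
      ((bfsLayer G v σ j).idxOf ((((bfsLayer G v σ j).find?
        (fun u => decide (G.Adj u b))).getD v))) * n + (σ b : ℕ) := by
  rw [bfsLayer]
  refine (List.pairwise_mergeSort (fun a b c h1 h2 => ?_) (fun a b => ?_) _).imp fun h => ?_
  · simp only [decide_eq_true_eq] at h1 h2 ⊢
    omega
  · simp only [Bool.or_eq_true, decide_eq_true_eq]
    omega
  · simpa using h

lemma TreeBall.mem_bfsLayer {n : ℕ} {G : SimpleGraph (Fin n)} {d s : ℕ} {L : List ℕ → Fin n}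
    (h : TreeBall G d s L) (σ : Equiv.Perm (Fin n)) {j : ℕ} (hj : j ≤ s) (w : Fin n) :
    w ∈ bfsLayer G (L []) σ j ↔ ∃ u ∈ ballW d s, u.length = j ∧ L u = w := by
  have key : w ∈ bfsLayer G (L []) σ j ↔ G.Reachable (L []) w ∧ G.dist (L []) w = j := by
    cases j with
    | zero =>
      rw [bfsLayer_zero, List.mem_singleton]
      constructor
      · rintro rfl; simp
      · rintro ⟨h1, h2⟩; exact (h1.dist_eq_zero_iff.1 h2).symm
    | succ j => exact mem_bfsLayer_succ G _ σ j w
  rw [key]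
  constructor
  · rintro ⟨h1, h2⟩
    obtain ⟨u, hu, h3, h4⟩ := h.exists_of_dist_le h1 (by omega)
    exact ⟨u, hu, by omega, h4⟩
  · rintro ⟨u, hu, rfl, rfl⟩
    exact ⟨h.reachable hu, h.dist_eq hu⟩

lemma TreeBall.find_parent {n : ℕ} {G : SimpleGraph (Fin n)} {d s : ℕ} {L : List ℕ → Fin n}
    (h : TreeBall G d s L) (σ : Equiv.Perm (Fin n)) {a : ℕ} {u : List ℕ}
    (hau : a :: u ∈ ballW d s) :
    (bfsLayer G (L []) σ u.length).find? (fun x => decide (G.Adj x (L (a :: u)))) = some (L u) := by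
  have hu := (ballW_isSubtree d s).parent_mem a u hau
  have hlen := (mem_ballW.1 hau).2
  rw [List.length_cons] at hlen
  have h1 : ((bfsLayer G (L []) σ u.length).find?
      (fun x => decide (G.Adj x (L (a :: u))))).isSome := by
    rw [List.find?_isSome]
    refine ⟨L u, (h.mem_bfsLayer σ (by omega) _).2 ⟨u, hu, rfl, rfl⟩, ?_⟩
    rw [decide_eq_true_eq, h.adj_iff hu (by omega) hau]
    exact Or.inl ⟨a, rfl⟩
  obtain ⟨x, hx⟩ := Option.isSome_iff_exists.1 h1
  rw [hx]
  have h2 := List.find?_some hx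
  obtain ⟨w, hw, hwl, rfl⟩ := (h.mem_bfsLayer σ (by omega) _).1 (List.mem_of_find?_eq_some hx)
  rw [decide_eq_true_eq, h.adj_iff hw (by omega) hau] at h2
  rcases h2 with ⟨i, hi⟩ | ⟨i, hi⟩
  · rw [(List.cons.inj hi).2]
  · rw [hi] at hwl
    simp at hwl
    omega

open Finset in
/-- The rank of the child `a :: u` among the children of `u` ordered by `t`, starting from `1`. -/
def childRank (d : ℕ) (t : List ℕ → ℕ) (u : List ℕ) (a : ℕ) : ℕ :=
  1 + #{b ∈ Icc 1 (maxLetter d u) | t (b :: u) < t (a :: u)}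

lemma childRank_lt {d : ℕ} {t : List ℕ → ℕ} {u : List ℕ} {a b : ℕ}
    (ha : a ∈ Finset.Icc 1 (maxLetter d u)) (h : t (a :: u) < t (b :: u)) :
    childRank d t u a < childRank d t u b := by
  unfold childRank
  refine Nat.add_lt_add_left (Finset.card_lt_card ?_) _
  refine ⟨fun c hc => ?_, fun hc => ?_⟩
  · rw [Finset.mem_filter] at hc ⊢
    exact ⟨hc.1, hc.2.trans h⟩
  · have := hc (Finset.mem_filter.2 ⟨ha, h⟩)
    simp at this

lemma childRank_mem {d : ℕ} {t : List ℕ → ℕ} {u : List ℕ} {a : ℕ}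
    (ha : a ∈ Finset.Icc 1 (maxLetter d u)) :
    childRank d t u a ∈ Finset.Icc 1 (maxLetter d u) := by
  unfold childRank
  have h1 : (Finset.Icc 1 (maxLetter d u)).filter (fun b => t (b :: u) < t (a :: u)) ⊂
      Finset.Icc 1 (maxLetter d u) := by
    rw [Finset.filter_ssubset]
    exact ⟨a, ha, lt_irrefl _⟩
  have h2 := Finset.card_lt_card h1
  rw [Nat.card_Icc] at h2
  rw [Finset.mem_Icc]
  omega

/-- Letters at height less than `s` are relabelled by their rank, all others are kept. -/
def rankLetter (d s : ℕ) (t : List ℕ → ℕ) (u : List ℕ) (a : ℕ) : ℕ :=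
  if u.length < s then childRank d t u a else a

/-- A local inverse of `rankLetter`. -/
def unrankLetter (d s : ℕ) (t : List ℕ → ℕ) (u : List ℕ) : ℕ → ℕ :=
  Function.invFunOn (rankLetter d s t u) (Finset.Icc 1 (maxLetter d u))

lemma rankLetter_bijOn {d s : ℕ} {t : List ℕ → ℕ} (ht : Set.InjOn t (ballW d s)) {u : List ℕ}
    (hu : ValidTd d u) : Set.BijOn (rankLetter d s t u) (Finset.Icc 1 (maxLetter d u))
      (Finset.Icc 1 (maxLetter d u)) := by
  by_cases hus : u.length < s
  · have h0 : rankLetter d s t u = childRank d t u := by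
      funext a
      rw [rankLetter, if_pos hus]
    rw [h0]
    have hm : Set.MapsTo (childRank d t u) (Finset.Icc 1 (maxLetter d u))
        (Finset.Icc 1 (maxLetter d u)) := fun a ha => childRank_mem ha
    have hi : Set.InjOn (childRank d t u) (Finset.Icc 1 (maxLetter d u)) := by
      intro a ha b hb hab
      have hmem : ∀ c ∈ (Finset.Icc 1 (maxLetter d u) : Finset ℕ), c :: u ∈ ballW d s := by
        intro c hc
        rw [mem_ballW, validTd_cons, List.length_cons]
        exact ⟨⟨hu, Finset.mem_Icc.1 hc⟩, hus⟩
      rcases lt_trichotomy (t (a :: u)) (t (b :: u)) with h | h | h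
      · exact absurd hab (childRank_lt ha h).ne
      · exact (List.cons.inj (ht (hmem a ha) (hmem b hb) h)).1
      · exact absurd hab (childRank_lt hb h).ne'
    exact ⟨hm, hi, Finset.surjOn_of_injOn_of_card_le _ hm hi le_rfl⟩
  · have h0 : rankLetter d s t u = id := by
      funext a
      rw [rankLetter, if_neg hus, id]
    rw [h0]
    exact Set.bijOn_id _

/-- The automorphism of the tree relabelling the ball of radius `s` according to the order
`t`. -/
def rankAut {d s : ℕ} {t : List ℕ → ℕ} (ht : Set.InjOn t (ballW d s)) : TdAut d :=
  locAut (rankLetter d s t) (unrankLetter d s t)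
    (fun u a hu => by
      rw [validTd_cons, ← Finset.mem_Icc] at hu
      have h := rankLetter_bijOn ht hu.1
      refine ⟨validTd_cons.2 ⟨hu.1, Finset.mem_Icc.1 (h.mapsTo hu.2)⟩, ?_⟩
      exact h.injOn.leftInvOn_invFunOn hu.2)
    (fun u a hu => by
      rw [validTd_cons, ← Finset.mem_Icc] at hu
      have h := rankLetter_bijOn ht hu.1
      have h1 := h.surjOn hu.2
      exact ⟨validTd_cons.2 ⟨hu.1, Finset.mem_Icc.1 (Function.invFunOn_mem h1)⟩,
        Function.invFunOn_eq h1⟩)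

lemma rankAut_mem {d s : ℕ} {t : List ℕ → ℕ} (ht : Set.InjOn t (ballW d s)) :
    rankAut ht ∈ fixS d 0 := mem_fixS_zero.2 rfl

/-- The automorphism attached to an arbitrary order on the tree. -/
def orderAut (d s : ℕ) (t : List ℕ → ℕ) : TdAut d :=
  if ht : Set.InjOn t (ballW d s) then rankAut ht else 1

lemma orderAut_mem (d s : ℕ) (t : List ℕ → ℕ) : orderAut d s t ∈ fixS d 0 := by
  unfold orderAut
  split
  · exact rankAut_mem _
  · exact one_mem _

open Finset in
lemma length_filter_takeWhile {α : Type*} [DecidableEq α] (key : α → ℕ) (w : α) (q : α → Prop)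
    [DecidablePred q] (l : List α) (hn : l.Nodup) (hl : l.Pairwise fun a b => key a ≤ key b)
    (hw : w ∈ l) (hq : ∀ a ∈ l, q a → a ≠ w → key a ≠ key w) :
    ((l.takeWhile (fun x => decide (x ≠ w))).filter (fun x => decide (q x))).length =
      #{a ∈ l.toFinset | q a ∧ key a < key w} := by
  induction l with
  | nil => simp
  | cons x l ih =>
    rw [List.pairwise_cons] at hl
    rw [List.nodup_cons] at hn
    by_cases hxw : x = w
    · subst hxw
      rw [List.takeWhile_cons_of_neg (by simp), List.filter_nil, List.length_nil, eq_comm,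
        Finset.card_eq_zero, Finset.filter_eq_empty_iff]
      rintro a ha ⟨-, h2⟩
      rw [List.mem_toFinset, List.mem_cons] at ha
      rcases ha with rfl | ha
      · exact lt_irrefl _ h2
      · exact absurd (hl.1 a ha) (by omega)
    · have hwl : w ∈ l := (List.mem_cons.1 hw).resolve_left (Ne.symm hxw)
      rw [List.takeWhile_cons_of_pos (by simpa using hxw)]
      have ih' := ih hn.2 hl.2 hwl fun a ha => hq a (List.mem_cons_of_mem _ ha)
      rw [List.toFinset_cons, Finset.filter_insert]
      by_cases hqx : q x
      · have h1 := hl.1 w hwl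
        have h2 := hq x List.mem_cons_self hqx hxw
        rw [List.filter_cons_of_pos (by simpa using hqx), if_pos ⟨hqx, by omega⟩,
          Finset.card_insert_of_notMem (by simp [hn.1]), List.length_cons, ih']
      · rw [List.filter_cons_of_neg (by simpa using hqx), if_neg (fun h => hqx h.1), ih']

/-- The order induced on the ball of radius `s` of the tree by a tie-breaking priority. -/
def ballOrder {n : ℕ} (d s : ℕ) (L : List ℕ → Fin n) (σ : Equiv.Perm (Fin n)) (u : List ℕ) : ℕ :=
  if u ∈ ballW d s then (σ (L u) : ℕ) else 0

lemma TreeBall.injOn_ballOrder {n : ℕ} {G : SimpleGraph (Fin n)} {d s : ℕ} {L : List ℕ → Fin n}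
    (h : TreeBall G d s L) (σ : Equiv.Perm (Fin n)) :
    Set.InjOn (ballOrder d s L σ) (ballW d s) := by
  intro u hu w hw huw
  rw [ballOrder, ballOrder, if_pos (Finset.mem_coe.1 hu), if_pos (Finset.mem_coe.1 hw)] at huw
  exact h.inj hu hw (σ.injective (Fin.ext huw))

open Finset in
lemma TreeBall.childRank_eq {n : ℕ} {G : SimpleGraph (Fin n)} {d s : ℕ} {L : List ℕ → Fin n}
    (h : TreeBall G d s L) (σ : Equiv.Perm (Fin n)) {a : ℕ} {u : List ℕ}
    (hau : a :: u ∈ ballW d s) :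
    1 + (((bfsLayer G (L []) σ (u.length + 1)).takeWhile
        (fun w' => decide (w' ≠ L (a :: u)))).filter
      (fun w' => decide ((bfsLayer G (L []) σ u.length).find?
        (fun x => decide (G.Adj x w')) = some (L u)))).length =
      childRank d (ballOrder d s L σ) u a := by
  have hu := (ballW_isSubtree d s).parent_mem a u hau
  have hlen := (mem_ballW.1 hau).2
  rw [List.length_cons] at hlen
  rw [childRank, length_filter_takeWhile _ _ _ _ (nodup_bfsLayer G _ σ _)
    (pairwise_bfsLayer_succ G _ σ _)
    ((h.mem_bfsLayer σ hlen _).2 ⟨a :: u, hau, rfl, rfl⟩)]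
  · congr 1
    symm
    refine Finset.card_bij (fun b _ => L (b :: u)) ?_ ?_ ?_
    · intro b hb
      rw [Finset.mem_filter, Finset.mem_Icc] at hb
      have hbu : b :: u ∈ ballW d s :=
        mem_ballW.2 ⟨validTd_cons.2 ⟨(mem_ballW.1 hu).1, hb.1⟩, hlen⟩
      rw [Finset.mem_filter, List.mem_toFinset]
      refine ⟨(h.mem_bfsLayer σ hlen _).2 ⟨b :: u, hbu, rfl, rfl⟩, h.find_parent σ hbu, ?_⟩
      rw [h.find_parent σ hbu, h.find_parent σ hau]
      have h2 := hb.2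
      rw [ballOrder, ballOrder, if_pos hbu, if_pos hau] at h2
      omega
    · intro b hb c hc hbc
      rw [Finset.mem_filter, Finset.mem_Icc] at hb hc
      have hv := (mem_ballW.1 hu).1
      exact (List.cons.inj (h.inj (mem_ballW.2 ⟨validTd_cons.2 ⟨hv, hb.1⟩, hlen⟩)
        (mem_ballW.2 ⟨validTd_cons.2 ⟨hv, hc.1⟩, hlen⟩) hbc)).1
    · intro x hx
      rw [Finset.mem_filter, List.mem_toFinset] at hx
      obtain ⟨hx1, hx2, hx3⟩ := hx
      obtain ⟨w, hw, hwl, rfl⟩ := (h.mem_bfsLayer σ hlen _).1 hx1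
      cases w with
      | nil => simp at hwl
      | cons b w =>
        rw [List.length_cons, Nat.add_right_cancel_iff] at hwl
        have hfp := h.find_parent σ hw
        rw [hwl, hx2] at hfp
        have hwu : u = w := h.inj hu ((ballW_isSubtree d s).parent_mem b w hw)
          (Option.some.inj hfp)
        subst hwu
        refine ⟨b, ?_, rfl⟩
        rw [hx2, h.find_parent σ hau] at hx3
        rw [Finset.mem_filter, Finset.mem_Icc, ballOrder, ballOrder, if_pos hw, if_pos hau]
        exact ⟨(validTd_cons.1 (mem_ballW.1 hw).1).2, by omega⟩
  · intro x _ hx2 hx3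
    rw [hx2, h.find_parent σ hau]
    intro h4
    exact hx3 (σ.injective (Fin.ext (by omega)))

lemma TreeBall.bfsPathAux_eq {n : ℕ} {G : SimpleGraph (Fin n)} {d s : ℕ} {L : List ℕ → Fin n}
    (h : TreeBall G d s L) (σ : Equiv.Perm (Fin n)) (u : List ℕ) (hu : u ∈ ballW d s) :
    bfsPathAux G (L []) σ u.length (L u) =
      some (locW (rankLetter d s (ballOrder d s L σ)) u) := by
  induction u with
  | nil => simp [bfsPathAux, locW]
  | cons a u ih =>
    have hu' := (ballW_isSubtree d s).parent_mem a u hu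
    have hlen := (mem_ballW.1 hu).2
    rw [List.length_cons] at hlen
    rw [List.length_cons, bfsPathAux, h.find_parent σ hu]
    simp only []
    rw [ih hu', Option.map_some, locW, rankLetter, if_pos (by omega), ← h.childRank_eq σ hu]

lemma TreeBall.bfsPath_eq {n : ℕ} {G : SimpleGraph (Fin n)} {d s : ℕ} {L : List ℕ → Fin n}
    (h : TreeBall G d s L) (σ : Equiv.Perm (Fin n)) {u : List ℕ} (hu : u ∈ ballW d s) :
    bfsPath G (L []) σ (L u) = some (locW (rankLetter d s (ballOrder d s L σ)) u) := by
  rw [bfsPath, if_pos (h.reachable hu), h.dist_eq hu, h.bfsPathAux_eq σ u hu]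

lemma length_of_bfsPathAux {n : ℕ} (G : SimpleGraph (Fin n)) (v : Fin n)
    (σ : Equiv.Perm (Fin n)) (k : ℕ) (w : Fin n) (l : List ℕ)
    (h : bfsPathAux G v σ k w = some l) : l.length = k := by
  induction k generalizing w l with
  | zero =>
    rw [bfsPathAux] at h
    split_ifs at h
    simp at h
    simp [← h]
  | succ k ih =>
    rw [bfsPathAux] at h
    split at h
    · simp at h
    · obtain ⟨l', hl', rfl⟩ := Option.map_eq_some_iff.1 h
      rw [List.length_cons, ih _ _ hl']

lemma TreeBall.bfsPath_eq_some_iff {n : ℕ} {G : SimpleGraph (Fin n)} {d s : ℕ}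
    {L : List ℕ → Fin n} (h : TreeBall G d s L) (σ : Equiv.Perm (Fin n)) {l : List ℕ}
    (hl : l.length ≤ s) (w : Fin n) :
    bfsPath G (L []) σ w = some l ↔
      ∃ hv : ValidTd d l, w = L ((rankAut (h.injOn_ballOrder σ))⁻¹ ⟨l, hv⟩).1 := by
  set φ := rankAut (h.injOn_ballOrder σ) with hφ
  have hval : ∀ v : TdVertex d, v.1 ∈ ballW d s → bfsPath G (L []) σ (L v.1) = some (φ v).1 :=
    fun v hv => h.bfsPath_eq σ hv
  constructor
  · intro hw
    have hr : G.Reachable (L []) w := by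
      by_contra hr
      rw [bfsPath, if_neg hr] at hw
      simp at hw
    have hd : l.length = G.dist (L []) w := by
      rw [bfsPath, if_pos hr] at hw
      exact length_of_bfsPathAux G _ σ _ _ _ hw
    obtain ⟨u, hu, -, rfl⟩ := h.exists_of_dist_le hr (hd ▸ hl)
    have h1 := hval ⟨u, (mem_ballW.1 hu).1⟩ hu
    rw [hw, Option.some.injEq] at h1
    subst h1
    refine ⟨(φ ⟨u, (mem_ballW.1 hu).1⟩).2, ?_⟩
    exact congrArg (fun v : TdVertex d => L v.1)
      (RelIso.inv_apply_self φ ⟨u, (mem_ballW.1 hu).1⟩).symm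
  · rintro ⟨hv, rfl⟩
    let v : TdVertex d := ⟨l, hv⟩
    have hm : φ⁻¹ v ∈ SrSet d s := (map_mem_SrSet (inv_mem (rankAut_mem _))).2 hl
    refine (hval (φ⁻¹ v) (mem_ballW.2 ⟨(φ⁻¹ v).2, hm⟩)).trans ?_
    rw [RelIso.apply_inv_self]

lemma TreeBall.resS_bfsRCG {n : ℕ} {M : Type*} {G : SimpleGraph (Fin n)} {d s r : ℕ}
    {L : List ℕ → Fin n} (h : TreeBall G d s L) (hrs : r < s) (f : Fin n → M)
    (σ : Equiv.Perm (Fin n)) :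
    resS r (bfsRCG G f (L []) σ) =
      resS r (iotaTd d fun v => f (L ((orderAut d s (ballOrder d s L σ))⁻¹ v).1)) := by
  have hφ : orderAut d s (ballOrder d s L σ) = rankAut (h.injOn_ballOrder σ) := dif_pos _
  rw [hφ]
  set φ := rankAut (h.injOn_ballOrder σ) with hφ'
  have hiff := fun (l : List ℕ) (hl : l.length ≤ r) w =>
    h.bfsPath_eq_some_iff σ (hl.trans hrs.le) w
  refine RCG.ext ?_ ?_
  · funext l
    simp only [resS]
    split_ifs with hl
    · simp only [bfsRCG, iotaTd]
      by_cases hv : ValidTd d l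
      · have hex : ∃ w, bfsPath G (L []) σ w = some l := ⟨_, (hiff l hl _).2 ⟨hv, rfl⟩⟩
        rw [dif_pos hex, dif_pos hv]
        obtain ⟨hv', h1⟩ := (hiff l hl _).1 hex.choose_spec
        rw [h1]
      · have hex : ¬ ∃ w, bfsPath G (L []) σ w = some l := by
          rintro ⟨w, hw⟩
          exact hv ((hiff l hl w).1 hw).1
        rw [dif_neg hex, dif_neg hv]
    · rfl
  · funext p
    simp only [resS]
    split_ifs with hp
    · simp only [bfsRCG, iotaTd]
      refine if_congr ?_ rfl rfl
      have hmem : ∀ v : TdVertex d, v.1.length ≤ r → (φ⁻¹ v).1.length ≤ r := fun v hv =>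
        (map_mem_SrSet (r := r) (inv_mem (rankAut_mem _))).2 hv
      have hadj : ∀ v w : TdVertex d, v.1.length ≤ r → w.1.length ≤ r →
          (G.Adj (L (φ⁻¹ v).1) (L (φ⁻¹ w).1) ↔ (TdGraph d).Adj v w) := by
        intro v w hv hw
        rw [h.adj_iff (mem_ballW.2 ⟨(φ⁻¹ v).2, (hmem v hv).trans hrs.le⟩)
          ((hmem v hv).trans_lt hrs) (mem_ballW.2 ⟨(φ⁻¹ w).2, (hmem w hw).trans hrs.le⟩)]
        exact (φ⁻¹).map_rel_iff
      constructor
      · rintro ⟨w₁, w₂, h1, h2, h3⟩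
        obtain ⟨hv1, rfl⟩ := (hiff _ hp.1 _).1 h1
        obtain ⟨hv2, rfl⟩ := (hiff _ hp.2 _).1 h2
        exact ⟨hv1, hv2, (hadj ⟨_, hv1⟩ ⟨_, hv2⟩ hp.1 hp.2).1 h3⟩
      · rintro ⟨hv1, hv2, h3⟩
        exact ⟨_, _, (hiff _ hp.1 _).2 ⟨hv1, rfl⟩, (hiff _ hp.2 _).2 ⟨hv2, rfl⟩,
          (hadj ⟨_, hv1⟩ ⟨_, hv2⟩ hp.1 hp.2).2 h3⟩
    · rfl

lemma exists_perm_of_injOn {V T : Type*} [Fintype V] [DecidableEq V] {L L' : T → V}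
    {P : Finset T} (hL : Set.InjOn L P) (hL' : Set.InjOn L' P) :
    ∃ ρ : Equiv.Perm V, ∀ u ∈ P, ρ (L u) = L' u := by
  rcases P.eq_empty_or_nonempty with rfl | ⟨u₀, hu₀⟩
  · exact ⟨1, by simp⟩
  have : Nonempty T := ⟨u₀⟩
  have hinv : ∀ u ∈ P, Function.invFunOn L P (L u) = u := fun u hu =>
    hL.leftInvOn_invFunOn (Finset.mem_coe.2 hu)
  obtain ⟨g, hg⟩ := Finset.exists_equiv_extend_of_card_eq (α := V) (t := Finset.univ)
    (s := P.image L) (f := fun x => L' (Function.invFunOn L P x)) (by rw [Finset.card_univ])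
    (Finset.subset_univ _) (by
      intro x hx y hy hxy
      rw [Finset.mem_coe, Finset.mem_image] at hx hy
      obtain ⟨u, hu, rfl⟩ := hx
      obtain ⟨w, hw, rfl⟩ := hy
      simp only [hinv u hu, hinv w hw] at hxy
      rw [hL' hu hw hxy])
  refine ⟨g.trans (Equiv.subtypeUnivEquiv fun x => Finset.mem_univ x), fun u hu => ?_⟩
  have := hg (L u) (Finset.mem_image_of_mem _ hu)
  simp only [hinv u hu] at this
  exact this

/-- Averaging over the tie-breaking priorities does not depend on the tree-like root. -/
lemma sum_perm_ballOrder {n d s : ℕ} {L L' : List ℕ → Fin n} (hL : Set.InjOn L (ballW d s))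
    (hL' : Set.InjOn L' (ballW d s)) (F : (List ℕ → ℕ) → ℝ) :
    ∑ σ : Equiv.Perm (Fin n), F (ballOrder d s L' σ) =
      ∑ σ : Equiv.Perm (Fin n), F (ballOrder d s L σ) := by
  obtain ⟨ρ, hρ⟩ := exists_perm_of_injOn hL hL'
  rw [← Equiv.sum_comp (Equiv.mulRight ρ) fun σ => F (ballOrder d s L σ)]
  refine Finset.sum_congr rfl fun σ _ => congrArg F ?_
  funext u
  unfold ballOrder
  split_ifs with hu
  · rw [Equiv.coe_mulRight, Equiv.Perm.mul_apply, hρ u hu]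
  · rfl

lemma resS_resS {M : Type*} {j r : ℕ} (h : j ≤ r) (g : RCG M) : resS j (resS r g) = resS j g := by
  refine RCG.ext ?_ ?_
  · funext l
    simp only [resS]
    split_ifs <;> first | rfl | omega
  · funext p
    simp only [resS]
    split_ifs <;> first | rfl | omega

lemma summable_rcgDist {M : Type*} (a b : RCG M) : Summable
    (fun r : ℕ => if resS r a = resS r b then (0:ℝ) else (2:ℝ)⁻¹ ^ r) := by
  refine Summable.of_nonneg_of_le (fun r => ?_) (fun r => ?_)
    (summable_geometric_of_lt_one (by norm_num) (by norm_num : (2:ℝ)⁻¹ < 1))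
  all_goals split_ifs <;> first | exact le_rfl | positivity

lemma resS_eq_of_dist_lt {M : Type*} {r : ℕ} {g g' : RCG M} (h : dist g g' < (2:ℝ)⁻¹ ^ r) :
    resS r g = resS r g' := by
  by_contra hne
  refine absurd h (not_lt.2 ?_)
  have := (summable_rcgDist g g').le_tsum r fun j _ => by split_ifs <;> positivity
  rwa [if_neg hne] at this

lemma tsum_le_of_eq_zero {f : ℕ → ℝ} (hs : Summable f) (hf : ∀ j, f j ≤ (2:ℝ)⁻¹ ^ j) {r : ℕ}
    (h0 : ∀ j ≤ r, f j = 0) : ∑' j, f j ≤ (2:ℝ)⁻¹ ^ r := by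
  rw [← hs.sum_add_tsum_nat_add (r + 1), Finset.sum_eq_zero fun j hj =>
    h0 j (Nat.lt_succ_iff.1 (Finset.mem_range.1 hj)), zero_add]
  have h1 : HasSum (fun j : ℕ => (2:ℝ)⁻¹ ^ (j + (r + 1))) ((2:ℝ)⁻¹ ^ r) := by
    have h2 := (hasSum_geometric_of_lt_one (r := (2:ℝ)⁻¹) (by norm_num) (by norm_num)).mul_right
      ((2:ℝ)⁻¹ ^ (r + 1))
    simp_rw [← pow_add] at h2
    have h3 : (1 - (2:ℝ)⁻¹)⁻¹ * (2:ℝ)⁻¹ ^ (r + 1) = (2:ℝ)⁻¹ ^ r := by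
      rw [pow_succ, show (1 - (2:ℝ)⁻¹)⁻¹ = 2 by norm_num]
      ring
    rwa [h3] at h2
  rw [← h1.tsum_eq]
  exact Summable.tsum_le_tsum (fun j => hf _) ((summable_nat_add_iff (r + 1)).2 hs) h1.summable

lemma dist_le_of_resS_eq {M : Type*} {r : ℕ} {g g' : RCG M} (h : resS r g = resS r g') :
    dist g g' ≤ (2:ℝ)⁻¹ ^ r := by
  refine tsum_le_of_eq_zero (summable_rcgDist g g') (fun j => ?_) fun j hj => ?_
  · split_ifs
    · positivity
    · exact le_rfl
  · rw [← resS_resS hj g, h, resS_resS hj, if_pos rfl]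

/-- Sets of rooted colored graphs determined by the ball of radius `r`. -/
def Saturated {M : Type*} (r : ℕ) (B : Set (RCG M)) : Prop :=
  ∀ g g', resS r g = resS r g' → g ∈ B → g' ∈ B

lemma Saturated.mem_iff {M : Type*} {r : ℕ} {B : Set (RCG M)} (hB : Saturated r B) {g g' : RCG M}
    (h : resS r g = resS r g') : g ∈ B ↔ g' ∈ B := ⟨hB g g' h, hB g' g h.symm⟩

lemma Saturated.isOpen {M : Type*} {r : ℕ} {B : Set (RCG M)} (hB : Saturated r B) : IsOpen B := by
  rw [Metric.isOpen_iff]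
  intro g hg
  refine ⟨(2:ℝ)⁻¹ ^ r, by positivity, fun g' hg' => hB g g' ?_ hg⟩
  exact (resS_eq_of_dist_lt (Metric.mem_ball.1 hg')).symm

lemma resS_iotaTd {M : Type*} {d r : ℕ} {x x' : TdVertex d → M}
    (h : ∀ v ∈ SrSet d r, x v = x' v) : resS r (iotaTd d x) = resS r (iotaTd d x') := by
  refine RCG.ext ?_ rfl
  funext l
  simp only [resS, iotaTd]
  split_ifs with h1 h2
  · rw [h _ (show (⟨l, h2⟩ : TdVertex d) ∈ SrSet d r from h1)]
  · rfl
  · rfl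

lemma Saturated.cylS {M : Type*} {d r : ℕ} {B : Set (RCG M)} (hB : Saturated r B) :
    CylS r fun x : TdVertex d → M => iotaTd d x ∈ B :=
  fun _ _ h => propext (hB.mem_iff (resS_iotaTd h))

lemma measurable_iotaTd {M : Type*} [Finite M] [Nonempty M] [MeasurableSpace M]
    [DiscreteMeasurableSpace M] (d : ℕ) : Measurable (iotaTd (M := M) d) := by
  refine measurable_of_isOpen fun U hU => ?_
  have h1 : iotaTd (M := M) d ⁻¹' U =
      ⋃ r : ℕ, {x | iotaTd d x ∈ {g | ∀ g', resS r g = resS r g' → g' ∈ U}} := by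
    ext x
    rw [Set.mem_iUnion]
    constructor
    · intro hx
      obtain ⟨ε, hε, hb⟩ := Metric.isOpen_iff.1 hU _ hx
      obtain ⟨r, hr⟩ := exists_pow_lt_of_lt_one hε (by norm_num : (2:ℝ)⁻¹ < 1)
      refine ⟨r, fun g' hg' => hb ?_⟩
      rw [Metric.mem_ball, dist_comm]
      exact (dist_le_of_resS_eq hg').trans_lt hr
    · rintro ⟨r, hr⟩
      exact hr _ rfl
  rw [h1]
  refine MeasurableSet.iUnion fun r => ?_
  have hs : Saturated r {g : RCG M | ∀ g', resS r g = resS r g' → g' ∈ U} :=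
    fun g g' h hg g'' h' => hg g'' (h.trans h')
  exact measurableSet_setOfPred.2 hs.cylS.measurable

/-- The rooted colored graphs that agree with an element of `B` up to distance `r`. -/
def saturate {M : Type*} (r : ℕ) (B : Set (RCG M)) : Set (RCG M) :=
  {g | ∃ b ∈ B, resS r b = resS r g}

lemma saturated_saturate {M : Type*} (r : ℕ) (B : Set (RCG M)) : Saturated r (saturate r B) :=
  fun _ _ h ⟨b, hb, hbg⟩ => ⟨b, hb, hbg.trans h⟩

lemma subset_saturate {M : Type*} (r : ℕ) (B : Set (RCG M)) : B ⊆ saturate r B :=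
  fun b hb => ⟨b, hb, rfl⟩

lemma saturate_subset_thickening {M : Type*} {r : ℕ} {ε : ℝ} (h : (2:ℝ)⁻¹ ^ r < ε)
    (B : Set (RCG M)) : saturate r B ⊆ Metric.thickening ε B := by
  rintro g ⟨b, hb, hbg⟩
  rw [Metric.mem_thickening_iff]
  exact ⟨b, hb, by rw [dist_comm]; exact (dist_le_of_resS_eq hbg).trans_lt h⟩

/-- Averaged over the priorities, a tree-like root sees the tree up to automorphisms that do not
depend on the root. -/
lemma exists_aut_sum_bfsRCG {n d s : ℕ} [NeZero d] {ι : Fin n × ZMod d → Fin n × ZMod d}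
    (hι : Function.Involutive ι) (hs : simpleH Prod.fst ι) :
    ∃ ψ : Equiv.Perm (Fin n) → TdAut d, (∀ σ, ψ σ ∈ fixS d 0) ∧
      ∀ k ∉ nonTree s ι, ∀ r < s, ∀ (M : Type) (f : Fin n → M) (B : Set (RCG M)), Saturated r B →
        ∑ σ, (if bfsRCG (hGraph Prod.fst ι) f k.1 σ ∈ B then (1:ℝ) else 0) =
        ∑ σ, if iotaTd d (fun v => vw ι f k (ψ σ v)) ∈ B then (1:ℝ) else 0 := by
  have hnt : ∀ k, k ∉ nonTree s ι ↔ Set.InjOn (lw ι k) (ballW d s) := by simp [nonTree]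
  by_cases hex : ∃ k₀, k₀ ∉ nonTree s ι
  · obtain ⟨k₀, hk₀⟩ := hex
    rw [hnt] at hk₀
    refine ⟨fun σ => (orderAut d s (ballOrder d s (lw ι k₀) σ))⁻¹,
      fun σ => inv_mem (orderAut_mem _ _ _), fun k hk r hr M f B hB => ?_⟩
    rw [hnt] at hk
    rw [← sum_perm_ballOrder hk₀ hk fun t =>
      if iotaTd d (fun v => vw ι f k ((orderAut d s t)⁻¹ v)) ∈ B then (1:ℝ) else 0]
    refine Finset.sum_congr rfl fun σ _ => if_congr (hB.mem_iff ?_) rfl rfl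
    exact (treeBall_of_injOn hι hs hk).resS_bfsRCG hr f σ
  · push Not at hex
    exact ⟨fun _ => 1, fun _ => one_mem _, fun k hk => absurd (hex k) hk⟩

open Finset in
lemma abs_sum_bfsRCG_sub_le {M : Type} [Fintype M] [MeasurableSpace M] [DiscreteMeasurableSpace M]
    {n d r : ℕ} [NeZero d] {μ : Measure (TdVertex d → M)} (hμ : μ ∈ InvMeas d M)
    {ι : Fin n × ZMod d → Fin n × ZMod d} (hι : Function.Involutive ι)
    (hs : simpleH Prod.fst ι) (f : Fin n → M) {B : Set (RCG M)} (hB : Saturated r B) :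
    |∑ k : Fin n × ZMod d, ∑ σ, (if bfsRCG (hGraph Prod.fst ι) f k.1 σ ∈ B then (1:ℝ) else 0) -
      n.factorial * (Fintype.card (Fin n × ZMod d) * μ.real {x | iotaTd d x ∈ B})| ≤
      n.factorial * (#(nonTree (r + 1) ι) + devF μ r (vw ι f)) := by
  have := hμ.1
  have : Nonempty M := nonempty_of_prob μ
  obtain ⟨ψ, hψ, h1⟩ := exists_aut_sum_bfsRCG (s := r + 1) hι hs
  have hcard : (#(univ : Finset (Equiv.Perm (Fin n))) : ℝ) = n.factorial := by
    rw [card_univ, Fintype.card_perm, Fintype.card_fin]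
  set A : Fin n × ZMod d → ℝ :=
    fun k => ∑ σ, (if bfsRCG (hGraph Prod.fst ι) f k.1 σ ∈ B then (1:ℝ) else 0)
  set H : (TdVertex d → M) → ℝ := fun x => if iotaTd d x ∈ B then (1:ℝ) else 0 with hH
  have hHc : CylS r H := fun x x' hx => by
    simp only [hH, hB.mem_iff (resS_iotaTd hx)]
  have hH1 : ∀ x, |H x| ≤ 1 := fun x => by
    simp only [hH]
    split_ifs <;> simp
  have hcyl : ∫ x, H x ∂μ = μ.real {x | iotaTd d x ∈ B} := by
    have hm : MeasurableSet {x : TdVertex d → M | iotaTd d x ∈ B} :=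
      measurableSet_setOfPred.2 hB.cylS.measurable
    rw [← integral_indicator_one hm]
    rfl
  have hbd : ∀ F : Equiv.Perm (Fin n) → ℝ, (∀ σ, 0 ≤ F σ ∧ F σ ≤ 1) →
      0 ≤ ∑ σ, F σ ∧ ∑ σ, F σ ≤ n.factorial := by
    intro F hF
    refine ⟨sum_nonneg fun σ _ => (hF σ).1, ?_⟩
    calc ∑ σ, F σ ≤ ∑ _σ : Equiv.Perm (Fin n), (1:ℝ) := sum_le_sum fun σ _ => (hF σ).2
      _ = n.factorial := by rw [sum_const, nsmul_eq_mul, mul_one, hcard]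
  have h2 : |∑ k, A k - ∑ k, ∑ σ, H fun v => vw ι f k (ψ σ v)| ≤
      n.factorial * #(nonTree (r + 1) ι) := by
    rw [← sum_sub_distrib]
    refine (abs_sum_le_sum_abs _ _).trans ?_
    rw [← sum_subset (subset_univ (nonTree (r + 1) ι)) fun k _ hk => by
      rw [show A k = ∑ σ, H fun v => vw ι f k (ψ σ v) from
        h1 k hk r (Nat.lt_succ_self r) M f B hB, sub_self, abs_zero]]
    refine (sum_le_card_nsmul _ _ (n.factorial : ℝ) fun k _ => ?_).trans (by
      rw [nsmul_eq_mul, mul_comm])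
    have ha := hbd (fun σ => if bfsRCG (hGraph Prod.fst ι) f k.1 σ ∈ B then (1:ℝ) else 0)
      fun σ => by split_ifs <;> norm_num
    have hb := hbd (fun σ => H fun v => vw ι f k (ψ σ v))
      fun σ => by simp only [hH]; split_ifs <;> norm_num
    rw [abs_le]
    constructor
    · linarith [ha.1, hb.2]
    · linarith [ha.2, hb.1]
  have h3 : |∑ k, ∑ σ, (H fun v => vw ι f k (ψ σ v)) -
      n.factorial * (Fintype.card (Fin n × ZMod d) * μ.real {x | iotaTd d x ∈ B})| ≤
      n.factorial * devF μ r (vw ι f) := by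
    have hc : ∀ X : ℝ, n.factorial * X = ∑ _σ : Equiv.Perm (Fin n), X := fun X => by
      rw [sum_const, nsmul_eq_mul, hcard]
    rw [sum_comm, hc, hc, ← sum_sub_distrib]
    refine (abs_sum_le_sum_abs _ _).trans (sum_le_sum fun σ _ => ?_)
    have := abs_sum_sub_le_devF μ (vw ι f) (hHc.comp_fix (hψ σ)) fun y => hH1 _
    rwa [one_mul, InvMeas.integral_comp hμ _ hHc, hcyl] at this
  rw [mul_add]
  exact (abs_sub_le _ _ _).trans (add_le_add h2 h3)

lemma distrG_apply {M : Type} {n : ℕ} (G : SimpleGraph (Fin n)) (f : Fin n → M)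
    {B : Set (RCG M)} (hB : MeasurableSet B) :
    distrG G f B = ENNReal.ofReal ((n:ℝ)⁻¹ * ((n.factorial : ℝ)⁻¹ *
      ∑ v, ∑ σ, if bfsRCG G f v σ ∈ B then (1:ℝ) else 0)) := by
  have h1 : ∀ v, distrAt G f v B = ENNReal.ofReal ((n.factorial : ℝ)⁻¹ *
      ∑ σ, if bfsRCG G f v σ ∈ B then (1:ℝ) else 0) := by
    intro v
    rw [distrAt, Measure.smul_apply, Measure.finsetSum_apply, smul_eq_mul,
      ENNReal.ofReal_mul (by positivity), ENNReal.ofReal_inv_of_pos (by positivity),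
      ENNReal.ofReal_natCast,
      ENNReal.ofReal_sum_of_nonneg fun σ _ => by split_ifs <;> norm_num]
    congr 1
    refine Finset.sum_congr rfl fun σ _ => ?_
    rw [Measure.dirac_apply' _ hB]
    by_cases h : bfsRCG G f v σ ∈ B <;> simp [h]
  rcases Nat.eq_zero_or_pos n with rfl | hn
  · simp [distrG]
  have h2 : (n.factorial : ℝ)⁻¹ * ∑ v, ∑ σ, (if bfsRCG G f v σ ∈ B then (1:ℝ) else 0) =
      ∑ v, (n.factorial : ℝ)⁻¹ * ∑ σ, if bfsRCG G f v σ ∈ B then (1:ℝ) else 0 :=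
    Finset.mul_sum _ _ _
  rw [h2, distrG, Measure.smul_apply, Measure.finsetSum_apply, smul_eq_mul,
    ENNReal.ofReal_mul (by positivity), ENNReal.ofReal_inv_of_pos (by positivity),
    ENNReal.ofReal_natCast, ENNReal.ofReal_sum_of_nonneg fun v _ => by positivity]
  simp_rw [h1]

lemma isProbabilityMeasure_distrG {M : Type} {n : ℕ} (hn : 0 < n) (G : SimpleGraph (Fin n))
    (f : Fin n → M) : IsProbabilityMeasure (distrG G f) := by
  refine ⟨?_⟩
  have h1 : (n : ℝ) ≠ 0 := by positivity
  have h2 : (n.factorial : ℝ) ≠ 0 := by positivity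
  rw [distrG_apply G f MeasurableSet.univ]
  simp only [Set.mem_univ, if_true, Finset.sum_const, Finset.card_univ, Fintype.card_perm,
    Fintype.card_fin, nsmul_eq_mul, mul_one]
  rw [mul_comm (n:ℝ) (n.factorial : ℝ), inv_mul_cancel_left₀ h2, inv_mul_cancel₀ h1,
    ENNReal.ofReal_one]

open Finset in
/-- The local statistics of a configuration control the Lévy–Prokhorov distance. -/
theorem levyProkhorovDist_distrG_le {M : Type} [Fintype M] [MeasurableSpace M]
    [DiscreteMeasurableSpace M] {n d r : ℕ} [NeZero d] (hn : 0 < n)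
    {μ : Measure (TdVertex d → M)} (hμ : μ ∈ InvMeas d M)
    {ι : Fin n × ZMod d → Fin n × ZMod d} (hι : Function.Involutive ι)
    (hs : simpleH Prod.fst ι) (f : Fin n → M) {ε : ℝ} (hr : (2:ℝ)⁻¹ ^ r ≤ ε)
    (h : #(nonTree (r + 1) ι) + devF μ r (vw ι f) ≤ ε * Fintype.card (Fin n × ZMod d)) :
    levyProkhorovDist (distrG (hGraph Prod.fst ι) f) (lawTd d μ) ≤ ε := by
  have := hμ.1
  have : Nonempty M := nonempty_of_prob μ
  have := isProbabilityMeasure_distrG hn (hGraph Prod.fst ι) f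
  have : IsProbabilityMeasure (lawTd d μ) :=
    Measure.isProbabilityMeasure_map (measurable_iotaTd d).aemeasurable
  have hε : 0 ≤ ε := le_trans (by positivity) hr
  refine levyProkhorovDist_le_of_forall_le _ _ hε fun δ B hδ _ => ?_
  set B' := saturate r B
  have hB' : Saturated r B' := saturated_saturate r B
  have hd0 : (0:ℝ) < d := by exact_mod_cast NeZero.pos d
  have hn0 : (0:ℝ) < n := by exact_mod_cast hn
  have hcard : (Fintype.card (Fin n × ZMod d) : ℝ) = n * d := by
    rw [Fintype.card_prod, Fintype.card_fin, ZMod.card, Nat.cast_mul]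
  have key : distrG (hGraph Prod.fst ι) f B' ≤ lawTd d μ B' + ENNReal.ofReal δ := by
    have h1 : lawTd d μ B' = ENNReal.ofReal (μ.real {x | iotaTd d x ∈ B'}) := by
      rw [lawTd, Measure.map_apply (measurable_iotaTd d) hB'.isOpen.measurableSet,
          ofReal_measureReal]
      rfl
    rw [distrG_apply _ _ hB'.isOpen.measurableSet, h1,
      ← ENNReal.ofReal_add measureReal_nonneg (hε.trans hδ.le)]
    refine ENNReal.ofReal_le_ofReal ?_
    have h2 := (abs_le.1 (abs_sum_bfsRCG_sub_le hμ hι hs f hB')).2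
    set S := ∑ v, ∑ σ, if bfsRCG (hGraph Prod.fst ι) f v σ ∈ B' then (1:ℝ) else 0 with hS
    have hsum : ∑ k : Fin n × ZMod d, ∑ σ,
        (if bfsRCG (hGraph Prod.fst ι) f k.1 σ ∈ B' then (1:ℝ) else 0) = d * S := by
      rw [Fintype.sum_prod_type, hS, mul_sum]
      refine sum_congr rfl fun v _ => ?_
      have hc := sum_const (s := (univ : Finset (ZMod d)))
        (∑ σ, if bfsRCG (hGraph Prod.fst ι) f v σ ∈ B' then (1:ℝ) else 0)
      rw [card_univ, ZMod.card, nsmul_eq_mul] at hc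
      exact hc
    rw [hsum, hcard] at h2
    rw [hcard] at h
    have hf0 : (0:ℝ) < n.factorial := by positivity
    rw [← mul_assoc, ← mul_inv, inv_mul_le_iff₀ (by positivity)]
    have h3 : (d:ℝ) * S ≤ d * (n * n.factorial * (μ.real {x | iotaTd d x ∈ B'} + δ)) := by
      have h4 : (n.factorial : ℝ) * (#(nonTree (r + 1) ι) + devF μ r (vw ι f)) ≤
          n.factorial * (δ * (n * d)) :=
        mul_le_mul_of_nonneg_left (h.trans (by gcongr)) hf0.le
      calc (d:ℝ) * S ≤ n.factorial * ((n * d) * μ.real {x | iotaTd d x ∈ B'}) +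
            n.factorial * (δ * (n * d)) := by linarith
        _ = _ := by ring
    exact le_of_mul_le_mul_left h3 hd0
  calc distrG (hGraph Prod.fst ι) f B ≤ distrG (hGraph Prod.fst ι) f B' :=
        measure_mono (subset_saturate r B)
    _ ≤ lawTd d μ B' + ENNReal.ofReal δ := key
    _ ≤ _ := by
        gcongr
        exact saturate_subset_thickening (hr.trans_lt hδ) B

lemma shannon_map_of_injective {α β : Type*} [MeasurableSpace α] [MeasurableSpace β]
    [MeasurableSingletonClass β] {g : α → β} (hg : Function.Injective g)
    (hgm : Measurable g) (ν : Measure α) : shannon (ν.map g) = shannon ν := by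
  unfold shannon
  rw [← hg.tsum_eq]
  · refine tsum_congr fun a => ?_
    rw [Measure.map_apply hgm (measurableSet_singleton _), ← Set.image_singleton,
      hg.preimage_image]
  · intro b hb
    by_contra hr
    refine hb ?_
    have h1 : g ⁻¹' {b} = ∅ := by
      ext a
      simp only [Set.mem_preimage, Set.mem_singleton_iff, Set.mem_empty_iff_false, iff_false]
      exact fun h => hr ⟨a, h⟩
    change Real.negMulLog ((ν.map g) {b}).toReal = 0
    rw [Measure.map_apply hgm (measurableSet_singleton _), h1]
    simp

/-- The diagonal coupling. -/
def diagM {M : Type*} [MeasurableSpace M] {d : ℕ} (μ : Measure (TdVertex d → M)) :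
    Measure (TdVertex d → M × M) := μ.map fun x v => (x v, x v)

lemma measurable_diag {M S : Type*} [MeasurableSpace M] :
    Measurable fun (x : S → M) v => (x v, x v) :=
  measurable_pi_lambda _ fun v => (measurable_pi_apply v).prodMk (measurable_pi_apply v)

lemma isInvCoupling_diagM {M : Type*} [MeasurableSpace M] {d : ℕ} {μ : Measure (TdVertex d → M)}
    (hμ : μ ∈ InvMeas d M) : IsInvCoupling d μ (diagM μ) := by
  have := hμ.1
  refine ⟨⟨Measure.isProbabilityMeasure_map measurable_diag.aemeasurable, fun φ => ?_⟩, ?_, ?_⟩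
  · have h1 : ∀ N : Type _, ∀ _ : MeasurableSpace N,
        Measurable fun (x : TdVertex d → N) v => x (φ v) :=
      fun N _ => measurable_pi_lambda _ fun v => measurable_pi_apply _
    conv_rhs => rw [diagM, ← hμ.2 φ, Measure.map_map measurable_diag (h1 _ _)]
    rw [diagM, Measure.map_map (h1 _ _) measurable_diag]
    rfl
  all_goals
    rw [diagM, Measure.map_map (measurable_pi_lambda _ fun v => by fun_prop) measurable_diag]
    exact Measure.map_id

lemma shannon_restrictTo_diagM {M : Type*} [MeasurableSpace M] [MeasurableSingletonClass M]
    {d : ℕ} (μ : Measure (TdVertex d → M)) {S : Set (TdVertex d)} (hS : S.Finite) :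
    shannon (restrictTo S (diagM μ)) = shannon (restrictTo S μ) := by
  have := hS.to_subtype
  have h1 : ∀ N : Type _, ∀ _ : MeasurableSpace N,
      Measurable fun (x : TdVertex d → N) (v : ↥S) => x v.1 :=
    fun N _ => measurable_pi_lambda _ fun v => measurable_pi_apply _
  rw [← shannon_map_of_injective (g := fun (x : ↥S → M) v => (x v, x v)) (fun x y h => by
    funext v
    exact (Prod.ext_iff.1 (congrFun h v)).1) measurable_diag (restrictTo S μ)]
  congr 1
  rw [restrictTo, restrictTo, diagM, Measure.map_map (h1 _ _) measurable_diag,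
    Measure.map_map measurable_diag (h1 _ _)]
  rfl

lemma SigmaR_diagM {M : Type*} [MeasurableSpace M] [MeasurableSingletonClass M] {d : ℕ}
    (μ : Measure (TdVertex d → M)) (r : ℕ) : SigmaR d r (diagM μ) = SigmaR d r μ := by
  have h : (SrSet d r).Finite := Set.toFinite _
  rw [SigmaR, SigmaR, shannon_restrictTo_diagM μ h,
    shannon_restrictTo_diagM μ (h.subset (ErSet_subset_SrSet d r))]

open Finset in
lemma sq_card_le_card_mul {α β : Type*} [Fintype α] [Fintype β] (P : α → β → Prop) :
    #{p : α × β | P p.1 p.2} ^ 2 ≤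
      #{a | ∃ b, P a b} * #{p : α × (β × β) | P p.1 p.2.1 ∧ P p.1 p.2.2} := by
  have h1 : #{p : α × β | P p.1 p.2} = ∑ a ∈ {a | ∃ b, P a b}, #{b | P a b} := by
    rw [Finset.card_eq_sum_card_fiberwise (f := Prod.fst) (t := {a | ∃ b, P a b})]
    · refine Finset.sum_congr rfl fun a _ => ?_
      refine Finset.card_bij (fun p _ => p.2) ?_ ?_ ?_
      · rintro ⟨a', b⟩ h
        simp only [Finset.mem_filter, Finset.mem_univ, true_and] at h ⊢
        exact h.2 ▸ h.1
      · rintro ⟨a', b⟩ h ⟨a'', b'⟩ h' e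
        simp only [Finset.mem_filter, Finset.mem_univ, true_and] at h h' e
        exact Prod.ext (h.2.trans h'.2.symm) e
      · intro b hb
        simp only [Finset.mem_filter, Finset.mem_univ, true_and] at hb
        exact ⟨(a, b), by simpa using hb, rfl⟩
    · rintro ⟨a, b⟩ h
      simp only [Finset.coe_filter, Finset.mem_univ, true_and, Set.mem_ofPred_eq] at h ⊢
      exact ⟨b, h⟩
  have h2 : ∑ a ∈ {a | ∃ b, P a b}, #{b | P a b} ^ 2 ≤
      #{p : α × (β × β) | P p.1 p.2.1 ∧ P p.1 p.2.2} := by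
    calc ∑ a ∈ {a | ∃ b, P a b}, #{b | P a b} ^ 2
        = #(({a | ∃ b, P a b} : Finset α).sigma
            fun a => ({b | P a b} : Finset β) ×ˢ ({b | P a b} : Finset β)) := by
          rw [Finset.card_sigma]
          exact Finset.sum_congr rfl fun a _ => by rw [Finset.card_product, sq]
      _ ≤ _ := by
          refine Finset.card_le_card_of_injOn (fun s => (s.1, s.2)) ?_ ?_
          · rintro ⟨a, b⟩ h
            simp only [Finset.coe_sigma, Set.mem_sigma_iff, Finset.coe_product,
              Set.mem_prod, Finset.coe_filter, Finset.mem_univ, true_and,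
              Set.mem_ofPred_eq] at h ⊢
            exact h.2
          · rintro ⟨a, b⟩ _ ⟨a', b'⟩ _ e
            simp only [Prod.mk.injEq] at e
            obtain ⟨rfl, rfl⟩ := e
            rfl
  rw [h1]
  exact (sq_sum_le_card_mul_sum_sq).trans (Nat.mul_le_mul_left _ h2)

/-- The second moment method: at exponential scale, most configurations have a colouring whose
local statistics are close to `μ`. -/
lemma exists_card_close_gt {M : Type} [Fintype M] [MeasurableSpace M]
    [DiscreteMeasurableSpace M] {d : ℕ} [NeZero d] {μ : Measure (TdVertex d → M)}
    (hμ : μ ∈ InvMeas d M) {rk : ℕ → ℕ} (hrk : StrictMono rk)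
    (hcoup : ∀ k, ∀ ν, IsInvCoupling d μ ν → SigmaR d (rk k) ν ≤ 2 * SigmaR d (rk k) μ)
    (r : ℕ) {η c : ℝ} (hη : 0 < η) (hc : 0 < c) :
    ∃ n₀ : ℕ, ∀ n : ℕ, n₀ ≤ n → ∀ m : ℕ, n * d = 2 * m →
      (2 * m).factorial * Real.exp (-(c * n)) <
        ((Finset.univ.filter fun π : Fin m × Bool ≃ Fin n × ZMod d => ∃ f : Fin n → M,
          devF μ r (vw (inv π) f) ≤ η * Fintype.card (Fin n × ZMod d)).card : ℝ) := by
  have hP : IsProbabilityMeasure μ := hμ.1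
  have hM : Nonempty M := nonempty_of_prob μ
  have hnn : ∀ k, 0 ≤ SigmaR d (rk k) μ := fun k => by
    have := hcoup k _ (isInvCoupling_diagM hμ)
    rw [SigmaR_diagM] at this
    linarith
  have hbdd : BddBelow (Set.range fun k => SigmaR d (rk k) μ) :=
    ⟨0, by rintro _ ⟨k, rfl⟩; exact hnn k⟩
  set δ : ℝ := c / 10 with hδdef
  have hδ : 0 < δ := by positivity
  obtain ⟨k, hk⟩ := exists_lt_of_ciInf_lt
    (show (⨅ k, SigmaR d (rk k) μ) < (⨅ k, SigmaR d (rk k) μ) + δ by linarith)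
  obtain ⟨R₀, ε₀, hε₀, c₁, c₂, hpairs⟩ :=
    card_pairs_le hμ (rk k) (2 * SigmaR d (rk k) μ) (hcoup k) hδ
  set k' : ℕ := r + R₀
  have hk'r : r ≤ rk k' := (Nat.le_add_right _ _).trans (hrk.id_le k')
  have hk'R : R₀ ≤ rk k' := (Nat.le_add_left _ _).trans (hrk.id_le k')
  have hinf := ciInf_le hbdd k'
  obtain ⟨n₁, hn₁⟩ := le_card_close hμ (rk k') (lt_min hη hε₀) hδ
  obtain ⟨n₂, hn₂⟩ := polyF_le_exp c₁ d (by exact_mod_cast NeZero.pos d) hδ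
  obtain ⟨n₃, hn₃⟩ := polyF_le_exp c₂ 1 one_pos hδ
  refine ⟨n₁ + n₂ + n₃ + 1, fun n hn m hm => ?_⟩
  have hn0 : Nonempty (Fin n) := ⟨⟨0, by omega⟩⟩
  have e1 := hn₁ n (by omega) m hm
  have e2 := hpairs (Fin n) m (by simpa using hm)
  have e3 := hn₂ n (by omega) (2 * m) (by rw [← hm]; push_cast; linarith)
  have e4 := hn₃ n (by omega) n (by simp)
  rw [Fintype.card_fin] at e2
  set N : ℝ := ((Fintype.card (Fin n × ZMod d) : ℕ) : ℝ)
  have hN0 : 0 ≤ N := Nat.cast_nonneg _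
  let P : (Fin m × Bool ≃ Fin n × ZMod d) → (Fin n → M) → Prop := fun π f =>
    devF μ (rk k') (vw (inv π) f) ≤ min η ε₀ * N
  have hcs := sq_card_le_card_mul P
  set A := (Finset.univ.filter fun p : (Fin m × Bool ≃ Fin n × ZMod d) × (Fin n → M) =>
    P p.1 p.2).card
  set Z := (Finset.univ.filter fun π : Fin m × Bool ≃ Fin n × ZMod d => ∃ f, P π f).card
  set Q := (Finset.univ.filter fun p : (Fin m × Bool ≃ Fin n × ZMod d) ×
    ((Fin n → M) × (Fin n → M)) => P p.1 p.2.1 ∧ P p.1 p.2.2).card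
  have hQ : (Q : ℝ) ≤ (2 * m).factorial * Real.exp (n * (2 * SigmaR d (rk k) μ + δ)) *
      (polyF c₁ (2 * m) * ((n : ℝ) + 1) ^ c₂) := by
    refine le_trans ?_ e2
    refine Nat.cast_le.2 (Finset.card_le_card fun p hp => ?_)
    simp only [Finset.mem_filter, Finset.mem_univ, true_and] at hp ⊢
    have hm' : min η ε₀ * N ≤ ε₀ * N := mul_le_mul_of_nonneg_right (min_le_right _ _) hN0
    exact ⟨((devF_mono μ hk'R _).trans hp.1).trans hm',
      ((devF_mono μ hk'R _).trans hp.2).trans hm'⟩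
  have hA : Real.exp (n * (SigmaR d (rk k') μ - δ)) * (2 * m).factorial ≤ (A : ℝ) := by
    convert e1
  have hZ : (Z : ℝ) ≤ ((Finset.univ.filter fun π : Fin m × Bool ≃ Fin n × ZMod d =>
      ∃ f : Fin n → M, devF μ r (vw (inv π) f) ≤ η * N).card : ℝ) := by
    refine Nat.cast_le.2 (Finset.card_le_card fun π hπ => ?_)
    simp only [Finset.mem_filter, Finset.mem_univ, true_and] at hπ ⊢
    obtain ⟨f, hf⟩ := hπ
    exact ⟨f, ((devF_mono μ hk'r _).trans hf).trans
      (mul_le_mul_of_nonneg_right (min_le_left _ _) hN0)⟩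
  refine lt_of_lt_of_le ?_ hZ
  have hcs' : (A : ℝ) ^ 2 ≤ Z * Q := by exact_mod_cast hcs
  have e5 : ((n : ℝ) + 1) ^ c₂ ≤ Real.exp (δ * n) := by
    refine le_trans ?_ e4
    unfold polyF
    gcongr
    exact le_mul_of_one_le_left (by positivity) (Real.one_le_exp zero_le_one)
  set F : ℝ := (((2 * m).factorial : ℕ) : ℝ)
  have hF0 : 0 < F := by positivity
  set X := Real.exp (n * (2 * SigmaR d (rk k) μ + 3 * δ)) with hX
  have hQ' : (Q : ℝ) ≤ F * X := by
    refine hQ.trans ?_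
    calc F * Real.exp (n * (2 * SigmaR d (rk k) μ + δ)) *
          (polyF c₁ (2 * m) * ((n : ℝ) + 1) ^ c₂)
        ≤ F * Real.exp (n * (2 * SigmaR d (rk k) μ + δ)) *
          (Real.exp (δ * n) * Real.exp (δ * n)) := by
          gcongr
      _ = F * X := by
          rw [hX, mul_assoc, ← Real.exp_add, ← Real.exp_add]
          congr 2
          ring
  have h6 : (Real.exp (n * (SigmaR d (rk k') μ - δ)) * F) ^ 2 ≤ Z * (F * X) :=
    ((pow_le_pow_left₀ (by positivity) hA 2).trans hcs').trans
      (mul_le_mul_of_nonneg_left hQ' (Nat.cast_nonneg _))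
  have hX0 : 0 < X := Real.exp_pos _
  have h7 : F * Real.exp (-(c * n)) * (F * X) < Z * (F * X) := by
    refine lt_of_lt_of_le ?_ h6
    have h8 : (Real.exp (n * (SigmaR d (rk k') μ - δ)) * F) ^ 2 =
        F * F * Real.exp (2 * (n * (SigmaR d (rk k') μ - δ))) := by
      rw [two_mul (n * _ : ℝ), Real.exp_add]
      ring
    rw [h8, show F * Real.exp (-(c * n)) * (F * X) = F * F * (Real.exp (-(c * n)) * X) by ring,
      hX, ← Real.exp_add]
    refine mul_lt_mul_of_pos_left (Real.exp_lt_exp.2 ?_) (by positivity)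
    have hn' : (0 : ℝ) < n := by exact_mod_cast (by omega : 0 < n)
    have : -c + (2 * SigmaR d (rk k) μ + 3 * δ) < 2 * (SigmaR d (rk k') μ - δ) := by
      linarith
    nlinarith [mul_lt_mul_of_pos_left this hn']
  exact lt_of_mul_lt_mul_right h7 (by positivity)

lemma card_two_eta_le {d n m : ℕ} [NeZero d] (hn : 0 < n) (hm : n * d = 2 * m)
    (F : (Fin m × Bool ≃ Fin n × ZMod d) → ℝ) {L η : ℝ} (hL : 0 < L) (hη : 0 < η)
    (hF : ∀ π i j, |F ((Equiv.swap i j).trans π) - F π| ≤ L)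
    (ha : (2 * m).factorial * Real.exp (-(η ^ 2 * d / (32 * L ^ 2) * n)) <
      ((Finset.univ.filter fun π => F π ≤ η * Fintype.card (Fin n × ZMod d)).card : ℝ)) :
    ((Finset.univ.filter fun π => 2 * η * Fintype.card (Fin n × ZMod d) ≤ F π).card : ℝ) ≤
      (2 * m).factorial * Real.exp (-(η ^ 2 * d / (32 * L ^ 2) * n)) := by
  have hκ : Fintype.card (Fin n × ZMod d) = 2 * m := by simp [hm, ZMod.card]
  have hd := NeZero.pos d
  have h2m : 0 < 2 * m := by rw [← hm]; positivity
  have hnd : ((2 * m : ℕ) : ℝ) = n * d := by rw [← hm]; push_cast; rfl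
  have hn' : (0 : ℝ) < n := by exact_mod_cast hn
  have hd' : (0 : ℝ) < d := by exact_mod_cast hd
  have he : η ^ 2 * d / (32 * L ^ 2) * n =
      (η * ((2 * m : ℕ) : ℝ) / 2) ^ 2 / (8 * L ^ 2 * ((2 * m : ℕ) : ℝ)) := by
    rw [hnd]
    field_simp
    ring
  rw [hκ] at ha ⊢
  rw [he] at ha ⊢
  have h := card_upper_tail_le (N := 2 * m) hL h2m (by simp [mul_comm]) hκ F hF
    (s := η * ((2 * m : ℕ) : ℝ) / 2) (by positivity) (η * ((2 * m : ℕ) : ℝ))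
    (by convert ha)
  convert h using 6
  ring

lemma lw_swap_agree {V : Type*} [Fintype V] {d : ℕ} [NeZero d] {s m : ℕ}
    (π : Fin m × Bool ≃ V × ZMod d) (i j : Fin m × Bool) :
    ((Finset.univ.filter fun k => ∃ u ∈ ballW d s,
      lw (inv π) k u ≠ lw (inv ((Equiv.swap i j).trans π)) k u).card : ℝ) ≤ 4 * badC d s := by
  set Bad : Finset (V × ZMod d) :=
    Finset.univ.filter fun h => inv π h ≠ inv ((Equiv.swap i j).trans π) h with hBad
  have h1 : (Finset.univ.filter fun k => ∃ u ∈ ballW d s,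
      lw (inv π) k u ≠ lw (inv ((Equiv.swap i j).trans π)) k u) ⊆ badL (inv π) Bad s := by
    intro k hk
    by_contra hkB
    obtain ⟨u, hu, hne⟩ := (Finset.mem_filter.1 hk).2
    have hu' := mem_ballW.1 hu
    refine hne (vw_agree (inv π) _ (inv_inv π) (inv_inv _) Bad (fun h hh => ?_) id s k hkB
      ⟨u, hu'.1⟩ hu'.2)
    by_contra hne'
    exact hh (Finset.mem_filter.2 ⟨Finset.mem_univ _, hne'⟩)
  have h2 := (Finset.card_le_card h1).trans
    (card_badL_le (inv π) (Function.Involutive.injective (inv_inv π)) Bad s)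
  have h3 : Bad.card ≤ 4 := by
    convert card_inv_swap_le π i j
  have h4 := h2.trans (Nat.mul_le_mul_left _ h3)
  rw [mul_comm]
  exact_mod_cast h4

lemma nonTree_swap_le {V : Type*} [Fintype V] {d : ℕ} [NeZero d] {s m : ℕ}
    (π : Fin m × Bool ≃ V × ZMod d) (i j : Fin m × Bool) :
    |((nonTree s (inv ((Equiv.swap i j).trans π))).card : ℝ) - (nonTree s (inv π)).card| ≤
      4 * badC d s := by
  have h := lw_swap_agree (s := s) π i j
  set ι := inv π
  set ι' := inv ((Equiv.swap i j).trans π)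
  set B : Finset (V × ZMod d) := Finset.univ.filter fun k => ∃ u ∈ ballW d s, lw ι k u ≠ lw ι' k u
  have hag : ∀ k ∉ B, Set.EqOn (lw ι k) (lw ι' k) (ballW d s) := fun k hk u hu => by
    by_contra hne
    exact hk (Finset.mem_filter.2 ⟨Finset.mem_univ _, u, hu, hne⟩)
  have h1 : nonTree s ι' ⊆ nonTree s ι ∪ B := fun k hk => by
    by_cases hkB : k ∈ B
    · exact Finset.mem_union_right _ hkB
    · refine Finset.mem_union_left _ (Finset.mem_filter.2 ⟨Finset.mem_univ _, fun hi => ?_⟩)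
      exact (Finset.mem_filter.1 hk).2 ((hag k hkB).injOn_iff.1 hi)
  have h2 : nonTree s ι ⊆ nonTree s ι' ∪ B := fun k hk => by
    by_cases hkB : k ∈ B
    · exact Finset.mem_union_right _ hkB
    · refine Finset.mem_union_left _ (Finset.mem_filter.2 ⟨Finset.mem_univ _, fun hi => ?_⟩)
      exact (Finset.mem_filter.1 hk).2 ((hag k hkB).injOn_iff.2 hi)
  have e1 : ((nonTree s ι').card : ℝ) ≤ (nonTree s ι).card + B.card := by
    exact_mod_cast (Finset.card_le_card h1).trans (Finset.card_union_le _ _)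
  have e2 : ((nonTree s ι).card : ℝ) ≤ (nonTree s ι').card + B.card := by
    exact_mod_cast (Finset.card_le_card h2).trans (Finset.card_union_le _ _)
  rw [abs_le]
  constructor <;> linarith

/-- All but exponentially few configurations have few half-edges that see a cycle. -/
lemma exists_card_nonTree_le (d : ℕ) [NeZero d] (s : ℕ) {η : ℝ} (hη : 0 < η) :
    ∃ c > 0, ∃ n₀ : ℕ, ∀ n : ℕ, n₀ ≤ n → ∀ m : ℕ, n * d = 2 * m →
      ((Finset.univ.filter fun π : Fin m × Bool ≃ Fin n × ZMod d =>
        2 * η * Fintype.card (Fin n × ZMod d) ≤ ((nonTree s (inv π)).card : ℝ)).card : ℝ) ≤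
      (2 * m).factorial * Real.exp (-(c * n)) := by
  obtain ⟨C, hC⟩ := exists_sum_nonTree_le d s
  set L : ℝ := 4 * badC d s + 1 with hLdef
  have hL : 0 < L := by positivity
  have hd : (0 : ℝ) < d := by exact_mod_cast NeZero.pos d
  set c : ℝ := η ^ 2 * d / (32 * L ^ 2) with hcdef
  have hc : 0 < c := by positivity
  obtain ⟨n₁, hn₁⟩ := exists_nat_gt ((2 * C + 1) / (η * d))
  obtain ⟨n₂, hn₂⟩ := exists_nat_gt (1 / c)
  refine ⟨c, hc, n₁ + n₂ + 1, fun n hn m hm => ?_⟩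
  have hκ : Fintype.card (Fin n × ZMod d) = 2 * m := by simp [hm, ZMod.card]
  have hnd : ((2 * m : ℕ) : ℝ) = n * d := by rw [← hm]; push_cast; rfl
  refine card_two_eta_le (by omega) hm (fun π => ((nonTree s (inv π)).card : ℝ)) hL hη
    (fun π i j => (nonTree_swap_le π i j).trans (by rw [hLdef]; linarith)) ?_
  have h1 := hC (Fin n) m hκ
  rw [hκ, hnd]
  have hn1 : (n₁ : ℝ) ≤ n := by exact_mod_cast (by omega : n₁ ≤ n)
  have hn2 : (n₂ : ℝ) ≤ n := by exact_mod_cast (by omega : n₂ ≤ n)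
  have h2 : 2 * C + 1 ≤ η * (n * d) := by
    have := (div_lt_iff₀ (by positivity)).1 (hn₁.trans_le hn1)
    linarith
  set G := Finset.univ.filter fun π : Fin m × Bool ≃ Fin n × ZMod d =>
    ((nonTree s (inv π)).card : ℝ) ≤ η * (n * d)
  have hF : (Fintype.card (Fin m × Bool ≃ Fin n × ZMod d) : ℝ) = (2 * m).factorial := by
    exact_mod_cast card_config hκ
  have h3 : ((Finset.univ.filter fun π : Fin m × Bool ≃ Fin n × ZMod d =>
      ¬ ((nonTree s (inv π)).card : ℝ) ≤ η * (n * d)).card : ℝ) * (2 * C + 1) ≤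
      C * (2 * m).factorial := by
    refine le_trans ?_ h1
    rw [← nsmul_eq_mul]
    refine (Finset.card_nsmul_le_sum _ (fun π => ((nonTree s (inv π)).card : ℝ)) _
      fun π hπ => ?_).trans (Finset.sum_le_sum_of_subset_of_nonneg (Finset.filter_subset _ _)
        fun _ _ _ => Nat.cast_nonneg _)
    have := (Finset.mem_filter.1 hπ).2
    push Not at this
    linarith
  have h4 := Finset.card_filter_add_card_filter_not (s := Finset.univ)
    (fun π : Fin m × Bool ≃ Fin n × ZMod d => ((nonTree s (inv π)).card : ℝ) ≤ η * (n * d))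
  have h5 : (G.card : ℝ) + ((Finset.univ.filter fun π : Fin m × Bool ≃ Fin n × ZMod d =>
      ¬ ((nonTree s (inv π)).card : ℝ) ≤ η * (n * d)).card : ℝ) = (2 * m).factorial := by
    rw [← hF, ← Finset.card_univ, ← h4, Nat.cast_add]
  have hf : (0 : ℝ) < (2 * m).factorial := by positivity
  have h6 : ((2 * m).factorial : ℝ) / 2 < G.card := by
    have hC0 : (0 : ℝ) ≤ C := Nat.cast_nonneg _
    nlinarith
  have h7 : Real.exp (-(c * n)) ≤ 1 / 2 := by
    have h8 : 1 ≤ c * n := by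
      have := (div_lt_iff₀ hc).1 (hn₂.trans_le hn2)
      linarith
    rw [Real.exp_neg, ← one_div]
    refine one_div_le_one_div_of_le two_pos ?_
    have := Real.add_one_le_exp (c * n)
    linarith
  nlinarith

/-- All but exponentially few configurations have a colouring whose local statistics are close
to `μ`. -/
lemma exists_card_far_le {M : Type} [Fintype M] [MeasurableSpace M]
    [DiscreteMeasurableSpace M] {d : ℕ} [NeZero d] {μ : Measure (TdVertex d → M)}
    (hμ : μ ∈ InvMeas d M) {rk : ℕ → ℕ} (hrk : StrictMono rk)
    (hcoup : ∀ k, ∀ ν, IsInvCoupling d μ ν → SigmaR d (rk k) ν ≤ 2 * SigmaR d (rk k) μ)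
    (r : ℕ) {η : ℝ} (hη : 0 < η) :
    ∃ c > 0, ∃ n₀ : ℕ, ∀ n : ℕ, n₀ ≤ n → ∀ m : ℕ, n * d = 2 * m →
      ((Finset.univ.filter fun π : Fin m × Bool ≃ Fin n × ZMod d => ∀ f : Fin n → M,
        2 * η * Fintype.card (Fin n × ZMod d) ≤ devF μ r (vw (inv π) f)).card : ℝ) ≤
      (2 * m).factorial * Real.exp (-(c * n)) := by
  have hP : IsProbabilityMeasure μ := hμ.1
  have hM : Nonempty M := nonempty_of_prob μ
  set L : ℝ := 8 * badC d r + 1 with hLdef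
  have hL : 0 < L := by positivity
  have hd : (0 : ℝ) < d := by exact_mod_cast NeZero.pos d
  set c : ℝ := η ^ 2 * d / (32 * L ^ 2) with hcdef
  have hc : 0 < c := by positivity
  obtain ⟨n₀, hn₀⟩ := exists_card_close_gt hμ hrk hcoup r hη hc
  refine ⟨c, hc, n₀ + 1, fun n hn m hm => ?_⟩
  have h := hn₀ n (by omega) m hm
  let F : (Fin m × Bool ≃ Fin n × ZMod d) → ℝ := fun π =>
    Finset.univ.inf' Finset.univ_nonempty fun f : Fin n → M => devF μ r (vw (inv π) f)
  have hle : ∀ π π' : Fin m × Bool ≃ Fin n × ZMod d,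
      (∀ f : Fin n → M, devF μ r (vw (inv π') f) ≤ devF μ r (vw (inv π) f) + L) →
      F π' ≤ F π + L := fun π π' hh => by
    obtain ⟨f, -, hf⟩ := Finset.exists_mem_eq_inf' (Finset.univ_nonempty (α := Fin n → M))
      fun f => devF μ r (vw (inv π) f)
    calc F π' ≤ devF μ r (vw (inv π') f) := Finset.inf'_le _ (Finset.mem_univ f)
      _ ≤ devF μ r (vw (inv π) f) + L := hh f
      _ = F π + L := by rw [← hf]
  have hFle : ∀ π t, F π ≤ t ↔ ∃ f : Fin n → M, devF μ r (vw (inv π) f) ≤ t := fun π t => by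
    simp [F, Finset.inf'_le_iff]
  have hleF : ∀ π t, t ≤ F π ↔ ∀ f : Fin n → M, t ≤ devF μ r (vw (inv π) f) := fun π t => by
    simp [F, Finset.le_inf'_iff]
  have key := card_two_eta_le (by omega) hm F hL hη (fun π i j => by
    have h1 : ∀ f : Fin n → M, _ := fun f => abs_le.1 (devF_swap_le μ r f π i j)
    rw [abs_le]
    constructor
    · have := hle ((Equiv.swap i j).trans π) π fun f => by linarith [(h1 f).1]
      linarith
    · have := hle π ((Equiv.swap i j).trans π) fun f => by linarith [(h1 f).2]
      linarith) (by
    convert h using 5 with π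
    exact hFle _ _)
  convert key using 4 with π
  exact (hleF _ _).symm

lemma PrG_le_one (d n : ℕ) (A : Set (SimpleGraph (Fin n))) : PrG d n A ≤ 1 := by
  refine div_le_one_of_le₀ ?_ (Nat.cast_nonneg _)
  exact_mod_cast Set.ncard_le_ncard Set.inter_subset_left (Set.toFinite _)

/-- Good colourings exist with probability exponentially close to one. -/
lemma exists_le_typicalPr {M : Type} [Fintype M] [MeasurableSpace M]
    [DiscreteMeasurableSpace M] {d : ℕ} (hd : 2 ≤ d) {μ : Measure (TdVertex d → M)}
    (hμ : μ ∈ InvMeas d M) {rk : ℕ → ℕ} (hrk : StrictMono rk)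
    (hcoup : ∀ k, ∀ ν, IsInvCoupling d μ ν → SigmaR d (rk k) ν ≤ 2 * SigmaR d (rk k) μ)
    {ε : ℝ} (hε : 0 < ε) :
    ∃ δ > 0, ∃ n₀ : ℕ, ∀ n ≥ n₀, n ∈ goodN d →
      1 - 4 * Real.exp (-(δ * n)) ≤ typicalPr d μ ε n := by
  have : NeZero d := ⟨by omega⟩
  obtain ⟨r, hr⟩ := exists_pow_lt_of_lt_one hε (by norm_num : (2 : ℝ)⁻¹ < 1)
  obtain ⟨c₁, hc₁, n₁, hn₁⟩ := exists_card_far_le hμ hrk hcoup r (η := ε / 4) (by positivity)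
  obtain ⟨c₂, hc₂, n₂, hn₂⟩ := exists_card_nonTree_le d (r + 1) (η := ε / 4) (by positivity)
  obtain ⟨C, m₀, hC⟩ := exists_card_simple_ge d hd
  set δ : ℝ := min c₁ c₂ / 2 with hδdef
  have hδ : 0 < δ := by positivity
  obtain ⟨n₃, hn₃⟩ := polyF_le_exp (2 * C) d (by exact_mod_cast NeZero.pos d) hδ
  refine ⟨δ, hδ, n₁ + n₂ + n₃ + m₀ + 1, fun n hn hg => ?_⟩
  obtain ⟨m, hm⟩ := hg.2.exists_two_nsmul
  rw [smul_eq_mul] at hm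
  have hκ : Fintype.card (Fin n × ZMod d) = 2 * m := by simp [hm, ZMod.card]
  have e1 := hn₁ n (by omega) m hm
  have e2 := hn₂ n (by omega) m hm
  have e3 := hn₃ n (by omega) (2 * m) (by rw [← hm]; push_cast; linarith)
  have e4 := hC (Fin n) m (by nlinarith) hκ
  set A : Set (SimpleGraph (Fin n)) :=
    {G | ∃ f : Fin n → M, levyProkhorovDist (distrG G f) (lawTd d μ) ≤ ε} with hA
  have e5 := PrG_mul_eq hm A
  change _ ≤ PrG d n A
  set S := Finset.univ.filter fun π : Fin m × Bool ≃ Fin n × ZMod d => simpleH Prod.fst (inv π)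
  set G := Finset.univ.filter fun π : Fin m × Bool ≃ Fin n × ZMod d =>
    simpleH Prod.fst (inv π) ∧ hGraph Prod.fst (inv π) ∈ A
  set B₁ := Finset.univ.filter fun π : Fin m × Bool ≃ Fin n × ZMod d => ∀ f : Fin n → M,
    2 * (ε / 4) * Fintype.card (Fin n × ZMod d) ≤ devF μ r (vw (inv π) f)
  set B₂ := Finset.univ.filter fun π : Fin m × Bool ≃ Fin n × ZMod d =>
    2 * (ε / 4) * Fintype.card (Fin n × ZMod d) ≤ ((nonTree (r + 1) (inv π)).card : ℝ)
  have hsub : S ⊆ G ∪ (B₁ ∪ B₂) := fun π hπ => by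
    by_cases h1 : π ∈ B₁
    · simp [h1]
    by_cases h2 : π ∈ B₂
    · simp [h2]
    refine Finset.mem_union_left _ (Finset.mem_filter.2 ⟨Finset.mem_univ _, ?_⟩)
    have hs := (Finset.mem_filter.1 hπ).2
    simp only [B₁, B₂, Finset.mem_filter, Finset.mem_univ, true_and] at h1 h2
    push Not at h1 h2
    obtain ⟨f, hf⟩ := h1
    exact ⟨hs, f, levyProkhorovDist_distrG_le (by omega) hμ (inv_inv π) hs f hr.le
      (by linarith)⟩
  have h1 : (S.card : ℝ) ≤ G.card + (B₁.card + B₂.card) := by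
    exact_mod_cast (Finset.card_le_card hsub).trans ((Finset.card_union_le _ _).trans
      (Nat.add_le_add_left (Finset.card_union_le _ _) _))
  have h2 : ∀ c, min c₁ c₂ ≤ c → Real.exp (-(c * n)) ≤ Real.exp (-(2 * δ * n)) := fun c hc => by
    refine Real.exp_le_exp.2 (neg_le_neg (mul_le_mul_of_nonneg_right ?_ (Nat.cast_nonneg n)))
    rw [hδdef]
    linarith
  have h3 : ((2 * m).factorial : ℝ) ≤ 2 * Real.exp (δ * n) * S.card := by
    have h4 : ((2 * m).factorial : ℝ) ≤ 2 * (1 + (2 * (m : ℝ)) ^ 2) ^ C * S.card := by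
      exact_mod_cast e4
    refine h4.trans ?_
    gcongr
    refine le_trans ?_ e3
    rw [polyF, pow_mul]
    refine pow_le_pow_left₀ (by positivity) ?_ _
    have h5 : (1 : ℝ) ≤ Real.exp 1 := Real.one_le_exp zero_le_one
    have h6 : (2 * (m : ℝ) + 1) ≤ Real.exp 1 * (2 * m + 1) :=
      le_mul_of_one_le_left (by positivity) h5
    have h7 := pow_le_pow_left₀ (by positivity) h6 2
    push_cast
    nlinarith [(Nat.cast_nonneg m : (0 : ℝ) ≤ m)]
  have hS : (0 : ℝ) < S.card := by
    have : (0 : ℝ) < (2 * m).factorial := by positivity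
    by_contra hcon
    have : (S.card : ℝ) = 0 := le_antisymm (not_lt.1 hcon) (Nat.cast_nonneg _)
    rw [this] at h3
    linarith
  have h8 : (B₁.card : ℝ) + B₂.card ≤ 4 * Real.exp (-(δ * n)) * S.card := by
    calc (B₁.card : ℝ) + B₂.card
        ≤ (2 * m).factorial * Real.exp (-(2 * δ * n)) +
          (2 * m).factorial * Real.exp (-(2 * δ * n)) := by
          refine add_le_add (e1.trans ?_) (e2.trans ?_)
          · exact mul_le_mul_of_nonneg_left (h2 _ (min_le_left _ _)) (Nat.cast_nonneg _)
          · exact mul_le_mul_of_nonneg_left (h2 _ (min_le_right _ _)) (Nat.cast_nonneg _)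
      _ = 2 * Real.exp (-(2 * δ * n)) * (2 * m).factorial := by ring
      _ ≤ 2 * Real.exp (-(2 * δ * n)) * (2 * Real.exp (δ * n) * S.card) :=
          mul_le_mul_of_nonneg_left h3 (by positivity)
      _ = 4 * (Real.exp (-(2 * δ * n)) * Real.exp (δ * n)) * S.card := by ring
      _ = _ := by
          rw [← Real.exp_add]
          congr 3
          ring
  refine le_of_mul_le_mul_right ?_ hS
  have e6 : PrG d n A * S.card = G.card := by
    rw [e5]
    congr!
  rw [e6]
  linarith

/-- If every invariant coupling `ν ∈ I_d(M×M)` of `μ` with itself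
satisfies `Σ_{r_k}(ν) ≤ 2 Σ_{r_k}(μ)` for all `k ≥ 1`, along an increasing sequence of
integers `(r_k)`, then `μ` is strongly typical. -/
theorem second_moment_strongly_typical
    (d : ℕ) (hd : 3 ≤ d) (M : Type) [Fintype M] [MeasurableSpace M]
    [DiscreteMeasurableSpace M]
    (μ : Measure (TdVertex d → M)) (hμ : μ ∈ InvMeas d M)
    (rk : ℕ → ℕ) (hrk : StrictMono rk) (hrk1 : ∀ k : ℕ, 1 ≤ rk k)
    (hcoup : ∀ k : ℕ, ∀ ν : Measure (TdVertex d → M × M), IsInvCoupling d μ ν →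
      SigmaR d (rk k) ν ≤ 2 * SigmaR d (rk k) μ) :
    StronglyTypical d μ := by
  refine ⟨fun _ => 1, fun ε hε => ?_, tendsto_const_nhds⟩
  obtain ⟨δ, hδ, n₀, h⟩ := exists_le_typicalPr (by omega) hμ hrk hcoup hε
  have h1 : Tendsto (fun n : ℕ => 1 - 4 * Real.exp (-(δ * n))) (goodFilter d) (𝓝 1) := by
    have h2 : Tendsto (fun n : ℕ => δ * (n : ℝ)) (goodFilter d) atTop :=
      (tendsto_natCast_atTop_atTop.const_mul_atTop hδ).mono_left inf_le_left
    simpa using ((Real.tendsto_exp_neg_atTop_nhds_zero.comp h2).const_mul 4).const_sub 1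
  refine tendsto_of_tendsto_of_tendsto_of_le_of_le' h1 tendsto_const_nhds ?_
    (Eventually.of_forall fun n => PrG_le_one d n _)
  exact eventually_inf_principal.2 ((eventually_ge_atTop n₀).mono h)

end TreeEntropy
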